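/- Let I ≠ {0} be an ideal of the ring 𝒪_o of germs of holomorphic functions at o ∈ ℂⁿ, generated by germs g₁, …, g_k, and set |I|² := |g₁|² + ⋯ + |g_k|². Let V_I denote the set of all local Zhou weights related to |I|² near o, and for a psh function φ near o set c_o^I(φ) := sup{ c ≥ 0 : |I|²e^{-2cφ} is integrable near o }. Then for every psh function φ near o, c_o^I(φ) = 1 / ( sup_{Φ ∈ V_I} σ(φ, Φ) ). -/

import Mathlib

open MeasureTheory Filter Topology
open scoped ENNReal NNReal

noncomputable section

/-- `ℂⁿ`. -/
abbrev Cn (n : ℕ) : Type := Fin n → ℂ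

variable {n : ℕ}

/-- The exponential function `EReal → ℝ≥0∞`, with `exp ⊥ = 0` and `exp ⊤ = ⊤`. -/
def expE (x : EReal) : ℝ≥0∞ :=
  if x = ⊥ then 0 else if x = ⊤ then ⊤ else ENNReal.ofReal (Real.exp x.toReal)

/-- The logarithm `ℝ → EReal`, with value `⊥` for `x ≤ 0`. -/
def elog (x : ℝ) : EReal := if x ≤ 0 then (⊥ : EReal) else ((Real.log x : ℝ) : EReal)

/-- The density `e^{c·φ} : ℂⁿ → [0,∞]` associated to an extended-real-valued `φ`. -/
def wexp (c : ℝ) (φ : Cn n → EReal) (z : Cn n) : ℝ≥0∞ := expE ((c : EReal) * φ z)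

/-- `|f₀|² = ∑ⱼ |f₀ⱼ|²` as a `[0,∞]`-valued density, for a tuple `f₀` of functions. -/
def normSq2 {m : ℕ} (f₀ : Fin m → Cn n → ℂ) (z : Cn n) : ℝ≥0∞ :=
  ∑ j, (‖f₀ j z‖₊ : ℝ≥0∞) ^ 2

/-- `log |f₀| = (1/2) log ∑ⱼ |f₀ⱼ|²` for a tuple `f₀`. -/
def logAbsT {m : ℕ} (f₀ : Fin m → Cn n → ℂ) (z : Cn n) : EReal :=
  elog (Real.sqrt (∑ j, ‖f₀ j z‖ ^ 2))

/-- The weight `|f₀|² e^{-2φ₀}`. -/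
def dens0 {m : ℕ} (f₀ : Fin m → Cn n → ℂ) (φ₀ : Cn n → EReal) (z : Cn n) : ℝ≥0∞ :=
  normSq2 f₀ z * wexp (-2) φ₀ z

/-- A nonnegative function is (Lebesgue-)integrable near the origin. -/
def IntNear (g : Cn n → ℝ≥0∞) : Prop := ∃ U ∈ 𝓝 (0 : Cn n), (∫⁻ z in U, g z) < ⊤

/-- `ψ ≤ φ + O(1)` near the origin. -/
def leO (ψ φ : Cn n → EReal) : Prop := ∃ C : ℝ, ∀ᶠ z in 𝓝 (0 : Cn n), ψ z ≤ φ z + (C : EReal)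

/-- `ψ = φ + O(1)` near the origin. -/
def eqO (ψ φ : Cn n → EReal) : Prop := leO ψ φ ∧ leO φ ψ

/-- The truncated average of `u` over the circle `θ ↦ z + r e^{iθ} w`, truncated below at `-m`. -/
def circleAvg (u : Cn n → EReal) (z w : Cn n) (r : ℝ) (m : ℕ) : ℝ :=
  (2 * Real.pi)⁻¹ * ∫ θ in (0:ℝ)..(2 * Real.pi),
    (max (u (z + ((r : ℂ) * Complex.exp (Complex.I * (θ : ℂ))) • w)) ((-(m : ℝ) : ℝ) : EReal)).toReal

/-- `u` is plurisubharmonic on `Ω`: it is upper semicontinuous on `Ω`, takes values in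
`[-∞, ∞)`, is not identically `-∞` on any connected component of `Ω`, and satisfies the
sub-mean value inequality on all small circles inside complex lines. -/
structure PSHOn (u : Cn n → EReal) (Ω : Set (Cn n)) : Prop where
  usc : UpperSemicontinuousOn u Ω
  lt_top : ∀ z ∈ Ω, u z < ⊤
  not_botOnComponents : ∀ z ∈ Ω, ∃ w ∈ connectedComponentIn Ω z, u w ≠ ⊥
  submean : ∀ z ∈ Ω, ∀ w : Cn n, ∃ ε > 0, ∀ r : ℝ, 0 < r → r < ε →
    u z ≤ ⨅ m : ℕ, ((circleAvg u z w r m : ℝ) : EReal)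

/-- `u` is plurisubharmonic near the origin. -/
def PSHNear (u : Cn n → EReal) : Prop := ∃ U ∈ 𝓝 (0 : Cn n), IsOpen U ∧ PSHOn u U

/-- `f` is holomorphic near the origin. -/
def HoloNear (f : Cn n → ℂ) : Prop := ∃ U ∈ 𝓝 (0 : Cn n), IsOpen U ∧ DifferentiableOn ℂ f U

/-- `Φ` is a (local) Zhou weight near the origin related to a general nonnegative
weight `W`. -/
structure IsZhouWeightFor (W : Cn n → ℝ≥0∞) (Φ : Cn n → EReal) : Prop where
  psh : PSHNear Φ
  intN : ∃ N₁ : ℕ, ∀ N₀ : ℕ, N₁ ≤ N₀ →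
    IntNear fun z => W z * ENNReal.ofReal (‖z‖ ^ (2 * N₀)) * wexp (-2) Φ z
  nonint : ¬ IntNear fun z => W z * wexp (-2) Φ z
  maximal : ∀ φ' : Cn n → EReal, PSHNear φ' → leO Φ φ' →
    (¬ IntNear fun z => W z * wexp (-2) φ' z) → eqO φ' Φ

/-- `Φ` is a local Zhou weight related to `|f₀|² e^{-2φ₀}` near the origin (including the
standing assumptions that `f₀` is a tuple of holomorphic functions near `o`, `φ₀` is
plurisubharmonic near `o`, and `|f₀|² e^{-2φ₀}` is integrable near `o`). -/
structure IsLocalZhouWeight {m : ℕ} (f₀ : Fin m → Cn n → ℂ) (φ₀ : Cn n → EReal)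
    (Φ : Cn n → EReal) : Prop where
  holo : ∀ j, HoloNear (f₀ j)
  psh₀ : PSHNear φ₀
  int₀ : IntNear (dens0 f₀ φ₀)
  zhou : IsZhouWeightFor (dens0 f₀ φ₀) Φ

/-- The Zhou number (relative type) `σ(ψ, Φ) = sup { b ≥ 0 : ψ ≤ bΦ + O(1) near o }`. -/
def zhouNumber (ψ Φ : Cn n → EReal) : ℝ :=
  sSup {b : ℝ | 0 ≤ b ∧ leO ψ fun z => (b : EReal) * Φ z}

/-- `log ‖f‖ : ℂⁿ → EReal`. -/
def logAbs (f : Cn n → ℂ) (z : Cn n) : EReal := elog ‖f z‖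

/-- `ν(f, Φ) = σ(log|f|, Φ)`. -/
def nuNumber (f : Cn n → ℂ) (Φ : Cn n → EReal) : ℝ := zhouNumber (logAbs f) Φ

/-- The jumping number `c_o^G(Φ) = sup { c ≥ 0 : |G|² e^{-2cΦ} integrable near o }`. -/
def jumping (G : Cn n → ℂ) (Φ : Cn n → EReal) : ℝ :=
  sSup {c : ℝ | 0 ≤ c ∧ IntNear fun z => (‖G z‖₊ : ℝ≥0∞) ^ 2 * wexp (-2 * c) Φ z}

/-- The inclusion `ℐ(φ)ₒ ⊆ ℐ(ψ)ₒ` of multiplier ideals at the origin. -/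
def mIdealLE (φ ψ : Cn n → EReal) : Prop :=
  ∀ f : Cn n → ℂ, HoloNear f →
    (IntNear fun z => (‖f z‖₊ : ℝ≥0∞) ^ 2 * wexp (-2) φ z) →
    IntNear fun z => (‖f z‖₊ : ℝ≥0∞) ^ 2 * wexp (-2) ψ z

/-- The Tian function `Tn(t; f, v, φ₀) = sup { c ≥ 0 : |f|^{2t} e^{-2cv - 2φ₀} integrable near o }`. -/
def tian (t : ℝ) (f : Cn n → ℂ) (v φ₀ : Cn n → EReal) : ℝ :=
  sSup {c : ℝ | 0 ≤ c ∧
    IntNear fun z => ENNReal.ofReal (‖f z‖ ^ (2 * t)) * wexp (-2 * c) v z * wexp (-2) φ₀ z}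

open Metric Real Set
open scoped ComplexConjugate ContDiff
open Complex (I I_mul_I add_re conjCLE conj_conj conj_ofNat continuous_re mul_conj
  normSq_eq_norm_sq norm_real ofRealCLM ofReal_re ofReal_zero reCLM re_add_im re_ofReal_mul
  sub_re)
open ContinuousLinearMap (proj)
open Finset (HasAntidiagonal mul_sum single_le_sum sum_add_distrib sum_congr sum_insert
  sum_le_sum sum_mul sum_nonneg sum_sub_distrib)
open MvPowerSeries (coeff coeff_C_mul coeff_monomial coeff_mul monomial)
open ENNReal (ofReal ofReal_mul ofReal_le_ofReal ofReal_ne_top ofReal_pow)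
open EReal (coe_le_coe_iff coe_lt_coe_iff coe_mul coe_add coe_nonneg coe_toReal)

variable {f g : Cn n → ℂ} {u φ : Cn n → EReal} {k v : Cn n → ℝ} {a : Fin n → Cn n → ℂ}
  {Ω U : Set (Cn n)} {z : Cn n} {ε δ t r R : ℝ}

theorem norm_fderiv_le_of_bound_ball {r M : ℝ} (hr : 0 < r) (hf : DifferentiableOn ℂ f (ball z r))
    (hM : ∀ x ∈ ball z r, ‖f x‖ ≤ M) :
    ‖fderiv ℂ f z‖ ≤ 2 * M / r := by
  refine Complex.norm_fderiv_le_div_of_mapsTo_ball hf (fun x hx => ?_) hr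
  rw [mem_closedBall, dist_eq_norm]
  have h1 := hM x hx
  have h2 := hM z (mem_ball_self hr)
  have := norm_sub_le (f x) (f z)
  linarith

/-- Integrals of holomorphic functions along a curve depend holomorphically on the base point. -/
theorem differentiableAt_curve_integral {m : ℕ} (hU : IsOpen U) (hf : DifferentiableOn ℂ f U)
    (A : Cn m →L[ℂ] Cn n) {γ : ℝ → Cn n} (hγ : Continuous γ) {k : ℝ → ℂ} (hk : Continuous k)
    (a b : ℝ) (x₀ : Cn m) (hx : ∀ θ ∈ uIcc a b, A x₀ + γ θ ∈ U) :
    DifferentiableAt ℂ (fun x => ∫ θ in a..b, k θ * f (A x + γ θ)) x₀ := by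
  set K : Set (Cn n) := (fun θ => A x₀ + γ θ) '' uIcc a b with hK
  have hKc : IsCompact K := isCompact_uIcc.image (by fun_prop)
  have hKU : K ⊆ U := by rintro _ ⟨θ, hθ, rfl⟩; exact hx θ hθ
  obtain ⟨δ, hδ, hδU⟩ := hKc.exists_cthickening_subset_open hU hKU
  have hTc : IsCompact (cthickening δ K) := hKc.cthickening
  obtain ⟨M, hM⟩ := hTc.exists_bound_of_continuousOn (hf.continuousOn.mono hδU)
  have hs : {x | ‖A x - A x₀‖ < δ / 2} ∈ 𝓝 x₀ := by
    have : Continuous fun x => ‖A x - A x₀‖ := by fun_prop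
    refine (isOpen_lt this continuous_const).mem_nhds ?_
    simpa using hδ
  have hball : ∀ x ∈ {x | ‖A x - A x₀‖ < δ / 2}, ∀ θ ∈ uIcc a b,
      ball (A x + γ θ) (δ / 2) ⊆ cthickening δ K := by
    intro x hx θ hθ y hy
    refine mem_cthickening_of_dist_le y (A x₀ + γ θ) δ K ⟨θ, hθ, rfl⟩ ?_
    have h1 : dist y (A x + γ θ) < δ / 2 := hy
    have h2 : dist (A x + γ θ) (A x₀ + γ θ) < δ / 2 := by
      rw [dist_add_right, dist_eq_norm]; exact hx
    linarith [dist_triangle y (A x + γ θ) (A x₀ + γ θ)]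
  obtain ⟨B, hB⟩ := isCompact_uIcc.exists_bound_of_continuousOn (f := k) (s := uIcc a b)
    hk.continuousOn
  have hcont : ∀ x ∈ {x | ‖A x - A x₀‖ < δ / 2},
      ContinuousOn (fun θ => k θ * f (A x + γ θ)) (uIcc a b) := by
    intro x hx
    refine hk.continuousOn.mul (hf.continuousOn.comp (by fun_prop) ?_)
    intro θ hθ
    exact hδU (hball x hx θ hθ (mem_ball_self (by linarith)))
  have key := hasFDerivAt_integral_of_dominated_of_fderiv_le (𝕜 := ℂ)
    (μ := volume.restrict (uIoc a b)) (F := fun x θ => k θ * f (A x + γ θ))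
    (F' := fun x θ => k θ • (fderiv ℂ f (A x + γ θ)).comp A) (x₀ := x₀)
    (bound := fun _ => B * (2 * M / (δ / 2) * ‖A‖)) hs ?_ ?_ ?_ ?_ ?_ ?_
  · simp only [intervalIntegral.intervalIntegral_eq_integral_uIoc]
    exact (key.differentiableAt).const_smul _
  · filter_upwards [hs] with x hx
    exact ((hcont x hx).mono uIoc_subset_uIcc).aestronglyMeasurable measurableSet_uIoc
  · have h0 : ‖A x₀ - A x₀‖ < δ / 2 := by simpa using hδ
    exact ((hcont x₀ h0).intervalIntegrable).def'
  · refine Measurable.aestronglyMeasurable ?_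
    refine hk.measurable.smul ?_
    have h1 : Measurable fun θ => fderiv ℂ f (A x₀ + γ θ) :=
      (measurable_fderiv ℂ f).comp (by fun_prop)
    have h2 : Continuous fun L : Cn n →L[ℂ] ℂ => L.comp A := by fun_prop
    exact h2.measurable.comp h1
  · refine (ae_restrict_iff' measurableSet_uIoc).2 (Eventually.of_forall fun θ hθ x hx => ?_)
    have hθ' := uIoc_subset_uIcc hθ
    rw [norm_smul]
    have h1 : ‖fderiv ℂ f (A x + γ θ)‖ ≤ 2 * M / (δ / 2) :=
      norm_fderiv_le_of_bound_ball (by linarith)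
        (hf.mono ((hball x hx θ hθ').trans hδU)) fun y hy => hM y (hball x hx θ hθ' hy)
    have h2 := ContinuousLinearMap.opNorm_comp_le (fderiv ℂ f (A x + γ θ)) A
    have h3 := hB θ hθ'
    have h4 : ‖(fderiv ℂ f (A x + γ θ)).comp A‖ ≤ 2 * M / (δ / 2) * ‖A‖ :=
      h2.trans (mul_le_mul_of_nonneg_right h1 (norm_nonneg _))
    exact mul_le_mul h3 h4 (norm_nonneg _) ((norm_nonneg _).trans h3)
  · exact (intervalIntegrable_const (μ := volume) (a := a) (b := b)).def'
  · refine (ae_restrict_iff' measurableSet_uIoc).2 (Eventually.of_forall fun θ hθ x hx => ?_)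
    have hθ' := uIoc_subset_uIcc hθ
    have hmem : A x + γ θ ∈ U := hδU (hball x hx θ hθ' (mem_ball_self (by linarith)))
    have h1 : HasFDerivAt f (fderiv ℂ f (A x + γ θ)) (A x + γ θ) :=
      (hf.differentiableAt (hU.mem_nhds hmem)).hasFDerivAt
    have h2 : HasFDerivAt (fun x => A x + γ θ) A x := A.hasFDerivAt.add_const _
    exact (h1.comp x h2).const_mul (k θ)

theorem differentiableOn_line (hU : IsOpen U) (hf : DifferentiableOn ℂ f U) (z w : Cn n) {s : Set ℂ}
    (hs : ∀ ζ ∈ s, z + ζ • w ∈ U) :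
    DifferentiableOn ℂ (fun ζ : ℂ => f (z + ζ • w)) s := by
  intro ζ hζ
  have h1 := hf.differentiableAt (hU.mem_nhds (hs ζ hζ))
  have h2 : DifferentiableAt ℂ (fun ζ : ℂ => z + ζ • w) ζ := by fun_prop
  exact (h1.comp ζ h2).differentiableWithinAt

/-- Directional derivatives of holomorphic functions are holomorphic. -/
theorem differentiableOn_fderiv_apply (hU : IsOpen U) (hf : DifferentiableOn ℂ f U) (w : Cn n) :
    DifferentiableOn ℂ (fun z => fderiv ℂ f z w) U := by
  intro z₀ hz₀
  obtain ⟨r, hr, hrU⟩ := Metric.isOpen_iff.1 hU z₀ hz₀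
  set ρ : ℝ := r / (2 * (1 + ‖w‖)) with hρ
  have hw : 0 < 1 + ‖w‖ := by positivity
  have hρ0 : 0 < ρ := by positivity
  have hρw : ρ * ‖w‖ < r / 2 := by
    have : ρ * (1 + ‖w‖) = r / 2 := by rw [hρ]; field_simp
    nlinarith
  have hmem : ∀ z ∈ ball z₀ (r / 2), ∀ ζ : ℂ, ‖ζ‖ ≤ ρ → z + ζ • w ∈ U := by
    intro z hz ζ hζ
    apply hrU
    rw [mem_ball, dist_eq_norm] at *
    have : z + ζ • w - z₀ = (z - z₀) + ζ • w := by abel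
    rw [this]
    have h1 : ‖ζ • w‖ ≤ ρ * ‖w‖ := by
      rw [norm_smul]; exact mul_le_mul_of_nonneg_right hζ (norm_nonneg _)
    linarith [norm_add_le (z - z₀) (ζ • w)]
  have hform : ∀ z ∈ ball z₀ (r / 2), fderiv ℂ f z w =
      (2 * Real.pi * I : ℂ)⁻¹ * ∫ θ in (0:ℝ)..2 * Real.pi,
        (deriv (circleMap 0 ρ) θ * ((circleMap 0 ρ θ) ^ 2)⁻¹) *
          f (ContinuousLinearMap.id ℂ (Cn n) z + circleMap 0 ρ θ • w) := by
    intro z hz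
    have hd : DifferentiableOn ℂ (fun ζ : ℂ => f (z + ζ • w)) (closedBall 0 ρ) := by
      refine differentiableOn_line hU hf z w fun ζ hζ => hmem z hz ζ (by simpa using hζ)
    have h0 := hd.deriv_eq_smul_circleIntegral hρ0
    have h1 : deriv (fun ζ : ℂ => f (z + ζ • w)) 0 = fderiv ℂ f z w := by
      have hz' : z ∈ U := by simpa using hmem z hz 0 (by simpa using hρ0.le)
      have h2 : HasFDerivAt f (fderiv ℂ f z) (z + (0:ℂ) • w) := by
        simpa using (hf.differentiableAt (hU.mem_nhds hz')).hasFDerivAt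
      have h3 : HasDerivAt (fun ζ : ℂ => z + ζ • w) w 0 := by
        simpa using ((hasDerivAt_id (0:ℂ)).smul_const w).const_add z
      exact (h2.comp_hasDerivAt 0 h3).deriv
    rw [h1] at h0
    have h2 : (2 * Real.pi * I : ℂ) ≠ 0 := Complex.two_pi_I_ne_zero
    rw [eq_inv_mul_iff_mul_eq₀ h2, ← smul_eq_mul, ← h0, circleIntegral]
    refine intervalIntegral.integral_congr fun θ _ => ?_
    simp only [smul_eq_mul, one_div, sub_zero, ContinuousLinearMap.id_apply]
    ring
  have hdiff : DifferentiableAt ℂ (fun z => (2 * Real.pi * I : ℂ)⁻¹ *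
      ∫ θ in (0:ℝ)..2 * Real.pi, (deriv (circleMap 0 ρ) θ * ((circleMap 0 ρ θ) ^ 2)⁻¹) *
          f (ContinuousLinearMap.id ℂ (Cn n) z + circleMap 0 ρ θ • w)) z₀ := by
    refine (differentiableAt_curve_integral hU hf _ ?_ ?_ _ _ z₀ ?_).const_mul _
    · exact (continuous_circleMap 0 ρ).smul continuous_const
    · simp only [deriv_circleMap]
      refine ((continuous_circleMap 0 ρ).mul continuous_const).mul
        (((continuous_circleMap 0 ρ).pow 2).inv₀ fun θ => ?_)
      exact pow_ne_zero _ (circleMap_ne_center hρ0.ne')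
    · intro θ _
      exact hmem z₀ (mem_ball_self (by linarith)) _ (by simp [abs_of_pos hρ0])
  refine (hdiff.congr_of_eventuallyEq ?_).differentiableWithinAt
  filter_upwards [ball_mem_nhds z₀ (half_pos hr)] with z hz using hform z hz

/-- Holomorphic functions of several variables are smooth. -/
theorem contDiffOn_of_holo (hU : IsOpen U) (hf : DifferentiableOn ℂ f U) : ContDiffOn ℂ ∞ f U := by
  rw [contDiffOn_infty]
  intro k
  induction k generalizing f with
  | zero => simpa using hf.continuousOn
  | succ k ih =>
    have := contDiffOn_succ_iff_fderiv_of_isOpen (𝕜 := ℂ) (n := (k : WithTop ℕ∞)) (f := f) hU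
    push_cast
    refine this.2 ⟨hf, fun h => ?_, ?_⟩
    · exact absurd h (by exact_mod_cast WithTop.coe_ne_top)
    · exact contDiffOn_clm_apply.2 fun w => ih (differentiableOn_fderiv_apply hU hf w)

theorem contDiffOn_real_of_holo (hU : IsOpen U) (hf : DifferentiableOn ℂ f U) : ContDiffOn ℝ ∞ f U :=
  (contDiffOn_of_holo hU hf).restrict_scalars ℝ

/-- The monomial `z ^ α`. -/
def zmono (z : Cn n) (α : Fin n →₀ ℕ) : ℂ := ∏ i, z i ^ α i

/-- Exponents in `n + 1` variables split off the first exponent. -/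
def consEquivFinsupp (n : ℕ) : ℕ × (Fin n →₀ ℕ) ≃ (Fin (n + 1) →₀ ℕ) where
  toFun p := Finsupp.cons p.1 p.2
  invFun α := (α 0, Finsupp.tail α)
  left_inv p := by simp
  right_inv α := by simp

theorem summable_prod_pow : ∀ {n : ℕ} (q : Fin n → ℝ), (∀ i, 0 ≤ q i) → (∀ i, q i < 1) →
    Summable fun α : Fin n →₀ ℕ => ∏ i, q i ^ α i
  | 0, q, _, _ => (hasSum_fintype _).summable
  | n + 1, q, h0, h1 => by
    rw [← (consEquivFinsupp n).summable_iff]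
    have h2 := summable_prod_pow (fun i : Fin n => q i.succ) (fun i => h0 _) (fun i => h1 _)
    have h3 := summable_geometric_of_lt_one (h0 0) (h1 0)
    refine (h3.mul_of_nonneg h2 (fun m => pow_nonneg (h0 0) m)
      (fun α => Finset.prod_nonneg fun i _ => pow_nonneg (h0 _) _)).congr fun p => ?_
    simp [consEquivFinsupp, Fin.prod_univ_succ]

/-- The inclusion `z' ↦ (0, z')`. -/
def consZeroL (n : ℕ) : Cn n →L[ℂ] Cn (n + 1) :=
  ContinuousLinearMap.pi fun i => Fin.cases 0 (fun j => proj j) i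

theorem consZeroL_add (z' : Cn n) (ζ : ℂ) :
    consZeroL n z' + ζ • Pi.single 0 1 = (Fin.cons ζ z' : Cn (n + 1)) := by
  ext i
  refine Fin.cases ?_ (fun j => ?_) i <;> simp [consZeroL]

theorem norm_cons_lt {z' : Cn n} {ζ : ℂ} (hr : 0 < r) (h1 : ‖ζ‖ < r) (h2 : ‖z'‖ < r) :
    ‖(Fin.cons ζ z' : Cn (n + 1))‖ < r := by
  rw [pi_norm_lt_iff hr] at *
  intro i
  refine Fin.cases ?_ (fun j => ?_) i
  · simpa using h1
  · simpa using h2 j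

/-- Power series expansion of a bounded holomorphic function on a polydisc. -/
theorem exists_power_series : ∀ {n : ℕ} {f : Cn n → ℂ} {R M ρ : ℝ}, 0 < ρ → ρ < R →
    DifferentiableOn ℂ f (ball 0 R) → (∀ z ∈ ball (0 : Cn n) R, ‖f z‖ ≤ M) →
    ∃ a : (Fin n →₀ ℕ) → ℂ, (∀ α, ‖a α‖ * ρ ^ (∑ i, α i) ≤ M) ∧
      ∀ z ∈ ball (0 : Cn n) ρ, HasSum (fun α => a α * zmono z α) (f z)
  | 0, f, R, M, ρ, hρ, hR, hf, hM => by
    refine ⟨fun _ => f 0, fun α => ?_, fun z _ => ?_⟩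
    · simpa using hM 0 (mem_ball_self (by linarith))
    · have : z = 0 := Subsingleton.elim _ _
      subst this
      simp [zmono]
  | n + 1, f, R, M, ρ, hρ, hR, hf, hM => by
    have hM0 : 0 ≤ M := (norm_nonneg _).trans (hM 0 (mem_ball_self (by linarith)))
    set c : ℕ → Cn n → ℂ := fun m z' => (2 * Real.pi * I : ℂ)⁻¹ *
      ∫ θ in (0:ℝ)..2 * Real.pi, (deriv (circleMap 0 ρ) θ * ((circleMap 0 ρ θ) ^ (m + 1))⁻¹) *
          f (consZeroL n z' + circleMap 0 ρ θ • Pi.single 0 1) with hc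
    have hin : ∀ z' ∈ ball (0 : Cn n) R, ∀ ζ : ℂ, ‖ζ‖ ≤ ρ →
        (Fin.cons ζ z' : Cn (n + 1)) ∈ ball (0 : Cn (n + 1)) R := by
      intro z' hz' ζ hζ
      rw [mem_ball_zero_iff] at *
      exact norm_cons_lt (by linarith) (by linarith) hz'
    have hcirc : ∀ m z', c m z' = (2 * Real.pi * I : ℂ)⁻¹ •
        ∮ ζ in C(0, ρ), (ζ ^ (m + 1))⁻¹ * f (Fin.cons ζ z') := by
      intro m z'
      simp only [hc, circleIntegral, smul_eq_mul, consZeroL_add]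
      congr 1
      refine intervalIntegral.integral_congr fun θ _ => ?_
      ring
    have hcd : ∀ m, DifferentiableOn ℂ (c m) (ball 0 R) := by
      intro m z' hz'
      refine ((differentiableAt_curve_integral isOpen_ball hf _ ?_ ?_ _ _ z'
        ?_).const_mul _).differentiableWithinAt
      · exact (continuous_circleMap 0 ρ).smul continuous_const
      · simp only [deriv_circleMap]
        refine ((continuous_circleMap 0 ρ).mul continuous_const).mul
          (((continuous_circleMap 0 ρ).pow _).inv₀ fun θ => ?_)
        exact pow_ne_zero _ (circleMap_ne_center hρ.ne')
      · intro θ _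
        rw [consZeroL_add]
        exact hin z' hz' _ (by simp [abs_of_pos hρ])
    have hcb : ∀ m, ∀ z' ∈ ball (0 : Cn n) R, ‖c m z'‖ ≤ M / ρ ^ m := by
      intro m z' hz'
      rw [hcirc]
      refine (circleIntegral.norm_two_pi_i_inv_smul_integral_le_of_norm_le_const hρ.le
        (C := (ρ ^ (m + 1))⁻¹ * M) fun ζ hζ => ?_).trans_eq ?_
      · have hζ' : ‖ζ‖ = ρ := by simpa using hζ
        rw [norm_mul, norm_inv, norm_pow, hζ']
        exact mul_le_mul_of_nonneg_left (hM _ (hin z' hz' ζ hζ'.le)) (by positivity)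
      · field_simp
        try ring
    choose a ha1 ha2 using fun m => exists_power_series hρ hR (hcd m) (hcb m)
    refine ⟨fun α => a (α 0) (Finsupp.tail α), fun α => ?_, fun z hz => ?_⟩
    · have h1 := ha1 (α 0) (Finsupp.tail α)
      rw [Fin.sum_univ_succ, pow_add]
      simp only [Finsupp.tail_apply] at h1
      have hp : 0 < ρ ^ α 0 := by positivity
      rw [le_div_iff₀ hp] at h1
      linarith
    · have hzn : ‖z‖ < ρ := by simpa using hz
      have hzi : ∀ i, ‖z i‖ < ρ := fun i => (norm_le_pi_norm z i).trans_lt hzn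
      have hsum : Summable fun α : Fin (n + 1) →₀ ℕ =>
          a (α 0) (Finsupp.tail α) * zmono z α := by
        have h1 := (summable_prod_pow (fun i => ‖z i‖ / ρ) (fun i => by positivity)
          (fun i => (div_lt_one hρ).2 (hzi i))).mul_left M
        refine Summable.of_norm_bounded h1 fun α => ?_
        have h2 := ha1 (α 0) (Finsupp.tail α)
        have hp : 0 < ρ ^ α 0 := by positivity
        rw [le_div_iff₀ hp] at h2
        have h3 : ‖a (α 0) (Finsupp.tail α)‖ * ρ ^ (∑ i, α i) ≤ M := by
          rw [Fin.sum_univ_succ, pow_add]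
          simp only [Finsupp.tail_apply] at h2
          linarith
        rw [norm_mul, zmono, norm_prod]
        simp only [norm_pow, div_pow, Finset.prod_div_distrib, Finset.prod_pow_eq_pow_sum]
        rw [mul_div_assoc', le_div_iff₀ (by positivity)]
        have h4 : 0 ≤ ∏ i, ‖z i‖ ^ α i := by positivity
        nlinarith
      have hz' : Fin.tail z ∈ ball (0 : Cn n) ρ := by
        rw [mem_ball_zero_iff, pi_norm_lt_iff hρ]
        exact fun i => hzi _
      have hz'R : Fin.tail z ∈ ball (0 : Cn n) R := ball_subset_ball hR.le hz'
      have hS : HasSum (fun m => c m (Fin.tail z) * z 0 ^ m) (f z) := by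
        have hd : DifferentiableOn ℂ (fun ζ : ℂ => f (Fin.cons ζ (Fin.tail z)))
            (closedBall 0 ρ) := by
          have := differentiableOn_line isOpen_ball hf (consZeroL n (Fin.tail z))
            (Pi.single 0 1) (s := closedBall 0 ρ) fun ζ hζ => by
              rw [consZeroL_add]; exact hin _ hz'R ζ (by simpa using hζ)
          simpa only [consZeroL_add] using this
        have h1 := hasSum_cauchyPowerSeries_integral (c := 0) (w := z 0)
          ((hd.continuousOn.mono sphere_subset_closedBall)|>.circleIntegrable hρ.le) (hzi 0)
        have h2 := hd.circleIntegral_sub_inv_smul (w := z 0) (by simpa using hzi 0)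
        rw [zero_add, h2, smul_smul, inv_mul_cancel₀ Complex.two_pi_I_ne_zero, one_smul,
          Fin.cons_self_tail] at h1
        refine h1.congr_fun fun m => ?_
        rw [hcirc, cauchyPowerSeries_apply, smul_mul_assoc, mul_comm _ (z 0 ^ m), ← smul_eq_mul (z 0 ^ m),
          ← circleIntegral.integral_smul]
        congr 1
        refine circleIntegral.integral_congr hρ.le fun ζ hζ => ?_
        have hζ0 : ζ ≠ 0 := by
          rintro rfl
          simp [hρ.ne] at hζ
        simp only [smul_eq_mul, sub_zero, div_pow, pow_succ]
        field_simp
      have hfin := hsum.hasSum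
      rw [← (consEquivFinsupp n).hasSum_iff] at hfin
      have h5 := hfin.prod_fiberwise (g := fun m => c m (Fin.tail z) * z 0 ^ m) fun m => by
        refine ((ha2 m _ hz').mul_right (z 0 ^ m)).congr_fun fun α => ?_
        simp only [consEquivFinsupp, Function.comp, Equiv.coe_fn_mk, zmono, Fin.prod_univ_succ,
          Finsupp.cons_zero, Finsupp.cons_succ, Finsupp.tail_cons, Fin.tail]
        ring
      rw [← h5.unique hS]
      exact hsum.hasSum

/-- Locally uniform limits of holomorphic functions of several variables are holomorphic. -/
theorem differentiableOn_of_tendstoUniformlyOn_ball {ι : Type*} [Nonempty ι] [SemilatticeSup ι]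
    {f : ι → Cn n → ℂ} (hr : 0 < r) (hf : ∀ i, DifferentiableOn ℂ (f i) (ball z r))
    (hfg : TendstoUniformlyOn f g atTop (ball z r)) :
    DifferentiableOn ℂ g (ball z (r / 2)) := by
  have hsub : ∀ x ∈ ball z (r / 2), ball x (r / 2) ⊆ ball z r := by
    intro x hx
    refine ball_subset_ball' ?_
    have : dist x z < r / 2 := hx
    linarith
  have hC : UniformCauchySeqOn (fun i => fderiv ℂ (f i)) atTop (ball z (r / 2)) := by
    rw [uniformCauchySeqOn_iff]
    intro ε hε
    obtain ⟨N, hN⟩ := uniformCauchySeqOn_iff.1 hfg.uniformCauchySeqOn (ε * r / 8)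
      (by positivity)
    refine ⟨N, fun m hm k hk x hx => ?_⟩
    have hx' : x ∈ ball z r := hsub x hx (mem_ball_self (by linarith))
    have hd : ∀ i, DifferentiableAt ℂ (f i) x := fun i =>
      (hf i).differentiableAt (isOpen_ball.mem_nhds hx')
    have h1 := norm_fderiv_le_of_bound_ball (f := fun y => f m y - f k y) (z := x)
      (r := r / 2) (M := ε * r / 8) (by linarith)
      (((hf m).sub (hf k)).mono (hsub x hx)) fun y hy => by
        have := hN m hm k hk y (hsub x hx hy)
        rw [dist_eq_norm] at this
        exact this.le
    have h2 : fderiv ℂ (fun y => f m y - f k y) x = fderiv ℂ (f m) x - fderiv ℂ (f k) x :=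
      fderiv_fun_sub (hd m) (hd k)
    rw [dist_eq_norm, ← h2]
    refine h1.trans_lt ?_
    have : 2 * (ε * r / 8) / (r / 2) = ε / 2 := by field_simp; ring
    rw [this]
    linarith
  have hlim : ∀ x ∈ ball z (r / 2), ∃ L, Tendsto (fun i => fderiv ℂ (f i) x) atTop (𝓝 L) :=
    fun x hx => CompleteSpace.complete (hC.cauchy_map hx)
  choose! g' hg' using hlim
  have hU := hC.tendstoUniformlyOn_of_tendsto hg'
  intro x hx
  refine (hasFDerivAt_of_tendstoUniformlyOn (f := f) isOpen_ball hU (fun i y hy => ?_)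
    (fun y hy => ?_) hx).differentiableAt.differentiableWithinAt
  · exact ((hf i).differentiableAt (isOpen_ball.mem_nhds
      (hsub y hy (mem_ball_self (by linarith))))).hasFDerivAt
  · exact hfg.tendsto_at (hsub y hy (mem_ball_self (by linarith)))

theorem exists_transcendental_gt_one : ∃ x : ℝ, 1 < x ∧ Transcendental ℤ x := by
  have h := (Algebraic.countable ℤ ℝ).dense_compl ℝ
  obtain ⟨x, hx, hx1⟩ := h.exists_mem_open isOpen_Ioi (⟨2, by simp⟩ : (Ioi (1:ℝ)).Nonempty)
  exact ⟨x, hx1, hx⟩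

/-- A transcendental number larger than one. -/
def wbase : ℝ := Classical.choose exists_transcendental_gt_one

theorem one_lt_wbase : 1 < wbase := (Classical.choose_spec exists_transcendental_gt_one).1

theorem transcendental_wbase : Transcendental ℤ wbase :=
  (Classical.choose_spec exists_transcendental_gt_one).2

/-- An injective additive weight on exponents. -/
def lam (α : Fin n →₀ ℕ) : ℝ := ∑ i, (α i : ℝ) * wbase ^ (i : ℕ)

theorem lam_add (α β : Fin n →₀ ℕ) : lam (α + β) = lam α + lam β := by
  simp [lam, add_mul, sum_add_distrib]

theorem sum_le_lam (α : Fin n →₀ ℕ) : ((∑ i, α i : ℕ) : ℝ) ≤ lam α := by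
  push_cast
  refine sum_le_sum fun i _ => ?_
  have : 1 ≤ wbase ^ (i : ℕ) := one_le_pow₀ one_lt_wbase.le
  nlinarith [(Nat.cast_nonneg (α i) : (0:ℝ) ≤ α i)]

theorem lam_nonneg (α : Fin n →₀ ℕ) : 0 ≤ lam α :=
  (Nat.cast_nonneg _).trans (sum_le_lam α)

theorem lam_injective : Function.Injective (lam (n := n)) := by
  intro α β h
  set P : Polynomial ℤ := ∑ i : Fin n, Polynomial.monomial (i : ℕ) ((α i : ℤ) - β i) with hP
  have h0 : Polynomial.aeval wbase P = 0 := by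
    simp only [hP, map_sum, Polynomial.aeval_monomial]
    simp only [map_sub, sub_mul, sum_sub_distrib]
    have := sub_eq_zero.2 h
    simpa [lam] using this
  have h1 : P = 0 := by
    by_contra hne
    exact transcendental_wbase ⟨P, hne, h0⟩
  ext i
  have h2 : P.coeff i = 0 := by rw [h1]; simp
  rw [hP, Polynomial.finsetSum_coeff] at h2
  simp only [Polynomial.coeff_monomial, Fin.val_inj, Finset.sum_ite_eq', Finset.mem_univ,
    if_true] at h2
  omega

theorem finite_lam_le (C : ℝ) : {α : Fin n →₀ ℕ | lam α ≤ C}.Finite := by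
  obtain ⟨N, hN⟩ := exists_nat_ge C
  refine (finite_Iic (Finsupp.equivFunOnFinite.symm fun _ : Fin n => N)).subset fun α hα i => ?_
  have h1 : ((∑ i, α i : ℕ) : ℝ) ≤ N := (sum_le_lam α).trans (le_trans hα hN)
  have h2 : ∑ i, α i ≤ N := by exact_mod_cast h1
  exact (single_le_sum (fun j _ => Nat.zero_le (α j)) (Finset.mem_univ i)).trans h2

/-- The weighted `ℓ¹` norm of a power series. -/
def normT (t : ℝ) (a : MvPowerSeries (Fin n) ℂ) : ℝ≥0∞ :=
  ∑' α, ‖coeff α a‖ₑ * ofReal (t ^ lam α)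

theorem normT_add_le (t : ℝ) (a b : MvPowerSeries (Fin n) ℂ) :
    normT t (a + b) ≤ normT t a + normT t b := by
  rw [normT, normT, normT, ← ENNReal.tsum_add]
  refine ENNReal.tsum_le_tsum fun α => ?_
  rw [← add_mul, map_add]
  gcongr
  exact enorm_add_le _ _

theorem normT_neg (t : ℝ) (a : MvPowerSeries (Fin n) ℂ) : normT t (-a) = normT t a := by
  simp [normT]

theorem normT_zero (t : ℝ) : normT t (0 : MvPowerSeries (Fin n) ℂ) = 0 := by
  simp [normT]

theorem normT_sum_le {ι : Type*} (s : Finset ι) (t : ℝ) (a : ι → MvPowerSeries (Fin n) ℂ) :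
    normT t (∑ i ∈ s, a i) ≤ ∑ i ∈ s, normT t (a i) := by
  classical
  induction s using Finset.induction_on with
  | empty => simp [normT_zero]
  | insert i s hi ih =>
    rw [sum_insert hi, sum_insert hi]
    exact (normT_add_le _ _ _).trans (by gcongr)

theorem normT_mul_le (ht : 0 < t) (a b : MvPowerSeries (Fin n) ℂ) :
    normT t (a * b) ≤ normT t a * normT t b := by
  classical
  set A : (Fin n →₀ ℕ) → ℝ≥0∞ := fun α => ‖coeff α a‖ₑ * ofReal (t ^ lam α)
  set B : (Fin n →₀ ℕ) → ℝ≥0∞ := fun α => ‖coeff α b‖ₑ * ofReal (t ^ lam α)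
  have h1 : normT t a * normT t b = ∑' p : (Fin n →₀ ℕ) × (Fin n →₀ ℕ), A p.1 * B p.2 := by
    rw [ENNReal.tsum_prod (f := fun x y => A x * B y)]
    simp_rw [ENNReal.tsum_mul_left, ENNReal.tsum_mul_right]
    rfl
  rw [h1, ← HasAntidiagonal.sigmaAntidiagonalEquivProd.tsum_eq, ENNReal.tsum_sigma']
  refine ENNReal.tsum_le_tsum fun α => ?_
  rw [coeff_mul, tsum_fintype]
  simp only [HasAntidiagonal.sigmaAntidiagonalEquivProd_apply]
  rw [Finset.univ_eq_attach, Finset.sum_attach (HasAntidiagonal.antidiagonal α) (fun p => A p.1 * B p.2)]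
  refine (mul_le_mul_left (enorm_sum_le _ _) _).trans ?_
  rw [sum_mul]
  refine sum_le_sum fun p hp => ?_
  have h2 : p.1 + p.2 = α := by simpa using hp
  rw [← h2, lam_add, rpow_add ht, ofReal_mul (by positivity), enorm_mul]
  simp only [A, B]
  exact (by ring : _ = _).le

theorem normT_mono {s t : ℝ} (hs : 0 ≤ s) (hst : s ≤ t) (a : MvPowerSeries (Fin n) ℂ) :
    normT s a ≤ normT t a :=
  ENNReal.tsum_le_tsum fun α => by
    gcongr
    exact lam_nonneg α

/-- Series all of whose exponents have weight larger than `lam α₀` are small relative to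
`t ^ lam α₀`. -/
theorem exists_normT_le_mul {a : MvPowerSeries (Fin n) ℂ} {α₀ : Fin n →₀ ℕ} {t₀ : ℝ} (ht₀ : 0 < t₀)
    (ha : normT t₀ a ≠ ⊤) (hα : ∀ β, coeff β a ≠ 0 → lam α₀ < lam β) (hε : 0 < ε) :
    ∃ t₁ > 0, ∀ t, 0 < t → t ≤ t₁ →
      normT t a ≤ ofReal (ε * t ^ lam α₀) := by
  obtain ⟨δ, hδ, hgap⟩ : ∃ δ > 0, ∀ β, coeff β a ≠ 0 → lam α₀ + δ ≤ lam β := by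
    have hfin : ({β : Fin n →₀ ℕ | lam β ≤ lam α₀ + 1} ∩ {β | lam α₀ < lam β}).Finite :=
      (finite_lam_le _).inter_of_left _
    rcases eq_empty_or_nonempty
      ({β : Fin n →₀ ℕ | lam β ≤ lam α₀ + 1} ∩ {β | lam α₀ < lam β}) with he | hne
    · refine ⟨1, one_pos, fun β hβ => ?_⟩
      by_contra hlt
      have : β ∈ ({β : Fin n →₀ ℕ | lam β ≤ lam α₀ + 1} ∩ {β | lam α₀ < lam β}) :=
        ⟨(not_le.1 hlt).le, hα β hβ⟩
      rw [he] at this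
      exact this
    · obtain ⟨γ, hγ, hmin⟩ := exists_min_image _ lam hfin hne
      have hγ2 : lam α₀ < lam γ := hγ.2
      refine ⟨min 1 (lam γ - lam α₀), lt_min one_pos (by linarith), fun β hβ => ?_⟩
      by_cases hb : lam β ≤ lam α₀ + 1
      · have := hmin β ⟨hb, hα β hβ⟩
        linarith [min_le_right 1 (lam γ - lam α₀)]
      · linarith [min_le_left 1 (lam γ - lam α₀)]
  set S := (normT t₀ a).toReal with hS
  have hS0 : 0 ≤ S := ENNReal.toReal_nonneg
  have hlim : Tendsto (fun t : ℝ => (t / t₀) ^ δ * (S * t₀ ^ (-lam α₀))) (𝓝 0) (𝓝 0) := by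
    have h1 : ContinuousAt (fun t : ℝ => (t / t₀) ^ δ * (S * t₀ ^ (-lam α₀))) 0 :=
      ((continuousAt_id.div_const t₀).rpow_const (Or.inr hδ.le)).mul continuousAt_const
    have h2 := h1.tendsto
    simpa [zero_rpow hδ.ne'] using h2
  have hev := (hlim.eventually (gt_mem_nhds hε))
  obtain ⟨t₁, ht₁, hb⟩ := Metric.eventually_nhds_iff.1 hev
  refine ⟨min (t₁ / 2) t₀, by positivity, fun t ht htt => ?_⟩
  have htt₀ : t ≤ t₀ := htt.trans (min_le_right _ _)
  have hbt := hb (y := t) (by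
    rw [dist_zero_right, norm_eq_abs, abs_of_pos ht]
    linarith [min_le_left (t₁ / 2) t₀])
  have hmain : normT t a ≤ ofReal ((t / t₀) ^ δ * t₀ ^ (-lam α₀) * t ^ lam α₀) * normT t₀ a := by
    rw [normT, normT, ← ENNReal.tsum_mul_left]
    refine ENNReal.tsum_le_tsum fun β => ?_
    by_cases hβ : coeff β a = 0
    · simp [hβ]
    rw [mul_left_comm, ← ofReal_mul (by positivity)]
    gcongr
    have hq : 0 < t / t₀ := by positivity
    have hq1 : t / t₀ ≤ 1 := (div_le_one ht₀).2 htt₀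
    have e1 : t ^ lam β = (t / t₀) ^ lam β * t₀ ^ lam β := by
      rw [← mul_rpow hq.le ht₀.le, div_mul_cancel₀ _ ht₀.ne']
    have e2 : (t / t₀) ^ lam β ≤ (t / t₀) ^ (lam α₀ + δ) :=
      rpow_le_rpow_of_exponent_ge hq hq1 (hgap β hβ)
    have e3 : (t / t₀) ^ (lam α₀ + δ) = (t / t₀) ^ δ * t₀ ^ (-lam α₀) * t ^ lam α₀ := by
      rw [rpow_add hq, div_rpow ht.le ht₀.le, rpow_neg ht₀.le]
      field_simp
    rw [e1, ← e3]
    gcongr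
  refine hmain.trans ?_
  rw [← ENNReal.ofReal_toReal ha, ← hS, ← ofReal_mul (by positivity)]
  refine ofReal_le_ofReal ?_
  have : (t / t₀) ^ δ * t₀ ^ (-lam α₀) * t ^ lam α₀ * S =
    ((t / t₀) ^ δ * (S * t₀ ^ (-lam α₀))) * t ^ lam α₀ := by ring
  rw [this]
  gcongr

theorem exists_ball_norm_zmono_le (ht : 0 < t) :
    ∃ ρ > 0, ∀ z ∈ ball (0 : Cn n) ρ, ∀ α, ‖zmono z α‖ ≤ t ^ lam α := by
  have h : ∀ᶠ z in 𝓝 (0 : Cn n), ∀ i : Fin n, ‖z i‖ < t ^ (wbase ^ (i : ℕ)) := by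
    rw [eventually_all]
    intro i
    have : Continuous fun z : Cn n => ‖z i‖ := by fun_prop
    refine (isOpen_lt this continuous_const).mem_nhds ?_
    simpa using rpow_pos_of_pos ht _
  obtain ⟨ρ, hρ, hb⟩ := eventually_nhds_iff_ball.1 h
  refine ⟨ρ, hρ, fun z hz α => ?_⟩
  rw [zmono, norm_prod, lam, rpow_sum_of_pos ht]
  refine Finset.prod_le_prod (fun i _ => norm_nonneg _) fun i _ => ?_
  rw [norm_pow, mul_comm, rpow_mul ht.le, rpow_natCast]
  exact pow_le_pow_left₀ (norm_nonneg _) (hb z hz i).le _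

theorem summable_of_normT (ht : 0 < t) {a : MvPowerSeries (Fin n) ℂ} (ha : normT t a ≠ ⊤) :
    Summable fun α => ‖coeff α a‖ * t ^ lam α := by
  have := ENNReal.summable_toReal ha
  refine this.congr fun α => ?_
  rw [ENNReal.toReal_mul, toReal_enorm, ENNReal.toReal_ofReal (by positivity)]

theorem norm_coeff_mul_zmono_le {a : MvPowerSeries (Fin n) ℂ} (hz : ∀ α, ‖zmono z α‖ ≤ t ^ lam α)
    (α : Fin n →₀ ℕ) :
    ‖coeff α a * zmono z α‖ ≤ ‖coeff α a‖ * t ^ lam α := by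
  rw [norm_mul]
  exact mul_le_mul_of_nonneg_left (hz α) (norm_nonneg _)

/-- The convergent power series `a` represents the function `f` near the origin. -/
def SeriesRep (f : Cn n → ℂ) (a : MvPowerSeries (Fin n) ℂ) : Prop :=
  (∃ t > 0, normT t a ≠ ⊤) ∧
    ∀ᶠ z in 𝓝 (0 : Cn n), HasSum (fun α => coeff α a * zmono z α) (f z)

theorem SeriesRep.add {a b : MvPowerSeries (Fin n) ℂ} (hf : SeriesRep f a) (hg : SeriesRep g b) :
    SeriesRep (fun z => f z + g z) (a + b) := by
  obtain ⟨⟨s, hs, hsa⟩, h1⟩ := hf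
  obtain ⟨⟨t, ht, htb⟩, h2⟩ := hg
  refine ⟨⟨min s t, lt_min hs ht, ?_⟩, ?_⟩
  · have hm : 0 ≤ min s t := (lt_min hs ht).le
    refine ne_top_of_le_ne_top (ENNReal.add_ne_top.2 ⟨hsa, htb⟩)
      ((normT_add_le _ _ _).trans (add_le_add ?_ ?_))
    · exact normT_mono hm (min_le_left _ _) _
    · exact normT_mono hm (min_le_right _ _) _
  · filter_upwards [h1, h2] with z hz1 hz2
    simpa [add_mul] using hz1.add hz2

theorem zmono_add (z : Cn n) (α β : Fin n →₀ ℕ) : zmono z (α + β) = zmono z α * zmono z β := by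
  simp [zmono, pow_add, Finset.prod_mul_distrib]

theorem SeriesRep.mul {a b : MvPowerSeries (Fin n) ℂ} (hf : SeriesRep f a) (hg : SeriesRep g b) :
    SeriesRep (fun z => f z * g z) (a * b) := by
  classical
  obtain ⟨⟨s, hs, hsa⟩, h1⟩ := hf
  obtain ⟨⟨t, ht, htb⟩, h2⟩ := hg
  have hm : 0 < min s t := lt_min hs ht
  have hA : normT (min s t) a ≠ ⊤ := ne_top_of_le_ne_top hsa (normT_mono hm.le (min_le_left _ _) _)
  have hB : normT (min s t) b ≠ ⊤ := ne_top_of_le_ne_top htb (normT_mono hm.le (min_le_right _ _) _)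
  refine ⟨⟨min s t, hm, ?_⟩, ?_⟩
  · exact ne_top_of_le_ne_top (ENNReal.mul_ne_top hA hB) (normT_mul_le hm _ _)
  · obtain ⟨ρ, hρ, hb⟩ := exists_ball_norm_zmono_le (n := n) hm
    filter_upwards [h1, h2, ball_mem_nhds _ hρ] with z hz1 hz2 hz3
    have sA : Summable fun α => ‖coeff α a * zmono z α‖ :=
      Summable.of_nonneg_of_le (fun _ => norm_nonneg _) (norm_coeff_mul_zmono_le (hb z hz3))
        (summable_of_normT hm hA)
    have sB : Summable fun α => ‖coeff α b * zmono z α‖ :=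
      Summable.of_nonneg_of_le (fun _ => norm_nonneg _) (norm_coeff_mul_zmono_le (hb z hz3))
        (summable_of_normT hm hB)
    have sAB := summable_mul_of_summable_norm sA sB
    have hs1 := summable_sum_mul_antidiagonal_of_summable_mul
      (f := fun α => coeff α a * zmono z α)
      (g := fun α => coeff α b * zmono z α) sAB
    have hs2 := Summable.tsum_mul_tsum_eq_tsum_sum_antidiagonal
      (f := fun α => coeff α a * zmono z α)
      (g := fun α => coeff α b * zmono z α) sA.of_norm sB.of_norm sAB
    have e : ∀ α, ∑ kl ∈ HasAntidiagonal.antidiagonal α,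
        coeff kl.1 a * zmono z kl.1 * (coeff kl.2 b * zmono z kl.2) =
        coeff α (a * b) * zmono z α := by
      intro α
      rw [coeff_mul, sum_mul]
      refine sum_congr rfl fun p hp => ?_
      have h2 : p.1 + p.2 = α := by simpa using hp
      rw [← h2, zmono_add]
      ring
    simp only [e] at hs1 hs2
    rw [hz1.tsum_eq, hz2.tsum_eq] at hs2
    rw [hs2]
    exact hs1.hasSum

theorem normT_monomial (t : ℝ) (α : Fin n →₀ ℕ) (c : ℂ) :
    normT t (monomial α c) = ‖c‖ₑ * ofReal (t ^ lam α) := by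
  classical
  rw [normT, tsum_eq_single α]
  · simp
  · intro β hβ
    simp [coeff_monomial, hβ]

theorem rep_monomial (α : Fin n →₀ ℕ) (c : ℂ) :
    SeriesRep (fun z => c * zmono z α) (monomial α c) := by
  classical
  refine ⟨⟨1, one_pos, ?_⟩, Eventually.of_forall fun z => ?_⟩
  · rw [normT_monomial]
    exact ENNReal.mul_ne_top (by simp) ofReal_ne_top
  · have := hasSum_single (f := fun β => coeff β (monomial α c)
      * zmono z β) α fun β hβ => by simp [coeff_monomial, hβ]
    simpa using this

theorem differentiable_zmono (α : Fin n →₀ ℕ) : Differentiable ℂ fun z : Cn n => zmono z α := by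
  unfold zmono
  have h : ∀ i ∈ (Finset.univ : Finset (Fin n)), Differentiable ℂ fun z : Cn n => z i ^ α i :=
    fun i _ => by fun_prop
  exact fun z => (HasFDerivAt.finsetProd fun i hi => (h i hi z).hasFDerivAt).differentiableAt

theorem SeriesRep.eventuallyEq {a : MvPowerSeries (Fin n) ℂ} (hf : SeriesRep f a)
    (hg : SeriesRep g a) : ∀ᶠ z in 𝓝 (0 : Cn n), f z = g z := by
  filter_upwards [hf.2, hg.2] with z h1 h2 using h1.unique h2

theorem exists_rep_of_normT (ht : 0 < t) {a : MvPowerSeries (Fin n) ℂ} (ha : normT t a ≠ ⊤) :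
    ∃ f : Cn n → ℂ, HoloNear f ∧ SeriesRep f a := by
  obtain ⟨ρ, hρ, hb⟩ := exists_ball_norm_zmono_le (n := n) ht
  have hs := summable_of_normT ht ha
  refine ⟨fun z => ∑' α, coeff α a * zmono z α,
    ⟨ball 0 (ρ / 2), ball_mem_nhds _ (by positivity), isOpen_ball, ?_⟩,
    ⟨t, ht, ha⟩, ?_⟩
  · refine differentiableOn_of_tendstoUniformlyOn_ball hρ (fun s => ?_)
      (tendstoUniformlyOn_tsum hs fun α z hz => norm_coeff_mul_zmono_le (hb z hz) α)
    exact DifferentiableOn.fun_sum fun α _ =>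
      ((differentiable_zmono α).const_mul _).differentiableOn
  · filter_upwards [ball_mem_nhds _ hρ] with z hz
    exact (Summable.of_norm_bounded hs (norm_coeff_mul_zmono_le (hb z hz))).hasSum

/-- Power series of a holomorphic function on a polydisc, with Cauchy estimates. -/
theorem exists_rep_normT_le (n : ℕ) : ∃ C : ℝ, 0 < C ∧ ∀ (f : Cn n → ℂ) (r M : ℝ), 0 < r → r < 4 →
    DifferentiableOn ℂ f (ball 0 r) → (∀ z ∈ ball (0 : Cn n) r, ‖f z‖ ≤ M) →
    ∃ a, SeriesRep f a ∧ normT (r / 4) a ≤ ofReal (C * M) := by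
  have hs := summable_prod_pow (fun _ : Fin n => (1 / 2 : ℝ)) (by norm_num) (by norm_num)
  refine ⟨(∑' α : Fin n →₀ ℕ, ∏ i, (1 / 2 : ℝ) ^ α i), ?_, fun f r M hr hr4 hf hM => ?_⟩
  · exact hs.tsum_pos (fun α => by positivity) 0 (by simp)
  have hM0 : 0 ≤ M := (norm_nonneg _).trans (hM 0 (mem_ball_self hr))
  obtain ⟨a, ha1, ha2⟩ := exists_power_series (half_pos hr) (half_lt_self hr) hf hM
  have hn : normT (r / 4) (a : MvPowerSeries (Fin n) ℂ) ≤
      ofReal ((∑' α : Fin n →₀ ℕ, ∏ i, (1 / 2 : ℝ) ^ α i) * M) := by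
    rw [mul_comm, ← tsum_mul_left, ENNReal.ofReal_tsum_of_nonneg (fun α => by positivity)
      (hs.mul_left M)]
    refine ENNReal.tsum_le_tsum fun α => ?_
    rw [← ofReal_norm, ← ofReal_mul (norm_nonneg _)]
    refine ofReal_le_ofReal ?_
    have h1 : (r / 4) ^ lam α ≤ (r / 4) ^ (∑ i, α i) := by
      rw [← rpow_natCast]
      exact rpow_le_rpow_of_exponent_ge (by positivity) (by linarith) (sum_le_lam α)
    have h2 : (r / 4) ^ (∑ i, α i) = (r / 2) ^ (∑ i, α i) * ∏ i, (1 / 2 : ℝ) ^ α i := by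
      rw [Finset.prod_pow_eq_pow_sum, ← mul_pow]
      congr 1
      ring
    have h3 : coeff α (a : MvPowerSeries (Fin n) ℂ) = a α := rfl
    rw [h3]
    calc ‖a α‖ * (r / 4) ^ lam α ≤ ‖a α‖ * ((r / 2) ^ (∑ i, α i) * ∏ i, (1 / 2 : ℝ) ^ α i) := by
          rw [← h2]; gcongr
      _ = ‖a α‖ * (r / 2) ^ (∑ i, α i) * ∏ i, (1 / 2 : ℝ) ^ α i := by ring
      _ ≤ M * ∏ i, (1 / 2 : ℝ) ^ α i := by gcongr; exact ha1 α
  refine ⟨a, ⟨⟨r / 4, by positivity, ne_top_of_le_ne_top ofReal_ne_top hn⟩, ?_⟩, hn⟩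
  filter_upwards [ball_mem_nhds _ (half_pos hr)] with z hz using ha2 z hz

theorem HoloNear.exists_rep (hf : HoloNear f) : ∃ a, SeriesRep f a := by
  obtain ⟨U, hU, hUo, hd⟩ := hf
  obtain ⟨C, _, hC⟩ := exists_rep_normT_le n
  have h0 : (0 : Cn n) ∈ U := mem_of_mem_nhds hU
  have hc : ContinuousAt f 0 := (hd.differentiableAt hU).continuousAt
  have h1 : ∀ᶠ z in 𝓝 (0 : Cn n), ‖f z‖ < ‖f 0‖ + 1 :=
    hc.norm.eventually (gt_mem_nhds (by linarith))
  obtain ⟨ρ, hρ, hb⟩ := eventually_nhds_iff_ball.1 (h1.and hU)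
  have hsub : ball (0 : Cn n) (min ρ 1) ⊆ ball 0 ρ :=
    ball_subset_ball (min_le_left _ _)
  obtain ⟨a, ha, _⟩ := hC f (min ρ 1) (‖f 0‖ + 1) (by positivity)
    ((min_le_right _ _).trans_lt (by norm_num))
    (hd.mono fun z hz => (hb z (hsub hz)).2) fun z hz => (hb z (hsub hz)).1.le
  exact ⟨a, ha⟩

/-- The power series with prescribed coefficients. -/
def mkSeries (c : (Fin n →₀ ℕ) → ℂ) : MvPowerSeries (Fin n) ℂ := c

@[simp] theorem coeff_mkSeries (c : (Fin n →₀ ℕ) → ℂ) (α : Fin n →₀ ℕ) :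
    coeff α (mkSeries c) = c α := rfl

theorem eq_zero_of_normT_eq_zero (ht : 0 < t) {a : MvPowerSeries (Fin n) ℂ} (h : normT t a = 0) :
    a = 0 := by
  ext α
  have := (ENNReal.tsum_eq_zero.1 h) α
  rcases mul_eq_zero.1 this with h | h
  · simpa using h
  · exact absurd h (by simpa using rpow_pos_of_pos ht _)

theorem normT_tail_tendsto_zero (ht : 0 < t) {p : ℕ → MvPowerSeries (Fin n) ℂ}
    (hp : ∑' k, normT t (p k) ≠ ⊤) : ∃ s : MvPowerSeries (Fin n) ℂ,
      normT t s ≤ ∑' k, normT t (p k) ∧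
      Tendsto (fun K => normT t (s - ∑ k ∈ Finset.range K, p k)) atTop (𝓝 0) := by
  have key : ∀ α, Summable fun k => coeff α (p k) := by
    intro α
    have h1 : ∑' k, ‖coeff α (p k)‖ₑ * ofReal (t ^ lam α) ≠ ⊤ :=
      ne_top_of_le_ne_top hp (ENNReal.tsum_le_tsum fun k => ENNReal.le_tsum α)
    rw [ENNReal.tsum_mul_right] at h1
    have h2 : ∑' k, ‖coeff α (p k)‖ₑ ≠ ⊤ := by
      intro h
      rw [h, ENNReal.top_mul (by simpa using rpow_pos_of_pos ht _)] at h1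
      exact h1 rfl
    have := ENNReal.summable_toReal h2
    simp only [toReal_enorm] at this
    exact this.of_norm
  have bound : ∀ q : ℕ → MvPowerSeries (Fin n) ℂ, normT t
      (mkSeries fun α => ∑' k, coeff α (q k)) ≤
      ∑' k, normT t (q k) := by
    intro q
    simp only [normT, coeff_mkSeries]
    rw [ENNReal.tsum_comm]
    refine ENNReal.tsum_le_tsum fun α => ?_
    rw [ENNReal.tsum_mul_right]
    gcongr
    exact enorm_tsum_le_tsum_enorm
  refine ⟨mkSeries fun α => ∑' k, coeff α (p k), bound p, ?_⟩
  refine tendsto_of_tendsto_of_tendsto_of_le_of_le tendsto_const_nhds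
    (ENNReal.tendsto_sum_nat_add _ hp) (fun _ => zero_le) fun K => ?_
  refine le_trans (le_of_eq ?_) (bound fun k => p (k + K))
  congr 1
  ext α
  have := (key α).sum_add_tsum_nat_add K
  rw [map_sub, map_sum, coeff_mkSeries, coeff_mkSeries]
  exact sub_eq_of_eq_add' this.symm

/-- A Neumann series argument: `1 - P` is onto if `P` is a contraction. -/
theorem exists_sub_eq_of_contraction (ht : 0 < t)
    (P : MvPowerSeries (Fin n) ℂ →+ MvPowerSeries (Fin n) ℂ)
    (hP : ∀ h, normT t (P h) ≤ 2⁻¹ * normT t h) (h : MvPowerSeries (Fin n) ℂ) (hh : normT t h ≠ ⊤) :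
    ∃ s, normT t s ≠ ⊤ ∧ s - P s = h := by
  have hk : ∀ k, normT t (P^[k] h) ≤ 2⁻¹ ^ k * normT t h := by
    intro k
    induction k with
    | zero => simp
    | succ k ih =>
      rw [Function.iterate_succ_apply']
      calc _ ≤ 2⁻¹ * normT t (P^[k] h) := hP _
        _ ≤ 2⁻¹ * (2⁻¹ ^ k * normT t h) := by gcongr
        _ = _ := by ring
  have hsum : ∑' k, normT t (P^[k] h) ≠ ⊤ := by
    refine ne_top_of_le_ne_top ?_ (ENNReal.tsum_le_tsum hk)
    rw [ENNReal.tsum_mul_right, ENNReal.tsum_geometric]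
    refine ENNReal.mul_ne_top ?_ hh
    simp
  obtain ⟨s, hs1, hs2⟩ := normT_tail_tendsto_zero ht hsum
  refine ⟨s, ne_top_of_le_ne_top hsum hs1, ?_⟩
  have h0 : Tendsto (fun K => normT t (P^[K] h)) atTop (𝓝 0) :=
    ENNReal.tendsto_atTop_zero_of_tsum_ne_top hsum
  have id1 : ∀ K, s - P s - h = (s - ∑ k ∈ Finset.range K, P^[k] h) +
      (-P (s - ∑ k ∈ Finset.range K, P^[k] h) + -P^[K] h) := by
    intro K
    have : ∑ k ∈ Finset.range K, P^[k] h - P (∑ k ∈ Finset.range K, P^[k] h) = h - P^[K] h := by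
      induction K with
      | zero => simp
      | succ K ih =>
        rw [Finset.sum_range_succ, map_add, ← Function.iterate_succ_apply' (f := P)]
        linear_combination ih
    rw [map_sub]
    linear_combination this
  have hle : ∀ K, normT t (s - P s - h) ≤ normT t (s - ∑ k ∈ Finset.range K, P^[k] h) +
      (2⁻¹ * normT t (s - ∑ k ∈ Finset.range K, P^[k] h) + normT t (P^[K] h)) := by
    intro K
    rw [id1 K]
    refine (normT_add_le _ _ _).trans (add_le_add le_rfl ?_)
    refine (normT_add_le _ _ _).trans ?_
    rw [normT_neg, normT_neg]
    exact add_le_add (hP _) le_rfl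
  have hlim : Tendsto (fun K => normT t (s - ∑ k ∈ Finset.range K, P^[k] h) +
      (2⁻¹ * normT t (s - ∑ k ∈ Finset.range K, P^[k] h) + normT t (P^[K] h))) atTop (𝓝 0) := by
    have h2 : (2⁻¹ : ℝ≥0∞) ≠ ⊤ := by simp
    simpa using hs2.add ((ENNReal.Tendsto.const_mul hs2 (Or.inr h2)).add h0)
  have := ge_of_tendsto' hlim hle
  exact sub_eq_zero.1 (eq_zero_of_normT_eq_zero ht (le_antisymm this zero_le))

/-- The part of `h` with exponents in `D`, divided by the monomial `z ^ a`. -/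
def quotPart (D : Set (Fin n →₀ ℕ)) (a : Fin n →₀ ℕ) :
    MvPowerSeries (Fin n) ℂ →+ MvPowerSeries (Fin n) ℂ where
  toFun h := mkSeries fun β =>
    open Classical in if a + β ∈ D then coeff (a + β) h else 0
  map_zero' := by ext; simp
  map_add' x y := by
    ext β
    simp only [map_add, coeff_mkSeries]
    split_ifs <;> simp

theorem coeff_quotPart (D : Set (Fin n →₀ ℕ)) (a β : Fin n →₀ ℕ) (h : MvPowerSeries (Fin n) ℂ) :
    coeff β (quotPart D a h) =
      open Classical in if a + β ∈ D then coeff (a + β) h else 0 := rfl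

theorem normT_quotPart_mul_le (ht : 0 < t) (D : Set (Fin n →₀ ℕ)) (a : Fin n →₀ ℕ)
    (h : MvPowerSeries (Fin n) ℂ) :
    ofReal (t ^ lam a) * normT t (quotPart D a h) ≤ normT t h := by
  rw [normT, ← ENNReal.tsum_mul_left]
  refine le_trans (ENNReal.tsum_le_tsum fun β => ?_) (ENNReal.tsum_comp_le_tsum_of_injective
    (add_right_injective a) fun α => ‖coeff α h‖ₑ * ofReal (t ^ lam α))
  rw [lam_add, rpow_add ht, ofReal_mul (by positivity), coeff_quotPart]
  split_ifs
  · exact le_of_eq (by ring)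
  · simp

/-- A set of functions which is the set of representatives of an ideal of the ring of germs of
holomorphic functions at the origin. -/
structure IsGermIdeal (J : Set (Cn n → ℂ)) : Prop where
  holo : ∀ f ∈ J, HoloNear f
  zero : (fun _ => 0) ∈ J
  add : ∀ f ∈ J, ∀ g ∈ J, (fun z => f z + g z) ∈ J
  mul : ∀ f, HoloNear f → ∀ g ∈ J, (fun z => f z * g z) ∈ J
  congr : ∀ f ∈ J, ∀ g : Cn n → ℂ, (∀ᶠ z in 𝓝 0, f z = g z) → g ∈ J

/-- Power series representing an element of `J`. -/
def seriesIn (J : Set (Cn n → ℂ)) (a : MvPowerSeries (Fin n) ℂ) : Prop := ∃ f ∈ J, SeriesRep f a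

theorem seriesRep_of_normT_eq {a b : MvPowerSeries (Fin n) ℂ} (h : SeriesRep f a) (hab : a = b) :
    SeriesRep f b := hab ▸ h

theorem holoNear_const (c : ℂ) : HoloNear fun _ : Cn n => c :=
  ⟨univ, univ_mem, isOpen_univ, differentiableOn_const c⟩

theorem seriesRep_const (c : ℂ) : SeriesRep (fun _ : Cn n => c) (MvPowerSeries.C c) := by
  have := seriesRep_of_normT_eq (rep_monomial (n := n) 0 c)
    (MvPowerSeries.monomial_zero_eq_C_apply c)
  simpa [zmono] using this

namespace IsGermIdeal

variable {J : Set (Cn n → ℂ)}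

theorem seriesIn_zero (hJ : IsGermIdeal J) : seriesIn J 0 := by
  refine ⟨_, hJ.zero, ?_⟩
  simpa using seriesRep_const (n := n) 0

theorem seriesIn_add (hJ : IsGermIdeal J) {a b : MvPowerSeries (Fin n) ℂ} (ha : seriesIn J a)
    (hb : seriesIn J b) :
    seriesIn J (a + b) := by
  obtain ⟨f, hf, hfa⟩ := ha
  obtain ⟨g, hg, hgb⟩ := hb
  exact ⟨_, hJ.add f hf g hg, hfa.add hgb⟩

theorem seriesIn_mul (hJ : IsGermIdeal J) (ht : 0 < t) {a b : MvPowerSeries (Fin n) ℂ}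
    (ha : normT t a ≠ ⊤) (hb : seriesIn J b) : seriesIn J (a * b) := by
  obtain ⟨f, hf, hfa⟩ := exists_rep_of_normT ht ha
  obtain ⟨g, hg, hgb⟩ := hb
  exact ⟨_, hJ.mul f hf g hg, hfa.mul hgb⟩

theorem seriesIn_C_mul (hJ : IsGermIdeal J) {b : MvPowerSeries (Fin n) ℂ} (c : ℂ)
    (hb : seriesIn J b) : seriesIn J (MvPowerSeries.C c * b) := by
  obtain ⟨g, hg, hgb⟩ := hb
  exact ⟨_, hJ.mul _ (holoNear_const c) g hg, (seriesRep_const c).mul hgb⟩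

theorem seriesIn_sum (hJ : IsGermIdeal J) {ι : Type*} (s : Finset ι)
    {a : ι → MvPowerSeries (Fin n) ℂ} (ha : ∀ i ∈ s, seriesIn J (a i)) : seriesIn J (∑ i ∈ s, a i) := by
  classical
  induction s using Finset.induction_on with
  | empty => simpa using hJ.seriesIn_zero
  | insert i s hi ih =>
    rw [sum_insert hi]
    exact hJ.seriesIn_add (ha i (by simp)) (ih fun j hj => ha j (by simp [hj]))

end IsGermIdeal

/-- The exponents of leading monomials of elements of `J`. -/
def leadExps (J : Set (Cn n → ℂ)) : Set (Fin n →₀ ℕ) :=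
  {α | ∃ p, seriesIn J p ∧ coeff α p = 1 ∧
    ∀ β, coeff β p ≠ 0 → lam α ≤ lam β}

/-- Division with remainder with respect to an ideal of germs. -/
theorem IsGermIdeal.exists_remainder {J : Set (Cn n → ℂ)} (hJ : IsGermIdeal J)
    {h : MvPowerSeries (Fin n) ℂ} {t₀ : ℝ} (ht₀ : 0 < t₀) (hh : normT t₀ h ≠ ⊤) :
    ∃ r : MvPowerSeries (Fin n) ℂ, (∃ t > 0, normT t r ≠ ⊤) ∧ seriesIn J (h - r) ∧
      ∀ α ∈ leadExps J, coeff α r = 0 := by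
  classical
  have hpwo : (leadExps J).IsPWO := isPWO_of_wellQuasiOrderedLE _
  have hfin : {a | Minimal (· ∈ leadExps J) a}.Finite :=
    (setOfPred_minimal_antichain _).finite_of_partiallyWellOrderedOn
      (hpwo.mono fun a ha => ha.prop)
  set A : Finset (Fin n →₀ ℕ) := hfin.toFinset with hA
  have hsel : ∀ α : Fin n →₀ ℕ, ∃ a, α ∈ leadExps J → a ∈ A ∧ a ≤ α := by
    intro α
    by_cases hα : α ∈ leadExps J
    · obtain ⟨a, ha, hm⟩ := hpwo.exists_le_minimal hα
      exact ⟨a, fun _ => ⟨by simpa [hA] using hm, ha⟩⟩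
    · exact ⟨0, fun h => absurd h hα⟩
  choose sel hsel using hsel
  have hgen : ∀ a : Fin n →₀ ℕ, ∃ p, a ∈ A → seriesIn J p ∧ coeff a p = 1 ∧
      ∀ β, coeff β p ≠ 0 → lam a ≤ lam β := by
    intro a
    by_cases ha : a ∈ A
    · obtain ⟨p, hp⟩ := (show Minimal (· ∈ leadExps J) a by simpa [hA] using ha).prop
      exact ⟨p, fun _ => hp⟩
    · exact ⟨0, fun h => absurd h ha⟩
  choose p hp using hgen
  set q : (Fin n →₀ ℕ) → MvPowerSeries (Fin n) ℂ := fun a => p a - monomial a 1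
    with hq
  set ε : ℝ := (2 * (A.card + 1))⁻¹ with hε
  have hε0 : 0 < ε := by positivity
  have hsmall : ∀ a : Fin n →₀ ℕ, ∃ t₁ > 0, a ∈ A → ∀ t, 0 < t → t ≤ t₁ →
      normT t (q a) ≤ ofReal (ε * t ^ lam a) := by
    intro a
    by_cases ha : a ∈ A
    · obtain ⟨⟨f, hf, ⟨s, hs, hsp⟩, -⟩, hc, hl⟩ := hp a ha
      have hs1 : normT (min s 1) (q a) ≠ ⊤ := by
        have hle : normT (min s 1) (q a) ≤ normT (min s 1) (p a) +
            normT (min s 1) (-monomial a 1) := by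
          rw [hq]
          simp only [sub_eq_add_neg]
          exact normT_add_le _ _ _
        refine ne_top_of_le_ne_top ?_ hle
        rw [normT_neg, normT_monomial]
        refine ENNReal.add_ne_top.2 ⟨ne_top_of_le_ne_top hsp
          (normT_mono (by positivity) (min_le_left _ _) _), ENNReal.mul_ne_top (by simp) (by simp)⟩
      obtain ⟨t₁, ht₁, h1⟩ := exists_normT_le_mul (α₀ := a) (by positivity) hs1 (fun β hβ => by
        have hne : β ≠ a := by
          rintro rfl
          simp [hq, hc] at hβ
        have : coeff β (p a) ≠ 0 := by
          simpa [hq, coeff_monomial, hne] using hβ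
        exact lt_of_le_of_ne (hl β this) fun h => hne (lam_injective h).symm) hε0
      exact ⟨t₁, ht₁, fun _ => h1⟩
    · exact ⟨1, one_pos, fun h => absurd h ha⟩
  choose t₁ ht₁ hsmall using hsmall
  obtain ⟨t, ht, htt₀, htA⟩ : ∃ t > 0, t ≤ t₀ ∧ ∀ a ∈ A, t ≤ t₁ a := by
    have : ∀ᶠ t in 𝓝[>] (0 : ℝ), t ≤ t₀ ∧ ∀ a ∈ A, t ≤ t₁ a := by
      refine nhdsWithin_le_nhds ((ge_mem_nhds ht₀).and ?_)
      exact (Filter.eventually_all_finset A).2 fun a _ => ge_mem_nhds (ht₁ a)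
    obtain ⟨t, h1, h2⟩ := (this.and self_mem_nhdsWithin).exists
    exact ⟨t, h2, h1⟩
  set D : (Fin n →₀ ℕ) → Set (Fin n →₀ ℕ) := fun a => {α | α ∈ leadExps J ∧ sel α = a} with hD
  let P : MvPowerSeries (Fin n) ℂ →+ MvPowerSeries (Fin n) ℂ :=
    -∑ a ∈ A, (AddMonoidHom.mulLeft (q a)).comp (quotPart (D a) a)
  have hPapp : ∀ x, P x = -∑ a ∈ A, q a * quotPart (D a) a x := fun x => by
    simp [P, AddMonoidHom.finsetSum_apply]
  have hP : ∀ x, normT t (P x) ≤ 2⁻¹ * normT t x := by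
    intro x
    rw [hPapp, normT_neg]
    refine (normT_sum_le _ _ _).trans ?_
    calc ∑ a ∈ A, normT t (q a * quotPart (D a) a x)
        ≤ ∑ a ∈ A, ofReal ε * normT t x := by
          refine sum_le_sum fun a ha => (normT_mul_le ht _ _).trans ?_
          calc _ ≤ ofReal (ε * t ^ lam a) * normT t (quotPart (D a) a x) := by
                gcongr
                exact hsmall a ha t ht (htA a ha)
            _ = ofReal ε * (ofReal (t ^ lam a) * normT t (quotPart (D a) a x)) := by
                rw [ofReal_mul hε0.le, mul_assoc]
            _ ≤ _ := by
                gcongr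
                exact normT_quotPart_mul_le ht _ _ _
      _ = ofReal (A.card * ε) * normT t x := by
          rw [Finset.sum_const, nsmul_eq_mul, ofReal_mul (by positivity),
            ENNReal.ofReal_natCast, mul_assoc]
      _ ≤ 2⁻¹ * normT t x := by
          gcongr
          have : (2⁻¹ : ℝ≥0∞) = ofReal 2⁻¹ := by
            rw [ENNReal.ofReal_inv_of_pos (by norm_num)]; simp
          rw [this]
          refine ofReal_le_ofReal ?_
          rw [hε, mul_inv, ← mul_assoc, mul_comm _ (2⁻¹ : ℝ), mul_assoc]
          have : (A.card : ℝ) * (A.card + 1 : ℝ)⁻¹ ≤ 1 := by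
            rw [← div_eq_mul_inv, div_le_one (by positivity)]
            linarith
          linarith
  obtain ⟨s, hs, hsP⟩ := exists_sub_eq_of_contraction ht P hP h
    (ne_top_of_le_ne_top hh (normT_mono ht.le htt₀ _))
  set r : MvPowerSeries (Fin n) ℂ :=
    mkSeries fun α => if α ∈ leadExps J then 0 else coeff α s with hr
  have hdecomp : s = ∑ a ∈ A, monomial a 1 * quotPart (D a) a s + r := by
    ext α
    rw [map_add, map_sum, hr, coeff_mkSeries]
    simp only [MvPowerSeries.coeff_monomial_mul, coeff_quotPart, one_mul]
    split_ifs with hα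
    · rw [Finset.sum_eq_single (sel α)]
      · have := (hsel α hα).2
        rw [if_pos this, add_tsub_cancel_of_le this, if_pos ⟨hα, rfl⟩, add_zero]
      · intro a _ hne
        split_ifs with h1 h2
        · rw [add_tsub_cancel_of_le h1] at h2
          exact absurd h2.2.symm hne
        · rfl
        · rfl
      · intro h
        exact absurd (hsel α hα).1 h
    · rw [Finset.sum_eq_zero, zero_add]
      intro a _
      split_ifs with h1 h2
      · rw [add_tsub_cancel_of_le h1] at h2
        exact absurd h2.1 hα
      · rfl
      · rfl
  refine ⟨r, ⟨t, ht, ?_⟩, ?_, fun α hα => by simp [hr, hα]⟩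
  · refine ne_top_of_le_ne_top hs (ENNReal.tsum_le_tsum fun α => ?_)
    gcongr
    rw [hr, coeff_mkSeries]
    split_ifs <;> simp
  · have : h - r = ∑ a ∈ A, quotPart (D a) a s * p a := by
      rw [← hsP, hPapp]
      calc s - -∑ a ∈ A, q a * quotPart (D a) a s - r
          = (∑ a ∈ A, monomial a 1 * quotPart (D a) a s + r)
            + ∑ a ∈ A, q a * quotPart (D a) a s - r := by rw [← hdecomp, sub_neg_eq_add]
        _ = ∑ a ∈ A, monomial a 1 * quotPart (D a) a s
            + ∑ a ∈ A, q a * quotPart (D a) a s := by ring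
        _ = _ := by
          rw [← sum_add_distrib]
          refine sum_congr rfl fun a _ => ?_
          rw [hq]
          ring
    rw [this]
    refine hJ.seriesIn_sum _ fun a ha => hJ.seriesIn_mul ht (fun htop => ?_) (hp a ha).1
    have := normT_quotPart_mul_le ht (D a) a s
    rw [htop, ENNReal.mul_top (by simpa using rpow_pos_of_pos ht _)] at this
    exact hs (top_le_iff.1 this)

theorem IsGermIdeal.exists_functional {J : Set (Cn n → ℂ)} (hJ : IsGermIdeal J)
    {r : MvPowerSeries (Fin n) ℂ} (hr0 : r ≠ 0) (hr : ∀ α ∈ leadExps J, coeff α r = 0) :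
    ∃ (M : ℕ) (c : ℝ), 0 < c ∧ ∀ a, seriesIn J (a - r) →
      ∃ β, lam β ≤ M ∧ c ≤ ‖coeff β a‖ := by
  classical
  obtain ⟨β₀, hβ₀⟩ : ∃ β, coeff β r ≠ 0 := by
    by_contra! h
    exact hr0 (MvPowerSeries.ext fun β => by simpa using h β)
  have hfin : {β : Fin n →₀ ℕ | lam β ≤ lam β₀ ∧ coeff β r ≠ 0}.Finite :=
    (finite_lam_le (lam β₀)).subset fun β hβ => hβ.1
  obtain ⟨α₀, ⟨hα₁, hα₂⟩, hmin⟩ := hfin.exists_minimalFor lam _ ⟨β₀, le_rfl, hβ₀⟩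
  have hmin' : ∀ β, lam β < lam α₀ → coeff β r = 0 := by
    intro β hβ
    by_contra h
    exact absurd (hmin ⟨hβ.le.trans hα₁, h⟩ hβ.le) (not_le.2 hβ)
  set T : Finset (Fin n →₀ ℕ) := (finite_lam_le (lam α₀)).toFinset with hT
  have hmemT : ∀ β, β ∈ T ↔ lam β ≤ lam α₀ := fun β => by simp [hT]
  let P : MvPowerSeries (Fin n) ℂ →ₗ[ℂ] (T → ℂ) := LinearMap.pi fun β => coeff β.1
  have hP : ∀ a (β : T), P a β = coeff β.1 a := fun a β => rfl
  let JS : Submodule ℂ (MvPowerSeries (Fin n) ℂ) :=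
    { carrier := {a | seriesIn J a}
      zero_mem' := hJ.seriesIn_zero
      add_mem' := fun ha hb => hJ.seriesIn_add ha hb
      smul_mem' := fun c a ha => by
        rw [MvPowerSeries.smul_eq_C_mul]
        exact hJ.seriesIn_C_mul c ha }
  have hmem : ∀ b, b ∈ JS ↔ seriesIn J b := fun b => Iff.rfl
  have hnot : P r ∉ JS.map P := by
    rintro ⟨b, hb, hbr⟩
    have hcoef : ∀ β, lam β ≤ lam α₀ → coeff β b = coeff β r := by
      intro β hβ
      have := congrFun hbr ⟨β, (hmemT β).2 hβ⟩
      simpa [hP] using this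
    refine hα₂ (hr α₀ ⟨MvPowerSeries.C (coeff α₀ r)⁻¹ * b,
      hJ.seriesIn_C_mul _ hb, ?_, fun β hβ => ?_⟩)
    · rw [coeff_C_mul, hcoef α₀ le_rfl, inv_mul_cancel₀ hα₂]
    · by_contra! h
      rw [coeff_C_mul, hcoef β h.le, hmin' β h, mul_zero] at hβ
      exact hβ rfl
  obtain ⟨ℓ, hℓ, hker⟩ := Submodule.exists_le_ker_of_notMem hnot
  let L : (T → ℂ) →L[ℂ] ℂ := LinearMap.toContinuousLinearMap ℓ
  obtain ⟨M, hM⟩ := exists_nat_ge (lam α₀)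
  refine ⟨M, ‖ℓ (P r)‖ / (‖L‖ + 1), by positivity, fun a ha => ?_⟩
  by_contra! h
  have h1 : ℓ (P a) = ℓ (P r) := by
    have : ℓ (P (a - r)) = 0 := hker (Submodule.mem_map_of_mem ((hmem _).2 ha))
    rw [map_sub, map_sub] at this
    exact sub_eq_zero.1 this
  have hc : 0 < ‖ℓ (P r)‖ / (‖L‖ + 1) := by positivity
  have h2 : ‖P a‖ ≤ ‖ℓ (P r)‖ / (‖L‖ + 1) := by
    refine (pi_norm_le_iff_of_nonneg hc.le).2 fun β => ?_
    exact (h β.1 (((hmemT _).1 β.2).trans hM)).le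
  have h3 : ‖ℓ (P a)‖ ≤ ‖L‖ * ‖P a‖ := L.le_opNorm _
  rw [h1] at h3
  have h4 : ‖L‖ * ‖P a‖ ≤ ‖L‖ * (‖ℓ (P r)‖ / (‖L‖ + 1)) := by gcongr
  have h5 : ‖L‖ * (‖ℓ (P r)‖ / (‖L‖ + 1)) < ‖ℓ (P r)‖ := by
    have : 0 < ‖ℓ (P r)‖ := by positivity
    rw [mul_div_assoc', div_lt_iff₀ (by positivity)]
    nlinarith
  linarith

/-- A quantitative form of the closedness of ideals of germs of holomorphic functions. -/
theorem IsGermIdeal.exists_lower_bound {J : Set (Cn n → ℂ)} (hJ : IsGermIdeal J) (hg : HoloNear g)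
    (hgJ : g ∉ J) :
    ∃ (M : ℕ) (c : ℝ), 0 < c ∧ ∀ (F : Cn n → ℂ) (r S : ℝ), 0 < r → r < 4 →
      DifferentiableOn ℂ F (ball 0 r) → (∀ z ∈ ball (0 : Cn n) r, ‖F z‖ ≤ S) →
      (fun z => F z - g z) ∈ J → c * r ^ M ≤ S := by
  obtain ⟨h, hgh⟩ := hg.exists_rep
  obtain ⟨t₀, ht₀, hh⟩ := hgh.1
  obtain ⟨ρ, ⟨t, ht, hρt⟩, ⟨j, hj, hjr⟩, hρ⟩ := hJ.exists_remainder ht₀ hh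
  have hρ0 : ρ ≠ 0 := by
    rintro rfl
    rw [sub_zero] at hjr
    exact hgJ (hJ.congr j hj g (hjr.eventuallyEq hgh))
  obtain ⟨M, c, hc, hMc⟩ := hJ.exists_functional hρ0 hρ
  obtain ⟨C, hC, hrep⟩ := exists_rep_normT_le n
  refine ⟨M, c / C * (1 / 4) ^ M, by positivity, fun F r S hr hr4 hF hS hFg => ?_⟩
  obtain ⟨a, haF, ha⟩ := hrep F r S hr hr4 hF hS
  have hmem : seriesIn J (a - ρ) := by
    have h1 : SeriesRep (fun z => F z + -1 * g z) (a + MvPowerSeries.C (-1) * h) :=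
      haF.add ((seriesRep_const (-1)).mul hgh)
    have h2 : seriesIn J (a + MvPowerSeries.C (-1) * h) :=
      ⟨_, hJ.congr _ hFg _ (Eventually.of_forall fun z => by ring), h1⟩
    have h3 := hJ.seriesIn_add h2 ⟨j, hj, hjr⟩
    have : a - ρ = a + MvPowerSeries.C (-1) * h + (h - ρ) := by
      rw [map_neg, map_one]
      ring
    rwa [this]
  obtain ⟨β, hβ, hβc⟩ := hMc a hmem
  have hS0 : 0 ≤ S := (norm_nonneg _).trans (hS 0 (mem_ball_self hr))
  have h1 : ‖coeff β a‖ * (r / 4) ^ lam β ≤ C * S := by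
    have h2 : ‖coeff β a‖ₑ * ofReal ((r / 4) ^ lam β) ≤
        ofReal (C * S) := (ENNReal.le_tsum β).trans ha
    rwa [← ofReal_norm, ← ofReal_mul (norm_nonneg _),
      ENNReal.ofReal_le_ofReal_iff (by positivity)] at h2
  have h2 : (r / 4) ^ M ≤ (r / 4) ^ lam β := by
    rw [← rpow_natCast]
    exact rpow_le_rpow_of_exponent_ge (by positivity) (by linarith) hβ
  have h3 : c * (r / 4) ^ M ≤ C * S := by
    refine le_trans ?_ h1
    gcongr
  have h4 : c / C * (1 / 4) ^ M * r ^ M = c * (r / 4) ^ M / C := by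
    rw [div_pow, div_pow, one_pow]
    ring
  rw [h4, div_le_iff₀ hC]
  linarith

theorem UpperSemicontinuous.exists_continuous_approx {X : Type*} [PseudoMetricSpace X] {F : X → ℝ}
    (hF : UpperSemicontinuous F) {B : ℝ} (hB : ∀ x, |F x| ≤ B) :
    ∃ h : ℕ → X → ℝ, (∀ k, Continuous (h k)) ∧ (∀ k x, F x ≤ h k x) ∧ (∀ k x, |h k x| ≤ B) ∧
      ∀ x, Tendsto (fun k => h k x) atTop (𝓝 (F x)) := by
  have hbd : ∀ (k : ℕ) x, BddAbove (Set.range fun y => F y - k * dist x y) := by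
    intro k x
    refine ⟨B, ?_⟩
    rintro _ ⟨y, rfl⟩
    have := (abs_le.1 (hB y)).2
    have : 0 ≤ (k : ℝ) * dist x y := by positivity
    simp only
    linarith
  have hge : ∀ (k : ℕ) x, F x ≤ ⨆ y, (F y - k * dist x y) := fun k x => by
    simpa using le_ciSup (hbd k x) x
  refine ⟨fun k x => ⨆ y, (F y - k * dist x y), fun k => ?_, hge, fun k x => ?_, fun x => ?_⟩
  · have hL : LipschitzWith (k : ℝ≥0) fun x => ⨆ y, (F y - k * dist x y) := by
      refine LipschitzWith.of_le_add_mul _ fun x x' => ?_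
      have : Nonempty X := ⟨x⟩
      refine ciSup_le fun y => ?_
      have h1 := le_ciSup (hbd k x') y
      have h2 : dist x' y ≤ dist x x' + dist x y := by
        rw [dist_comm x x']; exact dist_triangle _ _ _
      have h3 : (k : ℝ) * dist x' y ≤ k * (dist x x' + dist x y) := by gcongr
      simp only [NNReal.coe_natCast] at h1 ⊢
      linarith
    exact hL.continuous
  · have : Nonempty X := ⟨x⟩
    refine abs_le.2 ⟨(abs_le.1 (hB x)).1.trans (hge k x), ciSup_le fun y => ?_⟩
    have := (abs_le.1 (hB y)).2
    have : 0 ≤ (k : ℝ) * dist x y := by positivity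
    linarith
  · have : Nonempty X := ⟨x⟩
    rw [Metric.tendsto_atTop]
    intro η hη
    obtain ⟨δ, hδ, hball⟩ := Metric.eventually_nhds_iff.1 (hF x (F x + η / 2) (by linarith))
    obtain ⟨K, hK⟩ := exists_nat_ge ((B - F x) / δ)
    refine ⟨K, fun k hk => ?_⟩
    have hle : (⨆ y, (F y - k * dist x y)) ≤ F x + η / 2 := by
      refine ciSup_le fun y => ?_
      rcases lt_or_ge (dist y x) δ with h | h
      · have := hball h
        have : 0 ≤ (k : ℝ) * dist x y := by positivity
        linarith
      · have h1 := (abs_le.1 (hB y)).2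
        have h2 : (B - F x) / δ ≤ k := hK.trans (by exact_mod_cast hk)
        rw [div_le_iff₀ hδ] at h2
        have h3 : (k : ℝ) * δ ≤ k * dist x y := by rw [dist_comm]; gcongr
        linarith
    rw [dist_eq, abs_lt]
    constructor <;> linarith [hge k x]

/-- A continuous function on the circle is uniformly close to the real part of an entire
function. -/
theorem exists_entire_re_approx {h : ℂ → ℝ} (hh : Continuous h) (hδ : 0 < δ) :
    ∃ p : ℂ → ℂ, Differentiable ℂ p ∧ ∀ ζ : ℂ, ‖ζ‖ = 1 → |(p ζ).re - h ζ| ≤ δ := by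
  have : Fact (0 < 2 * Real.pi) := ⟨two_pi_pos⟩
  let H : C(AddCircle (2 * Real.pi), ℂ) :=
    ⟨fun x => (h (AddCircle.toCircle x : ℂ) : ℂ), by
      have := AddCircle.continuous_toCircle (T := 2 * Real.pi)
      fun_prop⟩
  have hmem : H ∈ (Submodule.span ℂ (Set.range (fourier (T := 2 * Real.pi)))).topologicalClosure := by
    rw [span_fourier_closure_eq_top]; trivial
  obtain ⟨q, hq, hqd⟩ := Metric.mem_closure_iff.1 hmem δ hδ
  have key : ∀ q ∈ Submodule.span ℂ (Set.range (fourier (T := 2 * Real.pi))),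
      ∃ p₁ p₂ : ℂ → ℂ, Differentiable ℂ p₁ ∧ Differentiable ℂ p₂ ∧
      ∀ x, q x = p₁ (AddCircle.toCircle x) + (conj) (p₂ (AddCircle.toCircle x)) := by
    intro q hq
    induction hq using Submodule.span_induction with
    | mem q hq =>
      obtain ⟨m, rfl⟩ := hq
      rcases le_total 0 m with hm | hm
      · obtain ⟨k, rfl⟩ := Int.eq_ofNat_of_zero_le hm
        refine ⟨fun ζ => ζ ^ k, fun _ => 0, by fun_prop, by fun_prop, fun x => ?_⟩
        rw [fourier_apply, AddCircle.toCircle_zsmul]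
        simp
      · obtain ⟨k, hk⟩ := Int.eq_ofNat_of_zero_le (neg_nonneg.2 hm)
        obtain rfl : m = -(k : ℤ) := by rw [← hk]; ring
        refine ⟨fun _ => 0, fun ζ => ζ ^ k, by fun_prop, by fun_prop, fun x => ?_⟩
        rw [fourier_apply, AddCircle.toCircle_zsmul, zpow_neg, Circle.coe_inv_eq_conj]
        simp
    | zero => exact ⟨fun _ => 0, fun _ => 0, by fun_prop, by fun_prop, by simp⟩
    | add x y _ _ hx hy =>
      obtain ⟨p₁, p₂, h1, h2, h3⟩ := hx
      obtain ⟨p₁', p₂', h1', h2', h3'⟩ := hy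
      refine ⟨fun ζ => p₁ ζ + p₁' ζ, fun ζ => p₂ ζ + p₂' ζ, h1.add h1', h2.add h2', fun x => ?_⟩
      simp [h3, h3']
      ring
    | smul c x _ hx =>
      obtain ⟨p₁, p₂, h1, h2, h3⟩ := hx
      refine ⟨fun ζ => c * p₁ ζ, fun ζ => (conj) c * p₂ ζ, h1.const_mul _,
        h2.const_mul _, fun x => ?_⟩
      simp [h3]
      ring
  obtain ⟨p₁, p₂, h1, h2, h3⟩ := key q hq
  refine ⟨fun ζ => p₁ ζ + p₂ ζ, h1.add h2, fun ζ hζ => ?_⟩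
  obtain ⟨x, hx⟩ := (AddCircle.homeomorphCircle (T := 2 * Real.pi) two_pi_pos.ne').surjective
    ⟨ζ, by simpa [Submonoid.unitSphere] using hζ⟩
  have hx' : (AddCircle.toCircle x : ℂ) = ζ := by
    rw [← AddCircle.homeomorphCircle_apply two_pi_pos.ne', hx]
  have h4 : ‖H x - q x‖ ≤ δ := by
    rw [← dist_eq_norm]
    exact (ContinuousMap.dist_apply_le_dist x).trans hqd.le
  have h5 : (p₁ ζ + p₂ ζ).re = (q x).re := by
    rw [h3 x, hx']
    simp
  have h6 : h ζ = (H x).re := by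
    change h ζ = ((h (AddCircle.toCircle x : ℂ) : ℂ)).re
    rw [hx']; simp
  rw [h5, h6, ← sub_re]
  refine (Complex.abs_re_le_norm _).trans ?_
  rwa [norm_sub_rev]

theorem circleAverage_re_of_entire {p : ℂ → ℂ} (hp : Differentiable ℂ p) (c : ℂ) (R : ℝ) :
    circleAverage (fun ζ => (p ζ).re) c R = (p c).re := by
  have h1 : circleAverage p c R = p c := hp.diffContOnCl.circleAverage
  have h2 := reCLM.circleAverage_comp_comm (f := p) (c := c) (R := R)
    hp.continuous.continuousOn.circleIntegrable'
  rw [h1] at h2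
  exact h2

theorem UpperSemicontinuousOn.comp_curve {X Y β : Type*} [TopologicalSpace X] [TopologicalSpace Y]
    [Preorder β] {f : X → β} {K : Set X} (hf : UpperSemicontinuousOn f K) {γ : Y → X}
    (hγ : Continuous γ) (hK : ∀ θ, γ θ ∈ K) :
    UpperSemicontinuous fun θ => f (γ θ) :=
  upperSemicontinuousOn_univ_iff.1 (hf.comp hγ.continuousOn fun θ _ => hK θ)

theorem UpperSemicontinuousOn.intervalIntegrable_curve {X : Type*} [TopologicalSpace X] {f : X → ℝ}
    {K : Set X} (hf : UpperSemicontinuousOn f K) {B : ℝ} (hB : ∀ x ∈ K, |f x| ≤ B) {γ : ℝ → X}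
    (hγ : Continuous γ) (hK : ∀ θ, γ θ ∈ K) (a b : ℝ) :
    IntervalIntegrable (fun θ => f (γ θ)) volume a b := by
  have hm : Measurable fun θ => f (γ θ) := (hf.comp_curve hγ hK).measurable
  rw [intervalIntegrable_iff]
  refine Measure.integrableOn_of_bounded (M := B) (by simp) hm.aestronglyMeasurable ?_
  exact ae_of_all _ fun θ => by simpa using hB _ (hK θ)

theorem UpperSemicontinuousOn.circleIntegrable {f : ℂ → ℝ} {K : Set ℂ}
    (hf : UpperSemicontinuousOn f K) {B : ℝ} (hB : ∀ x ∈ K, |f x| ≤ B) {c : ℂ} (hR : 0 ≤ R)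
    (hK : sphere c R ⊆ K) : CircleIntegrable f c R :=
  hf.intervalIntegrable_curve hB (continuous_circleMap c R)
    (fun θ => hK (circleMap_mem_sphere c hR θ)) _ _

/-- The local sub-mean value property implies the global one (comparison with the real part of
an entire function). -/
theorem le_re_entire_of_local_submean {f : ℂ → ℝ} (hf : UpperSemicontinuousOn f (closedBall 0 1))
    {B : ℝ} (hB : ∀ ζ ∈ closedBall (0 : ℂ) 1, |f ζ| ≤ B)
    (hsub : ∀ ζ ∈ ball (0 : ℂ) 1, ∃ ε > 0, ∀ r, 0 < r → r < ε → f ζ ≤ circleAverage f ζ r)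
    {p : ℂ → ℂ} (hp : Differentiable ℂ p) (hfp : ∀ ζ, ‖ζ‖ = 1 → f ζ ≤ (p ζ).re + δ) :
    f 0 ≤ (p 0).re + δ := by
  refine le_of_forall_pos_le_add fun ε hε => ?_
  have husc : UpperSemicontinuousOn (fun ζ : ℂ => f ζ + (-(p ζ).re + ε * ‖ζ‖ ^ 2))
      (closedBall 0 1) := by
    refine hf.add ((Continuous.upperSemicontinuous ?_).upperSemicontinuousOn _)
    have := hp.continuous
    fun_prop
  obtain ⟨ζ₁, hζ₁, hmax⟩ := husc.exists_isMaxOn ⟨0, by simp⟩ (isCompact_closedBall 0 1)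
  have h0 := hmax (show (0 : ℂ) ∈ closedBall 0 1 by simp)
  simp only [mem_ofPred_eq, norm_zero] at h0
  have hn : ‖ζ₁‖ ≤ 1 := by simpa using hζ₁
  rcases hn.lt_or_eq with h | h
  · exfalso
    obtain ⟨ε₁, hε₁, hs⟩ := hsub ζ₁ (by simpa using h)
    obtain ⟨r, hr0, hr⟩ := exists_between (lt_min hε₁ (sub_pos.2 h))
    have hr1 := hr.trans_le (min_le_left _ _)
    have hr2 := hr.trans_le (min_le_right _ _)
    have hs1 := hs r hr0 hr1
    have hsph : sphere ζ₁ r ⊆ closedBall 0 1 := by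
      intro x hx
      have e : ‖x - ζ₁‖ = r := by simpa [dist_eq_norm] using hx
      have : ‖x‖ ≤ ‖x - ζ₁‖ + ‖ζ₁‖ := by simpa using norm_add_le (x - ζ₁) ζ₁
      simp only [mem_closedBall_zero_iff]
      linarith
    set P : ℂ → ℂ := fun ζ => p ζ - ε * (2 * (conj) ζ₁ * (ζ - ζ₁)) +
      ((f ζ₁ - (p ζ₁).re - ε * r ^ 2 : ℝ) : ℂ) with hP
    have hPd : Differentiable ℂ P := by fun_prop
    have hle : circleAverage f ζ₁ r ≤ circleAverage (fun ζ => (P ζ).re) ζ₁ r := by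
      refine circleAverage_mono (hf.circleIntegrable hB hr0.le hsph) ?_ fun x hx => ?_
      · have := hPd.continuous
        exact Continuous.continuousOn (by fun_prop) |>.circleIntegrable'
      · rw [abs_of_pos hr0] at hx
        have h1 := hmax (hsph hx)
        simp only [mem_ofPred_eq] at h1
        have e : ‖x - ζ₁‖ = r := by simpa [dist_eq_norm] using hx
        have e2 : ‖x‖ ^ 2 = ‖ζ₁‖ ^ 2 + r ^ 2 + (2 * (conj) ζ₁ * (x - ζ₁)).re := by
          rw [← e]
          simp only [Complex.sq_norm, Complex.normSq_apply, sub_re, Complex.sub_im,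
            Complex.mul_re, Complex.mul_im, Complex.conj_re, Complex.conj_im, Complex.re_ofNat,
            Complex.im_ofNat]
          ring
        have e3 : (P x).re = (p x).re - ε * (2 * (conj) ζ₁ * (x - ζ₁)).re +
            (f ζ₁ - (p ζ₁).re - ε * r ^ 2) := by
          rw [hP]
          simp only [add_re, sub_re, re_ofReal_mul, ofReal_re]
        rw [e3]
        rw [e2] at h1
        linarith
    rw [circleAverage_re_of_entire hPd] at hle
    have e4 : (P ζ₁).re = f ζ₁ - ε * r ^ 2 := by
      rw [hP]
      simp only [add_re, sub_re, ofReal_re, sub_self, mul_zero,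
        Complex.zero_re]
      ring
    have : 0 < ε * r ^ 2 := by positivity
    linarith
  · have := hfp ζ₁ h
    rw [h] at h0
    linarith

theorem le_circleAverage_of_local_submean {f : ℂ → ℝ}
    (hf : UpperSemicontinuousOn f (closedBall 0 1)) {B : ℝ}
    (hB : ∀ ζ ∈ closedBall (0 : ℂ) 1, |f ζ| ≤ B)
    (hsub : ∀ ζ ∈ ball (0 : ℂ) 1, ∃ ε > 0, ∀ r, 0 < r → r < ε → f ζ ≤ circleAverage f ζ r) :
    f 0 ≤ circleAverage f 0 1 := by
  classical
  have hB0 : 0 ≤ B := (abs_nonneg _).trans (hB 0 (by simp))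
  set F : ℂ → ℝ := fun ζ => if ‖ζ‖ = 1 then f ζ else -B with hF
  have hFB : ∀ ζ, |F ζ| ≤ B := by
    intro ζ
    simp only [hF]
    split_ifs with h
    · exact hB _ (by simp [h])
    · rw [abs_neg, abs_of_nonneg hB0]
  have hFusc : UpperSemicontinuous F := by
    intro x y hy
    by_cases hx : ‖x‖ = 1
    · simp only [hF, hx, if_true] at hy
      have h1 := hf x (by simp [hx]) y hy
      rw [eventually_nhdsWithin_iff] at h1
      filter_upwards [h1] with x' hx'
      simp only [hF]
      split_ifs with h
      · exact hx' (by simp [h])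
      · exact lt_of_le_of_lt (abs_le.1 (hB x (by simp [hx]))).1 hy
    · simp only [hF, hx, if_false] at hy
      have : ∀ᶠ x' in 𝓝 x, ‖x'‖ ≠ 1 := continuous_norm.continuousAt.eventually_ne hx
      filter_upwards [this] with x' hx'
      simpa [hF, hx'] using hy
  obtain ⟨h, hc, hge, hbd, hlim⟩ := hFusc.exists_continuous_approx hFB
  have hk : ∀ k, f 0 ≤ circleAverage (h k) 0 1 := by
    intro k
    refine le_of_forall_pos_le_add fun δ hδ => ?_
    obtain ⟨p, hp, hph⟩ := exists_entire_re_approx (hc k) (half_pos hδ)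
    have h1 : f 0 ≤ (p 0).re + δ / 2 := by
      refine le_re_entire_of_local_submean hf hB hsub hp fun ζ hζ => ?_
      have h2 := hge k ζ
      simp only [hF, hζ, if_true] at h2
      have := (abs_le.1 (hph ζ hζ)).1
      linarith
    have h2 : circleAverage (fun ζ => (p ζ).re) 0 1 ≤
        circleAverage (fun ζ => h k ζ + δ / 2) 0 1 := by
      have := hp.continuous
      refine circleAverage_mono (Continuous.continuousOn (by fun_prop) |>.circleIntegrable')
        (Continuous.continuousOn (by have := hc k; fun_prop) |>.circleIntegrable') fun ζ hζ => ?_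
      have := (abs_le.1 (hph ζ (by simpa using hζ))).2
      linarith
    rw [circleAverage_re_of_entire hp, circleAverage_fun_add
      ((hc k).continuousOn.circleIntegrable') (circleIntegrable_const _ _ _),
      circleAverage_const] at h2
    linarith
  have hlim' : Tendsto (fun k => circleAverage (h k) 0 1) atTop
      (𝓝 (circleAverage F 0 1)) := by
    refine Tendsto.const_smul ?_ _
    refine intervalIntegral.tendsto_integral_filter_of_dominated_convergence (fun _ => B) ?_ ?_
      (by simp) ?_
    · refine Eventually.of_forall fun k => Continuous.aestronglyMeasurable ?_
      have := hc k
      fun_prop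
    · exact Eventually.of_forall fun k => ae_of_all _ fun θ _ => by simpa using hbd k _
    · exact ae_of_all _ fun θ _ => hlim _
  have hFf : circleAverage F 0 1 = circleAverage f 0 1 :=
    circleAverage_congr_sphere fun ζ hζ => by
      have : ‖ζ‖ = 1 := by simpa using hζ
      simp [hF, this]
  rw [← hFf]
  exact ge_of_tendsto' hlim' hk

/-- The local sub-mean value property of `v` at `z`, along all complex lines. -/
def SubAt (v : Cn n → ℝ) (z : Cn n) : Prop :=
  ∀ w : Cn n, ∃ ε > 0, ∀ r : ℝ, 0 < r → r < ε →
    v z ≤ circleAverage (fun ζ : ℂ => v (z + ζ • w)) 0 r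

/-- Real-valued plurisubharmonic functions which are bounded below. -/
structure RPsh (v : Cn n → ℝ) (Ω : Set (Cn n)) : Prop where
  usc : UpperSemicontinuousOn v Ω
  bdd : ∃ B, ∀ z ∈ Ω, B ≤ v z
  sub : ∀ z ∈ Ω, SubAt v z

theorem RPsh.mono {Ω Ω' : Set (Cn n)} (hv : RPsh v Ω) (h : Ω' ⊆ Ω) : RPsh v Ω' :=
  ⟨hv.usc.mono h, hv.bdd.imp fun _ hB z hz => hB z (h hz), fun z hz => hv.sub z (h hz)⟩

theorem continuous_line (z w : Cn n) : Continuous fun ζ : ℂ => z + ζ • w := by fun_prop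

theorem RPsh.exists_abs_le (hv : RPsh v Ω) {K : Set (Cn n)} (hK : IsCompact K) (hKΩ : K ⊆ Ω) :
    ∃ B, ∀ z ∈ K, |v z| ≤ B := by
  obtain ⟨B₁, hB₁⟩ := hv.bdd
  obtain ⟨B₂, hB₂⟩ := (hv.usc.mono hKΩ).bddAbove_of_isCompact hK
  refine ⟨max B₂ (-B₁), fun z hz => abs_le.2 ⟨?_, ?_⟩⟩
  · have := hB₁ z (hKΩ hz)
    have := le_max_right B₂ (-B₁)
    linarith
  · exact (hB₂ (mem_image_of_mem _ hz)).trans (le_max_left _ _)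

theorem isCompact_disc (z w : Cn n) (r : ℝ) :
    IsCompact ((fun ζ : ℂ => z + ζ • w) '' closedBall 0 r) :=
  (isCompact_closedBall 0 r).image (continuous_line z w)

theorem exists_disc_subset (hΩ : IsOpen Ω) (hz : z ∈ Ω) (w : Cn n) :
    ∃ ε > 0, ∀ ζ : ℂ, ‖ζ‖ < ε → z + ζ • w ∈ Ω := by
  have h : ∀ᶠ ζ : ℂ in 𝓝 0, z + ζ • w ∈ Ω :=
    (continuous_line z w).continuousAt.eventually (by simpa using hΩ.mem_nhds hz)
  obtain ⟨ε, hε, h⟩ := Metric.eventually_nhds_iff.1 h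
  exact ⟨ε, hε, fun ζ hζ => h (by simpa using hζ)⟩

theorem RPsh.circleIntegrable (hv : RPsh v Ω) {z w : Cn n} (hr : 0 ≤ r)
    (hd : ∀ ζ : ℂ, ‖ζ‖ ≤ r → z + ζ • w ∈ Ω) :
    CircleIntegrable (fun ζ : ℂ => v (z + ζ • w)) 0 r := by
  obtain ⟨B, hB⟩ := hv.exists_abs_le (isCompact_disc z w r) (by
    rintro _ ⟨ζ, hζ, rfl⟩; exact hd ζ (by simpa using hζ))
  have h1 : UpperSemicontinuousOn (fun ζ : ℂ => v (z + ζ • w)) (closedBall 0 r) :=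
    hv.usc.comp (continuous_line z w).continuousOn fun ζ hζ => hd ζ (by simpa using hζ)
  exact h1.circleIntegrable (fun ζ hζ => hB _ ⟨ζ, hζ, rfl⟩) hr sphere_subset_closedBall

theorem circleAverage_line (v : Cn n → ℝ) (z w : Cn n) (ζ : ℂ) (r : ℝ) :
    circleAverage (fun ξ : ℂ => v (z + ξ • w)) ζ r =
      circleAverage (fun ξ : ℂ => v (z + ζ • w + ξ • w)) 0 r := by
  simp only [circleAverage, circleMap, zero_add, add_smul, add_assoc]

theorem circleAverage_line_smul (v : Cn n → ℝ) (z w : Cn n) (r : ℝ) :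
    circleAverage (fun ξ : ℂ => v (z + ξ • w)) 0 r =
      circleAverage (fun ξ : ℂ => v (z + ξ • ((r : ℂ) • w))) 0 1 := by
  simp only [circleAverage, circleMap, zero_add, smul_smul, Complex.ofReal_one, one_mul,
    mul_comm (r : ℂ)]

/-- The sub-mean value inequality on every closed disc contained in the domain. -/
theorem RPsh.le_circleAverage (hv : RPsh v Ω) {z w : Cn n} (hd : ∀ ζ : ℂ, ‖ζ‖ ≤ 1 → z + ζ • w ∈ Ω) :
    v z ≤ circleAverage (fun ζ : ℂ => v (z + ζ • w)) 0 1 := by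
  obtain ⟨B, hB⟩ := hv.exists_abs_le (isCompact_disc z w 1) (by
    rintro _ ⟨ζ, hζ, rfl⟩; exact hd ζ (by simpa using hζ))
  have h1 : UpperSemicontinuousOn (fun ζ : ℂ => v (z + ζ • w)) (closedBall 0 1) :=
    hv.usc.comp (continuous_line z w).continuousOn fun ζ hζ => hd ζ (by simpa using hζ)
  have := le_circleAverage_of_local_submean h1 (fun ζ hζ => hB _ ⟨ζ, hζ, rfl⟩) fun ζ hζ => by
    obtain ⟨ε, hε, h⟩ := hv.sub _ (hd ζ (by simpa using (ball_subset_closedBall hζ))) w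
    refine ⟨ε, hε, fun r hr hr' => ?_⟩
    rw [circleAverage_line]
    exact h r hr hr'
  simpa using this

theorem RPsh.le_circleAverage' (hv : RPsh v Ω) {z w : Cn n} (hr : 0 ≤ r)
    (hd : ∀ ζ : ℂ, ‖ζ‖ ≤ r → z + ζ • w ∈ Ω) :
    v z ≤ circleAverage (fun ζ : ℂ => v (z + ζ • w)) 0 r := by
  rw [circleAverage_line_smul]
  refine hv.le_circleAverage fun ζ hζ => ?_
  rw [smul_smul]
  refine hd _ ?_
  rw [norm_mul, norm_real, norm_of_nonneg hr]
  nlinarith [norm_nonneg ζ]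

theorem SubAt.congr {v v' : Cn n → ℝ} (hv : SubAt v z) (h : ∀ᶠ y in 𝓝 z, v y = v' y) :
    SubAt v' z := by
  intro w
  obtain ⟨ε, hε, hs⟩ := hv w
  have h1 : ∀ᶠ ζ : ℂ in 𝓝 0, v (z + ζ • w) = v' (z + ζ • w) :=
    (continuous_line z w).continuousAt.eventually (p := fun y => v y = v' y) (by simpa using h)
  obtain ⟨ε', hε', h2⟩ := Metric.eventually_nhds_iff.1 h1
  refine ⟨min ε ε', lt_min hε hε', fun r hr hr' => ?_⟩
  rw [← h.self_of_nhds]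
  refine (hs r hr (hr'.trans_le (min_le_left _ _))).trans_eq ?_
  refine circleAverage_congr_sphere fun ζ hζ => h2 ?_
  rw [abs_of_pos hr] at hζ
  rw [mem_sphere.1 hζ]
  exact hr'.trans_le (min_le_right _ _)

theorem RPsh.max {u v : Cn n → ℝ} (hΩ : IsOpen Ω) (hu : RPsh u Ω) (hv : RPsh v Ω) :
    RPsh (fun z => max (u z) (v z)) Ω := by
  have husc : UpperSemicontinuousOn (fun z => Max.max (u z) (v z)) Ω := hu.usc.sup hv.usc
  have hbdd : ∃ B, ∀ z ∈ Ω, B ≤ Max.max (u z) (v z) :=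
    hu.bdd.imp fun B hB z hz => (hB z hz).trans (le_max_left _ _)
  refine ⟨husc, hbdd, fun z hz w => ?_⟩
  obtain ⟨ε₀, hε₀, hd⟩ := exists_disc_subset hΩ hz w
  refine ⟨ε₀, hε₀, fun r hr hr' => ?_⟩
  have hd' : ∀ ζ : ℂ, ‖ζ‖ ≤ r → z + ζ • w ∈ Ω := fun ζ hζ => hd ζ (hζ.trans_lt hr')
  have hInt : CircleIntegrable (fun ζ : ℂ => Max.max (u (z + ζ • w)) (v (z + ζ • w))) 0 r :=
    ⟨(hu.circleIntegrable hr.le hd').1.sup (hv.circleIntegrable hr.le hd').1,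
      (hu.circleIntegrable hr.le hd').2.sup (hv.circleIntegrable hr.le hd').2⟩
  refine max_le ?_ ?_
  · exact (hu.le_circleAverage' hr.le hd').trans
      (circleAverage_mono (hu.circleIntegrable hr.le hd') hInt fun ζ _ => le_max_left _ _)
  · exact (hv.le_circleAverage' hr.le hd').trans
      (circleAverage_mono (hv.circleIntegrable hr.le hd') hInt fun ζ _ => le_max_right _ _)

theorem RPsh.const (c : ℝ) (Ω : Set (Cn n)) : RPsh (fun _ => c) Ω :=
  ⟨continuousOn_const.upperSemicontinuousOn, ⟨c, fun _ _ => le_rfl⟩,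
    fun z _ w => ⟨1, one_pos, fun r _ _ => by rw [circleAverage_const]⟩⟩

theorem RPsh.affine (hv : RPsh v Ω) (hΩ : IsOpen Ω) {a : ℝ} (ha : 0 ≤ a) (b : ℝ) :
    RPsh (fun z => a * v z + b) Ω := by
  refine ⟨?_, ?_, fun z hz w => ?_⟩
  · exact (show Continuous fun x : ℝ => a * x + b by fun_prop).comp_upperSemicontinuousOn hv.usc
      fun x y h => add_le_add_left (mul_le_mul_of_nonneg_left h ha) b
  · obtain ⟨B, hB⟩ := hv.bdd
    exact ⟨a * B + b, fun z hz => by have := hB z hz; gcongr⟩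
  · obtain ⟨ε₀, hε₀, hd⟩ := exists_disc_subset hΩ hz w
    refine ⟨ε₀, hε₀, fun r hr hr' => ?_⟩
    have hd' : ∀ ζ : ℂ, ‖ζ‖ ≤ r → z + ζ • w ∈ Ω := fun ζ hζ => hd ζ (hζ.trans_lt hr')
    have hi : CircleIntegrable (fun ζ : ℂ => a * v (z + ζ • w)) 0 r :=
      (hv.circleIntegrable hr.le hd').const_mul a
    have h1 := hv.le_circleAverage' hr.le hd'
    have h2 := circleAverage_fun_smul (a := a) (f := fun ζ : ℂ => v (z + ζ • w)) (c := 0) (R := r)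
    simp only [smul_eq_mul] at h2
    rw [circleAverage_fun_add hi (circleIntegrable_const _ _ _),
      circleAverage_const, h2]
    gcongr

theorem rpsh_norm : RPsh (fun z : Cn n => ‖z‖) univ := by
  refine ⟨continuous_norm.upperSemicontinuous.upperSemicontinuousOn _,
    ⟨0, fun _ _ => norm_nonneg _⟩, fun z _ w => ⟨1, one_pos, fun r hr _ => ?_⟩⟩
  have hd : Differentiable ℂ fun ζ : ℂ => z + ζ • w := by fun_prop
  have h1 : circleAverage (fun ζ : ℂ => z + ζ • w) 0 r = z := by
    have : circleAverage (fun ζ : ℂ => z + ζ • w) 0 r = (fun ζ : ℂ => z + ζ • w) 0 :=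
      hd.diffContOnCl.circleAverage
    simpa using this
  calc ‖z‖ = ‖circleAverage (fun ζ : ℂ => z + ζ • w) 0 r‖ := by rw [h1]
    _ ≤ _ := by
      simp only [circleAverage, norm_smul, smul_eq_mul]
      rw [norm_of_nonneg (by positivity)]
      gcongr
      exact intervalIntegral.norm_integral_le_integral_norm (by positivity)

/-- The truncation `max (u, -L)`, as a real number. -/
def trunc (u : Cn n → EReal) (L : ℝ) (z : Cn n) : ℝ := (max (u z) ((-L : ℝ) : EReal)).toReal

theorem coe_trunc (h : u z < ⊤) (L : ℝ) :
    ((trunc u L z : ℝ) : EReal) = max (u z) ((-L : ℝ) : EReal) := by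
  refine coe_toReal ?_ ?_
  · exact (max_lt h (EReal.coe_lt_top _)).ne
  · exact (lt_of_lt_of_le (EReal.bot_lt_coe (-L)) (le_max_right _ _)).ne'

theorem neg_le_trunc (h : u z < ⊤) (L : ℝ) : -L ≤ trunc u L z := by
  rw [← coe_le_coe_iff, coe_trunc h]
  exact le_max_right _ _

theorem le_trunc (h : u z < ⊤) (L : ℝ) : u z ≤ trunc u L z := by
  rw [coe_trunc h]
  exact le_max_left _ _

theorem trunc_anti (h : u z < ⊤) {L M : ℝ} (hLM : L ≤ M) :
    trunc u M z ≤ trunc u L z := by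
  rw [← coe_le_coe_iff, coe_trunc h, coe_trunc h]
  exact max_le_max le_rfl (by exact_mod_cast neg_le_neg hLM)

/-- Plurisubharmonic functions with values in `[-∞, ∞)`, possibly identically `-∞`. -/
structure LPsh (u : Cn n → EReal) (Ω : Set (Cn n)) : Prop where
  usc : UpperSemicontinuousOn u Ω
  lt_top : ∀ z ∈ Ω, u z < ⊤
  sub : ∀ L : ℝ, ∀ z ∈ Ω, SubAt (trunc u L) z

theorem UpperSemicontinuousOn.trunc
    (hu : UpperSemicontinuousOn u Ω) (ht : ∀ z ∈ Ω, u z < ⊤) (L : ℝ) :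
    UpperSemicontinuousOn (trunc u L) Ω := by
  intro z hz y hy
  have hy' : max (u z) ((-L : ℝ) : EReal) < (y : EReal) := by
    rw [← coe_trunc (ht z hz)]; exact_mod_cast hy
  filter_upwards [hu z hz y ((le_max_left _ _).trans_lt hy'), self_mem_nhdsWithin] with x hx hxΩ
  rw [← coe_lt_coe_iff, coe_trunc (ht x hxΩ)]
  exact max_lt hx ((le_max_right _ _).trans_lt hy')

theorem LPsh.rpsh (hu : LPsh u Ω) (L : ℝ) :
    RPsh (trunc u L) Ω :=
  ⟨hu.usc.trunc hu.lt_top L, ⟨-L, fun z hz => neg_le_trunc (hu.lt_top z hz) L⟩, hu.sub L⟩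

theorem LPsh.mono {Ω Ω' : Set (Cn n)} (hu : LPsh u Ω) (h : Ω' ⊆ Ω) :
    LPsh u Ω' :=
  ⟨hu.usc.mono h, fun z hz => hu.lt_top z (h hz), fun L z hz => hu.sub L z (h hz)⟩

theorem circleAvg_eq (u : Cn n → EReal) (z w : Cn n) (r : ℝ) (m : ℕ) :
    circleAvg u z w r m = circleAverage (fun ζ : ℂ => trunc u m (z + ζ • w)) 0 r := by
  simp only [circleAvg, circleAverage, circleMap, zero_add, trunc, smul_eq_mul,
    mul_comm I]

theorem trunc_circleIntegrable (hu : UpperSemicontinuousOn u Ω) (ht : ∀ z ∈ Ω, u z < ⊤) {z w : Cn n}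
    (hr : 0 ≤ r) (hd : ∀ ζ : ℂ, ‖ζ‖ ≤ r → z + ζ • w ∈ Ω) (L : ℝ) :
    CircleIntegrable (fun ζ : ℂ => trunc u L (z + ζ • w)) 0 r := by
  have h1 : UpperSemicontinuousOn (fun ζ : ℂ => trunc u L (z + ζ • w)) (closedBall 0 r) :=
    (hu.trunc ht L).comp (continuous_line z w).continuousOn fun ζ hζ => hd ζ (by simpa using hζ)
  obtain ⟨B, hB⟩ := h1.bddAbove_of_isCompact (isCompact_closedBall 0 r)
  refine h1.circleIntegrable (B := max B L) (fun ζ hζ => abs_le.2 ⟨?_, ?_⟩) hr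
    sphere_subset_closedBall
  · have := neg_le_trunc (ht _ (hd ζ (by simpa using hζ))) L
    have := le_max_right B L
    linarith
  · exact (hB (mem_image_of_mem _ hζ)).trans (le_max_left _ _)

theorem PSHOn.lpsh (hu : PSHOn u Ω) (hΩ : IsOpen Ω) :
    LPsh u Ω := by
  refine ⟨hu.usc, hu.lt_top, fun L z hz w => ?_⟩
  obtain ⟨ε, hε, hs⟩ := hu.submean z hz w
  obtain ⟨ε₀, hε₀, hd⟩ := exists_disc_subset hΩ hz w
  refine ⟨min ε ε₀, lt_min hε hε₀, fun r hr hr' => ?_⟩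
  have hd' : ∀ ζ : ℂ, ‖ζ‖ ≤ r → z + ζ • w ∈ Ω :=
    fun ζ hζ => hd ζ (hζ.trans_lt (hr'.trans_le (min_le_right _ _)))
  have hInt := fun L => trunc_circleIntegrable hu.usc hu.lt_top hr.le hd' L
  have hsph : ∀ ζ ∈ sphere (0 : ℂ) |r|, u (z + ζ • w) < ⊤ := fun ζ hζ =>
    hu.lt_top _ (hd' ζ (by rw [abs_of_pos hr] at hζ; simpa using (mem_sphere.1 hζ).le))
  rw [← coe_le_coe_iff, coe_trunc (hu.lt_top z hz)]
  refine max_le ?_ ?_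
  · obtain ⟨m, hm⟩ := exists_nat_ge L
    refine (hs r hr (hr'.trans_le (min_le_left _ _))).trans ((iInf_le _ m).trans ?_)
    rw [circleAvg_eq, coe_le_coe_iff]
    exact circleAverage_mono (hInt m) (hInt L) fun ζ hζ => trunc_anti (hsph ζ hζ) hm
  · rw [coe_le_coe_iff, ← circleAverage_const (-L) (0 : ℂ) r]
    exact circleAverage_mono (circleIntegrable_const _ _ _) (hInt L)
      fun ζ hζ => neg_le_trunc (hsph ζ hζ) L

theorem LPsh.pshOn (hu : LPsh u Ω) (hΩ : IsOpen Ω)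
    (h : ∀ z ∈ Ω, ∃ w ∈ connectedComponentIn Ω z, u w ≠ ⊥) : PSHOn u Ω := by
  refine ⟨hu.usc, hu.lt_top, h, fun z hz w => ?_⟩
  obtain ⟨ε₀, hε₀, hd⟩ := exists_disc_subset hΩ hz w
  refine ⟨ε₀, hε₀, fun r hr hr' => le_iInf fun m => ?_⟩
  rw [circleAvg_eq]
  refine (le_trunc (hu.lt_top z hz) m).trans ?_
  rw [coe_le_coe_iff]
  exact (hu.rpsh m).le_circleAverage' hr.le fun ζ hζ => hd ζ (hζ.trans_lt hr')

theorem trunc_max {u v : Cn n → EReal} (hu : u z < ⊤) (hv : v z < ⊤) (L : ℝ) :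
    trunc (fun y => max (u y) (v y)) L z = max (trunc u L z) (trunc v L z) := by
  rw [← EReal.coe_eq_coe_iff, coe_trunc (u := fun y => max (u y) (v y)) (max_lt hu hv) L,
    EReal.coe_strictMono.monotone.map_max, coe_trunc hu, coe_trunc hv]
  rw [max_max_max_comm, max_self]

theorem LPsh.max {u v : Cn n → EReal} (hΩ : IsOpen Ω) (hu : LPsh u Ω) (hv : LPsh v Ω) :
    LPsh (fun z => max (u z) (v z)) Ω := by
  refine ⟨hu.usc.sup hv.usc, fun z hz => max_lt (hu.lt_top z hz) (hv.lt_top z hz),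
    fun L z hz => ?_⟩
  refine (((hu.rpsh L).max hΩ (hv.rpsh L)).sub z hz).congr ?_
  filter_upwards [hΩ.mem_nhds hz] with y hy
  exact (trunc_max (hu.lt_top y hy) (hv.lt_top y hy) L).symm

theorem LPsh.congr {u v : Cn n → EReal} (hu : LPsh u Ω) (hΩ : IsOpen Ω) (h : ∀ z ∈ Ω, u z = v z) :
    LPsh v Ω := by
  refine ⟨fun z hz y hy => ?_, fun z hz => h z hz ▸ hu.lt_top z hz, fun L z hz => ?_⟩
  · filter_upwards [hu.usc z hz y (by simpa only [h z hz] using hy), self_mem_nhdsWithin] with x hx hxΩ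
    rwa [← h x hxΩ]
  refine (hu.sub L z hz).congr ?_
  filter_upwards [hΩ.mem_nhds hz] with y hy
  simp only [trunc, h y hy]

/-- Plurisubharmonicity is a local property. -/
theorem LPsh.of_local (h : ∀ z ∈ Ω, ∃ Ω', IsOpen Ω' ∧ z ∈ Ω' ∧ LPsh u Ω') : LPsh u Ω := by
  refine ⟨fun z hz => ?_, fun z hz => ?_, fun L z hz => ?_⟩ <;>
    obtain ⟨Ω', hΩ', hz', hu⟩ := h z hz
  · intro y hy
    have := hu.usc z hz' y hy
    rw [hΩ'.nhdsWithin_eq hz'] at this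
    exact this.filter_mono nhdsWithin_le_nhds
  · exact hu.lt_top z hz'
  · exact hu.sub L z hz'

theorem LPsh.affine (hu : LPsh u Ω) (hΩ : IsOpen Ω) {a : ℝ} (ha : 0 < a) (b : ℝ) :
    LPsh (fun z => (a : EReal) * u z + (b : EReal)) Ω := by
  have ht : ∀ z ∈ Ω, (a : EReal) * u z + (b : EReal) < ⊤ := by
    intro z hz
    have := hu.lt_top z hz
    generalize u z = x at *
    induction x with
    | bot => rw [EReal.coe_mul_bot_of_pos ha]; simp
    | coe x => exact_mod_cast EReal.coe_lt_top (a * x + b)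
    | top => simp at this
  have key : ∀ x : EReal, ∀ y : ℝ, (a : EReal) * x + (b : EReal) < (y : EReal) ↔
      x < ((y - b) / a : ℝ) := by
    intro x y
    induction x with
    | bot => rw [EReal.coe_mul_bot_of_pos ha]; simp [EReal.bot_lt_coe]
    | coe x =>
      have : (a : EReal) * x + b = ((a * x + b : ℝ) : EReal) := by push_cast; rfl
      rw [this, coe_lt_coe_iff, coe_lt_coe_iff, lt_div_iff₀ ha, lt_sub_iff_add_lt,
        mul_comm]
    | top => rw [EReal.coe_mul_top_of_pos ha]; simp
  refine ⟨fun z hz y hy => ?_, ht, fun L z hz => ?_⟩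
  · induction y with
    | bot => simp at hy
    | coe y =>
      rw [key] at hy
      filter_upwards [hu.usc z hz _ hy] with x hx
      exact (key _ _).2 hx
    | top =>
      filter_upwards [self_mem_nhdsWithin] with x hx
      exact ht x hx
  · refine (((hu.rpsh ((L + b) / a)).affine hΩ ha.le b).sub z hz).congr ?_
    filter_upwards [hΩ.mem_nhds hz] with y hy
    rw [← EReal.coe_eq_coe_iff, coe_trunc (ht y hy)]
    have e : a * (-((L + b) / a)) + b = -L := by field_simp; ring
    rcases le_total (u y) ((-((L + b) / a) : ℝ) : EReal) with h | h
    · have h1 : trunc u ((L + b) / a) y = -((L + b) / a) := by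
        rw [← EReal.coe_eq_coe_iff, coe_trunc (hu.lt_top y hy), max_eq_right h]
      rw [h1, e, max_eq_right]
      by_contra hc
      push Not at hc
      have h2 : ¬ ((a : EReal) * u y + b < ((-L : ℝ) : EReal)) := hc.not_gt
      induction hx : u y with
      | bot => rw [hx, EReal.coe_mul_bot_of_pos ha] at hc; simp at hc
      | coe x =>
        rw [hx] at hc h
        have : (a : EReal) * x + b = ((a * x + b : ℝ) : EReal) := by push_cast; rfl
        rw [this, coe_lt_coe_iff] at hc
        rw [coe_le_coe_iff] at h
        have := mul_le_mul_of_nonneg_left h ha.le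
        linarith
      | top => rw [hx] at h; exact absurd h (by simp [-EReal.coe_neg])
    · have h1 : ((trunc u ((L + b) / a) y : ℝ) : EReal) = u y := by
        rw [coe_trunc (hu.lt_top y hy), max_eq_left h]
      rw [← h1] at h ⊢
      rw [coe_le_coe_iff] at h
      have : (a : EReal) * (trunc u ((L + b) / a) y : ℝ) + b =
        ((a * trunc u ((L + b) / a) y + b : ℝ) : EReal) := by push_cast; rfl
      rw [this, max_eq_left]
      rw [coe_le_coe_iff]
      have := mul_le_mul_of_nonneg_left h ha.le
      linarith

theorem elog_lt_coe {x y : ℝ} : elog x < (y : EReal) ↔ x < exp y := by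
  unfold elog
  split_ifs with h
  · simp only [EReal.bot_lt_coe, true_iff]
    exact h.trans_lt (exp_pos y)
  · rw [coe_lt_coe_iff, log_lt_iff_lt_exp (not_le.1 h)]

theorem elog_lt_top (x : ℝ) : elog x < ⊤ := by
  unfold elog
  split_ifs with h
  · simp
  · exact EReal.coe_lt_top _

theorem elog_of_pos {x : ℝ} (h : 0 < x) : elog x = (log x : ℝ) := by
  simp [elog, not_le.2 h]

theorem elog_mono {x y : ℝ} (h : x ≤ y) : elog x ≤ elog y := by
  rcases le_or_gt x 0 with hx | hx
  · simp [elog, hx]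
  · rw [elog_of_pos hx, elog_of_pos (hx.trans_le h), coe_le_coe_iff]
    exact log_le_log hx h

theorem lpsh_log_norm : LPsh (fun z : Cn n => elog ‖z‖) univ := by
  have husc : UpperSemicontinuousOn (fun z : Cn n => elog ‖z‖) univ := by
    rw [upperSemicontinuousOn_univ_iff]
    intro z y hy
    induction y with
    | bot => simp at hy
    | coe y =>
      have : ∀ᶠ x : Cn n in 𝓝 z, ‖x‖ < exp y :=
        continuous_norm.continuousAt.eventually_lt_const (elog_lt_coe.1 hy)
      exact this.mono fun x hx => elog_lt_coe.2 hx
    | top => exact Eventually.of_forall fun x => elog_lt_top _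
  refine ⟨husc, fun z _ => elog_lt_top _, fun L z _ w => ?_⟩
  have hInt : ∀ r, 0 < r → CircleIntegrable
      (fun ζ : ℂ => trunc (fun z : Cn n => elog ‖z‖) L (z + ζ • w)) 0 r := fun r hr =>
    trunc_circleIntegrable husc (fun z _ => elog_lt_top _) hr.le (fun _ _ => mem_univ _) L
  by_cases hz : z = 0
  · refine ⟨1, one_pos, fun r hr _ => ?_⟩
    have h0 : trunc (fun z : Cn n => elog ‖z‖) L z = -L := by simp [trunc, elog, hz]
    rw [h0, ← circleAverage_const (-L) (0 : ℂ) r]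
    exact circleAverage_mono (circleIntegrable_const _ _ _) (hInt r hr)
      fun ζ _ => neg_le_trunc (elog_lt_top _) L
  · obtain ⟨j, hj⟩ : ∃ j, ‖z‖ = ‖z j‖ := by
      have hne : Nonempty (Fin n) := by
        by_contra h
        rw [not_nonempty_iff] at h
        exact hz (Subsingleton.elim _ _)
      obtain ⟨j, -, hj⟩ := Finset.exists_mem_eq_sup Finset.univ
        (Finset.univ_nonempty) (fun j => ‖z j‖₊)
      exact ⟨j, by rw [Pi.norm_def, hj]; simp⟩
    have hzj : 0 < ‖z j‖ := by rw [← hj]; exact norm_pos_iff.2 hz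
    refine ⟨‖z j‖ / (‖w j‖ + 1), by positivity, fun r hr hr' => ?_⟩
    have hne : ∀ ζ : ℂ, ‖ζ‖ ≤ r → z j + ζ * w j ≠ 0 := by
      intro ζ hζ h
      have h1 : ‖z j‖ = ‖ζ‖ * ‖w j‖ := by
        rw [← norm_mul, eq_neg_of_add_eq_zero_left h, norm_neg]
      rw [lt_div_iff₀ (by positivity)] at hr'
      nlinarith [norm_nonneg (w j), norm_nonneg ζ]
    have han : ∀ ζ : ℂ, AnalyticAt ℂ (fun ζ : ℂ => z j + ζ * w j) ζ := fun ζ => by fun_prop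
    have hharm : InnerProductSpace.HarmonicOnNhd (fun ζ : ℂ => log ‖z j + ζ * w j‖)
        (closedBall 0 |r|) := fun ζ hζ =>
      (han ζ).harmonicAt_log_norm (hne ζ (by simpa [abs_of_pos hr] using hζ))
    have hmv := hharm.circleAverage_eq
    simp only [zero_mul, add_zero] at hmv
    have hle : ∀ ζ ∈ sphere (0 : ℂ) |r|, max (log ‖z j + ζ * w j‖) (-L) ≤
        trunc (fun z : Cn n => elog ‖z‖) L (z + ζ • w) := by
      intro ζ hζ
      have hζ' : ‖ζ‖ ≤ r := by rw [abs_of_pos hr] at hζ; simpa using (mem_sphere.1 hζ).le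
      refine max_le ?_ (neg_le_trunc (elog_lt_top _) L)
      rw [← coe_le_coe_iff, ← elog_of_pos (norm_pos_iff.2 (hne ζ hζ'))]
      refine le_trans (elog_mono ?_)
        (le_trunc (u := fun z : Cn n => elog ‖z‖) (z := z + ζ • w) (elog_lt_top _) L)
      exact norm_le_pi_norm (z + ζ • w) j
    have hci : CircleIntegrable (fun ζ : ℂ => log ‖z j + ζ * w j‖) 0 r := by
      refine ContinuousOn.circleIntegrable hr.le ?_
      intro ζ hζ
      have := hne ζ (by simpa using (mem_sphere.1 hζ).le)
      exact ContinuousWithinAt.log (by fun_prop) (by simpa using this)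
    have h0 : trunc (fun z : Cn n => elog ‖z‖) L z = max (log ‖z j‖) (-L) := by
      rw [← EReal.coe_eq_coe_iff, coe_trunc (elog_lt_top _), hj, elog_of_pos hzj,
        EReal.coe_strictMono.monotone.map_max]
    rw [h0]
    refine max_le ?_ ?_
    · rw [← hmv]
      exact circleAverage_mono hci (hInt r hr) fun ζ hζ => (le_max_left _ _).trans (hle ζ hζ)
    · rw [← circleAverage_const (-L) (0 : ℂ) r]
      exact circleAverage_mono (circleIntegrable_const _ _ _) (hInt r hr)
        fun ζ hζ => (le_max_right _ _).trans (hle ζ hζ)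

theorem UpperSemicontinuousOn.measurable_indicator {X β : Type*} [TopologicalSpace X]
    [MeasurableSpace X] [OpensMeasurableSpace X] [TopologicalSpace β] [LinearOrder β]
    [OrderTopology β] [SecondCountableTopology β] [MeasurableSpace β] [BorelSpace β] [Zero β]
    {f : X → β} {K : Set X} (hf : UpperSemicontinuousOn f K) (hK : MeasurableSet K) :
    Measurable (K.indicator f) := by
  refine measurable_of_restrict_of_restrict_compl hK ?_ ?_
  · have h1 : UpperSemicontinuous fun x : K => f x :=
      hf.comp_curve (γ := fun x : K => (x : X)) continuous_subtype_val fun x => x.2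
    have h2 : K.domRestrict (K.indicator f) = fun x : K => f x := by
      ext x
      exact indicator_of_mem x.2 f
    rw [h2]
    exact h1.measurable
  · have h2 : (Kᶜ).domRestrict (K.indicator f) = fun _ => 0 := by
      ext x
      exact indicator_of_notMem x.2 f
    rw [h2]
    exact measurable_const

theorem measurePreserving_rotate {c : ℂ} (hc : ‖c‖ = 1) :
    MeasurePreserving (fun y : Cn n => c • y) := by
  refine volume_preserving_pi (f := fun (_ : Fin n) (x : ℂ) => c • x) fun _ => ?_
  exact (rotation (⟨c, by simpa [Submonoid.unitSphere] using hc⟩ : Circle)).measurePreserving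

theorem measurableEmbedding_smul {c : ℂ} (hc : c ≠ 0) :
    MeasurableEmbedding (fun y : Cn n => c • y) :=
  (Homeomorph.smulOfNeZero c hc).measurableEmbedding

theorem circleMap_one_eq (θ : ℝ) : ‖circleMap 0 1 θ‖ = 1 := by simp

/-- Plurisubharmonic functions are below their averages against circular kernels. -/
theorem RPsh.mul_integral_le (hv : RPsh v Ω) (hz : closedBall z ε ⊆ Ω) (hk : Measurable k)
    (hki : Integrable k) (hk0 : ∀ y, 0 ≤ k y) (hsupp : ∀ y, k y ≠ 0 → ‖y‖ ≤ ε)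
    (hinv : ∀ c : ℂ, ‖c‖ = 1 → ∀ y, k (c • y) = k y) :
    v z * ∫ y, k y ≤ ∫ y, v (z + y) * k y := by
  obtain ⟨B, hB⟩ := hv.exists_abs_le (isCompact_closedBall z ε) hz
  set V := (closedBall z ε).indicator v with hV
  have hVm : Measurable V :=
    (hv.usc.mono hz).measurable_indicator isClosed_closedBall.measurableSet
  rcases (closedBall z ε).eq_empty_or_nonempty with hemp | ⟨x₀, hx₀⟩
  · have : ε < 0 := by simpa using hemp
    have hk' : k = 0 := by
      ext y
      by_contra h
      have := hsupp y h
      have := norm_nonneg y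
      linarith
    simp [hk']
  have hB0 : 0 ≤ B := (abs_nonneg _).trans (hB x₀ hx₀)
  have hVB : ∀ y, |V y| ≤ B := by
    intro y
    simp only [hV, indicator]
    split_ifs with h
    · exact hB y h
    · simpa using hB0
  have hVv : ∀ y, V (z + y) * k y = v (z + y) * k y := by
    intro y
    by_cases h : k y = 0
    · simp [h]
    · have : z + y ∈ closedBall z ε := by simpa using hsupp y h
      simp [hV, this]
  set μ : Measure ℝ := volume.restrict (Ioc 0 (2 * Real.pi)) with hμ
  set G : Cn n × ℝ → ℝ := fun q => V (z + circleMap 0 1 q.2 • q.1) * k q.1 with hG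
  have hGm : Measurable G := by
    have h1 : Measurable fun q : Cn n × ℝ => z + circleMap 0 1 q.2 • q.1 :=
      Continuous.measurable (by fun_prop)
    exact (hVm.comp h1).mul (hk.comp measurable_fst)
  have hGi : Integrable G (volume.prod μ) := by
    refine (hki.mul_prod (integrable_const B : Integrable (fun _ => B) μ)).mono'
      hGm.aestronglyMeasurable (ae_of_all _ fun q => ?_)
    simp only [hG, norm_mul, norm_eq_abs, abs_of_nonneg (hk0 _)]
    rw [mul_comm]
    exact mul_le_mul_of_nonneg_left (hVB _) (hk0 _)
  have hswap : ∫ y, ∫ θ, G (y, θ) ∂μ = ∫ θ, (∫ y, G (y, θ)) ∂μ := integral_integral_swap hGi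
  have hrot : ∀ θ, ∫ y, G (y, θ) = ∫ y, v (z + y) * k y := by
    intro θ
    have h1 : ∀ y, G (y, θ) = (fun y => V (z + y) * k y) (circleMap 0 1 θ • y) := by
      intro y
      simp only [hG]
      rw [hinv _ (circleMap_one_eq θ)]
    simp only [h1]
    have h2 := (measurePreserving_rotate (n := n) (circleMap_one_eq θ)).integral_comp
      (measurableEmbedding_smul (by simp [circleMap])) fun y => V (z + y) * k y
    rw [h2]
    simp only [hVv]
  have hμ1 : μ.real univ = 2 * Real.pi := by
    simp [hμ, measureReal_def, pi_pos.le]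
  simp only [hrot, integral_const, hμ1, smul_eq_mul] at hswap
  have hpt : ∀ y, (2 * Real.pi) * (v z * k y) ≤ ∫ θ, G (y, θ) ∂μ := by
    intro y
    by_cases hy : k y = 0
    · simp [hG, hy]
    · have hd : ∀ ζ : ℂ, ‖ζ‖ ≤ 1 → z + ζ • y ∈ closedBall z ε := by
        intro ζ hζ
        have := hsupp y hy
        simp only [mem_closedBall, dist_self_add_left, norm_smul]
        nlinarith [norm_nonneg y, norm_nonneg ζ]
      have h1 := hv.le_circleAverage fun ζ hζ => hz (hd ζ hζ)
      have h2 : ∫ θ, G (y, θ) ∂μ =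
          (∫ θ in (0:ℝ)..(2 * Real.pi), v (z + circleMap 0 1 θ • y)) * k y := by
        rw [intervalIntegral.integral_of_le (by positivity), ← integral_mul_const]
        refine integral_congr_ae (ae_of_all _ fun θ => ?_)
        have := hd (circleMap 0 1 θ) (circleMap_one_eq θ).le
        simp [hG, hV, this]
      rw [h2, ← mul_assoc]
      refine mul_le_mul_of_nonneg_right ?_ (hk0 y)
      simp only [circleAverage, smul_eq_mul] at h1
      rw [inv_mul_eq_div, le_div_iff₀ (by positivity)] at h1
      linarith
  have hle : ∫ y, (2 * Real.pi) * (v z * k y) ≤ ∫ y, ∫ θ, G (y, θ) ∂μ :=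
    integral_mono ((hki.const_mul _).const_mul _) hGi.integral_prod_left hpt
  rw [hswap, integral_const_mul, integral_const_mul] at hle
  exact le_of_mul_le_mul_left hle (by positivity)

/-- The sub-mean value inequality on polydiscs. -/
theorem RPsh.mul_volume_le (hv : RPsh v Ω) (hz : closedBall z ε ⊆ Ω) :
    v z * (volume (ball z ε)).toReal ≤ ∫ y in ball z ε, v y := by
  have hm : MeasurableSet (ball (0 : Cn n) ε) := isOpen_ball.measurableSet
  have h := hv.mul_integral_le (z := z) (ε := ε) hz (k := (ball 0 ε).indicator fun _ => 1)
    (measurable_const.indicator hm)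
    ((integrable_indicator_iff hm).2 (integrableOn_const (measure_ball_lt_top.ne)))
    (fun y => indicator_nonneg (fun _ _ => zero_le_one) y)
    (fun y hy => by
      have := mem_of_indicator_ne_zero hy
      exact (by simpa using this : ‖y‖ < ε).le)
    (fun c hc y => by simp [indicator, norm_smul, hc])
  rw [integral_indicator hm, integral_const] at h
  have e1 : (volume.restrict (ball (0 : Cn n) ε)).real univ =
      (volume (ball z ε)).toReal := by
    rw [measureReal_def, Measure.restrict_apply_univ]
    congr 1
    rw [← Measure.addHaar_ball_center volume z]
  have e2 : ∫ y, v (z + y) * (ball (0 : Cn n) ε).indicator (fun _ => (1 : ℝ)) y =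
      ∫ y in ball z ε, v y := by
    rw [← integral_indicator isOpen_ball.measurableSet,
      ← integral_add_left_eq_self ((ball z ε).indicator v) z]
    congr 1
    ext y
    simp [indicator]
  rw [e1, e2] at h
  simpa using h

theorem RPsh.integrableOn_ball (hv : RPsh v Ω) (hz : closedBall z ε ⊆ Ω) :
    IntegrableOn v (ball z ε) := by
  obtain ⟨B, hB⟩ := hv.exists_abs_le (isCompact_closedBall z ε) hz
  have hm : MeasurableSet (ball z ε) := isOpen_ball.measurableSet
  have h1 : Measurable ((ball z ε).indicator v) :=
    (hv.usc.mono (ball_subset_closedBall.trans hz)).measurable_indicator hm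
  have hc : IntegrableOn (fun _ => B) (ball z ε) :=
    integrableOn_const measure_ball_lt_top.ne
  refine Integrable.mono' hc
    ((aestronglyMeasurable_indicator_iff hm).1 h1.aestronglyMeasurable) ?_
  filter_upwards [ae_restrict_mem hm] with y hy
  exact hB y (ball_subset_closedBall hy)

theorem exists_closedBall_subset (hΩ : IsOpen Ω) (hz : z ∈ Ω) :
    ∃ ε > 0, closedBall z ε ⊆ Ω :=
  nhds_basis_closedBall.mem_iff.1 (hΩ.mem_nhds hz)

theorem volume_ball_toReal_pos (z : Cn n) (hε : 0 < ε) :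
    0 < (volume (ball z ε)).toReal :=
  ENNReal.toReal_pos (measure_ball_pos volume z hε).ne' measure_ball_lt_top.ne

theorem RPsh.le_of_ae_le {u v : Cn n → ℝ} (hΩ : IsOpen Ω) (hv : RPsh v Ω)
    (hu : UpperSemicontinuousOn u Ω) (h : ∀ᵐ y, y ∈ Ω → v y ≤ u y) (hz : z ∈ Ω) :
    v z ≤ u z := by
  by_contra! hc
  obtain ⟨a, ha, ha'⟩ := exists_between hc
  have h1 := hu z hz a ha
  rw [hΩ.nhdsWithin_eq hz] at h1
  obtain ⟨ε, hε, hs⟩ := nhds_basis_closedBall.mem_iff.1 (inter_mem h1 (hΩ.mem_nhds hz))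
  have h2 := hv.mul_volume_le fun y hy => (hs hy).2
  have h3 : ∫ y in ball z ε, v y ≤ ∫ y in ball z ε, a := by
    refine integral_mono_ae (hv.integrableOn_ball fun y hy => (hs hy).2)
      (integrableOn_const measure_ball_lt_top.ne) ?_
    filter_upwards [ae_restrict_mem isOpen_ball.measurableSet,
      ae_restrict_of_ae h] with y hy hy'
    have hm := hs (ball_subset_closedBall hy)
    exact (hy' hm.2).trans (le_of_lt hm.1)
  rw [integral_const, measureReal_def, Measure.restrict_apply_univ, smul_eq_mul, mul_comm _ a] at h3
  have := volume_ball_toReal_pos z hε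
  nlinarith

theorem LPsh.le_of_ae_le {u v : Cn n → EReal} (hΩ : IsOpen Ω) (hv : LPsh v Ω) (hu : LPsh u Ω)
    (h : ∀ᵐ y, y ∈ Ω → v y ≤ u y) (hz : z ∈ Ω) :
    v z ≤ u z := by
  have hL : ∀ L : ℝ, trunc v L z ≤ trunc u L z := by
    intro L
    refine (hv.rpsh L).le_of_ae_le hΩ (hu.rpsh L).usc ?_ hz
    filter_upwards [h] with y hy hyΩ
    rw [← coe_le_coe_iff, coe_trunc (hv.lt_top y hyΩ), coe_trunc (hu.lt_top y hyΩ)]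
    exact max_le_max (hy hyΩ) le_rfl
  by_contra! hc
  obtain ⟨q, hq, hq'⟩ := EReal.lt_iff_exists_real_btwn.1 hc
  have h1 := hL (-q)
  rw [← coe_le_coe_iff, coe_trunc (hv.lt_top z hz), coe_trunc (hu.lt_top z hz), neg_neg,
    max_eq_right hq.le] at h1
  exact absurd ((le_max_left _ _).trans h1) (not_le.2 hq')

theorem LPsh.measurableSet_bot (hu : LPsh u Ω) (hΩ : IsOpen Ω) : MeasurableSet ({z | u z = ⊥} ∩ Ω) := by
  have h1 := hu.usc.measurable_indicator hΩ.measurableSet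
  have : {z | u z = ⊥} ∩ Ω = (Ω.indicator u) ⁻¹' {⊥} ∩ Ω := by
    ext z
    constructor
    · rintro ⟨h, hz⟩
      exact ⟨by simpa [hz] using h, hz⟩
    · rintro ⟨h, hz⟩
      exact ⟨by simpa [hz] using h, hz⟩
  rw [this]
  exact (h1 (measurableSet_singleton ⊥)).inter hΩ.measurableSet

theorem LPsh.eq_bot_of_measure_pos (hu : LPsh u Ω) (hΩ : IsOpen Ω) (hz : closedBall z ε ⊆ Ω)
    (hε : 0 < ε) (hpos : volume (({y | u y = ⊥} ∩ Ω) ∩ ball z ε) ≠ 0) : u z = ⊥ := by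
  have hzΩ : z ∈ Ω := hz (mem_closedBall_self hε.le)
  set P := ({y | u y = ⊥} ∩ Ω) ∩ ball z ε with hP
  have hPm : MeasurableSet P := (hu.measurableSet_bot hΩ).inter isOpen_ball.measurableSet
  have hPfin : volume P ≠ ⊤ :=
    ((measure_mono inter_subset_right).trans_lt measure_ball_lt_top).ne
  obtain ⟨M, hM⟩ := (hu.rpsh 0).exists_abs_le (isCompact_closedBall z ε) hz
  have hM0 : 0 ≤ M := (abs_nonneg _).trans (hM z (mem_closedBall_self hε.le))
  set m := (volume (ball z ε)).toReal with hm
  have hm0 : 0 < m := volume_ball_toReal_pos z hε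
  have hp0 : 0 < (volume P).toReal := ENNReal.toReal_pos hpos hPfin
  have hest : ∀ L : ℝ, 0 ≤ L → trunc u L z * m ≤ M * m - L * (volume P).toReal := by
    intro L hL
    refine ((hu.rpsh L).mul_volume_le hz).trans ?_
    have hi1 : Integrable (fun _ => M) (volume.restrict (ball z ε)) :=
      integrableOn_const measure_ball_lt_top.ne
    have hi2 : Integrable (P.indicator fun _ => -L) (volume.restrict (ball z ε)) :=
      (integrableOn_const (C := -L) measure_ball_lt_top.ne).indicator hPm
    have h2 : ∫ y in ball z ε, trunc u L y ≤
        ∫ y in ball z ε, (M + P.indicator (fun _ => -L) y) := by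
      refine integral_mono_ae ((hu.rpsh L).integrableOn_ball hz) ?_ ?_
      · exact hi1.add hi2
      · filter_upwards [ae_restrict_mem isOpen_ball.measurableSet] with y hy
        have hyc := ball_subset_closedBall hy
        by_cases hyP : y ∈ P
        · have : u y = ⊥ := hyP.1.1
          simp [hyP, trunc, this]
          exact hM0
        · simp only [hyP, not_false_eq_true, indicator_of_notMem, add_zero]
          exact (trunc_anti (hu.lt_top y (hz hyc)) hL).trans ((le_abs_self _).trans (hM y hyc))
    refine h2.trans_eq ?_
    rw [integral_add hi1 hi2, setIntegral_indicator hPm]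
    have : ball z ε ∩ P = P := inter_eq_right.2 inter_subset_right
    rw [this]
    simp [measureReal_def, hm]
    ring
  by_contra hne
  have hx := coe_toReal (hu.lt_top z hzΩ).ne hne
  set x := (u z).toReal
  have hlow : ∀ L : ℝ, x ≤ trunc u L z := by
    intro L
    rw [← coe_le_coe_iff, hx]
    exact le_trunc (hu.lt_top z hzΩ) L
  set L := (Max.max 0 (M * m - x * m) + 1) / (volume P).toReal with hLdef
  have hL0 : 0 ≤ L := by positivity
  have h1 := hest L hL0
  have h2 : L * (volume P).toReal = Max.max 0 (M * m - x * m) + 1 := by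
    rw [hLdef]; field_simp
  have h3 := mul_le_mul_of_nonneg_right (hlow L) hm0.le
  have := le_max_right 0 (M * m - x * m)
  linarith

theorem LPsh.eq_bot_near (hu : LPsh u Ω) (hΩ : IsOpen Ω) (hz : z ∈ Ω)
    (hpos : ∀ δ > 0, volume (({y | u y = ⊥} ∩ Ω) ∩ ball z δ) ≠ 0) :
    ∀ᶠ y in 𝓝 z, u y = ⊥ := by
  obtain ⟨ε, hε, hs⟩ := exists_closedBall_subset hΩ hz
  have hε3 : 0 < ε / 3 := by positivity
  filter_upwards [ball_mem_nhds z hε3] with y hy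
  refine hu.eq_bot_of_measure_pos hΩ (z := y) (ε := 2 * (ε / 3)) ?_ (by positivity) ?_
  · refine (closedBall_subset_closedBall' ?_).trans hs
    have := (mem_ball.1 hy).le
    linarith
  · intro h0
    refine hpos (ε / 3) hε3 (measure_mono_null (inter_subset_inter_right _ ?_) h0)
    refine ball_subset_ball' ?_
    have := (mem_ball'.1 hy).le
    linarith

/-- The polar set of a plurisubharmonic function is a null set. -/
theorem PSHOn.volume_bot (hu : PSHOn u Ω) (hΩ : IsOpen Ω) :
    volume ({y | u y = ⊥} ∩ Ω) = 0 := by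
  by_contra hne
  have hL := hu.lpsh hΩ
  obtain ⟨z, hzP, hz⟩ := exists_mem_forall_mem_nhdsWithin_pos_measure hne
  have key : ∀ z ∈ Ω, (∀ δ > 0, ∃ a, dist a z < δ ∧ a ∈ Ω ∧ ∀ᶠ y in 𝓝 a, u y = ⊥) →
      ∀ᶠ y in 𝓝 z, u y = ⊥ := by
    intro z hz h
    refine hL.eq_bot_near hΩ hz fun δ hδ => ?_
    obtain ⟨a, ha, haΩ, hb⟩ := h δ hδ
    have h1 : ({y | u y = ⊥} ∩ Ω) ∩ ball z δ ∈ 𝓝 a :=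
      inter_mem (inter_mem hb (hΩ.mem_nhds haΩ)) (isOpen_ball.mem_nhds ha)
    exact (Measure.measure_pos_of_mem_nhds volume h1).ne'
  set A := {a | a ∈ Ω ∧ ∀ᶠ y in 𝓝 a, u y = ⊥} with hA
  have hAo : IsOpen A := by
    rw [isOpen_iff_mem_nhds]
    rintro a ⟨ha, hb⟩
    filter_upwards [hΩ.mem_nhds ha, hb.eventually_nhds] with y hy hy'
    exact ⟨hy, hy'⟩
  have hAc : IsOpen (Ω \ A) := by
    rw [isOpen_iff_mem_nhds]
    rintro a ⟨ha, hb⟩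
    have : ∃ δ > 0, ∀ x, dist x a < δ → x ∈ Ω → ¬ ∀ᶠ y in 𝓝 x, u y = ⊥ := by
      by_contra! hc
      exact hb ⟨ha, key a ha fun δ hδ => (hc δ hδ).imp fun x hx => hx⟩
    obtain ⟨δ, hδ, hx⟩ := this
    filter_upwards [hΩ.mem_nhds ha, ball_mem_nhds a hδ] with y hy hy'
    exact ⟨hy, fun h => hx y hy' hy h.2⟩
  have hzA : z ∈ A := ⟨hzP.2, hL.eq_bot_near hΩ hzP.2 fun δ hδ => by
    have := hz (({y | u y = ⊥} ∩ Ω) ∩ ball z δ)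
      (inter_mem self_mem_nhdsWithin (mem_nhdsWithin_of_mem_nhds (ball_mem_nhds z hδ)))
    exact this.ne'⟩
  obtain ⟨w, hw, hwne⟩ := hu.not_botOnComponents z hzP.2
  have hsub : connectedComponentIn Ω z ⊆ A := by
    refine IsPreconnected.subset_left_of_subset_union hAo hAc disjoint_sdiff_right ?_
      ⟨z, mem_connectedComponentIn hzP.2, hzA⟩ isPreconnected_connectedComponentIn
    refine (connectedComponentIn_subset Ω z).trans fun x hx => ?_
    by_cases hxA : x ∈ A
    · exact Or.inl hxA
    · exact Or.inr ⟨hx, hxA⟩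
  exact hwne (hsub hw).2.self_of_nhds

theorem circle_line_mem {z w y : Cn n} {r ρ : ℝ} (hρ : closedBall z ρ ⊆ Ω) (hrw : r * ‖w‖ < ρ / 2)
    (hy : dist y z < ρ / 2) {ζ : ℂ} (hζ : ‖ζ‖ ≤ r) : y + ζ • w ∈ Ω := by
  refine hρ ?_
  rw [mem_closedBall, dist_eq_norm] at *
  calc ‖y + ζ • w - z‖ = ‖(y - z) + ζ • w‖ := by congr 1; abel
    _ ≤ ‖y - z‖ + ‖ζ‖ * ‖w‖ := (norm_add_le _ _).trans_eq (by rw [norm_smul])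
    _ ≤ ρ / 2 + r * ‖w‖ := by gcongr
    _ ≤ ρ := by linarith

theorem subAt_of_approx {v : ℕ → Cn n → ℝ} {V : Cn n → ℝ} (hΩ : IsOpen Ω) (hv : ∀ j, RPsh (v j) Ω)
    {L : ℝ} (hVL : ∀ y ∈ Ω, -L ≤ V y) (hV0 : ∀ y ∈ Ω, V y ≤ 0) (hvV : ∀ j, ∀ y ∈ Ω, v j y ≤ V y)
    (hV : UpperSemicontinuousOn V Ω) (hz : z ∈ Ω) (happ : ∀ a < V z, ∃ᶠ y in 𝓝 z, ∃ j, a < v j y) :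
    SubAt V z := by
  intro w
  obtain ⟨ρ, hρ, hρs⟩ := exists_closedBall_subset hΩ hz
  refine ⟨ρ / 2 / (‖w‖ + 1), by positivity, fun r hr hrε => ?_⟩
  have hrw : r * ‖w‖ < ρ / 2 := by
    rw [lt_div_iff₀ (by positivity)] at hrε
    nlinarith
  refine le_of_forall_lt fun a ha => ?_
  obtain ⟨a', haa', ha'⟩ := exists_between ha
  refine haa'.trans_le ?_
  have hf := (happ a' ha').and_eventually (ball_mem_nhds z (half_pos hρ))
  obtain ⟨y, hyz, hy⟩ := exists_seq_forall_of_frequently hf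
  choose j hj using fun k => (hy k).1
  have hyb : ∀ k, dist (y k) z < ρ / 2 := fun k => (hy k).2
  have hγ : ∀ x : Cn n, Continuous fun θ : ℝ => x + circleMap 0 r θ • w := fun x => by
    have := continuous_circleMap 0 r
    fun_prop
  have hmem : ∀ x, dist x z < ρ / 2 → ∀ θ : ℝ, x + circleMap 0 r θ • w ∈ Ω := fun x hx θ =>
    circle_line_mem hρs hrw hx (by simp [abs_of_pos hr])
  have hzz : dist z z < ρ / 2 := by simpa using hρ
  have hB : ∀ x ∈ Ω, |V x| ≤ L := fun x hx => by
    have := hVL x hx; have := hV0 x hx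
    rw [abs_of_nonpos (by assumption)]; linarith
  have hInt : ∀ x, dist x z < ρ / 2 → IntervalIntegrable
      (fun θ => V (x + circleMap 0 r θ • w)) volume 0 (2 * Real.pi) := fun x hx =>
    hV.intervalIntegrable_curve hB (hγ x) (hmem x hx) _ _
  have hpi : (0 : ℝ) ≤ 2 * Real.pi := by positivity
  have hk : ∀ k, a' ≤ circleAverage (fun ζ : ℂ => V (y k + ζ • w)) 0 r := by
    intro k
    have h1 := (hv (j k)).le_circleAverage' (z := y k) (w := w) hr.le
      fun ζ hζ => circle_line_mem hρs hrw (hyb k) hζ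
    refine (hj k).le.trans (h1.trans ?_)
    refine circleAverage_mono ((hv (j k)).circleIntegrable hr.le
      fun ζ hζ => circle_line_mem hρs hrw (hyb k) hζ) (hInt _ (hyb k)) ?_
    intro ζ hζ
    refine hvV _ _ (circle_line_mem hρs hrw (hyb k) ?_)
    rw [abs_of_pos hr] at hζ
    simpa using hζ.le
  have hlin : ∀ x, dist x z < ρ / 2 →
      ∫⁻ θ in Ioc 0 (2 * Real.pi), ofReal (-V (x + circleMap 0 r θ • w)) =
      ofReal (-(2 * Real.pi * circleAverage (fun ζ : ℂ => V (x + ζ • w)) 0 r)) := by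
    intro x hx
    rw [← ofReal_integral_eq_lintegral_ofReal]
    · rw [circleAverage_def, intervalIntegral.integral_of_le hpi, integral_neg, smul_eq_mul]
      congr 2
      field_simp
    · exact ((hInt x hx).1).neg
    · exact Eventually.of_forall fun θ => by simpa using hV0 _ (hmem x hx θ)
  have hmeas : ∀ x, dist x z < ρ / 2 →
      Measurable fun θ : ℝ => ofReal (-V (x + circleMap 0 r θ • w)) := fun x hx =>
    (hV.comp_curve (hγ x) (hmem x hx)).measurable.neg.ennreal_ofReal
  have hfat := lintegral_liminf_le (u := atTop) (μ := volume.restrict (Ioc 0 (2 * Real.pi)))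
    (fun k => hmeas (y k) (hyb k))
  have hlow : ∫⁻ θ in Ioc 0 (2 * Real.pi), ofReal (-V (z + circleMap 0 r θ • w)) ≤
      ∫⁻ θ in Ioc 0 (2 * Real.pi),
        liminf (fun k => ofReal (-V (y k + circleMap 0 r θ • w))) atTop := by
    refine lintegral_mono fun θ => ?_
    refine le_of_forall_lt fun b hb => ?_
    obtain ⟨b', hbb', hb'⟩ := exists_between hb
    refine hbb'.trans_le (le_liminf_of_le (by isBoundedDefault) ?_)
    have hbt : b' ≠ ⊤ := (hb'.trans ENNReal.ofReal_lt_top).ne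
    have h1 : b'.toReal < -V (z + circleMap 0 r θ • w) := by
      rw [← ENNReal.ofReal_toReal hbt, ENNReal.ofReal_lt_ofReal_iff'] at hb'
      exact hb'.1
    have h2 := hV _ (hmem z hzz θ) (-b'.toReal) (by linarith)
    rw [hΩ.nhdsWithin_eq (hmem z hzz θ)] at h2
    have h3 : Tendsto (fun k => y k + circleMap 0 r θ • w) atTop (𝓝 (z + circleMap 0 r θ • w)) :=
      hyz.add_const _
    filter_upwards [h3.eventually h2] with k hk
    rw [← ENNReal.ofReal_toReal hbt]
    exact ofReal_le_ofReal (by linarith)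
  have hup : liminf (fun k => ∫⁻ θ in Ioc 0 (2 * Real.pi),
      ofReal (-V (y k + circleMap 0 r θ • w))) atTop ≤
      ofReal (-(2 * Real.pi * a')) := by
    refine liminf_le_of_frequently_le' (Frequently.of_forall fun k => ?_)
    rw [hlin _ (hyb k)]
    exact ofReal_le_ofReal (neg_le_neg (mul_le_mul_of_nonneg_left (hk k) hpi))
  have hfin := (hlow.trans hfat).trans hup
  have ha0 : a' < 0 := ha'.trans_le (hV0 z hz)
  rw [hlin z hzz, ENNReal.ofReal_le_ofReal_iff (by nlinarith [pi_pos])] at hfin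
  nlinarith [pi_pos]

theorem ae_le_iSup_of_approx {v : ℕ → Cn n → ℝ} {V : Cn n → ℝ} (hΩ : IsOpen Ω)
    (hv : ∀ j, RPsh (v j) Ω) {L : ℝ} (hvL : ∀ j, ∀ y ∈ Ω, -L ≤ v j y)
    (hv0 : ∀ j, ∀ y ∈ Ω, v j y ≤ 0) (happ : ∀ z ∈ Ω, ∀ a < V z, ∃ᶠ y in 𝓝 z, ∃ j, a < v j y) :
    ∀ᵐ z, z ∈ Ω → V z ≤ ⨆ j, v j z := by
  set S : Cn n → ℝ := fun z => ⨆ j, Ω.indicator (v j) z with hS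
  have hSΩ : ∀ z ∈ Ω, S z = ⨆ j, v j z := fun z hz => by simp [hS, hz]
  have hSm : Measurable S := Measurable.iSup fun j => (hv j).usc.measurable_indicator
    hΩ.measurableSet
  have hbdd : ∀ z, BddAbove (Set.range fun j => Ω.indicator (v j) z) := fun z => by
    refine ⟨0, ?_⟩
    rintro _ ⟨j, rfl⟩
    by_cases hz : z ∈ Ω
    · simpa [hz] using hv0 j z hz
    · simp [hz]
  have hSb : ∀ z, ‖S z‖ ≤ |L| := fun z => by
    by_cases hz : z ∈ Ω
    · have h1 : S z ≤ 0 := by rw [hSΩ z hz]; exact ciSup_le fun j => hv0 j z hz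
      have h2 : -L ≤ S z := by
        refine (hvL 0 z hz).trans ?_
        have := le_ciSup (hbdd z) 0
        simpa [hz, hS] using this
      rw [norm_eq_abs, abs_of_nonpos h1]
      linarith [le_abs_self L]
    · simp [hS, hz]
  have hSli : LocallyIntegrable S := by
    refine (locallyIntegrable_const (μ := volume) |L|).mono hSm.aestronglyMeasurable ?_
    exact Eventually.of_forall fun z => by simpa using hSb z
  filter_upwards [IsUnifLocDoublingMeasure.ae_tendsto_average (μ := volume) hSli 1] with z hz hzΩ
  obtain ⟨ρ, hρ, hρs⟩ := exists_closedBall_subset hΩ hzΩ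
  rw [← hSΩ z hzΩ]
  have h1 := hz (l := 𝓝[>] (0 : ℝ)) (fun _ => z) id tendsto_id
    (by filter_upwards [self_mem_nhdsWithin] with x (hx : 0 < x); simpa using hx.le)
  refine ge_of_tendsto h1 ?_
  have hev : ∀ᶠ s : ℝ in 𝓝[>] 0, s < ρ / 2 :=
    mem_nhdsWithin_of_mem_nhds (Iio_mem_nhds (half_pos hρ))
  filter_upwards [hev, self_mem_nhdsWithin] with s hs (hs0 : 0 < s)
  simp only [id]
  set m := (volume (closedBall z s)).toReal with hm
  have hm0 : 0 < m := (volume_ball_toReal_pos z hs0).trans_le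
    (ENNReal.toReal_mono measure_closedBall_lt_top.ne (measure_mono ball_subset_closedBall))
  have hsΩ : closedBall z s ⊆ Ω :=
    (closedBall_subset_closedBall (by linarith)).trans hρs
  have hSint : ∀ x t, IntegrableOn S (closedBall x t) := fun x t =>
    Measure.integrableOn_of_bounded (M := |L|) measure_closedBall_lt_top.ne
      hSm.aestronglyMeasurable (Eventually.of_forall fun x => hSb x)
  set d := Module.finrank ℝ (Cn n)
  have hvol : ∀ (x : Cn n) (t : ℝ), 0 < t → (volume (ball x t)).toReal =
      t ^ d * (volume (ball (0 : Cn n) 1)).toReal := fun x t ht => by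
    rw [Measure.addHaar_ball_of_pos _ _ ht, ENNReal.toReal_mul,
      ENNReal.toReal_ofReal (by positivity)]
  have hkey : ∀ ε, s < ε → ε < ρ / 2 →
      V z * (ε ^ d * (volume (ball (0 : Cn n) 1)).toReal) ≤
        ∫ y in closedBall z s, S y := by
    intro ε hsε hερ
    have hε0 := hs0.trans hsε
    have hp := volume_ball_toReal_pos z hε0
    rw [hvol z ε hε0] at hp
    rw [← le_div_iff₀ hp]
    refine le_of_forall_lt fun a ha => ?_
    obtain ⟨a', haa', ha'⟩ := exists_between ha
    refine haa'.trans_le ?_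
    rw [le_div_iff₀ hp]
    obtain ⟨y, ⟨j, hj⟩, hyz⟩ := ((happ z hzΩ a' ha').and_eventually
      (ball_mem_nhds z (sub_pos.2 hsε))).exists
    have hyz' : dist y z < ε - s := hyz
    have hyΩ : closedBall y ε ⊆ Ω :=
      (closedBall_subset_closedBall' (by linarith)).trans hρs
    have hsub : closedBall z s ⊆ ball y ε :=
      closedBall_subset_ball' (by rw [dist_comm]; linarith)
    have h2 := (hv j).mul_volume_le hyΩ
    rw [hvol y ε hε0] at h2
    have h3 : ∫ x in ball y ε, v j x ≤ ∫ x in closedBall z s, v j x := by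
      have hi := (hv j).integrableOn_ball hyΩ
      have := setIntegral_mono_set (f := fun x => -v j x) hi.neg
        (by
          filter_upwards [ae_restrict_mem isOpen_ball.measurableSet] with x hx
          simpa using hv0 j x (hyΩ (ball_subset_closedBall hx)))
        (LE.le.eventuallyLE hsub)
      rw [integral_neg, integral_neg] at this
      linarith
    have h4 : ∫ x in closedBall z s, v j x ≤ ∫ x in closedBall z s, S x := by
      refine setIntegral_mono_on (((hv j).integrableOn_ball hyΩ).mono_set hsub) (hSint _ _)
        isClosed_closedBall.measurableSet fun x hx => ?_
      have := le_ciSup (hbdd x) j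
      simpa [hsΩ hx, hS] using this
    have := mul_le_mul_of_nonneg_right hj.le hp.le
    linarith
  have hlim : V z * m ≤ ∫ y in closedBall z s, S y := by
    have hmv : m = s ^ d * (volume (ball (0 : Cn n) 1)).toReal := by
      rw [hm, Measure.addHaar_closedBall _ _ hs0.le, ENNReal.toReal_mul,
        ENNReal.toReal_ofReal (by positivity)]
    rw [hmv]
    have hc : Tendsto (fun ε : ℝ => V z * (ε ^ d * (volume (ball (0 : Cn n) 1)).toReal))
        (𝓝[>] s) (𝓝 (V z * (s ^ d * (volume (ball (0 : Cn n) 1)).toReal))) := by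
      refine Tendsto.mono_left ?_ nhdsWithin_le_nhds
      exact Continuous.tendsto (by fun_prop) s
    refine le_of_tendsto hc ?_
    have hev : ∀ᶠ ε : ℝ in 𝓝[>] s, ε < ρ / 2 := mem_nhdsWithin_of_mem_nhds (Iio_mem_nhds hs)
    filter_upwards [hev, self_mem_nhdsWithin] with ε h1 h2 using hkey ε h2 h1
  rw [setAverage_eq, measureReal_def, smul_eq_mul, inv_mul_eq_div, le_div_iff₀ hm0]
  exact hlim

theorem LPsh.exists_sup_regularization {u : ℕ → Cn n → EReal} (hΩ : IsOpen Ω)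
    (hu : ∀ j, LPsh (u j) Ω) (hu0 : ∀ j, ∀ z ∈ Ω, u j z ≤ 0) :
    ∃ W : Cn n → EReal, LPsh W Ω ∧ (∀ z ∈ Ω, W z ≤ 0) ∧ (∀ j, ∀ z ∈ Ω, u j z ≤ W z) ∧
      ∀ᵐ z, z ∈ Ω → W z = ⨆ j, u j z := by
  set w : Cn n → EReal := fun z => ⨆ j, u j z with hw
  set W : Cn n → EReal := fun z => limsup w (𝓝 z) with hWdef
  have hwW : ∀ z, w z ≤ W z := fun z => by
    refine le_limsup_of_frequently_le ?_ (by isBoundedDefault)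
    intro h
    exact (mem_of_mem_nhds h : ¬ _) le_rfl
  have huW : ∀ j z, u j z ≤ W z := fun j z => (le_iSup (fun j => u j z) j).trans (hwW z)
  have hW0 : ∀ z ∈ Ω, W z ≤ 0 := fun z hz => by
    refine limsup_le_of_le (by isBoundedDefault) ?_
    filter_upwards [hΩ.mem_nhds hz] with y hy
    exact iSup_le fun j => hu0 j y hy
  have hWt : ∀ z ∈ Ω, W z < ⊤ := fun z hz => (hW0 z hz).trans_lt EReal.zero_lt_top
  have hut : ∀ j, ∀ z ∈ Ω, u j z < ⊤ := fun j z hz => (hu0 j z hz).trans_lt EReal.zero_lt_top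
  have hWu : UpperSemicontinuous W := by
    intro z b hb
    obtain ⟨c, hc, hcb⟩ := exists_between hb
    have h1 := eventually_lt_of_limsup_lt (u := w) hc
    filter_upwards [eventually_eventually_nhds.2 h1] with y hy
    exact (limsup_le_of_le (by isBoundedDefault) (hy.mono fun _ h => h.le)).trans_lt hcb
  have hWuΩ : UpperSemicontinuousOn W Ω := hWu.upperSemicontinuousOn _
  have happ : ∀ L : ℝ, ∀ z ∈ Ω, ∀ a < trunc W L z, ∃ᶠ y in 𝓝 z, ∃ j, a < trunc (u j) L y := by
    intro L z hz a ha
    have hev := hΩ.mem_nhds hz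
    rw [← coe_lt_coe_iff, coe_trunc (hWt z hz), lt_max_iff] at ha
    rcases ha with ha | ha
    · refine ((frequently_lt_of_lt_limsup (by isBoundedDefault) ha).and_eventually hev).mono ?_
      rintro y ⟨hy, hyΩ⟩
      obtain ⟨j, hj⟩ := lt_iSup_iff.1 hy
      exact ⟨j, by
        rw [← coe_lt_coe_iff]; exact hj.trans_le (le_trunc (hut j y hyΩ) L)⟩
    · refine Eventually.frequently ?_
      filter_upwards [hev] with y hyΩ
      exact ⟨0, (coe_lt_coe_iff.1 ha).trans_le (neg_le_trunc (hut 0 y hyΩ) L)⟩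
  have hle0 : ∀ {f : Cn n → EReal} {L : ℝ}, 0 ≤ L → ∀ z, f z ≤ 0 → trunc f L z ≤ 0 := by
    intro f L hL z hz
    rw [← coe_le_coe_iff, coe_trunc (hz.trans_lt EReal.zero_lt_top)]
    refine max_le (by simpa using hz) ?_
    exact coe_le_coe_iff.2 (by linarith)
  have hmono : ∀ L j, ∀ y ∈ Ω, trunc (u j) L y ≤ trunc W L y := fun L j y hy => by
    rw [← coe_le_coe_iff, coe_trunc (hut j y hy), coe_trunc (hWt y hy)]
    exact max_le_max (huW j y) le_rfl
  refine ⟨W, ⟨hWuΩ, hWt, ?_⟩, hW0, fun j z _ => huW j z, ?_⟩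
  · intro L z hz
    rcases le_total 0 L with hL | hL
    · exact subAt_of_approx hΩ (fun j => (hu j).rpsh L)
        (fun y hy => neg_le_trunc (hWt y hy) L) (fun y hy => hle0 hL y (hW0 y hy)) (hmono L)
        (hWuΩ.trunc hWt L) hz (happ L z hz)
    · have hcon : ∀ y ∈ Ω, trunc W L y = -L := by
        intro y hy
        apply EReal.coe_injective
        rw [coe_trunc (hWt y hy)]
        refine max_eq_right ((hW0 y hy).trans ?_)
        exact_mod_cast (by linarith : (0 : ℝ) ≤ -L)
      exact ((RPsh.const (-L) Ω).sub z hz : SubAt (fun _ => -L) z).congr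
        (by filter_upwards [hΩ.mem_nhds hz] with y hy using (hcon y hy).symm)
  · have hall : ∀ᵐ z, ∀ L : ℕ, z ∈ Ω → trunc W L z ≤ ⨆ j, trunc (u j) L z := by
      rw [ae_all_iff]
      intro L
      exact ae_le_iSup_of_approx hΩ (fun j => (hu j).rpsh L) (L := L)
        (fun j y hy => neg_le_trunc (hut j y hy) L)
        (fun j y hy => hle0 (Nat.cast_nonneg L) y (hu0 j y hy)) (happ L)
    filter_upwards [hall] with z hz hzΩ
    refine le_antisymm ?_ (hwW z)
    by_contra! hc
    obtain ⟨q, hq, hq'⟩ := EReal.lt_iff_exists_real_btwn.1 hc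
    obtain ⟨L, hL⟩ := exists_nat_gt (-q)
    have h1 : trunc W L z ≤ q := by
      refine (hz L hzΩ).trans (ciSup_le fun j => ?_)
      rw [← coe_le_coe_iff, coe_trunc (hut j z hzΩ)]
      exact max_le ((le_iSup (fun j => u j z) j).trans hq.le)
        (coe_le_coe_iff.2 (by linarith))
    have h2 := le_trunc (hWt z hzΩ) L
    exact absurd (h2.trans (coe_le_coe_iff.2 h1)) (not_le.2 hq')

/-- Smooth complex-valued functions on `ℂⁿ`. -/
abbrev Sm (f : Cn n → ℂ) : Prop := ContDiff ℝ ∞ f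

/-- The real directional derivative. -/
def Dr (w : Cn n) (f : Cn n → ℂ) (z : Cn n) : ℂ := fderiv ℝ f z w

/-- The Wirtinger derivative `∂_w`. -/
def dz (w : Cn n) (f : Cn n → ℂ) (z : Cn n) : ℂ :=
  (1 / 2) * (Dr w f z - I * Dr (I • w) f z)

/-- The Wirtinger derivative `∂̄_w`. -/
def dzb (w : Cn n) (f : Cn n → ℂ) (z : Cn n) : ℂ :=
  (1 / 2) * (Dr w f z + I * Dr (I • w) f z)

/-- Test functions. -/
def Test (f : Cn n → ℂ) : Prop := Sm f ∧ HasCompactSupport f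

theorem Sm.differentiableAt (hf : Sm f) (z : Cn n) : DifferentiableAt ℝ f z :=
  (hf.differentiable (by simp)).differentiableAt

theorem Sm.Dr (hf : Sm f) (w : Cn n) : Sm (Dr w f) :=
  (hf.fderiv_right (m := ∞) (by simp)).clm_apply contDiff_const

theorem Sm.dz (hf : Sm f) (w : Cn n) : Sm (dz w f) :=
  contDiff_const.mul ((hf.Dr w).sub (contDiff_const.mul (hf.Dr _)))

theorem Sm.dzb (hf : Sm f) (w : Cn n) : Sm (dzb w f) :=
  contDiff_const.mul ((hf.Dr w).add (contDiff_const.mul (hf.Dr _)))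

theorem Sm.conj (hf : Sm f) : Sm fun z => conj (f z) :=
  conjCLE.contDiff.comp hf

theorem HasCompactSupport.Dr (hf : HasCompactSupport f) (w : Cn n) :
    HasCompactSupport (Dr w f) := hf.fderiv_apply (𝕜 := ℝ) w

theorem HasCompactSupport.dz (hf : HasCompactSupport f) (w : Cn n) :
    HasCompactSupport (dz w f) := by
  refine HasCompactSupport.mul_left (f := fun _ => (1 / 2 : ℂ)) ?_
  exact (hf.Dr w).sub ((hf.Dr _).mul_left (f := fun _ => I))

theorem HasCompactSupport.dzb (hf : HasCompactSupport f) (w : Cn n) :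
    HasCompactSupport (dzb w f) := by
  refine HasCompactSupport.mul_left (f := fun _ => (1 / 2 : ℂ)) ?_
  exact (hf.Dr w).add ((hf.Dr _).mul_left (f := fun _ => I))

theorem HasCompactSupport.conj (hf : HasCompactSupport f) :
    HasCompactSupport fun z => conj (f z) :=
  hf.comp_left (g := conj) (map_zero _)

theorem Test.dz (hf : Test f) (w : Cn n) : Test (dz w f) :=
  ⟨hf.1.dz w, hf.2.dz w⟩

theorem Test.dzb (hf : Test f) (w : Cn n) : Test (dzb w f) :=
  ⟨hf.1.dzb w, hf.2.dzb w⟩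

theorem Test.conj (hf : Test f) : Test fun z => conj (f z) :=
  ⟨hf.1.conj, hf.2.conj⟩

theorem Test.add (hf : Test f) (hg : Test g) : Test fun z => f z + g z :=
  ⟨hf.1.add hg.1, hf.2.add hg.2⟩

theorem Test.sub (hf : Test f) (hg : Test g) : Test fun z => f z - g z :=
  ⟨hf.1.sub hg.1, hf.2.sub hg.2⟩

theorem Test.neg (hf : Test f) : Test fun z => -f z :=
  ⟨hf.1.neg, hf.2.neg⟩

theorem Test.mul (hf : Sm f) (hg : Test g) : Test fun z => f z * g z :=
  ⟨hf.mul hg.1, hg.2.mul_left⟩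

theorem Test.mul' (hf : Test f) (hg : Sm g) : Test fun z => f z * g z :=
  ⟨hf.1.mul hg, hf.2.mul_right⟩

theorem test_zero : Test fun _ : Cn n => (0 : ℂ) := ⟨contDiff_const, HasCompactSupport.zero⟩

theorem Test.sum {ι : Type*} {s : Finset ι} {f : ι → Cn n → ℂ} (hf : ∀ i ∈ s, Test (f i)) :
    Test fun z => ∑ i ∈ s, f i z := by
  classical
  induction s using Finset.induction_on with
  | empty => simpa using test_zero
  | insert a s ha ih =>
    simp only [sum_insert ha]
    exact (hf a (by simp)).add (ih fun i hi => hf i (by simp [hi]))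

theorem Test.integrable (hf : Test f) : Integrable f :=
  hf.1.continuous.integrable_of_hasCompactSupport hf.2

theorem Test.memLp (hf : Test f) : MemLp f 2 :=
  hf.1.continuous.memLp_of_hasCompactSupport hf.2

theorem Dr_add (hf : Sm f) (hg : Sm g) (w z : Cn n) :
    Dr w (fun z => f z + g z) z = Dr w f z + Dr w g z := by
  rw [Dr, fderiv_fun_add (hf.differentiableAt z) (hg.differentiableAt z)]; rfl

theorem Dr_mul (hf : Sm f) (hg : Sm g) (w z : Cn n) :
    Dr w (fun z => f z * g z) z = Dr w f z * g z + f z * Dr w g z := by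
  rw [Dr, fderiv_fun_mul (hf.differentiableAt z) (hg.differentiableAt z)]
  simp [Dr]; ring

theorem Dr_const_mul (hf : Sm f) (c : ℂ) (w z : Cn n) :
    Dr w (fun z => c * f z) z = c * Dr w f z := by
  rw [Dr, fderiv_const_mul (hf.differentiableAt z)]; rfl

theorem Dr_sub (hf : Sm f) (hg : Sm g) (w z : Cn n) :
    Dr w (fun z => f z - g z) z = Dr w f z - Dr w g z := by
  rw [Dr, fderiv_fun_sub (hf.differentiableAt z) (hg.differentiableAt z)]; rfl

theorem Dr_conj (w z : Cn n) :
    Dr w (fun z => conj (f z)) z = conj (Dr w f z) := by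
  have := conjCLE.comp_fderiv (f := f) (x := z)
  change fderiv ℝ (conjCLE ∘ f) z w = _
  rw [this]; rfl

theorem Dr_comm (hf : Sm f) (v w z : Cn n) :
    Dr v (Dr w f) z = Dr w (Dr v f) z := by
  have hs : IsSymmSndFDerivAt ℝ f z := by
    refine (hf.contDiffAt (x := z)).isSymmSndFDerivAt ?_
    rw [minSmoothness_of_isRCLikeNormedField]
    exact WithTop.coe_le_coe.2 (by simp)
  have hd : DifferentiableAt ℝ (fderiv ℝ f) z :=
    ((hf.fderiv_right (m := ∞) (by simp)).differentiable (by simp)).differentiableAt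
  have key : ∀ a b : Cn n, Dr a (Dr b f) z = fderiv ℝ (fderiv ℝ f) z a b := by
    intro a b
    change fderiv ℝ (fun y => fderiv ℝ f y b) z a = _
    rw [fderiv_clm_apply hd (differentiableAt_const b)]
    simp
  rw [key, key]
  exact hs v w

theorem dz_add (hf : Sm f) (hg : Sm g) (w z : Cn n) :
    dz w (fun z => f z + g z) z = dz w f z + dz w g z := by
  simp only [dz, Dr_add hf hg]; ring

theorem dzb_add (hf : Sm f) (hg : Sm g) (w z : Cn n) :
    dzb w (fun z => f z + g z) z = dzb w f z + dzb w g z := by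
  simp only [dzb, Dr_add hf hg]; ring

theorem dz_mul (hf : Sm f) (hg : Sm g) (w z : Cn n) :
    dz w (fun z => f z * g z) z = dz w f z * g z + f z * dz w g z := by
  simp only [dz, Dr_mul hf hg]; ring

theorem dzb_mul (hf : Sm f) (hg : Sm g) (w z : Cn n) :
    dzb w (fun z => f z * g z) z = dzb w f z * g z + f z * dzb w g z := by
  simp only [dzb, Dr_mul hf hg]; ring

theorem dzb_const_mul (hf : Sm f) (c : ℂ) (w z : Cn n) :
    dzb w (fun z => c * f z) z = c * dzb w f z := by
  simp only [dzb, Dr_const_mul hf]; ring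

theorem dz_const_mul (hf : Sm f) (c : ℂ) (w z : Cn n) :
    dz w (fun z => c * f z) z = c * dz w f z := by
  simp only [dz, Dr_const_mul hf]; ring

theorem dz_conj (w z : Cn n) :
    dz w (fun z => conj (f z)) z = conj (dzb w f z) := by
  simp only [dz, dzb, Dr_conj, map_mul, map_add, Complex.conj_I, map_div₀, map_one]
  simp only [conj_ofNat]; ring

theorem dzb_conj (w z : Cn n) :
    dzb w (fun z => conj (f z)) z = conj (dz w f z) := by
  simp only [dz, dzb, Dr_conj, map_mul, map_sub, Complex.conj_I, map_div₀, map_one]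
  simp only [conj_ofNat]; ring

theorem Dr_dz (hf : Sm f) (v w z : Cn n) :
    Dr v (dz w f) z = (1 / 2) * (Dr v (Dr w f) z - I * Dr v (Dr (I • w) f) z) := by
  have h1 := hf.Dr w
  have h2 := hf.Dr (I • w)
  have h3 : Sm fun z => I * Dr (I • w) f z := contDiff_const.mul h2
  rw [show dz w f = fun z => (1 / 2 : ℂ) * (Dr w f z - I * Dr (I • w) f z) from rfl,
    Dr_const_mul (h1.sub h3), Dr_sub h1 h3, Dr_const_mul h2]

theorem Dr_dzb (hf : Sm f) (v w z : Cn n) :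
    Dr v (dzb w f) z = (1 / 2) * (Dr v (Dr w f) z + I * Dr v (Dr (I • w) f) z) := by
  have h1 := hf.Dr w
  have h2 := hf.Dr (I • w)
  have h3 : Sm fun z => I * Dr (I • w) f z := contDiff_const.mul h2
  rw [show dzb w f = fun z => (1 / 2 : ℂ) * (Dr w f z + I * Dr (I • w) f z) from rfl,
    Dr_const_mul (h1.add h3), Dr_add h1 h3, Dr_const_mul h2]

theorem dz_dzb_comm (hf : Sm f) (v w z : Cn n) :
    dz v (dzb w f) z = dzb w (dz v f) z := by
  rw [dz, dzb, Dr_dzb hf, Dr_dzb hf, Dr_dz hf, Dr_dz hf, Dr_comm hf v w,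
    Dr_comm hf v (I • w), Dr_comm hf (I • v) w,
    Dr_comm hf (I • v) (I • w)]
  ring

theorem dzb_dzb_comm (hf : Sm f) (v w z : Cn n) :
    dzb v (dzb w f) z = dzb w (dzb v f) z := by
  rw [dzb, dzb, Dr_dzb hf, Dr_dzb hf, Dr_dzb hf, Dr_dzb hf, Dr_comm hf v w,
    Dr_comm hf v (I • w), Dr_comm hf (I • v) w,
    Dr_comm hf (I • v) (I • w)]
  ring

theorem integral_mul_Dr (hf : Sm f) (hg : Test g) (w : Cn n) :
    ∫ z, f z * Dr w g z = -∫ z, Dr w f z * g z := by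
  refine integral_mul_fderiv_eq_neg_fderiv_mul_of_integrable ?_ ?_ ?_
    (fun x _ => hf.differentiableAt x) (fun x _ => hg.1.differentiableAt x)
  · exact (Test.mul (hf.Dr w) hg).integrable
  · exact (Test.mul hf ⟨hg.1.Dr w, hg.2.Dr w⟩).integrable
  · exact (Test.mul hf hg).integrable

theorem integral_mul_dzb (hf : Sm f) (hg : Test g) (w : Cn n) :
    ∫ z, f z * dzb w g z = -∫ z, dzb w f z * g z := by
  have h1 := integral_mul_Dr hf hg w
  have h2 := integral_mul_Dr hf hg (I • w)
  have i1 : ∀ w, Integrable fun z => f z * Dr w g z := fun w =>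
    (Test.mul hf ⟨hg.1.Dr w, hg.2.Dr w⟩).integrable
  have i2 : ∀ w, Integrable fun z => Dr w f z * g z := fun w => (Test.mul (hf.Dr w) hg).integrable
  have e1 : ∀ z, f z * dzb w g z =
      (1 / 2) * (f z * Dr w g z) + (I / 2) * (f z * Dr (I • w) g z) := fun z => by
    rw [dzb]; ring
  have e2 : ∀ z, dzb w f z * g z =
      (1 / 2) * (Dr w f z * g z) + (I / 2) * (Dr (I • w) f z * g z) := fun z => by
    rw [dzb]; ring
  simp_rw [e1, e2]
  rw [integral_add ((i1 _).const_mul _) ((i1 _).const_mul _),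
    integral_add ((i2 _).const_mul _) ((i2 _).const_mul _)]
  simp only [integral_const_mul, h1, h2]
  ring

/-- The coordinate vector `e_j`. -/
def ev (j : Fin n) : Cn n := Pi.single j 1

/-- The twisted operator `∂̄_j + a_j`. -/
def DD (a : Fin n → Cn n → ℂ) (j : Fin n) (f : Cn n → ℂ) (z : Cn n) : ℂ :=
  dzb (ev j) f z + a j z * f z

/-- The formal adjoint `-∂_j + ā_j` of the twisted operator. -/
def DS (a : Fin n → Cn n → ℂ) (j : Fin n) (f : Cn n → ℂ) (z : Cn n) : ℂ :=
  -dz (ev j) f z + conj (a j z) * f z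

theorem Test.DD (ha : ∀ j, Sm (a j)) (hf : Test f) (j : Fin n) : Test (DD a j f) := (hf.dzb _).add (Test.mul (ha j) hf)

theorem Test.DS (ha : ∀ j, Sm (a j)) (hf : Test f) (j : Fin n) : Test (DS a j f) := (hf.dz _).neg.add (Test.mul (ha j).conj hf)

theorem integral_DD_mul_conj (ha : ∀ j, Sm (a j)) (hf : Sm f) (hg : Test g) (j : Fin n) :
    ∫ z, DD a j f z * conj (g z) = ∫ z, f z * conj (DS a j g z) := by
  have h1 := integral_mul_dzb hf hg.conj (ev j)
  simp only [dzb_conj] at h1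
  have e1 : ∀ z, DD a j f z * conj (g z) =
      dzb (ev j) f z * conj (g z) + a j z * f z * conj (g z) := fun z => by
    rw [DD]; ring
  have e2 : ∀ z, f z * conj (DS a j g z) =
      -(f z * conj (dz (ev j) g z)) + a j z * f z * conj (g z) := fun z => by
    rw [DS]; simp only [map_add, map_neg, map_mul, conj_conj]; ring
  simp_rw [e1, e2]
  have i1 : Integrable fun z => dzb (ev j) f z * conj (g z) :=
    (Test.mul (hf.dzb _) hg.conj).integrable
  have i2 : Integrable fun z => a j z * f z * conj (g z) :=
    (Test.mul ((ha j).mul hf) hg.conj).integrable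
  have i3 : Integrable fun z => f z * conj (dz (ev j) g z) :=
    (Test.mul hf (hg.dz _).conj).integrable
  have i4 : Integrable fun z => -(f z * conj (dz (ev j) g z)) := i3.neg
  rw [integral_add i1 i2, integral_add i4 i2, integral_neg, h1, neg_neg]

theorem DD_DS (ha : ∀ j, Sm (a j)) (hf : Sm f) (j k : Fin n) (z : Cn n) :
    DD a k (DS a j f) z = DS a j (DD a k f) z +
      (conj (dz (ev k) (a j) z) + dz (ev j) (a k) z) * f z := by
  have hac := (ha j).conj
  have h1 : dzb (ev k) (DS a j f) z = -dzb (ev k) (dz (ev j) f) z +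
      (conj (dz (ev k) (a j) z) * f z + conj (a j z) * dzb (ev k) f z) := by
    have e : DS a j f = fun z => (-1 : ℂ) * dz (ev j) f z + conj (a j z) * f z := by
      funext z; rw [DS]; ring
    have hs : Sm fun z => (-1 : ℂ) * dz (ev j) f z := contDiff_const.mul (hf.dz _)
    rw [e, dzb_add hs (hac.mul hf), dzb_const_mul (hf.dz _), dzb_mul hac hf, dzb_conj]
    ring
  have h2 : dz (ev j) (DD a k f) z = dz (ev j) (dzb (ev k) f) z +
      (dz (ev j) (a k) z * f z + a k z * dz (ev j) f z) := by
    have e : DD a k f = fun z => dzb (ev k) f z + a k z * f z := rfl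
    rw [e, dz_add (hf.dzb _) ((ha k).mul hf), dz_mul (ha k) hf]
  rw [DD, h1, DS, DS, h2, DD, dz_dzb_comm hf]
  ring

theorem norm_sq_eq_mul_conj (x : ℂ) : ((‖x‖ ^ 2 : ℝ) : ℂ) = x * conj x := by
  rw [mul_conj, normSq_eq_norm_sq]

theorem Test.integrable_norm_sq (hf : Test f) :
    Integrable fun z => ‖f z‖ ^ 2 :=
  (memLp_two_iff_integrable_sq_norm hf.1.continuous.aestronglyMeasurable).1 hf.memLp

theorem neg_re_sum_le_half_sum_norm_sq (X : Fin n → Fin n → ℂ) :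
    -(∑ j, ∑ k, X k j * conj (X j k)).re ≤
      (1 / 2) * ∑ j, ∑ k, ‖X k j - X j k‖ ^ 2 := by
  rw [Complex.re_sum, mul_sum, ← Finset.sum_neg_distrib]
  refine sum_le_sum fun j _ => ?_
  rw [Complex.re_sum, mul_sum, ← Finset.sum_neg_distrib]
  refine sum_le_sum fun k _ => ?_
  have : ‖X k j - X j k‖ ^ 2 =
      ‖X k j‖ ^ 2 + ‖X j k‖ ^ 2 - 2 * (X k j * conj (X j k)).re := by
    rw [← normSq_eq_norm_sq, ← normSq_eq_norm_sq, ← normSq_eq_norm_sq,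
      Complex.normSq_sub]
  rw [this]
  nlinarith [sq_nonneg ‖X k j‖, sq_nonneg ‖X j k‖]

/-- The Kohn–Morrey inequality for test forms. -/
theorem kohn_morrey (ha : ∀ j, Sm (a j)) {β : Fin n → Cn n → ℂ} (hβ : ∀ j, Test (β j)) :
    ∫ z, (∑ j, ∑ k, (conj (dz (ev k) (a j) z) + dz (ev j) (a k) z) * β j z *
        conj (β k z)).re ≤
      (∫ z, ‖∑ j, DS a j (β j) z‖ ^ 2) +
        ∫ z, (1 / 2) * ∑ j, ∑ k, ‖DD a k (β j) z - DD a j (β k) z‖ ^ 2 := by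
  set M : Fin n → Fin n → Cn n → ℂ := fun j k z =>
    conj (dz (ev k) (a j) z) + dz (ev j) (a k) z with hM
  have hMs : ∀ j k, Sm (M j k) := fun j k => ((ha j).dz _).conj.add ((ha k).dz _)
  have hterm : ∀ j k, ∫ z, M j k z * β j z * conj (β k z) =
      (∫ z, DS a j (β j) z * conj (DS a k (β k) z)) -
        ∫ z, DD a k (β j) z * conj (DD a j (β k) z) := by
    intro j k
    have h1 := integral_DD_mul_conj ha ((hβ j).DS ha j).1 (hβ k) k
    have h2 := integral_DD_mul_conj ha ((hβ k).1) ((hβ j).DD ha k) j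
    have h2' : ∫ z, DS a j (DD a k (β j)) z * conj (β k z) =
        ∫ z, DD a k (β j) z * conj (DD a j (β k) z) := by
      have := congrArg (conj) h2
      rw [← integral_conj, ← integral_conj] at this
      simp only [map_mul, conj_conj] at this
      simp only [mul_comm] at this ⊢
      exact this.symm
    rw [← h1, ← h2', ← integral_sub]
    · congr 1; funext z
      rw [DD_DS ha (hβ j).1]; ring
    · exact (((hβ j).DS ha j).DD ha k).mul' (hβ k).conj.1 |>.integrable
    · exact (((hβ j).DD ha k).DS ha j).mul' (hβ k).conj.1 |>.integrable
  have i1 : ∀ j k, Integrable fun z => M j k z * β j z * conj (β k z) := fun j k =>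
    (Test.mul ((hMs j k).mul (hβ j).1) (hβ k).conj).integrable
  have i2 : ∀ j k, Integrable fun z => DS a j (β j) z * conj (DS a k (β k) z) :=
    fun j k => (((hβ j).DS ha j).mul' ((hβ k).DS ha k).conj.1).integrable
  have i3 : ∀ j k, Integrable fun z => DD a k (β j) z * conj (DD a j (β k) z) :=
    fun j k => (((hβ j).DD ha k).mul' ((hβ k).DD ha j).conj.1).integrable
  have hsum : ∫ z, ∑ j, ∑ k, M j k z * β j z * conj (β k z) =
      (∫ z, ((‖∑ j, DS a j (β j) z‖ ^ 2 : ℝ) : ℂ)) -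
        ∫ z, ∑ j, ∑ k, DD a k (β j) z * conj (DD a j (β k) z) := by
    have e : ∀ z, ((‖∑ j, DS a j (β j) z‖ ^ 2 : ℝ) : ℂ) =
        ∑ j, ∑ k, DS a j (β j) z * conj (DS a k (β k) z) := fun z => by
      rw [norm_sq_eq_mul_conj, map_sum, Finset.sum_mul_sum]
    simp_rw [e]
    rw [integral_finsetSum _ fun j _ => integrable_finsetSum _ fun k _ => i1 j k,
      integral_finsetSum _ fun j _ => integrable_finsetSum _ fun k _ => i2 j k,
      integral_finsetSum _ fun j _ => integrable_finsetSum _ fun k _ => i3 j k,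
      ← sum_sub_distrib]
    refine sum_congr rfl fun j _ => ?_
    rw [integral_finsetSum _ fun k _ => i1 j k, integral_finsetSum _ fun k _ => i2 j k,
      integral_finsetSum _ fun k _ => i3 j k, ← sum_sub_distrib]
    exact sum_congr rfl fun k _ => hterm j k
  have hI1 : Integrable fun z => ∑ j, ∑ k, M j k z * β j z * conj (β k z) :=
    integrable_finsetSum _ fun j _ => integrable_finsetSum _ fun k _ => i1 j k
  have hI3 : Integrable fun z => ∑ j, ∑ k, DD a k (β j) z * conj (DD a j (β k) z) :=
    integrable_finsetSum _ fun j _ => integrable_finsetSum _ fun k _ => i3 j k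
  have hre : ∫ z, (∑ j, ∑ k, M j k z * β j z * conj (β k z)).re =
      (∫ z, ‖∑ j, DS a j (β j) z‖ ^ 2) +
        ∫ z, -(∑ j, ∑ k, DD a k (β j) z * conj (DD a j (β k) z)).re := by
    have h1 := congrArg Complex.re hsum
    rw [sub_re, integral_complex_ofReal, ofReal_re] at h1
    have h2 := integral_re hI1
    have h3 := integral_re hI3
    simp only [RCLike.re_to_complex] at h2 h3
    rw [integral_neg, h2, h3, h1]
    ring
  have hI4 : Integrable fun z =>
      -(∑ j, ∑ k, DD a k (β j) z * conj (DD a j (β k) z)).re :=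
    (reCLM.integrable_comp hI3).neg
  rw [hre]
  refine add_le_add le_rfl (integral_mono hI4 ?_ fun z => ?_)
  · exact (integrable_finsetSum _ fun j _ => integrable_finsetSum _ fun k _ =>
      (((hβ j).DD ha k).sub ((hβ k).DD ha j)).integrable_norm_sq).const_mul _
  · exact neg_re_sum_le_half_sum_norm_sq fun k j => DD a k (β j) z

/-- A smooth nonnegative kernel of mass one, supported in the polydisc of radius `ε` and invariant
under scalar rotations. -/
structure Ker (ε : ℝ) (k : Cn n → ℝ) : Prop where
  smooth : ContDiff ℝ ∞ k
  nonneg : ∀ y, 0 ≤ k y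
  supp : ∀ y, k y ≠ 0 → ‖y‖ ≤ ε
  inv : ∀ c : ℂ, ‖c‖ = 1 → ∀ y, k (c • y) = k y
  int_one : ∫ y, k y = 1

theorem Ker.even (hk : Ker ε k) (y : Cn n) : k (-y) = k y := by
  have := hk.inv (-1) (by simp) y
  simpa using this

theorem Ker.hasCompactSupport (hk : Ker ε k) : HasCompactSupport k := by
  refine HasCompactSupport.of_support_subset_isCompact (isCompact_closedBall (0 : Cn n) ε) ?_
  intro y hy
  simpa using hk.supp y hy

theorem Ker.integrable (hk : Ker ε k) : Integrable k :=
  hk.smooth.continuous.integrable_of_hasCompactSupport hk.hasCompactSupport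

theorem Ker.test (hk : Ker ε k) : Test fun y => (k y : ℂ) :=
  ⟨ofRealCLM.contDiff.comp hk.smooth, hk.hasCompactSupport.comp_left ofReal_zero⟩

theorem exists_ker (hε : 0 < ε) : ∃ k : Cn n → ℝ, Ker ε k := by
  set q : Cn n → ℝ := fun y => smoothTransition (1 - (∑ j, ‖y j‖ ^ 2) / ε ^ 2) with hq
  have hs : ContDiff ℝ ∞ q := by
    refine smoothTransition.contDiff.comp (contDiff_const.sub (ContDiff.div_const ?_ _))
    exact ContDiff.sum fun j _ => (contDiff_norm_sq ℝ).comp (contDiff_apply ℝ ℂ j)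
  have h0 : ∀ y, 0 ≤ q y := fun y => smoothTransition.nonneg _
  have hsupp : ∀ y, q y ≠ 0 → ‖y‖ ≤ ε := by
    intro y hy
    have h1 : 0 < 1 - (∑ j, ‖y j‖ ^ 2) / ε ^ 2 := by
      by_contra h
      exact hy (smoothTransition.zero_of_nonpos (not_lt.1 h))
    have h2 : ∑ j, ‖y j‖ ^ 2 < ε ^ 2 := by
      rwa [sub_pos, div_lt_one (by positivity)] at h1
    refine (pi_norm_le_iff_of_nonneg hε.le).2 fun i => ?_
    have h3 : ‖y i‖ ^ 2 ≤ ∑ j, ‖y j‖ ^ 2 :=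
      single_le_sum (f := fun j => ‖y j‖ ^ 2) (fun j _ => by positivity) (Finset.mem_univ i)
    exact (abs_le_of_sq_le_sq' (h3.trans h2.le) hε.le).2
  have hcs : HasCompactSupport q := by
    refine HasCompactSupport.of_support_subset_isCompact (isCompact_closedBall (0 : Cn n) ε) ?_
    intro y hy
    simpa using hsupp y hy
  have hi : Integrable q := hs.continuous.integrable_of_hasCompactSupport hcs
  have hpos : 0 < ∫ y, q y := by
    refine hs.continuous.integral_pos_of_hasCompactSupport_nonneg_nonzero hcs h0 (x := 0) ?_
    simp [hq]
  refine ⟨fun y => (∫ y, q y)⁻¹ * q y, contDiff_const.mul hs,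
    fun y => mul_nonneg (inv_nonneg.2 hpos.le) (h0 y), fun y hy => hsupp y (right_ne_zero_of_mul hy),
    fun c hc y => ?_, ?_⟩
  · simp [hq, hc]
  · rw [integral_const_mul, inv_mul_cancel₀ hpos.ne']

/-- Convolution of `f` with a complex kernel `κ`. -/
def cv (f κ : Cn n → ℂ) (x : Cn n) : ℂ := ∫ t, f t * κ (x - t)

theorem cv_eq_convolution (f κ : Cn n → ℂ) :
    cv f κ = convolution f κ (ContinuousLinearMap.mul ℝ ℂ) volume := rfl

theorem cv_integrable {f κ : Cn n → ℂ} (hf : LocallyIntegrable f) (hκ : Test κ) (x : Cn n) :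
    Integrable fun t => f t * κ (x - t) :=
  hκ.2.convolutionExists_right (ContinuousLinearMap.mul ℝ ℂ) hf hκ.1.continuous x

theorem Sm.cv {f κ : Cn n → ℂ} (hf : LocallyIntegrable f) (hκ : Test κ) : Sm (cv f κ) :=
  hκ.2.contDiff_convolution_right (ContinuousLinearMap.mul ℝ ℂ) hf hκ.1

theorem Test.Dr (hf : Test f) (w : Cn n) : Test (Dr w f) :=
  ⟨hf.1.Dr w, hf.2.Dr w⟩

theorem Dr_cv {f κ : Cn n → ℂ} (hf : LocallyIntegrable f) (hκ : Test κ) (w x : Cn n) :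
    Dr w (cv f κ) x = cv f (Dr w κ) x := by
  have h := hκ.2.hasFDerivAt_convolution_right (ContinuousLinearMap.mul ℝ ℂ) hf
    (hκ.1.of_le (by exact_mod_cast le_top)) x
  rw [Dr, cv_eq_convolution, h.fderiv, convolution, ContinuousLinearMap.integral_apply]
  · rfl
  · exact (hκ.2.fderiv (𝕜 := ℝ)).convolutionExists_right _ hf
      (hκ.1.continuous_fderiv (by simp)) x

theorem dz_cv {f κ : Cn n → ℂ} (hf : LocallyIntegrable f) (hκ : Test κ) (w x : Cn n) :
    dz w (cv f κ) x = cv f (dz w κ) x := by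
  have h1 := cv_integrable hf (hκ.Dr w) x
  have h2 := cv_integrable hf (hκ.Dr (I • w)) x
  rw [dz, Dr_cv hf hκ, Dr_cv hf hκ, cv, cv, cv, ← integral_const_mul, ← integral_sub h1 (h2.const_mul _),
    ← integral_const_mul]
  congr 1; funext t; rw [dz]; ring

theorem dzb_cv {f κ : Cn n → ℂ} (hf : LocallyIntegrable f) (hκ : Test κ) (w x : Cn n) :
    dzb w (cv f κ) x = cv f (dzb w κ) x := by
  have h1 := cv_integrable hf (hκ.Dr w) x
  have h2 := cv_integrable hf (hκ.Dr (I • w)) x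
  rw [dzb, Dr_cv hf hκ, Dr_cv hf hκ, cv, cv, cv, ← integral_const_mul, ← integral_add h1 (h2.const_mul _),
    ← integral_const_mul]
  congr 1; funext t; rw [dzb]; ring

/-- The reflected translate `t ↦ κ (x - t)`. -/
theorem Test.refl {κ : Cn n → ℂ} (hκ : Test κ) (x : Cn n) : Test fun t => κ (x - t) :=
  ⟨hκ.1.comp (contDiff_const.sub contDiff_id), hκ.2.comp_homeomorph (Homeomorph.subLeft x)⟩

theorem Dr_refl {κ : Cn n → ℂ} (hκ : Sm κ) (w x t : Cn n) :
    Dr w (fun t => κ (x - t)) t = -Dr w κ (x - t) := by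
  have h1 : HasFDerivAt (fun t : Cn n => x - t) (-ContinuousLinearMap.id ℝ (Cn n)) t :=
    (hasFDerivAt_id t).const_sub x
  have h2 := ((hκ.differentiableAt (x - t)).hasFDerivAt.comp t h1).fderiv
  rw [Dr, show (fun t => κ (x - t)) = κ ∘ fun t => x - t from rfl, h2]
  simp [Dr]

theorem dz_refl {κ : Cn n → ℂ} (hκ : Sm κ) (w x t : Cn n) :
    dz w (fun t => κ (x - t)) t = -dz w κ (x - t) := by
  rw [dz, Dr_refl hκ, Dr_refl hκ, dz]; ring

theorem dzb_refl {κ : Cn n → ℂ} (hκ : Sm κ) (w x t : Cn n) :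
    dzb w (fun t => κ (x - t)) t = -dzb w κ (x - t) := by
  rw [dzb, Dr_refl hκ, Dr_refl hκ, dzb]; ring

theorem Test.cv {f κ : Cn n → ℂ} (hf : Test f) (hκ : Test κ) : Test (cv f κ) :=
  ⟨Sm.cv hf.integrable.locallyIntegrable hκ,
    hf.2.convolution (ContinuousLinearMap.mul ℝ ℂ) hκ.2⟩

theorem LocallyIntegrable.norm' (hf : LocallyIntegrable f) :
    LocallyIntegrable fun x => ‖f x‖ := fun x => (hf x).norm

theorem cv_assoc {f g k : Cn n → ℂ} (hf : LocallyIntegrable f) (hg : Test g) (hk : Test k)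
    (x : Cn n) :
    cv (cv f g) k x = cv f (cv g k) x := by
  have hgn : HasCompactSupport fun x => ‖g x‖ := hg.2.norm
  have hkn : HasCompactSupport fun x => ‖k x‖ := hk.2.norm
  have hgi : LocallyIntegrable fun x => ‖g x‖ := hg.integrable.norm.locallyIntegrable
  refine convolution_assoc (ContinuousLinearMap.mul ℝ ℂ) (ContinuousLinearMap.mul ℝ ℂ)
    (ContinuousLinearMap.mul ℝ ℂ) (ContinuousLinearMap.mul ℝ ℂ) (fun x y z => mul_assoc x y z)
    hf.aestronglyMeasurable hg.1.continuous.aestronglyMeasurable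
    hk.1.continuous.aestronglyMeasurable (.of_forall fun y => cv_integrable hf hg y)
    (.of_forall fun y => ?_) ?_
  · exact hkn.convolutionExists_right _ hgi hk.1.continuous.norm y
  · exact (hgn.convolution (ContinuousLinearMap.mul ℝ ℝ) hkn).convolutionExists_right _
      (LocallyIntegrable.norm' hf) (hkn.continuous_convolution_right _ hgi hk.1.continuous.norm) x

theorem cv_comm (f g : Cn n → ℂ) (x : Cn n) : cv f g x = cv g f x := by
  unfold cv
  rw [← integral_sub_left_eq_self _ _ x]
  congr 1; funext t; rw [sub_sub_cancel, mul_comm]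

/-- The average of `‖g‖` against the kernel `k`. -/
def ymr (k : Cn n → ℝ) (g : Cn n → ℂ) (x : Cn n) : ℝ := ∫ t, ‖g t‖ * k (x - t)

theorem Ker.integrable_mul (hk : Ker ε k) {g : Cn n → ℝ} (hg : LocallyIntegrable g) (x : Cn n) :
    Integrable fun t => g t * k (x - t) :=
  hk.hasCompactSupport.convolutionExists_right (ContinuousLinearMap.mul ℝ ℝ) hg
    hk.smooth.continuous x

theorem Ker.integral_sub (hk : Ker ε k) (x : Cn n) :
    ∫ t, k (x - t) = 1 := by
  rw [integral_sub_left_eq_self, hk.int_one]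

theorem ymr_nonneg (hk : Ker ε k) (g : Cn n → ℂ) (x : Cn n) :
    0 ≤ ymr k g x := integral_nonneg fun _ => mul_nonneg (norm_nonneg _) (hk.nonneg _)

theorem norm_kernel_integral_le {ε τ : ℝ} (hk : Ker ε k) (hg : LocallyIntegrable g) {b : Cn n → ℂ}
    {x : Cn n} (hb : ∀ t, ‖x - t‖ ≤ ε → ‖b t‖ ≤ τ) :
    ‖∫ t, b t * (g t * (k (x - t) : ℂ))‖ ≤ τ * ymr k g x := by
  rw [ymr, ← integral_const_mul]
  refine norm_integral_le_of_norm_le ((hk.integrable_mul (LocallyIntegrable.norm' hg) x).const_mul τ)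
    (.of_forall fun t => ?_)
  rw [norm_mul, norm_mul, norm_real, norm_of_nonneg (hk.nonneg _)]
  by_cases h : k (x - t) = 0
  · simp [h]
  · exact mul_le_mul_of_nonneg_right (hb t (hk.supp _ h))
      (mul_nonneg (norm_nonneg _) (hk.nonneg _))

theorem norm_cv_le (hk : Ker ε k) (hg : LocallyIntegrable g) (x : Cn n) :
    ‖cv g (fun y => (k y : ℂ)) x‖ ≤ ymr k g x := by
  have := norm_kernel_integral_le (b := fun _ => 1) (τ := 1) hk hg (x := x) (by simp)
  simpa [cv] using this

theorem MemLp.locallyIntegrable_two (hg : MemLp g 2) : LocallyIntegrable g :=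
  hg.locallyIntegrable (by norm_num)

theorem MemLp.integrable_norm_sq' (hg : MemLp g 2) :
    Integrable fun z => ‖g z‖ ^ 2 :=
  (memLp_two_iff_integrable_sq_norm hg.1).1 hg

theorem ymr_sq_le (hk : Ker ε k) (hg : MemLp g 2) (x : Cn n) :
    ymr k g x ^ 2 ≤ ∫ t, ‖g t‖ ^ 2 * k (x - t) := by
  have h1 := hk.integrable_mul (LocallyIntegrable.norm' (MemLp.locallyIntegrable_two hg)) x
  have h2 := hk.integrable_mul (MemLp.integrable_norm_sq' hg).locallyIntegrable x
  have h3 : Integrable fun t => k (x - t) := hk.integrable.comp_sub_left x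
  set m := ymr k g x with hm
  have h4 : 0 ≤ ∫ t, (‖g t‖ - m) ^ 2 * k (x - t) :=
    integral_nonneg fun t => mul_nonneg (sq_nonneg _) (hk.nonneg _)
  have e : ∀ t, (‖g t‖ - m) ^ 2 * k (x - t) =
      ‖g t‖ ^ 2 * k (x - t) - 2 * m * (‖g t‖ * k (x - t)) + m ^ 2 * k (x - t) := fun t => by ring
  simp_rw [e] at h4
  have h5 : Integrable fun t => ‖g t‖ ^ 2 * k (x - t) - 2 * m * (‖g t‖ * k (x - t)) :=
    h2.sub (h1.const_mul _)
  rw [integral_add h5 (h3.const_mul _), integral_sub h2 (h1.const_mul _),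
    integral_const_mul, integral_const_mul, hk.integral_sub] at h4
  have : ∫ t, ‖g t‖ * k (x - t) = m := rfl
  rw [this] at h4
  nlinarith

theorem continuous_ymr (hk : Ker ε k) (hg : LocallyIntegrable g) : Continuous (ymr k g) :=
  hk.hasCompactSupport.continuous_convolution_right (ContinuousLinearMap.mul ℝ ℝ)
    (LocallyIntegrable.norm' hg) hk.smooth.continuous

/-- Young's inequality. -/
theorem integral_ymr_sq_le (hk : Ker ε k) (hg : MemLp g 2) :
    Integrable (fun x => ymr k g x ^ 2) ∧ ∫ x, ymr k g x ^ 2 ≤ ∫ x, ‖g x‖ ^ 2 := by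
  have hi := MemLp.integrable_norm_sq' hg
  have h1 : Integrable fun x => ∫ t, ‖g t‖ ^ 2 * k (x - t) :=
    hi.integrable_convolution (ContinuousLinearMap.mul ℝ ℝ) hk.integrable
  have h2 : ∫ x, ∫ t, ‖g t‖ ^ 2 * k (x - t) = ∫ x, ‖g x‖ ^ 2 := by
    have := integral_convolution (ContinuousLinearMap.mul ℝ ℝ) hi hk.integrable
    simp only [ContinuousLinearMap.mul_apply', hk.int_one, mul_one, convolution] at this
    exact this
  have h3 : Integrable fun x => ymr k g x ^ 2 := by
    refine h1.mono' ((continuous_ymr hk (MemLp.locallyIntegrable_two hg)).pow 2).aestronglyMeasurable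
      (.of_forall fun x => ?_)
    rw [norm_of_nonneg (sq_nonneg _)]
    exact ymr_sq_le hk hg x
  exact ⟨h3, h2 ▸ integral_mono h3 h1 fun x => ymr_sq_le hk hg x⟩

/-- Small scalar cutoffs: smooth, equal to one on a given ball, with small first derivatives. -/
theorem exists_cutoff (hδ : 0 < δ) (R : ℝ) : ∃ θ : Cn n → ℂ, Test θ ∧ (∀ z, ‖θ z‖ ≤ 1) ∧
    (∀ z, ‖z‖ ≤ R → θ z = 1) ∧ (∀ j z, ‖dz (ev j) θ z‖ ≤ δ) ∧ ∀ j z, ‖dzb (ev j) θ z‖ ≤ δ := by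
  let B : ContDiffBump (0 : Cn n) := ⟨1, 2, one_pos, one_lt_two⟩
  set τ : Cn n → ℂ := fun z => (B z : ℂ) with hτ
  have hτt : Test τ := ⟨ofRealCLM.contDiff.comp B.contDiff,
    B.hasCompactSupport.comp_left ofReal_zero⟩
  have hbd : ∀ f : Cn n → ℂ, Test f → ∃ C, ∀ z, ‖f z‖ ≤ C := fun f hf => by
    obtain ⟨C, hC⟩ := hf.2.exists_bound_of_continuous hf.1.continuous
    exact ⟨C, hC⟩
  choose C1 hC1 using fun j : Fin n => hbd _ (hτt.dz (ev j))
  choose C2 hC2 using fun j : Fin n => hbd _ (hτt.dzb (ev j))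
  have hC1' : ∀ j, 0 ≤ C1 j := fun j => (norm_nonneg _).trans (hC1 j 0)
  have hC2' : ∀ j, 0 ≤ C2 j := fun j => (norm_nonneg _).trans (hC2 j 0)
  set C := ∑ j, (C1 j + C2 j) with hC
  have hCn : 0 ≤ C := sum_nonneg fun j _ => add_nonneg (hC1' j) (hC2' j)
  have hCj : ∀ j, C1 j + C2 j ≤ C := fun j =>
    single_le_sum (f := fun j => C1 j + C2 j)
      (fun j _ => add_nonneg (hC1' j) (hC2' j)) (Finset.mem_univ j)
  set s : ℝ := max (max R 1) (C / δ) with hs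
  have hs1 : 1 ≤ s := (le_max_right _ _).trans (le_max_left _ _)
  have hs0 : 0 < s := one_pos.trans_le hs1
  have hsC : s⁻¹ * C ≤ δ := by
    have : C / δ ≤ s := le_max_right _ _
    rw [inv_mul_le_iff₀ hs0]
    rwa [div_le_iff₀ hδ] at this
  have hDr : ∀ w z, Dr w (fun z => τ (s⁻¹ • z)) z = (s⁻¹ : ℝ) * Dr w τ (s⁻¹ • z) := by
    intro w z
    have h1 : HasFDerivAt (fun z : Cn n => s⁻¹ • z) (s⁻¹ • ContinuousLinearMap.id ℝ (Cn n)) z :=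
      (hasFDerivAt_id z).const_smul s⁻¹
    have h2 := ((hτt.1.differentiableAt (s⁻¹ • z)).hasFDerivAt.comp z h1).fderiv
    rw [Dr, show (fun z => τ (s⁻¹ • z)) = τ ∘ fun z => s⁻¹ • z from rfl, h2]
    simp [Dr]
  have hdz : ∀ w z, dz w (fun z => τ (s⁻¹ • z)) z = (s⁻¹ : ℝ) * dz w τ (s⁻¹ • z) := by
    intro w z; rw [dz, hDr, hDr, dz]; ring
  have hdzb : ∀ w z, dzb w (fun z => τ (s⁻¹ • z)) z = (s⁻¹ : ℝ) * dzb w τ (s⁻¹ • z) := by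
    intro w z; rw [dzb, hDr, hDr, dzb]; ring
  have hsn : ‖((s⁻¹ : ℝ) : ℂ)‖ = s⁻¹ := by
    rw [norm_real, norm_of_nonneg (inv_nonneg.2 hs0.le)]
  refine ⟨fun z => τ (s⁻¹ • z), ⟨hτt.1.comp (contDiff_const_smul _), ?_⟩, fun z => ?_, fun z hz => ?_,
    fun j z => ?_, fun j z => ?_⟩
  · exact hτt.2.comp_homeomorph (Homeomorph.smulOfNeZero (s⁻¹) (inv_ne_zero hs0.ne'))
  · rw [hτ, norm_real, norm_of_nonneg B.nonneg]; exact B.le_one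
  · have : B (s⁻¹ • z) = 1 := by
      refine B.one_of_mem_closedBall ?_
      rw [mem_closedBall_zero_iff, norm_smul, norm_of_nonneg (inv_nonneg.2 hs0.le),
        inv_mul_le_iff₀ hs0]
      change ‖z‖ ≤ s * 1
      rw [mul_one]
      exact hz.trans ((le_max_left _ _).trans (le_max_left _ _))
    simp [hτ, this]
  · rw [hdz, norm_mul, hsn]
    refine le_trans (mul_le_mul_of_nonneg_left ?_ (inv_nonneg.2 hs0.le)) hsC
    linarith [hC1 j (s⁻¹ • z), hC2' j, hCj j]
  · rw [hdzb, norm_mul, hsn]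
    refine le_trans (mul_le_mul_of_nonneg_left ?_ (inv_nonneg.2 hs0.le)) hsC
    linarith [hC2 j (s⁻¹ • z), hC1' j, hCj j]

theorem cv_ker_sub_le {ε τ : ℝ} (hk : Ker ε k) {α : Cn n → ℂ} (hα : Test α) {x : Cn n}
    (h : ∀ t, ‖x - t‖ ≤ ε → ‖α t - α x‖ ≤ τ) :
    ‖cv α (fun y => (k y : ℂ)) x - α x‖ ≤ τ := by
  have h1 := cv_integrable hα.integrable.locallyIntegrable hk.test x
  have h2 : Integrable fun t => (k (x - t) : ℂ) := (hk.integrable.comp_sub_left x).ofReal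
  have h3 : α x = ∫ t, α x * (k (x - t) : ℂ) := by
    rw [integral_const_mul, integral_complex_ofReal, hk.integral_sub]; simp
  have h4 : cv α (fun y => (k y : ℂ)) x - α x = ∫ t, (α t - α x) * (1 * (k (x - t) : ℂ)) := by
    conv_lhs => rw [h3]
    rw [cv, ← integral_sub h1 (h2.const_mul _)]
    congr 1; funext t; ring
  have h5 := norm_kernel_integral_le (g := fun _ => 1) (b := fun t => α t - α x) hk
    (continuous_const.locallyIntegrable) h
  rw [h4]
  refine h5.trans (le_of_eq ?_)
  simp [ymr, hk.integral_sub]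

/-- Mollification converges weakly. -/
theorem exists_weak_approx {γ α : Cn n → ℂ} (hγ : LocallyIntegrable γ) (hα : Test α) (hδ : 0 < δ) :
    ∃ ε₀ > 0, ∀ ε, 0 < ε → ε ≤ ε₀ → ∀ k : Cn n → ℝ, Ker ε k →
      ‖(∫ x, cv γ (fun y => (k y : ℂ)) x * α x) - ∫ x, γ x * α x‖ ≤ δ := by
  obtain ⟨R, hR⟩ := hα.2.isCompact.isBounded.subset_closedBall (0 : Cn n)
  have hInt : IntegrableOn (fun x => ‖γ x‖) (closedBall 0 (R + 1)) :=
    (hγ.integrableOn_isCompact (isCompact_closedBall _ _)).norm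
  set I := ∫ x in closedBall (0 : Cn n) (R + 1), ‖γ x‖ with hI
  have hI0 : 0 ≤ I := integral_nonneg fun _ => norm_nonneg _
  have huc : UniformContinuous α := hα.2.uniformContinuous_of_continuous hα.1.continuous
  obtain ⟨ε₁, hε₁, h1⟩ := Metric.uniformContinuous_iff.1 huc (δ / (I + 1)) (by positivity)
  refine ⟨min (ε₁ / 2) 1, by positivity, fun ε hε hε' k hk => ?_⟩
  have hκ := hk.test
  set κ : Cn n → ℂ := fun y => (k y : ℂ) with hκd
  have hkey : ∫ x, cv γ κ x * α x = ∫ x, γ x * cv α κ x := by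
    have h2 := cv_assoc hγ hκ (hα.refl 0) 0
    have e1 : cv (cv γ κ) (fun t => α (0 - t)) 0 = ∫ x, cv γ κ x * α x := by
      rw [cv]; simp
    rw [e1] at h2
    rw [h2, cv]
    congr 1; funext t
    congr 1
    rw [cv_comm]
    rw [cv, cv, ← integral_neg_eq_self]
    congr 1; funext s
    simp only [sub_neg_eq_add, zero_add, zero_sub]
    congr 1
    have := hk.even (t - s)
    rw [hκd]
    simp only
    rw [← this]; congr 2; abel
  have hd : ∀ x, ‖cv α κ x - α x‖ ≤ δ / (I + 1) := fun x => by
    refine cv_ker_sub_le hk hα fun t ht => ?_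
    rw [← dist_eq_norm]
    refine (h1 ?_).le
    rw [dist_comm, dist_eq_norm]
    refine ht.trans_lt (hε'.trans_lt ?_)
    exact (min_le_left _ _).trans_lt (by linarith)
  have hzero : ∀ x, x ∉ closedBall (0 : Cn n) (R + 1) → cv α κ x - α x = 0 := by
    intro x hx
    rw [mem_closedBall_zero_iff, not_le] at hx
    have hα0 : ∀ y, R < ‖y‖ → α y = 0 := fun y hy => by
      by_contra h
      have := hR (subset_tsupport _ h)
      rw [mem_closedBall_zero_iff] at this
      linarith
    rw [hα0 x (by linarith), sub_zero, cv]
    refine integral_eq_zero_of_ae (.of_forall fun t => ?_)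
    by_cases h : k (x - t) = 0
    · simp [hκd, h]
    · have h3 := hk.supp _ h
      have h4 : ‖x‖ ≤ ‖x - t‖ + ‖t‖ := by simpa using norm_add_le (x - t) t
      have h5 : ε ≤ 1 := hε'.trans (min_le_right _ _)
      simp [hα0 t (by linarith)]
  have hi1 : Integrable fun x => γ x * cv α κ x := by
    have := cv_integrable hγ ((hα.cv hκ).refl 0) 0
    simpa using this
  have hi2 : Integrable fun x => γ x * α x := by
    have := cv_integrable hγ (hα.refl 0) 0
    simpa using this
  rw [hkey, ← integral_sub hi1 hi2]
  have hle : ‖∫ x, (γ x * cv α κ x - γ x * α x)‖ ≤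
      ∫ x, (closedBall (0 : Cn n) (R + 1)).indicator (fun x => δ / (I + 1) * ‖γ x‖) x := by
    refine norm_integral_le_of_norm_le
      ((integrable_indicator_iff measurableSet_closedBall).2 (hInt.const_mul _))
      (.of_forall fun x => ?_)
    rw [← mul_sub, norm_mul]
    by_cases hx : x ∈ closedBall (0 : Cn n) (R + 1)
    · rw [indicator_of_mem hx, mul_comm]
      exact mul_le_mul_of_nonneg_right (hd x) (norm_nonneg _)
    · rw [hzero x hx, indicator_of_notMem hx]; simp
  refine hle.trans ?_
  rw [integral_indicator measurableSet_closedBall, integral_const_mul, div_mul_eq_mul_div,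
    div_le_iff₀ (by linarith)]
  nlinarith

theorem DS_mul {θ G : Cn n → ℂ} (hθ : Sm θ) (hG : Sm G) (j : Fin n) (x : Cn n) :
    DS a j (fun z => θ z * G z) x = θ x * DS a j G x - dz (ev j) θ x * G x := by
  rw [DS, dz_mul hθ hG, DS]; ring

theorem DD_mul {θ G : Cn n → ℂ} (hθ : Sm θ) (hG : Sm G) (j : Fin n) (x : Cn n) :
    DD a j (fun z => θ z * G z) x = θ x * DD a j G x + dzb (ev j) θ x * G x := by
  rw [DD, dzb_mul hθ hG, DD]; ring

/-- Commutator of the twisted `∂̄`-system with mollification. -/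
theorem DD_cv_sub (ha : ∀ j, Sm (a j)) {γ : Fin n → Cn n → ℂ} (hγ : ∀ j, LocallyIntegrable (γ j))
    (hS : ∀ j k η, Test η → ∫ z, γ j z * conj (DS a k η z) = ∫ z, γ k z * conj (DS a j η z))
    (hk : Ker ε k) (i j : Fin n) (x : Cn n) :
    DD a i (cv (γ j) fun y => (k y : ℂ)) x - DD a j (cv (γ i) fun y => (k y : ℂ)) x =
      (∫ t, (a i x - a i t) * (γ j t * (k (x - t) : ℂ))) -
        ∫ t, (a j x - a j t) * (γ i t * (k (x - t) : ℂ)) := by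
  have hκ := hk.test
  set κ : Cn n → ℂ := fun y => (k y : ℂ) with hκd
  have key : ∀ i j : Fin n, DD a i (cv (γ j) κ) x -
      ∫ t, (a i x - a i t) * (γ j t * (k (x - t) : ℂ)) =
      ∫ t, γ j t * conj (DS a i (fun t => κ (x - t)) t) := by
    intro i j
    have i1 := cv_integrable (hγ j) (hκ.dzb (ev i)) x
    have i2 := (cv_integrable (hγ j) hκ x).const_mul (a i x)
    have i3 : Integrable fun t => (a i x - a i t) * (γ j t * (k (x - t) : ℂ)) := by
      have : Test fun t => (a i x - a i (x - t)) * κ t :=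
        Test.mul (contDiff_const.sub ((ha i).comp (contDiff_const.sub contDiff_id))) hκ
      refine (cv_integrable (hγ j) this x).congr (.of_forall fun t => ?_)
      simp only [sub_sub_cancel, hκd]; ring
    rw [DD, dzb_cv (hγ j) hκ, cv, cv, ← integral_const_mul]
    have := integral_sub (i1.add i2) i3
    rw [integral_add' i1 i2] at this
    refine this.symm.trans ?_
    congr 1; funext t
    have hreal : conj (dz (ev i) (fun t => κ (x - t)) t) =
        dzb (ev i) (fun t => κ (x - t)) t := by
      rw [← dzb_conj]
      congr 1; funext t; simp [hκd]
    rw [DS]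
    simp only [map_add, map_neg, map_mul, conj_conj, hreal, dzb_refl hκ.1, Pi.add_apply]
    simp only [hκd, Complex.conj_ofReal]
    ring
  have h1 := key i j
  have h2 := key j i
  rw [hS j i _ (hκ.refl x), ← h2] at h1
  linear_combination h1

theorem sum_DS_cv (ha : ∀ j, Sm (a j)) {γ : Fin n → Cn n → ℂ} (hγ : ∀ j, LocallyIntegrable (γ j))
    {w : Cn n → ℂ} (hT : ∀ η, Test η → ∑ j, ∫ z, γ j z * conj (DD a j η z) = ∫ z, w z * conj (η z))
    (hk : Ker ε k) (x : Cn n) :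
    ∑ j, DS a j (cv (γ j) fun y => (k y : ℂ)) x = cv w (fun y => (k y : ℂ)) x +
      ∑ j, ∫ t, (conj (a j x) - conj (a j t)) * (γ j t * (k (x - t) : ℂ)) := by
  have hκ := hk.test
  set κ : Cn n → ℂ := fun y => (k y : ℂ) with hκd
  have key : ∀ j : Fin n, DS a j (cv (γ j) κ) x =
      (∫ t, (conj (a j x) - conj (a j t)) * (γ j t * (k (x - t) : ℂ))) +
      ∫ t, γ j t * conj (DD a j (fun t => κ (x - t)) t) := by
    intro j
    have i1 := (cv_integrable (hγ j) (hκ.dz (ev j)) x).neg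
    have i2 := (cv_integrable (hγ j) hκ x).const_mul (conj (a j x))
    have i3 : Integrable fun t => (conj (a j x) - conj (a j t)) *
        (γ j t * (k (x - t) : ℂ)) := by
      have : Test fun t => (conj (a j x) - conj (a j (x - t))) * κ t :=
        Test.mul (contDiff_const.sub ((ha j).conj.comp (contDiff_const.sub contDiff_id))) hκ
      refine (cv_integrable (hγ j) this x).congr (.of_forall fun t => ?_)
      simp only [sub_sub_cancel, hκd]; ring
    rw [← sub_eq_iff_eq_add', DS, dz_cv (hγ j) hκ, cv, cv, ← integral_const_mul, ← integral_neg]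
    have := integral_sub (i1.add i2) i3
    rw [integral_add' i1 i2] at this
    refine this.symm.trans ?_
    congr 1; funext t
    have hreal : conj (dzb (ev j) (fun t => κ (x - t)) t) =
        dz (ev j) (fun t => κ (x - t)) t := by
      rw [← dz_conj]
      congr 1; funext t; simp [hκd]
    rw [DD]
    simp only [map_add, map_mul, hreal, dz_refl hκ.1, Pi.add_apply, Pi.neg_apply]
    simp only [hκd, Complex.conj_ofReal]
    ring
  rw [sum_congr rfl fun j _ => key j, sum_add_distrib, hT _ (hκ.refl x), add_comm]
  congr 1
  rw [cv]
  simp [hκd]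

theorem exists_uniform_modulus (ha : ∀ j, Continuous (a j)) {S : Set (Cn n)} (hS : IsCompact S)
    (hδ : 0 < δ) :
    ∃ ε₀ > 0, ∀ x ∈ S, ∀ t, ‖x - t‖ ≤ ε₀ → ∀ j, ‖a j x - a j t‖ ≤ δ := by
  obtain ⟨R, hR⟩ := hS.isBounded.subset_closedBall (0 : Cn n)
  have h : ∀ j, ∃ ε > 0, ∀ x ∈ S, ∀ t, ‖x - t‖ ≤ ε → ‖a j x - a j t‖ ≤ δ := by
    intro j
    have huc := (isCompact_closedBall (0 : Cn n) (R + 1)).uniformContinuousOn_of_continuous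
      (ha j).continuousOn
    obtain ⟨ε, hε, h⟩ := uniformContinuousOn_iff.1 huc δ hδ
    refine ⟨min (ε / 2) 1, by positivity, fun x hx t ht => ?_⟩
    have hx' : ‖x‖ ≤ R := by simpa using hR hx
    have ht1 : ‖x - t‖ ≤ 1 := ht.trans (min_le_right _ _)
    have ht2 : ‖x - t‖ ≤ ε / 2 := ht.trans (min_le_left _ _)
    have h4 : ‖t‖ ≤ ‖x‖ + ‖x - t‖ := by
      simpa using norm_sub_le x (x - t)
    have := h x (by simp; linarith) t (by simp; linarith) (by rw [dist_eq_norm]; linarith)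
    rw [dist_eq_norm] at this
    exact this.le
  choose ε hε h using h
  by_cases hn : Nonempty (Fin n)
  · refine ⟨Finset.univ.inf' Finset.univ_nonempty ε, ?_, fun x hx t ht j => h j x hx t ?_⟩
    · rw [gt_iff_lt, Finset.lt_inf'_iff]
      exact fun j _ => hε j
    · exact ht.trans (Finset.inf'_le _ (Finset.mem_univ j))
  · exact ⟨1, one_pos, fun x hx t ht j => absurd ⟨j⟩ hn⟩

theorem norm_sq_le_of_le {W Y x δ : ℝ} (hδ : 0 < δ) (hx0 : 0 ≤ x) (hx : x ≤ W + 2 * δ * Y) :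
    x ^ 2 ≤ (1 + δ) * W ^ 2 + 4 * δ * (1 + δ) * Y ^ 2 := by
  have h1 : x ^ 2 ≤ (W + 2 * δ * Y) ^ 2 := by
    exact pow_le_pow_left₀ hx0 hx 2
  have h2 : 0 ≤ δ * (W - 2 * Y) ^ 2 := by positivity
  nlinarith

/-- Forms in the kernel of the weak twisted `∂̄` are approximable by test forms in the graph norm. -/
theorem exists_test_approx (ha : ∀ j, Sm (a j)) {γ : Fin n → Cn n → ℂ} (hγ : ∀ j, MemLp (γ j) 2)
    {w : Cn n → ℂ} (hw : MemLp w 2)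
    (hS : ∀ j k η, Test η → ∫ z, γ j z * conj (DS a k η z) = ∫ z, γ k z * conj (DS a j η z))
    (hT : ∀ η, Test η → ∑ j, ∫ z, γ j z * conj (DD a j η z) = ∫ z, w z * conj (η z))
    {α : Fin n → Cn n → ℂ} (hα : ∀ j, Test (α j)) (hδ : 0 < δ) (hδ1 : δ ≤ 1) :
    ∃ β : Fin n → Cn n → ℂ, (∀ j, Test (β j)) ∧
      (∫ z, ‖∑ j, DS a j (β j) z‖ ^ 2 ≤
        (1 + δ) * (∫ z, ‖w z‖ ^ 2) + δ * (8 * n * ∑ j, ∫ z, ‖γ j z‖ ^ 2)) ∧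
      (∫ z, (1 / 2) * ∑ j, ∑ k, ‖DD a k (β j) z - DD a j (β k) z‖ ^ 2 ≤
        δ * (8 * n * ∑ j, ∫ z, ‖γ j z‖ ^ 2)) ∧
      ∀ j, ‖(∫ z, β j z * α j z) - ∫ z, γ j z * α j z‖ ≤ δ := by
  have hγl : ∀ j, LocallyIntegrable (γ j) := fun j => MemLp.locallyIntegrable_two (hγ j)
  have hwl := MemLp.locallyIntegrable_two hw
  have hsupp : IsCompact (⋃ j, tsupport (α j)) := isCompact_iUnion fun j => (hα j).2.isCompact
  obtain ⟨R, hR⟩ := hsupp.isBounded.subset_closedBall (0 : Cn n)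
  obtain ⟨θ, hθ, hθ1, hθR, hθz, hθb⟩ := exists_cutoff (n := n) hδ R
  obtain ⟨ε₁, hε₁, hmod⟩ := exists_uniform_modulus (fun j => (ha j).continuous) hθ.2.isCompact hδ
  have hweak := fun j => exists_weak_approx (hγl j) (hα j) hδ
  choose ε₂ hε₂ hweak using hweak
  obtain ⟨ε, hε, hεε₁, hεε₂⟩ : ∃ ε > 0, ε ≤ ε₁ ∧ ∀ j, ε ≤ ε₂ j := by
    have h : ∀ᶠ ε in 𝓝[>] (0 : ℝ), ε ≤ ε₁ ∧ ∀ j, ε ≤ ε₂ j :=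
      (Filter.Eventually.filter_mono nhdsWithin_le_nhds (eventually_le_nhds hε₁)).and
        (eventually_all.2 fun j =>
          Filter.Eventually.filter_mono nhdsWithin_le_nhds (eventually_le_nhds (hε₂ j)))
    obtain ⟨ε, h1, h2⟩ := (h.and self_mem_nhdsWithin).exists
    exact ⟨ε, h2, h1⟩
  obtain ⟨k, hk⟩ := exists_ker (n := n) hε
  have hκ := hk.test
  set κ : Cn n → ℂ := fun y => (k y : ℂ) with hκd
  set G : Fin n → Cn n → ℂ := fun j => cv (γ j) κ with hG
  have hGs : ∀ j, Sm (G j) := fun j => Sm.cv (hγl j) hκ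
  set Y : Fin n → Cn n → ℝ := fun j => ymr k (γ j) with hY
  have hGY : ∀ j x, ‖G j x‖ ≤ Y j x := fun j x => norm_cv_le hk (hγl j) x
  have hY0 : ∀ j x, 0 ≤ Y j x := fun j x => ymr_nonneg hk _ x
  have hβ : ∀ j, Test fun z => θ z * G j z := fun j => hθ.mul' (hGs j)
  have hθs : ∀ x, x ∉ tsupport θ → θ x = 0 ∧ (∀ j, dz (ev j) θ x = 0) ∧ ∀ j, dzb (ev j) θ x = 0 := by
    intro x hx
    have h0 : θ =ᶠ[𝓝 x] 0 := notMem_tsupport_iff_eventuallyEq.1 hx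
    have hf : fderiv ℝ θ x = 0 := by rw [h0.fderiv_eq]; simp
    refine ⟨h0.eq_of_nhds, fun j => ?_, fun j => ?_⟩
    · simp [dz, Dr, hf]
    · simp [dzb, Dr, hf]
  have hmod' : ∀ x ∈ tsupport θ, ∀ j, ∀ t, ‖x - t‖ ≤ ε → ‖a j x - a j t‖ ≤ δ :=
    fun x hx j t ht => hmod x hx t (ht.trans hεε₁) j
  have hYi : ∀ j, Integrable fun x => Y j x ^ 2 := fun j => (integral_ymr_sq_le hk (hγ j)).1
  have hYle : ∀ j, ∫ x, Y j x ^ 2 ≤ ∫ x, ‖γ j x‖ ^ 2 := fun j => (integral_ymr_sq_le hk (hγ j)).2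
  have hYs : ∫ x, ∑ j, Y j x ^ 2 ≤ ∑ j, ∫ x, ‖γ j x‖ ^ 2 := by
    rw [integral_finsetSum _ fun j _ => hYi j]
    exact sum_le_sum fun j _ => hYle j
  have hYsi : Integrable fun x => ∑ j, Y j x ^ 2 := integrable_finsetSum _ fun j _ => hYi j
  obtain ⟨hWi, hWle⟩ := integral_ymr_sq_le hk hw
  refine ⟨fun j z => θ z * G j z, hβ, ?_, ?_, fun j => ?_⟩
  · have hpt : ∀ x, ‖∑ j, DS a j (fun z => θ z * G j z) x‖ ^ 2 ≤
        (1 + δ) * ymr k w x ^ 2 + 8 * δ * n * ∑ j, Y j x ^ 2 := by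
      intro x
      have h1 : ‖∑ j, DS a j (fun z => θ z * G j z) x‖ ≤ ymr k w x + 2 * δ * ∑ j, Y j x := by
        have hW0 := ymr_nonneg hk w x
        have hYs0 : 0 ≤ ∑ j, Y j x := sum_nonneg fun j _ => hY0 j x
        have e : ∑ j, DS a j (fun z => θ z * G j z) x =
            θ x * ∑ j, DS a j (G j) x - ∑ j, dz (ev j) θ x * G j x := by
          rw [mul_sum, ← sum_sub_distrib]
          exact sum_congr rfl fun j _ => DS_mul hθ.1 (hGs j) j x
        by_cases hx : x ∈ tsupport θ
        · rw [e, sum_DS_cv ha hγl hT hk x]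
          have h2 : ‖∑ j, ∫ t, (conj (a j x) - conj (a j t)) *
              (γ j t * (k (x - t) : ℂ))‖ ≤ δ * ∑ j, Y j x := by
            rw [mul_sum]
            refine norm_sum_le_of_le _ fun j _ => ?_
            refine norm_kernel_integral_le hk (hγl j) fun t ht => ?_
            rw [← map_sub, RCLike.norm_conj]
            exact hmod' x hx j t ht
          have h3 : ‖∑ j, dz (ev j) θ x * G j x‖ ≤ δ * ∑ j, Y j x := by
            rw [mul_sum]
            refine norm_sum_le_of_le _ fun j _ => ?_
            rw [norm_mul]
            exact mul_le_mul (hθz j x) (hGY j x) (norm_nonneg _) hδ.le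
          refine (norm_sub_le _ _).trans ?_
          rw [norm_mul]
          have h4 := (norm_add_le _ _).trans (add_le_add (norm_cv_le hk hwl x) h2)
          have h5 := mul_le_mul (hθ1 x) h4 (norm_nonneg _) zero_le_one
          linarith
        · obtain ⟨hx0, hxz, -⟩ := hθs x hx
          rw [e, hx0]
          simp only [hxz, zero_mul, Finset.sum_const_zero, sub_zero, norm_zero]
          positivity
      have h2 := norm_sq_le_of_le hδ (norm_nonneg _) h1
      have h3 : (∑ j, Y j x) ^ 2 ≤ n * ∑ j, Y j x ^ 2 := by
        simpa using sq_sum_le_card_mul_sum_sq (s := (Finset.univ : Finset (Fin n)))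
          (f := fun j => Y j x)
      refine h2.trans (add_le_add le_rfl ?_)
      have h4 : 4 * δ * (1 + δ) ≤ 8 * δ := by nlinarith
      calc 4 * δ * (1 + δ) * (∑ j, Y j x) ^ 2 ≤ 8 * δ * (∑ j, Y j x) ^ 2 :=
            mul_le_mul_of_nonneg_right h4 (sq_nonneg _)
        _ ≤ 8 * δ * (n * ∑ j, Y j x ^ 2) := mul_le_mul_of_nonneg_left h3 (by positivity)
        _ = _ := by ring
    have hT' : Test fun z => ∑ j, DS a j (fun z => θ z * G j z) z :=
      Test.sum fun j _ => (hβ j).DS ha j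
    have h2 := integral_mono hT'.integrable_norm_sq
      ((hWi.const_mul (1 + δ)).add (hYsi.const_mul (8 * δ * n))) hpt
    refine h2.trans ?_
    rw [integral_add' (hWi.const_mul _) (hYsi.const_mul _), integral_const_mul, integral_const_mul]
    refine add_le_add (mul_le_mul_of_nonneg_left hWle (by linarith)) ?_
    calc _ ≤ 8 * δ * n * ∑ j, ∫ x, ‖γ j x‖ ^ 2 := mul_le_mul_of_nonneg_left hYs (by positivity)
      _ = _ := by ring
  · have hpt : ∀ x, (1 / 2) * ∑ j, ∑ i, ‖DD a i (fun z => θ z * G j z) x -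
        DD a j (fun z => θ z * G i z) x‖ ^ 2 ≤ 8 * δ ^ 2 * n * ∑ j, Y j x ^ 2 := by
      intro x
      have h1 : ∀ i j, ‖DD a i (fun z => θ z * G j z) x - DD a j (fun z => θ z * G i z) x‖ ^ 2 ≤
          8 * δ ^ 2 * (Y j x ^ 2 + Y i x ^ 2) := by
        intro i j
        have h2 : ‖DD a i (fun z => θ z * G j z) x - DD a j (fun z => θ z * G i z) x‖ ≤
            2 * δ * (Y j x + Y i x) := by
          rw [DD_mul hθ.1 (hGs j), DD_mul hθ.1 (hGs i)]
          have e : θ x * DD a i (G j) x + dzb (ev i) θ x * G j x -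
              (θ x * DD a j (G i) x + dzb (ev j) θ x * G i x) =
              θ x * (DD a i (G j) x - DD a j (G i) x) +
                (dzb (ev i) θ x * G j x - dzb (ev j) θ x * G i x) := by ring
          rw [e]
          by_cases hx : x ∈ tsupport θ
          · rw [DD_cv_sub ha hγl hS hk i j x]
            have h3 := norm_kernel_integral_le hk (hγl j) (hmod' x hx i)
            have h4 := norm_kernel_integral_le hk (hγl i) (hmod' x hx j)
            have h5 := mul_le_mul (hθb i x) (hGY j x) (norm_nonneg _) hδ.le
            have h6 := mul_le_mul (hθb j x) (hGY i x) (norm_nonneg _) hδ.le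
            have h7 := mul_le_mul (hθ1 x) ((norm_sub_le _ _).trans (add_le_add h3 h4))
              (norm_nonneg _) zero_le_one
            rw [← norm_mul] at h5 h6 h7
            have h8 := (norm_sub_le _ _).trans (add_le_add h5 h6)
            have h9 := (norm_add_le _ _).trans (add_le_add h7 h8)
            refine h9.trans (le_of_eq ?_)
            simp only [hY]; ring
          · obtain ⟨hx0, -, hxb⟩ := hθs x hx
            rw [hx0, hxb, hxb]
            simp only [zero_mul, sub_zero, add_zero, norm_zero]
            have := hY0 j x; have := hY0 i x
            positivity
        have h3 := pow_le_pow_left₀ (norm_nonneg _) h2 2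
        refine h3.trans ?_
        nlinarith [mul_nonneg (sq_nonneg δ) (sq_nonneg (Y j x - Y i x))]
      calc _ ≤ (1 / 2) * ∑ j, ∑ i, 8 * δ ^ 2 * (Y j x ^ 2 + Y i x ^ 2) := by
            refine mul_le_mul_of_nonneg_left ?_ (by norm_num)
            exact sum_le_sum fun j _ => sum_le_sum fun i _ => h1 i j
        _ = _ := by
          simp only [← mul_sum, sum_add_distrib, Finset.sum_const, Finset.card_univ,
            Fintype.card_fin, nsmul_eq_mul]
          ring
    have hI : Integrable fun x => (1 / 2) * ∑ j, ∑ i, ‖DD a i (fun z => θ z * G j z) x -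
        DD a j (fun z => θ z * G i z) x‖ ^ 2 :=
      (integrable_finsetSum _ fun j _ => integrable_finsetSum _ fun i _ =>
        (((hβ j).DD ha i).sub ((hβ i).DD ha j)).integrable_norm_sq).const_mul _
    refine (integral_mono hI (hYsi.const_mul (8 * δ ^ 2 * n)) hpt).trans ?_
    rw [integral_const_mul]
    have hΓ : 0 ≤ ∑ j, ∫ x, ‖γ j x‖ ^ 2 :=
      sum_nonneg fun j _ => integral_nonneg fun x => sq_nonneg _
    calc _ ≤ 8 * δ ^ 2 * n * ∑ j, ∫ x, ‖γ j x‖ ^ 2 := mul_le_mul_of_nonneg_left hYs (by positivity)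
      _ = δ * (δ * (8 * n * ∑ j, ∫ x, ‖γ j x‖ ^ 2)) := by ring
      _ ≤ δ * (1 * (8 * n * ∑ j, ∫ x, ‖γ j x‖ ^ 2)) := by gcongr
      _ = _ := by ring
  · have h := hweak j ε hε (hεε₂ j) k hk
    have e : ∫ z, θ z * G j z * α j z = ∫ z, G j z * α j z := by
      congr 1; funext z
      by_cases hz : z ∈ tsupport (α j)
      · have : ‖z‖ ≤ R := by simpa using hR (mem_iUnion.2 ⟨j, hz⟩)
        rw [hθR z this, one_mul]
      · simp [image_eq_zero_of_notMem_tsupport hz]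
    rw [e]
    exact h

theorem inner_toLp (hf : MemLp f 2) (x : Lp ℂ 2 (volume : Measure (Cn n))) :
    inner ℂ (hf.toLp f) x = ∫ z, x z * conj (f z) := by
  rw [L2.inner_def]
  refine integral_congr_ae ?_
  filter_upwards [hf.coeFn_toLp] with z hz
  rw [hz, RCLike.inner_apply]

theorem norm_sq_Lp (x : Lp ℂ 2 (volume : Measure (Cn n))) : ‖x‖ ^ 2 = ∫ z, ‖x z‖ ^ 2 := by
  rw [← inner_self_eq_norm_sq (𝕜 := ℂ), L2.inner_def]
  have : ∀ z, inner ℂ (x z) (x z) = ((‖x z‖ ^ 2 : ℝ) : ℂ) := fun z => by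
    rw [inner_self_eq_norm_sq_to_K]; simp
  simp_rw [this]
  rw [integral_complex_ofReal]
  simp

theorem DD_comm (ha : ∀ j, Sm (a j)) (ha2 : ∀ j k z, dzb (ev k) (a j) z = dzb (ev j) (a k) z)
    (hf : Sm f) (j k : Fin n) (z : Cn n) : DD a k (DD a j f) z = DD a j (DD a k f) z := by
  have h : ∀ j k : Fin n, DD a k (DD a j f) z = dzb (ev k) (dzb (ev j) f) z +
      (dzb (ev k) (a j) z * f z + a j z * dzb (ev k) f z) +
        a k z * (dzb (ev j) f z + a j z * f z) := by
    intro j k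
    rw [DD, show DD a j f = fun z => dzb (ev j) f z + a j z * f z from rfl,
      dzb_add (hf.dzb _) ((ha j).mul hf), dzb_mul (ha j) hf]
  rw [h, h, dzb_dzb_comm hf, ha2 j k]
  ring

theorem DS_add (hf : Sm f) (hg : Sm g) (j : Fin n) (z : Cn n) :
    DS a j (fun z => f z + g z) z = DS a j f z + DS a j g z := by
  rw [DS, dz_add hf hg, DS, DS]; ring

theorem DS_const_mul (hf : Sm f) (c : ℂ) (j : Fin n) (z : Cn n) :
    DS a j (fun z => c * f z) z = c * DS a j f z := by
  rw [DS, dz_const_mul hf, DS]; ring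

theorem Test.const_mul (hf : Test f) (c : ℂ) : Test fun z => c * f z :=
  Test.mul contDiff_const hf

/-- Projection of a test form to the kernel of the twisted `∂̄`. -/
theorem exists_projection (ha : ∀ j, Sm (a j))
    (ha2 : ∀ j k z, dzb (ev k) (a j) z = dzb (ev j) (a k) z) {β : Fin n → Cn n → ℂ}
    (hβ : ∀ j, Test (β j)) :
    ∃ γ : Fin n → Cn n → ℂ, (∀ j, MemLp (γ j) 2) ∧
      (∀ j k η, Test η → ∫ z, γ j z * conj (DS a k η z) =
        ∫ z, γ k z * conj (DS a j η z)) ∧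
      ∀ η, Test η → ∑ j, ∫ z, γ j z * conj (DD a j η z) =
        ∑ j, ∫ z, β j z * conj (DD a j η z) := by
  let H := Lp ℂ 2 (volume : Measure (Cn n))
  let HF := PiLp 2 fun _ : Fin n => H
  let ι : {f : Cn n → ℂ // Test f} → HF := fun f => WithLp.toLp 2 fun j =>
    (f.2.DD ha j).memLp.toLp (DD a j f.1)
  let K : Submodule ℂ HF := (Submodule.span ℂ (Set.range ι)).topologicalClosure
  have hKc : IsClosed (K : Set HF) := Submodule.isClosed_topologicalClosure _
  have : CompleteSpace K := hKc.completeSpace_coe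
  let b : HF := WithLp.toLp 2 fun j => (hβ j).memLp.toLp (β j)
  obtain ⟨y, hy, x, hx, hbx⟩ := Submodule.exists_add_mem_mem_orthogonal (K := K) b
  refine ⟨fun j => y j, fun j => Lp.memLp _, fun j k η hη => ?_, fun η hη => ?_⟩
  · let p : HF →L[ℂ] ℂ :=
      (innerSL ℂ ((hη.DS ha k).memLp.toLp (DS a k η))).comp (PiLp.proj 2 (fun _ : Fin n => H) j) -
      (innerSL ℂ ((hη.DS ha j).memLp.toLp (DS a j η))).comp (PiLp.proj 2 (fun _ : Fin n => H) k)
    have hp : ∀ y : HF, p y = (∫ z, (y j) z * conj (DS a k η z)) -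
        ∫ z, (y k) z * conj (DS a j η z) := by
      intro y
      rw [← inner_toLp (hη.DS ha k).memLp, ← inner_toLp (hη.DS ha j).memLp]
      rfl
    have hle : K ≤ LinearMap.ker p.toLinearMap := by
      refine Submodule.topologicalClosure_minimal _ ?_ p.isClosed_ker
      rw [Submodule.span_le]
      rintro _ ⟨⟨f, hf⟩, rfl⟩
      change p _ = 0
      rw [hp]
      have e : ∀ i l : Fin n, ∫ z, (ι ⟨f, hf⟩ i) z * conj (DS a l η z) =
          ∫ z, DD a l (DD a i f) z * conj (η z) := by
        intro i l
        rw [integral_DD_mul_conj ha (hf.DD ha i).1 hη l]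
        refine integral_congr_ae ?_
        filter_upwards [(hf.DD ha i).memLp.coeFn_toLp] with z hz
        exact congrArg (· * _) hz
      rw [e, e, sub_eq_zero]
      congr 1; funext z
      rw [DD_comm ha ha2 hf.1]
    have := hle hy
    change p y = 0 at this
    rw [hp, sub_eq_zero] at this
    exact this
  · have h1 : inner ℂ (ι ⟨η, hη⟩) x = 0 :=
      hx _ (Submodule.le_topologicalClosure _ (Submodule.subset_span ⟨_, rfl⟩))
    have h2 : inner ℂ (ι ⟨η, hη⟩) b = inner ℂ (ι ⟨η, hη⟩) y := by
      rw [hbx, inner_add_right, h1, add_zero]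
    rw [PiLp.inner_apply, PiLp.inner_apply] at h2
    have e1 : ∀ j, inner ℂ (ι ⟨η, hη⟩ j) (y j) =
        ∫ z, (y j) z * conj (DD a j η z) := fun j => inner_toLp (hη.DD ha j).memLp _
    have e2 : ∀ j, inner ℂ (ι ⟨η, hη⟩ j) (b j) =
        ∫ z, β j z * conj (DD a j η z) := fun j => by
      refine (inner_toLp (hη.DD ha j).memLp _).trans (integral_congr_ae ?_)
      filter_upwards [(hβ j).memLp.coeFn_toLp] with z hz
      exact congrArg (· * _) hz
    simp only [e1, e2] at h2
    exact h2.symm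

theorem sq_le_of_approx {X A w C : ℝ} {m : ℕ} (hX : 0 ≤ X)
    (h : ∀ δ : ℝ, 0 < δ → δ ≤ 1 → ∃ x, X ≤ x + m * δ ∧ 0 ≤ x ∧ x ^ 2 ≤ A * ((1 + δ) * w + δ * C)) :
    X ^ 2 ≤ A * w := by
  have hev : ∀ᶠ δ in 𝓝[>] (0 : ℝ), X ≤ sqrt (A * ((1 + δ) * w + δ * C)) + m * δ := by
    filter_upwards [Ioc_mem_nhdsGT (zero_lt_one' ℝ)] with δ hδ
    obtain ⟨x, h1, h2, h3⟩ := h δ hδ.1 hδ.2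
    exact h1.trans (add_le_add (le_sqrt_of_sq_le h3) le_rfl)
  have hlim : Tendsto (fun δ : ℝ => sqrt (A * ((1 + δ) * w + δ * C)) + m * δ) (𝓝[>] 0)
      (𝓝 (sqrt (A * ((1 + 0) * w + 0 * C)) + m * 0)) := by
    refine Tendsto.mono_left (Continuous.tendsto ?_ _) nhdsWithin_le_nhds
    fun_prop
  have hle := ge_of_tendsto hlim hev
  simp only [add_zero, one_mul, zero_mul, mul_zero] at hle
  rcases le_or_gt 0 (A * w) with h0 | h0
  · exact (le_sqrt hX h0).1 hle
  · exfalso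
    rw [sqrt_eq_zero_of_nonpos h0.le] at hle
    obtain ⟨δ, hδ, hδ1, hneg⟩ : ∃ δ : ℝ, 0 < δ ∧ δ ≤ 1 ∧ A * ((1 + δ) * w + δ * C) < 0 := by
      have h2 : Tendsto (fun δ : ℝ => A * ((1 + δ) * w + δ * C)) (𝓝[>] 0)
          (𝓝 (A * ((1 + 0) * w + 0 * C))) := by
        refine Tendsto.mono_left (Continuous.tendsto ?_ _) nhdsWithin_le_nhds
        fun_prop
      simp only [add_zero, one_mul, zero_mul] at h2
      obtain ⟨δ, h3, h4⟩ := ((h2.eventually_lt_const h0).and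
        (Ioc_mem_nhdsGT (zero_lt_one' ℝ))).exists
      exact ⟨δ, h4.1, h4.2, h3⟩
    obtain ⟨x, -, -, h3⟩ := h δ hδ hδ1
    nlinarith [sq_nonneg x]

theorem DS_sum_estimate (ha : ∀ j, Sm (a j))
    (ha2 : ∀ j k z, dzb (ev k) (a j) z = dzb (ev j) (a k) z) (hf : Test f) {A : ℝ}
    (hA0 : 0 ≤ A)
    (hA : ∀ β : Fin n → Cn n → ℂ, (∀ j, Test (β j)) →
      ‖∑ j, ∫ z, β j z * conj (DD a j f z)‖ ^ 2 ≤
        A * ∫ z, (∑ j, ∑ k, (conj (dz (ev k) (a j) z) + dz (ev j) (a k) z) * β j z *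
          conj (β k z)).re)
    {β : Fin n → Cn n → ℂ} (hβ : ∀ j, Test (β j)) :
    ‖∑ j, ∫ z, β j z * conj (DD a j f z)‖ ^ 2 ≤
      A * ∫ z, ‖∑ j, DS a j (β j) z‖ ^ 2 := by
  obtain ⟨γ, hγ, hS, hT⟩ := exists_projection ha ha2 hβ
  rw [← hT f hf]
  set w : Cn n → ℂ := fun z => ∑ j, DS a j (β j) z with hw
  have hwt : Test w := Test.sum fun j _ => (hβ j).DS ha j
  have hT' : ∀ η, Test η → ∑ j, ∫ z, γ j z * conj (DD a j η z) =
      ∫ z, w z * conj (η z) := by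
    intro η hη
    rw [hT η hη]
    simp only [hw, sum_mul]
    rw [integral_finsetSum _ fun j _ => (((hβ j).DS ha j).mul' hη.conj.1).integrable]
    refine sum_congr rfl fun j _ => ?_
    have h2 := congrArg (conj) (integral_DD_mul_conj ha hη.1 (hβ j) j)
    rw [← integral_conj, ← integral_conj] at h2
    simp only [map_mul, conj_conj] at h2
    simp only [mul_comm (conj (DD a j η _)), mul_comm (conj (η _))] at h2
    exact h2
  have hα : ∀ j, Test fun z => conj (DD a j f z) := fun j => (hf.DD ha j).conj
  refine sq_le_of_approx (m := n) (C := 2 * (8 * n * ∑ j, ∫ z, ‖γ j z‖ ^ 2)) (norm_nonneg _)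
    fun δ hδ hδ1 => ?_
  obtain ⟨β', hβ', h1, h2, h3⟩ := exists_test_approx ha hγ hwt.memLp hS hT' hα hδ hδ1
  refine ⟨‖∑ j, ∫ z, β' j z * conj (DD a j f z)‖, ?_, norm_nonneg _, ?_⟩
  · have h4 : ‖∑ j, ((∫ z, β' j z * conj (DD a j f z)) -
        ∫ z, γ j z * conj (DD a j f z))‖ ≤ n * δ := by
      refine (norm_sum_le_of_le _ fun j _ => h3 j).trans (le_of_eq ?_)
      simp
    rw [sum_sub_distrib] at h4
    have h5 := norm_sub_norm_le (∑ j, ∫ z, γ j z * conj (DD a j f z))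
      (∑ j, ∫ z, β' j z * conj (DD a j f z))
    rw [norm_sub_rev] at h5
    linarith
  · refine (hA β' hβ').trans (mul_le_mul_of_nonneg_left ?_ hA0)
    have := kohn_morrey ha hβ'
    linarith

/-- The `L²` estimate for the twisted `∂̄`-equation. -/
theorem l2_estimate (ha : ∀ j, Sm (a j))
    (ha2 : ∀ j k z, dzb (ev k) (a j) z = dzb (ev j) (a k) z) (hf : Test f) {A : ℝ}
    (hA0 : 0 ≤ A)
    (hA : ∀ β : Fin n → Cn n → ℂ, (∀ j, Test (β j)) →
      ‖∑ j, ∫ z, β j z * conj (DD a j f z)‖ ^ 2 ≤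
        A * ∫ z, (∑ j, ∑ k, (conj (dz (ev k) (a j) z) + dz (ev j) (a k) z) * β j z *
          conj (β k z)).re) :
    ∃ u : Cn n → ℂ, MemLp u 2 ∧ ∫ z, ‖f z - u z‖ ^ 2 ≤ A ∧
      ∀ j η, Test η → ∫ z, u z * conj (DS a j η z) = 0 := by
  let H := Lp ℂ 2 (volume : Measure (Cn n))
  have hmem : ∀ {β : Fin n → Cn n → ℂ}, (∀ j, Test (β j)) →
      Test fun z => ∑ j, DS a j (β j) z := fun hβ => Test.sum fun j _ => (hβ j).DS ha j
  let P : Submodule ℂ H :=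
    { carrier := {x | ∃ β : Fin n → Cn n → ℂ, (∀ j, Test (β j)) ∧
        x =ᵐ[volume] fun z => ∑ j, DS a j (β j) z}
      add_mem' := by
        rintro x y ⟨β, hβ, hx⟩ ⟨β', hβ', hy⟩
        refine ⟨fun j z => β j z + β' j z, fun j => (hβ j).add (hβ' j), ?_⟩
        filter_upwards [Lp.coeFn_add x y, hx, hy] with z h1 h2 h3
        rw [h1, Pi.add_apply, h2, h3, ← sum_add_distrib]
        exact sum_congr rfl fun j _ => (DS_add (hβ j).1 (hβ' j).1 j z).symm
      zero_mem' := by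
        refine ⟨fun j z => 0, fun j => test_zero, ?_⟩
        filter_upwards [Lp.coeFn_zero ℂ 2 (volume : Measure (Cn n))] with z h1
        rw [h1]
        have : ∀ j, DS a j (fun _ => 0) z = 0 := fun j => by
          simpa using DS_const_mul (a := a) (test_zero (n := n)).1 0 j z
        simp [this]
      smul_mem' := by
        rintro c x ⟨β, hβ, hx⟩
        refine ⟨fun j z => c * β j z, fun j => (hβ j).const_mul c, ?_⟩
        filter_upwards [Lp.coeFn_smul c x, hx] with z h1 h2
        rw [h1, Pi.smul_apply, h2, smul_eq_mul, mul_sum]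
        exact sum_congr rfl fun j _ => (DS_const_mul (hβ j).1 c j z).symm }
  have hKc : IsClosed (P.topologicalClosure : Set H) := Submodule.isClosed_topologicalClosure _
  have : CompleteSpace P.topologicalClosure := hKc.completeSpace_coe
  obtain ⟨v, hv, u, hu, hvu⟩ := Submodule.exists_add_mem_mem_orthogonal
    (K := P.topologicalClosure) (hf.memLp.toLp f)
  have hbound : ∀ x ∈ P.topologicalClosure, ‖inner ℂ x v‖ ≤ sqrt A * ‖x‖ := by
    have hcl : IsClosed {x : H | ‖inner ℂ x v‖ ≤ sqrt A * ‖x‖} :=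
      isClosed_le (by fun_prop) (by fun_prop)
    have : ∀ x ∈ P, ‖inner ℂ x v‖ ≤ sqrt A * ‖x‖ := by
      rintro x ⟨β, hβ, hx⟩
      have h0 : inner ℂ x u = 0 :=
        hu x (Submodule.le_topologicalClosure _ ⟨β, hβ, hx⟩)
      have h1 : inner ℂ x v = ∫ z, f z * conj (∑ j, DS a j (β j) z) := by
        have : inner ℂ x (hf.memLp.toLp f) = inner ℂ x v := by
          rw [hvu, inner_add_right, h0, add_zero]
        rw [← this, L2.inner_def]
        refine integral_congr_ae ?_
        filter_upwards [hx, hf.memLp.coeFn_toLp] with z h1 h2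
        rw [h1, h2, RCLike.inner_apply]
      have h2 : inner ℂ x v = conj (∑ j, ∫ z, β j z * conj (DD a j f z)) := by
        rw [h1]
        simp only [map_sum, mul_sum]
        rw [integral_finsetSum _ fun j _ => (hf.mul' ((hβ j).DS ha j).conj.1).integrable]
        refine sum_congr rfl fun j _ => ?_
        rw [← integral_DD_mul_conj ha hf.1 (hβ j) j, ← integral_conj]
        congr 1; funext z
        simp [mul_comm]
      have h3 := DS_sum_estimate ha ha2 hf hA0 hA hβ
      have h4 : ∫ z, ‖∑ j, DS a j (β j) z‖ ^ 2 = ‖x‖ ^ 2 := by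
        rw [norm_sq_Lp]
        refine integral_congr_ae ?_
        filter_upwards [hx] with z hz
        rw [hz]
      rw [h4] at h3
      rw [h2, RCLike.norm_conj]
      refine abs_le_of_sq_le_sq' ?_ (by positivity) |>.2
      rw [mul_pow, sq_sqrt hA0]
      exact h3
    intro x hx
    exact closure_minimal this hcl hx
  have hvA : ‖v‖ ^ 2 ≤ A := by
    have h1 := hbound v hv
    rw [inner_self_eq_norm_sq_to_K] at h1
    have h2 : ‖v‖ ^ 2 ≤ sqrt A * ‖v‖ := by simpa using h1
    have h3 : ‖v‖ ≤ sqrt A := by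
      by_contra h
      push Not at h
      have : 0 < ‖v‖ := (sqrt_nonneg _).trans_lt h
      nlinarith
    calc ‖v‖ ^ 2 ≤ sqrt A ^ 2 := pow_le_pow_left₀ (norm_nonneg _) h3 2
      _ = A := sq_sqrt hA0
  refine ⟨u, Lp.memLp u, ?_, fun j η hη => ?_⟩
  · refine le_trans (le_of_eq ?_) hvA
    rw [norm_sq_Lp]
    refine integral_congr_ae ?_
    have h1 := hf.memLp.coeFn_toLp
    rw [hvu] at h1
    filter_upwards [h1, Lp.coeFn_add v u] with z h2 h3
    rw [← h2, h3, Pi.add_apply, add_sub_cancel_right]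
  · have h1 : ∀ i, Test ((Pi.single j η : Fin n → Cn n → ℂ) i) := fun i => by
      by_cases h : i = j
      · subst h; simpa using hη
      · rw [Pi.single_eq_of_ne h]
        exact test_zero
    have h2 : (fun z => ∑ i, DS a i ((Pi.single j η : Fin n → Cn n → ℂ) i) z) = DS a j η := by
      funext z
      rw [Finset.sum_eq_single j]
      · simp
      · intro i _ h
        rw [Pi.single_eq_of_ne h]
        have h0 := DS_const_mul (a := a) (test_zero (n := n)).1 0 i z
        simp only [mul_zero, zero_mul] at h0
        exact h0
      · simp
    have h3 := hu ((hη.DS ha j).memLp.toLp _) (Submodule.le_topologicalClosure _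
      ⟨Pi.single j η, h1, by rw [h2]; exact (hη.DS ha j).memLp.coeFn_toLp⟩)
    rw [inner_toLp] at h3
    exact h3

/-- The Cauchy–Riemann equations imply complex differentiability. -/
theorem differentiable_of_dzb_eq_zero (hf : Sm f) (h : ∀ j z, dzb (ev j) f z = 0) :
    Differentiable ℂ f := by
  intro z
  set L := fderiv ℝ f z with hL
  have h1 : ∀ j, L (I • ev j) = I * L (ev j) := fun j => by
    have h2 : Dr (ev j) f z + I * Dr (I • ev j) f z = 0 := by
      have := h j z
      rw [dzb] at this
      exact (mul_eq_zero.1 this).resolve_left (by norm_num)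
    have h3 : L (ev j) + I * L (I • ev j) = 0 := h2
    have h4 : L (I • ev j) = I * L (ev j) -
      I * (L (ev j) + I * L (I • ev j)) := by
      linear_combination L (I • ev j) * I_mul_I
    rw [h4, h3]; ring
  have h2 : ∀ (c : ℂ) j, L (c • ev j) = c * L (ev j) := fun c j => by
    have : c • ev j = c.re • ev j + c.im • (I • ev (n := n) j) := by
      rw [← Complex.coe_smul, ← Complex.coe_smul, smul_smul, ← add_smul, re_add_im]
    rw [this, map_add, map_smul, map_smul, h1]
    conv_rhs => rw [← re_add_im c]
    simp only [Complex.real_smul]; ring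
  have h3 : ∀ w : Cn n, L w = ∑ j, w j * L (ev j) := fun w => by
    conv_lhs => rw [show w = ∑ j, w j • ev j by
      funext i; simp [ev, Finset.sum_apply, Pi.single_apply]]
    rw [map_sum]
    exact sum_congr rfl fun j _ => h2 _ _
  have h4 : ∀ (c : ℂ) (w : Cn n), L (c • w) = c • L w := fun c w => by
    rw [h3, h3 w, smul_eq_mul, mul_sum]
    refine sum_congr rfl fun j _ => ?_
    simp [mul_assoc]
  let g : Cn n →L[ℂ] ℂ :=
    { toFun := L, map_add' := L.map_add, map_smul' := h4, cont := L.continuous }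
  refine (differentiableAt_iff_restrictScalars ℝ (hf.differentiableAt z)).2 ⟨g, ?_⟩
  ext w; rfl

theorem subAt_re_of_entire {G : Cn n → ℂ} (hG : Differentiable ℂ G) (z : Cn n) :
    SubAt (fun z => (G z).re) z := by
  intro w
  refine ⟨1, one_pos, fun r _ _ => ?_⟩
  have hp : Differentiable ℂ fun ζ : ℂ => G (z + ζ • w) := hG.comp (by fun_prop)
  have := circleAverage_re_of_entire hp 0 r
  rw [this]; simp

/-- The mean value property for entire functions. -/
theorem cv_ker_of_entire {G : Cn n → ℂ} (hG : Differentiable ℂ G) (hk : Ker ε k) (x : Cn n) :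
    cv G (fun y => (k y : ℂ)) x = G x := by
  have hInt : Integrable fun y => G (x + y) * (k y : ℂ) := by
    refine Continuous.integrable_of_hasCompactSupport ?_ hk.test.2.mul_left
    exact (hG.continuous.comp (by fun_prop)).mul hk.test.1.continuous
  have e1 : cv G (fun y => (k y : ℂ)) x = ∫ y, G (x + y) * (k y : ℂ) := by
    unfold cv
    rw [← integral_add_left_eq_self _ x]
    congr 1; funext y
    rw [show x - (x + y) = -y by abel]
    change G (x + y) * ((k (-y) : ℝ) : ℂ) = _
    rw [hk.even]
  have key : ∀ c : ℂ, (c * G x).re ≤ (c * ∫ y, G (x + y) * (k y : ℂ)).re := fun c => by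
    have hd : Differentiable ℂ fun z => c * G z := hG.const_mul c
    have hv : RPsh (fun z => (c * G z).re) (closedBall x ε) := by
      have hc : Continuous fun z => (c * G z).re := continuous_re.comp hd.continuous
      refine ⟨hc.upperSemicontinuous.upperSemicontinuousOn _, ?_, fun z _ => subAt_re_of_entire hd z⟩
      obtain ⟨B, hB⟩ := (isCompact_closedBall x ε).bddBelow_image hc.continuousOn
      exact ⟨B, fun z hz => hB ⟨z, hz, rfl⟩⟩
    have := hv.mul_integral_le le_rfl hk.smooth.continuous.measurable hk.integrable hk.nonneg
      hk.supp hk.inv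
    rw [hk.int_one, mul_one] at this
    refine this.trans (le_of_eq ?_)
    rw [← integral_const_mul]
    have h2 : (∫ y, c * (G (x + y) * (k y : ℂ))).re = ∫ y, (c * (G (x + y) * (k y : ℂ))).re :=
      (reCLM.integral_comp_comm (hInt.const_mul c)).symm
    rw [h2]
    congr 1; funext y
    rw [← mul_assoc, Complex.re_mul_ofReal]
  rw [e1]
  set D := (∫ y, G (x + y) * (k y : ℂ)) - G x with hD
  have h1 := key (-(conj D))
  have h2 : 0 ≤ (-(conj D) * D).re := by
    rw [hD, mul_sub, sub_re, ← hD]; linarith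
  have h3 : -(conj D) * D = ((-(‖D‖ ^ 2) : ℝ) : ℂ) := by
    rw [neg_mul, mul_comm, mul_conj, normSq_eq_norm_sq]; push_cast; ring
  rw [h3, ofReal_re] at h2
  have h4 : ‖D‖ = 0 := by nlinarith [norm_nonneg D]
  exact sub_eq_zero.1 (norm_eq_zero.1 h4)

/-- A weakly holomorphic function agrees almost everywhere with an entire function. -/
theorem exists_entire_ae_eq {F : Cn n → ℂ} (hF : LocallyIntegrable F)
    (h : ∀ j η, Test η → ∫ z, F z * dzb (ev j) η z = 0) :
    ∃ G : Cn n → ℂ, Differentiable ℂ G ∧ F =ᵐ[volume] G := by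
  have hhol : ∀ {κ : Cn n → ℂ}, Test κ → Differentiable ℂ (cv F κ) := fun {κ} hκ => by
    refine differentiable_of_dzb_eq_zero (Sm.cv hF hκ) fun j x => ?_
    rw [dzb_cv hF hκ, cv]
    have := h j _ (hκ.refl x)
    simp_rw [dzb_refl hκ.1, mul_neg, integral_neg] at this
    exact neg_eq_zero.1 this
  obtain ⟨k₁, hk₁⟩ := exists_ker (n := n) one_pos
  refine ⟨cv F fun y => (k₁ y : ℂ), hhol hk₁.test, ?_⟩
  set G := cv F fun y => (k₁ y : ℂ) with hGdef
  have hindep : ∀ {ε : ℝ} {k : Cn n → ℝ}, Ker ε k → cv F (fun y => (k y : ℂ)) = G := by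
    intro ε k hk
    funext x
    have h1 := cv_ker_of_entire (hhol hk.test) hk₁ x
    have h2 := cv_ker_of_entire (hhol hk₁.test) hk x
    rw [← h1, cv_assoc hF hk.test hk₁.test, hGdef, ← h2, cv_assoc hF hk₁.test hk.test]
    congr 1; funext y; exact cv_comm _ _ y
  have hGc : Continuous G := (hhol hk₁.test).continuous
  have hGl : LocallyIntegrable G := hGc.locallyIntegrable
  have hw : ∀ α, Test α → ∫ x, F x * α x = ∫ x, G x * α x := fun α hα => by
    have : ∀ δ > 0, ‖(∫ x, G x * α x) - ∫ x, F x * α x‖ ≤ δ := fun δ hδ => by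
      obtain ⟨ε₀, hε₀, h1⟩ := exists_weak_approx hF hα hδ
      obtain ⟨k, hk⟩ := exists_ker (n := n) hε₀
      have := h1 ε₀ hε₀ le_rfl k hk
      rwa [hindep hk] at this
    have h0 := le_of_forall_pos_le_add fun δ hδ => (this δ hδ).trans (by simp : δ ≤ 0 + δ)
    exact (sub_eq_zero.1 (norm_le_zero_iff.1 h0)).symm
  have hz : ∀ᵐ x, F x - G x = 0 := by
    refine ae_eq_zero_of_integral_contDiff_smul_eq_zero (hF.sub hGl) fun φ hφ hφc => ?_
    have hα : Test fun x => (φ x : ℂ) :=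
      ⟨ofRealCLM.contDiff.comp hφ, hφc.comp_left ofReal_zero⟩
    have h1 : Integrable fun x => F x * (φ x : ℂ) := by
      have := hF.integrable_smul_left_of_hasCompactSupport hα.1.continuous hα.2
      refine this.congr (Eventually.of_forall fun x => ?_)
      simp [mul_comm]
    have h2 : Integrable fun x => G x * (φ x : ℂ) :=
      (hGc.mul hα.1.continuous).integrable_of_hasCompactSupport hα.2.mul_left
    have h3 := hw _ hα
    rw [← sub_eq_zero, ← integral_sub h1 h2] at h3
    rw [← h3]
    congr 1; funext x
    simp; ring
  filter_upwards [hz] with x hx using sub_eq_zero.1 hx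

/-- The Levi form of `Φ`. -/
def lev (Φ : Cn n → ℝ) (w z : Cn n) : ℝ :=
  (∑ j, ∑ k, dz (ev j) (dzb (ev k) fun z => (Φ z : ℂ)) z * w j * conj (w k)).re

theorem Dr_cexp (hf : Sm f) (w z : Cn n) :
    Dr w (fun z => Complex.exp (f z)) z = Complex.exp (f z) * Dr w f z := by
  have := (hf.differentiableAt z).hasFDerivAt.cexp
  rw [Dr, this.fderiv]; rfl

theorem dzb_cexp (hf : Sm f) (w z : Cn n) :
    dzb w (fun z => Complex.exp (f z)) z = Complex.exp (f z) * dzb w f z := by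
  rw [dzb, Dr_cexp hf, Dr_cexp hf, dzb]; ring

theorem dz_cexp (hf : Sm f) (w z : Cn n) :
    dz w (fun z => Complex.exp (f z)) z = Complex.exp (f z) * dz w f z := by
  rw [dz, Dr_cexp hf, Dr_cexp hf, dz]; ring

theorem sm_ofReal {f : Cn n → ℝ} (hf : ContDiff ℝ ∞ f) : Sm fun z => (f z : ℂ) :=
  ofRealCLM.contDiff.comp hf

theorem conj_dzb_ofReal {f : Cn n → ℝ} (w z : Cn n) :
    conj (dzb w (fun z => (f z : ℂ)) z) = dz w (fun z => (f z : ℂ)) z := by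
  rw [← dz_conj]; simp

theorem conj_dz_dzb_ofReal {f : Cn n → ℝ} (hf : ContDiff ℝ ∞ f) (v w z : Cn n) :
    conj (dz v (dzb w fun z => (f z : ℂ)) z) = dz w (dzb v fun z => (f z : ℂ)) z := by
  rw [← dzb_conj, dz_dzb_comm (sm_ofReal hf)]
  congr 1; funext y; exact conj_dzb_ofReal w y

theorem sq_le_mul_of_forall_pos {X A B : ℝ} (hX : 0 ≤ X) (hA : 0 ≤ A) (hB : 0 ≤ B)
    (h : ∀ s : ℝ, 0 < s → 2 * X ≤ s * A + B / s) : X ^ 2 ≤ A * B := by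
  have h1 : ∀ s : ℝ, 0 ≤ A * (s * s) + (-(2 * X)) * s + B := fun s => by
    rcases le_or_gt s 0 with hs | hs
    · have := mul_nonneg hA (mul_self_nonneg s)
      nlinarith
    · have h2 := mul_le_mul_of_nonneg_right (h s hs) hs.le
      rw [add_mul, div_mul_cancel₀ _ hs.ne'] at h2
      nlinarith
  have := discrim_le_zero h1
  rw [discrim] at this
  nlinarith

/-- Hörmander's `L²` estimate. -/
theorem hormander {Φ : Cn n → ℝ} (hΦ : ContDiff ℝ ∞ Φ) {b : Cn n → ℂ} (hb : Test b) {g : Cn n → ℝ}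
    (hg : ∀ z, 0 ≤ g z) (hL : ∀ z w, 0 ≤ lev Φ w z) (hgi : Integrable fun z => g z * exp (-Φ z))
    (h : ∀ z w : Cn n, ‖∑ j, dzb (ev j) b z * conj (w j)‖ ^ 2 ≤ g z * lev Φ w z) :
    ∃ F : Cn n → ℂ, Differentiable ℂ F ∧
      Integrable (fun z => ‖b z - F z‖ ^ 2 * exp (-Φ z)) ∧
      ∫ z, ‖b z - F z‖ ^ 2 * exp (-Φ z) ≤ ∫ z, g z * exp (-Φ z) := by
  have hΦc : Sm fun z => (Φ z : ℂ) := sm_ofReal hΦ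
  set a : Fin n → Cn n → ℂ := fun j z => (1 / 2) * dzb (ev j) (fun z => (Φ z : ℂ)) z with ha_def
  have ha : ∀ j, Sm (a j) := fun j => contDiff_const.mul (hΦc.dzb _)
  have ha2 : ∀ j k z, dzb (ev k) (a j) z = dzb (ev j) (a k) z := fun j k z => by
    rw [ha_def, dzb_const_mul (hΦc.dzb _), dzb_const_mul (hΦc.dzb _), dzb_dzb_comm hΦc]
  have hhalf : ∀ c : ℂ, Sm fun z => c * (Φ z : ℂ) := fun c => contDiff_const.mul hΦc
  have hE : ∀ c : ℂ, Sm fun z => Complex.exp (c * (Φ z : ℂ)) := fun c => (hhalf c).cexp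
  set f : Cn n → ℂ := fun z => b z * Complex.exp ((-1 / 2) * (Φ z : ℂ)) with hf_def
  have hf : Test f := hb.mul' (hE _)
  have hDD : ∀ j z, DD a j f z = dzb (ev j) b z * Complex.exp ((-1 / 2) * (Φ z : ℂ)) :=
    fun j z => by
      rw [DD, hf_def, dzb_mul hb.1 (hE _), dzb_cexp (hhalf _), dzb_const_mul hΦc]
      simp only [ha_def]; ring
  have hA0 : 0 ≤ ∫ z, g z * exp (-Φ z) :=
    integral_nonneg fun z => mul_nonneg (hg z) (exp_nonneg _)
  have hexp : ∀ z, ‖Complex.exp ((-1 / 2) * (Φ z : ℂ))‖ ^ 2 = exp (-Φ z) := fun z => by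
    rw [Complex.norm_exp, ← exp_nat_mul]
    congr 1
    have : ((-1 / 2 : ℂ) * (Φ z : ℂ)) = ((-1 / 2 * Φ z : ℝ) : ℂ) := by push_cast; ring
    rw [this, ofReal_re]; push_cast; ring
  obtain ⟨u, hu, hu1, hu2⟩ := l2_estimate ha ha2 hf hA0 (fun β hβ => by
    have hM : ∀ z, (∑ j, ∑ k, (conj (dz (ev k) (a j) z) + dz (ev j) (a k) z) * β j z *
        conj (β k z)).re = lev Φ (fun j => β j z) z := fun z => by
      rw [lev]
      congr 1
      refine sum_congr rfl fun j _ => sum_congr rfl fun k _ => ?_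
      congr 2
      rw [ha_def, dz_const_mul (hΦc.dzb _), dz_const_mul (hΦc.dzb _), map_mul,
        conj_dz_dzb_ofReal hΦ]
      simp only [map_div₀, map_one, conj_ofNat]; ring
    simp_rw [hM]
    have hLi : Integrable fun z => lev Φ (fun j => β j z) z := by
      refine Integrable.re (𝕜 := ℂ) (Test.integrable ?_)
      refine Test.sum fun j _ => Test.sum fun k _ => ?_
      exact (Test.mul ((hΦc.dzb _).dz _) (hβ j)).mul' (hβ k).conj.1
    have hpt : ∀ z, ‖∑ j, β j z * conj (DD a j f z)‖ ^ 2 ≤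
        g z * exp (-Φ z) * lev Φ (fun j => β j z) z := fun z => by
      have h1 := h z fun j => β j z
      have h2 : ∑ j, β j z * conj (DD a j f z) =
          conj ((∑ j, dzb (ev j) b z * conj (β j z)) *
            Complex.exp ((-1 / 2) * (Φ z : ℂ))) := by
        rw [sum_mul, map_sum]
        refine sum_congr rfl fun j _ => ?_
        rw [hDD]; simp only [map_mul, conj_conj]; ring
      rw [h2, RCLike.norm_conj, norm_mul, mul_pow, hexp]
      calc _ ≤ g z * lev Φ (fun j => β j z) z * exp (-Φ z) := by gcongr
        _ = _ := by ring
    refine sq_le_mul_of_forall_pos (norm_nonneg _) hA0 (integral_nonneg fun z => hL z _)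
      fun s hs => ?_
    have hti : ∀ j ∈ Finset.univ, Integrable fun z => β j z * conj (DD a j f z) :=
      fun j _ => ((hβ j).mul' (hf.DD ha j).conj.1).integrable
    rw [← integral_finsetSum _ hti]
    have hni := (integrable_finsetSum _ hti).norm
    calc 2 * ‖∫ z, ∑ j, β j z * conj (DD a j f z)‖
        ≤ 2 * ∫ z, ‖∑ j, β j z * conj (DD a j f z)‖ := by
          gcongr; exact norm_integral_le_integral_norm _
      _ = ∫ z, 2 * ‖∑ j, β j z * conj (DD a j f z)‖ := (integral_const_mul _ _).symm
      _ ≤ ∫ z, (s * (g z * exp (-Φ z)) + lev Φ (fun j => β j z) z / s) := by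
          refine integral_mono (hni.const_mul 2) ((hgi.const_mul s).add (hLi.div_const s))
            fun z => ?_
          have h1 := hpt z
          have h2 := hL z fun j => β j z
          have h3 : 0 ≤ g z * exp (-Φ z) := mul_nonneg (hg z) (exp_nonneg _)
          set x := ‖∑ j, β j z * conj (DD a j f z)‖
          set p := g z * exp (-Φ z)
          set q := lev Φ (fun j => β j z) z
          change 2 * x ≤ s * p + q / s
          have h4 : q = s * (q / s) := by field_simp
          have h5 : 0 ≤ q / s := by positivity
          have h6 : x ^ 2 ≤ (s * p) * (q / s) := by
            rw [h4] at h1; linarith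
          refine abs_le_of_sq_le_sq' ?_ (by positivity) |>.2
          nlinarith [sq_nonneg (s * p - q / s)]
      _ = _ := by
          rw [integral_add (hgi.const_mul s) (hLi.div_const s), integral_const_mul,
            integral_div])
  set F : Cn n → ℂ := fun z => u z * Complex.exp ((1 / 2) * (Φ z : ℂ)) with hF_def
  have hFl : LocallyIntegrable F := by
    have h1 : LocallyIntegrable u := MemLp.locallyIntegrable_two hu
    rw [locallyIntegrable_iff] at h1 ⊢
    exact fun K hK => (h1 K hK).mul_continuousOn (hE (1 / 2)).continuous.continuousOn hK
  obtain ⟨G, hG, hGF⟩ := exists_entire_ae_eq hFl fun j η hη => by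
    have h1 := hu2 j _ (hη.conj.mul' (hE (1 / 2)))
    have h2 : ∀ z, conj (DS a j (fun z => conj (η z) *
        Complex.exp ((1 / 2) * (Φ z : ℂ))) z) =
          -(dzb (ev j) η z * Complex.exp ((1 / 2) * (Φ z : ℂ))) := fun z => by
      rw [DS, dz_mul hη.conj.1 (hE _), dz_cexp (hhalf _), dz_const_mul hΦc, dz_conj, ha_def]
      have h3 : conj ((1 / 2) * dzb (ev j) (fun z => (Φ z : ℂ)) z) =
          (1 / 2) * dz (ev j) (fun z => (Φ z : ℂ)) z := by
        rw [map_mul, conj_dzb_ofReal]; simp [conj_ofNat]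
      have h4 : conj (Complex.exp ((1 / 2) * (Φ z : ℂ))) =
          Complex.exp ((1 / 2) * (Φ z : ℂ)) := by
        rw [← Complex.exp_conj]; simp [conj_ofNat]
      simp only [h3]
      rw [show -(conj (dzb (ev j) η z) * Complex.exp ((1 / 2) * (Φ z : ℂ)) +
        conj (η z) * (Complex.exp ((1 / 2) * (Φ z : ℂ)) *
          ((1 / 2) * dz (ev j) (fun z => (Φ z : ℂ)) z))) +
        (1 / 2) * dz (ev j) (fun z => (Φ z : ℂ)) z * (conj (η z) *
          Complex.exp ((1 / 2) * (Φ z : ℂ))) =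
          -(conj (dzb (ev j) η z) * Complex.exp ((1 / 2) * (Φ z : ℂ))) by ring,
        map_neg, map_mul, conj_conj, h4]
    simp_rw [h2, mul_neg, integral_neg, neg_eq_zero] at h1
    rw [← h1]
    congr 1; funext z; rw [hF_def]; ring
  have hae : ∀ᵐ z, ‖f z - u z‖ ^ 2 = ‖b z - G z‖ ^ 2 * exp (-Φ z) := by
    filter_upwards [hGF] with z hz
    rw [← hz, ← hexp, ← mul_pow, ← norm_mul, hf_def, hF_def, sub_mul, mul_assoc (u z),
      ← Complex.exp_add]
    congr 3
    ring_nf; simp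
  refine ⟨G, hG, ?_, ?_⟩
  · refine Integrable.congr ?_ hae
    exact MemLp.integrable_norm_sq' (MemLp.sub hf.memLp hu)
  · rw [← integral_congr_ae hae]; exact hu1

theorem Dr_smul (c : ℂ) (w : Cn n) (f : Cn n → ℂ) (z : Cn n) :
    Dr (c • w) f z = c.re * Dr w f z + c.im * Dr (I • w) f z := by
  have : c • w = c.re • w + c.im • (I • w) := by
    rw [← Complex.coe_smul, ← Complex.coe_smul, smul_smul, ← add_smul, re_add_im]
  rw [Dr, this, map_add, map_smul, map_smul]
  simp only [Complex.real_smul]; rfl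

theorem Dr_I_smul_I_smul (w : Cn n) (f : Cn n → ℂ) (z : Cn n) :
    Dr (I • (I • w)) f z = -Dr w f z := by
  rw [smul_smul, I_mul_I, neg_one_smul, Dr, map_neg]; rfl

theorem dz_smul (c : ℂ) (w : Cn n) (f : Cn n → ℂ) (z : Cn n) :
    dz (c • w) f z = c * dz w f z := by
  rw [dz, smul_comm I c w, Dr_smul c w, Dr_smul c (I • w), Dr_I_smul_I_smul, dz]
  conv_rhs => rw [← re_add_im c]
  linear_combination (1 / 2 * (c.im : ℂ) * Dr (I • w) f z) * I_mul_I

theorem dzb_smul (c : ℂ) (w : Cn n) (f : Cn n → ℂ) (z : Cn n) :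
    dzb (c • w) f z = conj c * dzb w f z := by
  have h := dz_smul c w (fun z => conj (f z)) z
  rw [dz_conj, dz_conj] at h
  have h2 := congrArg (conj) h
  simpa using h2

theorem Dr_sum_left {ι : Type*} (s : Finset ι) (w : ι → Cn n) (f : Cn n → ℂ) (z : Cn n) :
    Dr (∑ i ∈ s, w i) f z = ∑ i ∈ s, Dr (w i) f z := by
  simp only [Dr, map_sum]

theorem eq_sum_ev (w : Cn n) : w = ∑ j, w j • ev j := by
  funext i; simp [ev, Finset.sum_apply, Pi.single_apply]

theorem dz_eq_sum (w : Cn n) (f : Cn n → ℂ) (z : Cn n) :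
    dz w f z = ∑ j, w j * dz (ev j) f z := by
  have : dz w f z = ∑ j, dz (w j • ev j) f z := by
    conv_lhs => rw [eq_sum_ev w]
    simp only [dz, Finset.smul_sum, Dr_sum_left]
    rw [mul_sum, ← sum_sub_distrib, mul_sum]
  rw [this]
  exact sum_congr rfl fun j _ => dz_smul _ _ _ _

theorem dzb_eq_sum (w : Cn n) (f : Cn n → ℂ) (z : Cn n) :
    dzb w f z = ∑ j, conj (w j) * dzb (ev j) f z := by
  have : dzb w f z = ∑ j, dzb (w j • ev j) f z := by
    conv_lhs => rw [eq_sum_ev w]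
    simp only [dzb, Finset.smul_sum, Dr_sum_left]
    rw [mul_sum, ← sum_add_distrib, mul_sum]
  rw [this]
  exact sum_congr rfl fun j _ => dzb_smul _ _ _ _

theorem lev_eq {Φ : Cn n → ℝ} (hΦ : ContDiff ℝ ∞ Φ) (w z : Cn n) :
    lev Φ w z = (dz w (dzb w fun z => (Φ z : ℂ)) z).re := by
  have hc := sm_ofReal hΦ
  rw [lev, dz_eq_sum]
  congr 1
  refine sum_congr rfl fun j _ => ?_
  rw [dz_dzb_comm hc, dzb_eq_sum, mul_sum]
  refine sum_congr rfl fun k _ => ?_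
  rw [dz_dzb_comm hc]; ring

theorem lev_eq_Dr {Φ : Cn n → ℝ} (hΦ : ContDiff ℝ ∞ Φ) (w z : Cn n) :
    lev Φ w z = (1 / 4) * ((Dr w (Dr w fun z => (Φ z : ℂ)) z).re +
      (Dr (I • w) (Dr (I • w) fun z => (Φ z : ℂ)) z).re) := by
  have hc := sm_ofReal hΦ
  rw [lev_eq hΦ, dz, Dr_dzb hc, Dr_dzb hc, Dr_comm hc (I • w) w]
  set x := Dr w (Dr w fun z => (Φ z : ℂ)) z
  set y := Dr (I • w) (Dr (I • w) fun z => (Φ z : ℂ)) z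
  have : (1 / 2 : ℂ) * ((1 / 2) * (x + I * Dr w (Dr (I • w) fun z => (Φ z : ℂ)) z) -
      I * ((1 / 2) * (Dr w (Dr (I • w) fun z => (Φ z : ℂ)) z + I * y))) =
      ((1 / 4 : ℝ) : ℂ) * (x + y) := by
    push_cast
    linear_combination (-(1 / 4) * y) * I_mul_I
  rw [this, re_ofReal_mul, add_re]

theorem lev_add {Φ Ψ : Cn n → ℝ} (hΦ : ContDiff ℝ ∞ Φ) (hΨ : ContDiff ℝ ∞ Ψ) (w z : Cn n) :
    lev (fun z => Φ z + Ψ z) w z = lev Φ w z + lev Ψ w z := by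
  rw [lev_eq (hΦ.add hΨ), lev_eq hΦ, lev_eq hΨ, ← add_re,
    ← dz_add ((sm_ofReal hΦ).dzb w) ((sm_ofReal hΨ).dzb w)]
  congr 2
  funext y
  rw [← dzb_add (sm_ofReal hΦ) (sm_ofReal hΨ)]
  simp

theorem lev_const_mul {Φ : Cn n → ℝ} (hΦ : ContDiff ℝ ∞ Φ) (c : ℝ) (w z : Cn n) :
    lev (fun z => c * Φ z) w z = c * lev Φ w z := by
  rw [lev_eq (contDiff_const.mul hΦ), lev_eq hΦ, ← re_ofReal_mul,
    ← dz_const_mul ((sm_ofReal hΦ).dzb w)]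
  congr 2
  funext y
  rw [← dzb_const_mul (sm_ofReal hΦ)]
  simp

theorem dzb_comp_real {q q' : ℝ → ℝ} (hq : ∀ x, HasDerivAt q (q' x) x) {ψ : Cn n → ℝ}
    (hψ : ContDiff ℝ ∞ ψ) (w z : Cn n) :
    dzb w (fun z => ((q (ψ z) : ℝ) : ℂ)) z = (q' (ψ z) : ℂ) * dzb w (fun z => (ψ z : ℂ)) z := by
  have key : ∀ w, Dr w (fun z => ((q (ψ z) : ℝ) : ℂ)) z = (q' (ψ z) : ℂ) * Dr w (fun z => (ψ z : ℂ)) z := by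
    intro w
    have h1 : HasFDerivAt ψ (fderiv ℝ ψ z) z :=
      ((hψ.differentiable (by simp)).differentiableAt).hasFDerivAt
    have h2 := (hq (ψ z)).hasFDerivAt.comp z h1
    have h3 : HasFDerivAt (fun z => ((q (ψ z) : ℝ) : ℂ)) _ z :=
      ofRealCLM.hasFDerivAt.comp z h2
    have h4 : HasFDerivAt (fun z => (ψ z : ℂ)) _ z := ofRealCLM.hasFDerivAt.comp z h1
    rw [Dr, h3.fderiv, Dr, h4.fderiv]
    simp [mul_comm]
  rw [dzb, dzb, key, key]; ring

theorem lev_comp {q q' q'' : ℝ → ℝ} (hq : ∀ x, HasDerivAt q (q' x) x)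
    (hq' : ∀ x, HasDerivAt q' (q'' x) x) (hqs : ContDiff ℝ ∞ q) (hqs' : ContDiff ℝ ∞ q')
    {ψ : Cn n → ℝ} (hψ : ContDiff ℝ ∞ ψ) (w z : Cn n) :
    lev (fun z => q (ψ z)) w z =
      q' (ψ z) * lev ψ w z + q'' (ψ z) * ‖dzb w (fun z => (ψ z : ℂ)) z‖ ^ 2 := by
  rw [lev_eq (Φ := fun z => q (ψ z)) (hqs.comp hψ), lev_eq hψ]
  have h1 : (dzb w fun z => ((q (ψ z) : ℝ) : ℂ)) =
      fun z => ((q' (ψ z) : ℝ) : ℂ) * dzb w (fun z => (ψ z : ℂ)) z := by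
    funext y; exact dzb_comp_real hq hψ w y
  have h2 : dz w (fun z => ((q' (ψ z) : ℝ) : ℂ)) z =
      (q'' (ψ z) : ℂ) * conj (dzb w (fun z => (ψ z : ℂ)) z) := by
    rw [← conj_dzb_ofReal, dzb_comp_real hq' hψ]; simp
  rw [h1, dz_mul (sm_ofReal (f := fun z => q' (ψ z)) (hqs'.comp hψ)) ((sm_ofReal hψ).dzb w), h2, mul_assoc,
    mul_comm (conj _), mul_conj, normSq_eq_norm_sq, add_re,
    re_ofReal_mul, re_ofReal_mul, ofReal_re]
  ring

theorem contDiff_sum_norm_sq : ContDiff ℝ ∞ fun z : Cn n => ∑ j, ‖z j‖ ^ 2 :=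
  ContDiff.sum fun j _ => (contDiff_norm_sq ℝ).comp (contDiff_apply ℝ ℂ j)

theorem Dr_coord (j : Fin n) (w z : Cn n) : Dr w (fun z => z j) z = w j := by
  have : HasFDerivAt (fun z : Cn n => z j) (proj (R := ℝ) j) z :=
    (proj (R := ℝ) (φ := fun _ : Fin n => ℂ) j).hasFDerivAt
  rw [Dr, this.fderiv]; rfl

theorem lev_sum_norm_sq (w z : Cn n) : lev (fun z => ∑ j, ‖z j‖ ^ 2) w z = ∑ j, ‖w j‖ ^ 2 := by
  have hs : ∀ j : Fin n, Sm fun z : Cn n => z j := fun j => contDiff_apply ℝ ℂ j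
  have h1 : ∀ j z, dzb w (fun z : Cn n => z j) z = 0 := fun j z => by
    rw [dzb, Dr_coord, Dr_coord]
    simp [← mul_assoc]
  have h2 : ∀ j z, dz w (fun z : Cn n => z j) z = w j := fun j z => by
    rw [dz, Dr_coord, Dr_coord]
    simp [← mul_assoc]; ring
  have h3 : ∀ j z, dzb w (fun z : Cn n => ((‖z j‖ ^ 2 : ℝ) : ℂ)) z =
      conj (w j) * z j := fun j z => by
    have : (fun z : Cn n => ((‖z j‖ ^ 2 : ℝ) : ℂ)) = fun z => z j * conj (z j) := by
      funext z; rw [mul_conj, normSq_eq_norm_sq]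
    rw [this, dzb_mul (hs j) (hs j).conj, h1, dzb_conj, h2]; ring
  have hj : ∀ j : Fin n, ContDiff ℝ ∞ fun z : Cn n => ‖z j‖ ^ 2 := fun j =>
    (contDiff_norm_sq ℝ).comp (contDiff_apply ℝ ℂ j)
  have h4 : ∀ j, lev (fun z : Cn n => ‖z j‖ ^ 2) w z = ‖w j‖ ^ 2 := fun j => by
    rw [lev_eq (hj j), show (dzb w fun z : Cn n => ((‖z j‖ ^ 2 : ℝ) : ℂ)) =
      fun z => conj (w j) * z j from funext fun z => h3 j z, dz_const_mul (hs j), h2,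
      mul_comm, mul_conj, normSq_eq_norm_sq, ofReal_re]
  have h5 : ∀ s : Finset (Fin n), lev (fun z => ∑ j ∈ s, ‖z j‖ ^ 2) w z = ∑ j ∈ s, ‖w j‖ ^ 2 := by
    intro s
    classical
    induction s using Finset.induction_on with
    | empty =>
      have := lev_const_mul (contDiff_const (c := (0 : ℝ)) : ContDiff ℝ ∞ fun _ : Cn n => (0 : ℝ)) 0 w z
      simpa using this
    | insert a s ha ih =>
      simp_rw [sum_insert ha]
      rw [lev_add (hj a) (ContDiff.sum fun j _ => hj j), h4, ih]
  exact h5 _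

theorem RPsh.measurable (hv : RPsh v univ) : Measurable v := by
  have := hv.usc.measurable_indicator MeasurableSet.univ
  rwa [indicator_univ] at this

theorem RPsh.locallyIntegrable (hv : RPsh v univ) :
    LocallyIntegrable fun z => (v z : ℂ) := by
  intro x
  refine ⟨ball x 1, ball_mem_nhds x one_pos, ?_⟩
  exact (hv.integrableOn_ball (subset_univ _)).ofReal

/-- The average of `v` against the kernel `k`. -/
def mol (v k : Cn n → ℝ) (x : Cn n) : ℝ := ∫ y, v (x + y) * k y

theorem mol_eq_cv (v : Cn n → ℝ) (hk : Ker ε k) (x : Cn n) :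
    (mol v k x : ℂ) = cv (fun z => (v z : ℂ)) (fun y => (k y : ℂ)) x := by
  unfold cv mol
  rw [← integral_complex_ofReal]
  refine Eq.trans ?_ (integral_add_left_eq_self (fun t => (v t : ℂ) * (k (x - t) : ℂ)) x)
  congr 1; funext y
  rw [show x - (x + y) = -y by abel]
  simp only [hk.even]
  push_cast; rfl

theorem contDiff_mol (hv : RPsh v univ) (hk : Ker ε k) :
    ContDiff ℝ ∞ (mol v k) := by
  have : mol v k = fun x => (cv (fun z => (v z : ℂ)) (fun y => (k y : ℂ)) x).re := by
    funext x; rw [← mol_eq_cv v hk, ofReal_re]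
  rw [this]
  exact reCLM.contDiff.comp (Sm.cv hv.locallyIntegrable hk.test)

theorem le_mol (hv : RPsh v univ) (hk : Ker ε k) (x : Cn n) : v x ≤ mol v k x := by
  have := hv.mul_integral_le (subset_univ (closedBall x ε))
    hk.smooth.continuous.measurable hk.integrable hk.nonneg hk.supp hk.inv
  rwa [hk.int_one, mul_one] at this

theorem mol_integrable (hv : RPsh v univ) (hk : Ker ε k) (x : Cn n) :
    Integrable fun y => v (x + y) * k y := by
  obtain ⟨B, hB⟩ := hv.exists_abs_le (isCompact_closedBall x ε) (subset_univ _)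
  refine (hk.integrable.const_mul B).mono'
    ((hv.measurable.comp (measurable_const_add x)).mul
      hk.smooth.continuous.measurable).aestronglyMeasurable (ae_of_all _ fun y => ?_)
  rw [norm_mul, norm_eq_abs, norm_eq_abs, abs_of_nonneg (hk.nonneg y)]
  by_cases h : k y = 0
  · simp [h]
  · exact mul_le_mul_of_nonneg_right (hB _ (by simpa using hk.supp y h)) (hk.nonneg y)

theorem mol_le (hv : RPsh v univ) (hk : Ker ε k) {x : Cn n} {M : ℝ}
    (hM : ∀ y, ‖y‖ ≤ ε → v (x + y) ≤ M) : mol v k x ≤ M := by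
  calc mol v k x ≤ ∫ y, M * k y := by
        refine integral_mono (mol_integrable hv hk x) (hk.integrable.const_mul M) fun y => ?_
        by_cases h : k y = 0
        · simp [h]
        · exact mul_le_mul_of_nonneg_right (hM y (hk.supp y h)) (hk.nonneg y)
    _ = M := by rw [integral_const_mul, hk.int_one, mul_one]

theorem subAt_mol (hv : RPsh v univ) (hk : Ker ε k) (x : Cn n) : SubAt (mol v k) x := by
  intro w
  refine ⟨1, one_pos, fun r hr _ => ?_⟩
  obtain ⟨B, hB⟩ := hv.exists_abs_le (isCompact_closedBall x (r * ‖w‖ + ε)) (subset_univ _)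
  set μ : Measure ℝ := volume.restrict (Ioc 0 (2 * Real.pi)) with hμ
  set G : Cn n × ℝ → ℝ := fun q => v (x + circleMap 0 r q.2 • w + q.1) * k q.1 with hG
  have hGm : Measurable G := by
    have h1 : Measurable fun q : Cn n × ℝ => x + circleMap 0 r q.2 • w + q.1 :=
      Continuous.measurable (by fun_prop)
    exact (hv.measurable.comp h1).mul (hk.smooth.continuous.measurable.comp measurable_fst)
  have hGi : Integrable G (volume.prod μ) := by
    refine (hk.integrable.mul_prod (integrable_const B : Integrable (fun _ => B) μ)).mono'
      hGm.aestronglyMeasurable (ae_of_all _ fun q => ?_)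
    simp only [hG, norm_mul, norm_eq_abs, abs_of_nonneg (hk.nonneg _)]
    rw [mul_comm]
    by_cases h : k q.1 = 0
    · simp [h]
    refine mul_le_mul_of_nonneg_left (hB _ ?_) (hk.nonneg _)
    have h1 := hk.supp _ h
    rw [mem_closedBall, dist_eq_norm, add_assoc, add_sub_cancel_left]
    refine (norm_add_le _ _).trans ?_
    rw [norm_smul, norm_circleMap_zero, abs_of_pos hr]
    linarith
  have hswap : ∫ y, ∫ θ, G (y, θ) ∂μ = ∫ θ, (∫ y, G (y, θ)) ∂μ := integral_integral_swap hGi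
  have hpt : ∀ y, (2 * Real.pi) * (v (x + y) * k y) ≤ ∫ θ, G (y, θ) ∂μ := fun y => by
    have h1 := hv.le_circleAverage' (z := x + y) (w := w) hr.le fun _ _ => mem_univ _
    rw [circleAverage, smul_eq_mul, inv_mul_eq_div, le_div_iff₀ (by positivity),
      intervalIntegral.integral_of_le (by positivity)] at h1
    have h2 : ∫ θ, G (y, θ) ∂μ = (∫ θ, v (x + y + circleMap 0 r θ • w) ∂μ) * k y := by
      rw [← integral_mul_const]
      congr 1; funext θ
      simp only [hG]; congr 2; abel
    rw [h2]
    nlinarith [hk.nonneg y]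
  have h3 : (2 * Real.pi) * mol v k x ≤ ∫ y, ∫ θ, G (y, θ) ∂μ := by
    unfold mol
    rw [← integral_const_mul]
    exact integral_mono ((mol_integrable hv hk x).const_mul _) hGi.integral_prod_left hpt
  rw [circleAverage, smul_eq_mul, inv_mul_eq_div, le_div_iff₀ (by positivity),
    intervalIntegral.integral_of_le (by positivity), mul_comm]
  rw [hswap] at h3
  exact h3

theorem le_of_deriv2_le {s s' s'' : ℝ → ℝ} {K : ℝ} (h1 : ∀ t, HasDerivAt s (s' t) t)
    (h2 : ∀ t, HasDerivAt s' (s'' t) t) (hK : ∀ t ∈ Icc (0 : ℝ) 1, s'' t ≤ K) :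
    s 1 ≤ s 0 + s' 0 + K / 2 := by
  have a1 : ∀ t ∈ Icc (0 : ℝ) 1, s' t ≤ s' 0 + K * t := by
    intro t ht
    refine image_le_of_deriv_right_le_deriv_boundary (f := s') (f' := s'') (a := 0) (b := 1)
      (B := fun t => s' 0 + K * t) (B' := fun _ => K)
      (fun t _ => (h2 t).continuousAt.continuousWithinAt) (fun t _ => (h2 t).hasDerivWithinAt)
      (by simp) (by fun_prop) (fun t _ => ?_)
      (fun t ht => hK t ⟨ht.1, ht.2.le⟩) ht
    have := ((hasDerivAt_id t).const_mul K).const_add (s' 0)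
    simpa using this.hasDerivWithinAt
  refine (image_le_of_deriv_right_le_deriv_boundary (f := s) (f' := s') (a := 0) (b := 1)
      (B := fun t => s 0 + s' 0 * t + K / 2 * t ^ 2) (B' := fun t => s' 0 + K * t)
      (fun t _ => (h1 t).continuousAt.continuousWithinAt) (fun t _ => (h1 t).hasDerivWithinAt)
      (by simp) (by fun_prop) (fun t _ => ?_)
      (fun t ht => a1 t ⟨ht.1, ht.2.le⟩) (right_mem_Icc.2 zero_le_one)).trans (by norm_num)
  have := (((hasDerivAt_id t).const_mul (s' 0)).const_add (s 0)).add
    (((hasDerivAt_id t).pow 2).const_mul (K / 2))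
  refine (this.congr_deriv ?_).hasDerivWithinAt
  simp; ring

/-- The sub-mean value property implies nonnegativity of the Levi form. -/
theorem lev_nonneg {h : Cn n → ℝ} (hh : ContDiff ℝ ∞ h) (hs : SubAt h z) (w : Cn n) : 0 ≤ lev h w z := by
  have hc := sm_ofReal hh
  set H : Cn n → ℂ := fun z => (h z : ℂ) with hH
  set J := I • w with hJ
  have hA : ∀ v v' : Cn n, Continuous fun y => (Dr v (Dr v' H) y).re := fun v v' =>
    continuous_re.comp ((hc.Dr v').Dr v).continuous
  set A := (Dr w (Dr w H) z).re with hAdef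
  set B := (Dr w (Dr J H) z).re with hBdef
  set C := (Dr J (Dr J H) z).re with hCdef
  rw [lev_eq_Dr hh]
  change 0 ≤ (1 / 4) * (A + C)
  have main : ∀ η > 0, 0 ≤ (A + C) / 4 + η := by
    intro η hη
    have ev1 : ∀ᶠ y in 𝓝 z, (Dr w (Dr w H) y).re < A + η ∧ |(Dr w (Dr J H) y).re - B| < η ∧
        (Dr J (Dr J H) y).re < C + η := by
      refine ((hA w w).continuousAt.eventually (gt_mem_nhds (by linarith))).and
        (Eventually.and ?_ ((hA J J).continuousAt.eventually (gt_mem_nhds (by linarith))))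
      have := continuousAt_iff'.1 ((hA w J).continuousAt (x := z)) η hη
      simpa [dist_eq] using this
    obtain ⟨ρ, hρ, hball⟩ := Metric.eventually_nhds_iff.1 ev1
    obtain ⟨ε, hε, hsub⟩ := hs w
    have hW : 0 < ‖w‖ + 1 := by positivity
    set r := min (ε / 2) (ρ / (‖w‖ + 1)) with hr
    have hr0 : 0 < r := lt_min (by positivity) (by positivity)
    have hrρ : r * ‖w‖ < ρ := by
      have : r ≤ ρ / (‖w‖ + 1) := min_le_right _ _
      rw [le_div_iff₀ hW] at this
      nlinarith
    have hle := hsub r hr0 ((min_le_left _ _).trans_lt (by linarith))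
    set P : ℂ → ℂ := fun ζ => ((Dr w H z).re - I * (Dr J H z).re) * ζ +
      (((A - C) / 4 : ℝ) - I * ((B / 2 : ℝ) : ℂ)) * ζ ^ 2 with hP
    have hpt : ∀ ζ : ℂ, ‖ζ‖ = r → h (z + ζ • w) ≤ (P ζ).re + (h z + ((A + C) / 4 + η) * r ^ 2) := by
      intro ζ hζ
      have hd : ∀ (f : Cn n → ℂ), Sm f → ∀ t : ℝ, HasDerivAt (fun t : ℝ => (f (z + t • (ζ • w))).re)
          ((Dr (ζ • w) f (z + t • (ζ • w))).re) t := by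
        intro f hf t
        have e1 : HasDerivAt (fun t : ℝ => z + t • (ζ • w)) (ζ • w) t := by
          have := ((hasDerivAt_id t).smul_const (ζ • w)).const_add z
          simpa using this
        have e2 : HasDerivAt (fun t : ℝ => f (z + t • (ζ • w))) _ t :=
          (hf.differentiableAt _).hasFDerivAt.comp_hasDerivAt t e1
        exact reCLM.hasFDerivAt.comp_hasDerivAt t e2
      have hDr2 : ∀ y, (Dr (ζ • w) (Dr (ζ • w) H) y).re = ζ.re ^ 2 * (Dr w (Dr w H) y).re +
          2 * (ζ.re * ζ.im) * (Dr w (Dr J H) y).re + ζ.im ^ 2 * (Dr J (Dr J H) y).re := by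
        intro y
        have e1 : Dr (ζ • w) H = fun y => (ζ.re : ℂ) * Dr w H y + (ζ.im : ℂ) * Dr J H y :=
          funext fun y => Dr_smul ζ w H y
        have e2 : ∀ v, Dr v (Dr (ζ • w) H) y = ζ.re * Dr v (Dr w H) y + ζ.im * Dr v (Dr J H) y := by
          intro v
          rw [e1, Dr_add (contDiff_const.mul (hc.Dr w)) (contDiff_const.mul (hc.Dr J)),
            Dr_const_mul (hc.Dr w), Dr_const_mul (hc.Dr J)]
        rw [Dr_smul, e2, e2, Dr_comm hc (I • w) w]
        simp only [add_re, re_ofReal_mul]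
        ring
      have hζ2 : ζ.re ^ 2 + ζ.im ^ 2 = r ^ 2 := by
        rw [← hζ, ← normSq_eq_norm_sq, Complex.normSq_apply]; ring
      have hK : ∀ t ∈ Icc (0 : ℝ) 1, (Dr (ζ • w) (Dr (ζ • w) H) (z + t • (ζ • w))).re ≤
          ζ.re ^ 2 * A + 2 * (ζ.re * ζ.im) * B + ζ.im ^ 2 * C + 2 * η * r ^ 2 := by
        intro t ht
        obtain ⟨b1, b2, b3⟩ := hball (y := z + t • (ζ • w)) (by
          rw [dist_eq_norm, add_sub_cancel_left, norm_smul, norm_smul, hζ, norm_eq_abs,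
            abs_of_nonneg ht.1]
          refine lt_of_le_of_lt ?_ hrρ
          exact mul_le_of_le_one_left (by positivity) ht.2)
        rw [hDr2]
        set a' := (Dr w (Dr w H) (z + t • (ζ • w))).re
        set b' := (Dr w (Dr J H) (z + t • (ζ • w))).re
        set c' := (Dr J (Dr J H) (z + t • (ζ • w))).re
        have f1 : ζ.re ^ 2 * a' ≤ ζ.re ^ 2 * (A + η) := by gcongr
        have f3 : ζ.im ^ 2 * c' ≤ ζ.im ^ 2 * (C + η) := by gcongr
        have f2 : 2 * (ζ.re * ζ.im) * (b' - B) ≤ r ^ 2 * η := by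
          have g1 : |2 * (ζ.re * ζ.im) * (b' - B)| ≤ r ^ 2 * η := by
            rw [abs_mul]
            refine mul_le_mul ?_ b2.le (abs_nonneg _) (by positivity)
            rw [abs_le, ← hζ2]
            constructor <;> nlinarith [sq_nonneg (ζ.re - ζ.im), sq_nonneg (ζ.re + ζ.im)]
          exact (le_abs_self _).trans g1
        nlinarith
      have key := le_of_deriv2_le (hd H hc) (hd _ (hc.Dr (ζ • w))) hK
      simp only [one_smul, zero_smul, add_zero] at key
      have hP' : (P ζ).re = (Dr (ζ • w) H z).re +
          (A - C) / 4 * (ζ.re ^ 2 - ζ.im ^ 2) + B * (ζ.re * ζ.im) := by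
        rw [Dr_smul]
        simp only [hP, pow_two, add_re, sub_re, Complex.mul_re, Complex.mul_im,
          ofReal_re, Complex.ofReal_im, Complex.I_re, Complex.I_im, Complex.sub_im]
        ring
      rw [hP', hH] at *
      simp only [ofReal_re] at key
      refine key.trans (le_of_eq ?_)
      linear_combination ((A + C) / 4) * hζ2
    have hPd : Differentiable ℂ P := by
      rw [hP]; fun_prop
    have havg : circleAverage (fun ζ : ℂ => h (z + ζ • w)) 0 r ≤
        circleAverage (fun ζ => (P ζ).re + (h z + ((A + C) / 4 + η) * r ^ 2)) 0 r := by
      refine circleAverage_mono ?_ ?_ fun ζ hζ => hpt ζ (by simpa [abs_of_pos hr0] using hζ)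
      · exact ((hh.continuous.comp (continuous_line z w)).continuousOn).circleIntegrable'
      · exact ((continuous_re.comp hPd.continuous).add continuous_const).continuousOn.circleIntegrable'
    have hc1 : circleAverage (fun ζ => (P ζ).re + (h z + ((A + C) / 4 + η) * r ^ 2)) 0 r =
        h z + ((A + C) / 4 + η) * r ^ 2 := by
      have := circleAverage_re_of_entire (p := fun ζ => P ζ + ((h z + ((A + C) / 4 + η) * r ^ 2 : ℝ) : ℂ))
        (hPd.add_const _) 0 r
      simp only [add_re, ofReal_re] at this
      rw [this]; simp [hP]
    rw [hc1] at havg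
    have h5 : 0 ≤ ((A + C) / 4 + η) * r ^ 2 := by linarith
    by_contra hneg
    push Not at hneg
    nlinarith [pow_pos hr0 2]
  have : 0 ≤ (A + C) / 4 := le_of_forall_pos_le_add main
  linarith

theorem deriv_smoothTransition_ne_zero {x : ℝ} (h : deriv smoothTransition x ≠ 0) :
    0 < x ∧ x < 1 := by
  constructor
  · by_contra hx
    refine h (IsLocalMin.deriv_eq_zero (Eventually.of_forall fun y => ?_))
    rw [smoothTransition.zero_of_nonpos (not_lt.1 hx)]
    exact smoothTransition.nonneg y
  · by_contra hx
    refine h (IsLocalMax.deriv_eq_zero (Eventually.of_forall fun y => ?_))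
    rw [smoothTransition.one_of_one_le (not_lt.1 hx)]
    exact smoothTransition.le_one y

theorem exists_deriv_smoothTransition_bound :
    ∃ C : ℝ, 0 < C ∧ ∀ x, |deriv smoothTransition x| ≤ C := by
  have hc : Continuous (deriv smoothTransition) :=
    (smoothTransition.contDiff (n := 1)).continuous_deriv (by simp)
  obtain ⟨C, hC⟩ := isCompact_Icc.exists_bound_of_continuousOn (s := Icc (0 : ℝ) 1)
    hc.continuousOn
  refine ⟨max C 1, by positivity, fun x => ?_⟩
  by_cases h : deriv smoothTransition x = 0
  · rw [h]; simp
  · obtain ⟨h0, h1⟩ := deriv_smoothTransition_ne_zero h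
    exact (hC x ⟨h0.le, h1.le⟩).trans (le_max_left _ _)

/-- The convex increasing function `s + log (1 + e^{s+t}) / (1 + t)`. -/
def qf (t s : ℝ) : ℝ := s + (1 + t)⁻¹ * log (1 + exp (s + t))

theorem qf_ge (ht : 0 ≤ t) (s : ℝ) : s ≤ qf t s := by
  have : 0 ≤ log (1 + exp (s + t)) := log_nonneg (by linarith [exp_pos (s + t)])
  unfold qf
  have : 0 ≤ (1 + t)⁻¹ * log (1 + exp (s + t)) := by positivity
  linarith

theorem qf_le {t s : ℝ} (ht : 0 ≤ t) (hs : s ≤ 0) : qf t s ≤ s + 1 := by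
  have h1 : log (1 + exp (s + t)) ≤ 1 + t := by
    rw [log_le_iff_le_exp (by positivity), exp_add 1]
    have h2 : exp (s + t) ≤ exp t := exp_le_exp.2 (by linarith)
    have h3 : 1 ≤ exp t := one_le_exp ht
    have h4 : (2 : ℝ) ≤ exp 1 := by linarith [add_one_le_exp (1 : ℝ)]
    nlinarith
  have h2 : (1 + t)⁻¹ * log (1 + exp (s + t)) ≤ 1 := by
    rw [inv_mul_le_iff₀ (by linarith)]; linarith
  unfold qf; linarith

theorem contDiff_qf (t : ℝ) : ContDiff ℝ ∞ (qf t) := by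
  unfold qf
  refine contDiff_id.add (contDiff_const.mul (ContDiff.log ?_ fun x => by positivity))
  exact contDiff_const.add (contDiff_exp.comp (contDiff_id.add contDiff_const))

def qf' (t s : ℝ) : ℝ := 1 + (1 + t)⁻¹ * (exp (s + t) / (1 + exp (s + t)))

def qf'' (t s : ℝ) : ℝ := (1 + t)⁻¹ * (exp (s + t) / (1 + exp (s + t)) ^ 2)

theorem hasDerivAt_exp_add (t s : ℝ) :
    HasDerivAt (fun s => exp (s + t)) (exp (s + t)) s := by
  simpa using ((hasDerivAt_id s).add_const t).exp

theorem hasDerivAt_qf (t s : ℝ) : HasDerivAt (qf t) (qf' t s) s := by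
  have h := ((hasDerivAt_exp_add t s).const_add 1).log (by positivity)
  exact (hasDerivAt_id s).add (h.const_mul _)

theorem hasDerivAt_qf' (t s : ℝ) : HasDerivAt (qf' t) (qf'' t s) s := by
  have h := ((hasDerivAt_exp_add t s).div ((hasDerivAt_exp_add t s).const_add 1) (by positivity))
  refine ((h.const_mul (1 + t)⁻¹).const_add 1).congr_deriv ?_
  unfold qf''
  congr 2
  ring

theorem contDiff_qf' (t : ℝ) : ContDiff ℝ ∞ (qf' t) := by
  unfold qf'
  have : ContDiff ℝ ∞ fun s => exp (s + t) :=
    contDiff_exp.comp (contDiff_id.add contDiff_const)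
  exact contDiff_const.add (contDiff_const.mul (this.div (contDiff_const.add this)
    fun x => by positivity))

theorem qf''_ge {t s : ℝ} (ht : 0 ≤ t) (h0 : -1 ≤ s + t) (h1 : s + t ≤ 0) :
    (1 + t)⁻¹ * (exp (-1) / 4) ≤ qf'' t s := by
  unfold qf''
  have h2 : exp (s + t) ≤ 1 := exp_le_one_iff.2 h1
  have h3 : exp (-1) ≤ exp (s + t) := exp_le_exp.2 h0
  have h4 := exp_pos (s + t)
  gcongr
  nlinarith

theorem lev_qf_add {ψ η : Cn n → ℝ} (hψ : ContDiff ℝ ∞ ψ) (hη : ContDiff ℝ ∞ η) (w z : Cn n) :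
    lev (fun z => qf t (ψ z) + η z) w z = qf' t (ψ z) * lev ψ w z +
      qf'' t (ψ z) * ‖dzb w (fun z => (ψ z : ℂ)) z‖ ^ 2 + lev η w z := by
  rw [lev_add (Φ := fun z => qf t (ψ z)) ((contDiff_qf t).comp hψ) hη]
  congr 1
  exact lev_comp (hasDerivAt_qf t) (hasDerivAt_qf' t) (contDiff_qf t) (contDiff_qf' t) hψ w z

/-- The one-step estimate: correcting `χ(ψ) h` to an entire function. -/
theorem exists_entire_step : ∃ K : ℝ, 0 < K ∧ ∀ (n : ℕ) (t L : ℝ) (ψ η : Cn n → ℝ) (h : Cn n → ℂ),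
    0 ≤ t → ContDiff ℝ ∞ ψ → ContDiff ℝ ∞ η → Test h →
    (∀ w z, 0 ≤ lev ψ w z) → (∀ w z, ∑ j, ‖w j‖ ^ 2 ≤ lev η w z) → (∀ z, 0 ≤ η z) →
    (∀ z j, dzb (ev j) h z ≠ 0 → L ≤ ψ z + η z) →
    ∃ F : Cn n → ℂ, Differentiable ℂ F ∧
      Integrable (fun z => ‖(smoothTransition (-ψ z - t) : ℂ) * h z - F z‖ ^ 2 *
        exp (-(qf t (ψ z) + η z))) ∧
      ∫ z, ‖(smoothTransition (-ψ z - t) : ℂ) * h z - F z‖ ^ 2 *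
        exp (-(qf t (ψ z) + η z)) ≤
      K * (1 + t) * exp t * (∫ z in {z | ψ z < -t}, ‖h z‖ ^ 2) +
        2 * exp (-L) * ∫ z, ∑ j, ‖dzb (ev j) h z‖ ^ 2 := by
  obtain ⟨C, hC, hCb⟩ := exists_deriv_smoothTransition_bound
  set c : ℝ := exp (-1) / 4 with hc
  have hc0 : 0 < c := by positivity
  refine ⟨2 / c * C ^ 2 * exp 1, by positivity, ?_⟩
  intro n t L ψ η h ht hψ hη hh hψl hηl hη0 hL
  have h1t : 0 < 1 + t := by linarith
  set χ : ℝ → ℝ := fun s => smoothTransition (-s - t) with hχ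
  set χ' : ℝ → ℝ := fun s => -deriv smoothTransition (-s - t) with hχ'
  have hχd : ∀ s, HasDerivAt χ (χ' s) s := by
    intro s
    have e1 : HasDerivAt smoothTransition (deriv smoothTransition (-s - t)) (-s - t) :=
      ((smoothTransition.contDiff (n := 1)).differentiable (by simp)).differentiableAt.hasDerivAt
    have e2 : HasDerivAt (fun s : ℝ => -s - t) (-1) s := ((hasDerivAt_id s).neg).sub_const t
    refine (e1.comp s e2).congr_deriv ?_
    simp [hχ']
  have hχs : ContDiff ℝ ∞ χ :=
    smoothTransition.contDiff.comp (contDiff_id.neg.sub contDiff_const)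
  have hχ'c : Continuous χ' := by
    have : Continuous (deriv smoothTransition) :=
      (smoothTransition.contDiff (n := 1)).continuous_deriv (by simp)
    exact (this.comp (by fun_prop)).neg
  have hχ'0 : ∀ s, χ' s ≠ 0 → -1 ≤ s + t ∧ s < -t := by
    intro s hs
    obtain ⟨a1, a2⟩ := deriv_smoothTransition_ne_zero (x := -s - t) (by simpa [hχ'] using hs)
    constructor <;> linarith
  have hχ'b : ∀ s, χ' s ^ 2 ≤ C ^ 2 := by
    intro s
    simp only [hχ', neg_sq]
    exact sq_le_sq' (abs_le.1 (hCb _)).1 (abs_le.1 (hCb _)).2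
  have hχ1 : ∀ s, χ s ^ 2 ≤ 1 := fun s =>
    pow_le_one₀ (smoothTransition.nonneg _) (smoothTransition.le_one _)
  set T : Cn n → ℝ := fun z => ∑ j, ‖dzb (ev j) h z‖ ^ 2 with hT
  have hT0 : ∀ z, 0 ≤ T z := fun z => sum_nonneg fun j _ => sq_nonneg _
  have hTc : Continuous T := continuous_finsetSum _ fun j _ => ((hh.1.dzb (ev j)).continuous.norm).pow 2
  set Φ : Cn n → ℝ := fun z => qf t (ψ z) + η z with hΦ
  have hΦs : ContDiff ℝ ∞ Φ := ((contDiff_qf t).comp hψ).add hη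
  have hΦge : ∀ z, ψ z + η z ≤ Φ z := fun z => by
    have := qf_ge ht (ψ z); simp only [hΦ]; linarith
  set D : ℝ := 2 * (1 + t) / c with hD
  have hD0 : 0 < D := by positivity
  set g : Cn n → ℝ := fun z => 2 * (χ (ψ z) ^ 2 * T z) + D * (χ' (ψ z) ^ 2 * ‖h z‖ ^ 2) with hg
  have hb : Test fun z => ((χ (ψ z) : ℝ) : ℂ) * h z :=
    Test.mul (sm_ofReal (f := fun z => χ (ψ z)) (hχs.comp hψ)) hh
  have hg0 : ∀ z, 0 ≤ g z := fun z => by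
    have := hT0 z
    simp only [hg]; positivity
  have hlevΦ : ∀ z w, qf'' t (ψ z) * ‖dzb w (fun z => (ψ z : ℂ)) z‖ ^ 2 + ∑ j, ‖w j‖ ^ 2
      ≤ lev Φ w z := by
    intro z w
    rw [hΦ, lev_qf_add hψ hη]
    have e1 : 0 ≤ qf' t (ψ z) := by unfold qf'; positivity
    have := mul_nonneg e1 (hψl w z)
    linarith [hηl w z]
  have hq''0 : ∀ s, 0 ≤ qf'' t s := fun s => by unfold qf''; positivity
  have hsupp : ∀ z, z ∉ tsupport h → h z = 0 ∧ T z = 0 := by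
    intro z hz
    refine ⟨image_eq_zero_of_notMem_tsupport hz, Finset.sum_eq_zero fun j _ => ?_⟩
    have : fderiv ℝ h z = 0 := by
      have := fun hz' => hz (tsupport_fderiv_subset ℝ (f := h) hz')
      exact image_eq_zero_of_notMem_tsupport this
    simp [dzb, Dr, this]
  have hgc : Continuous g := by
    have a1 : Continuous fun z => χ (ψ z) := hχs.continuous.comp hψ.continuous
    have a2 : Continuous fun z => χ' (ψ z) := hχ'c.comp hψ.continuous
    have a3 := hh.1.continuous
    fun_prop
  have cs : ∀ {G : Cn n → ℝ}, Continuous G → (∀ z, z ∉ tsupport h → G z = 0) → Integrable G :=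
    fun hG h0 => hG.integrable_of_hasCompactSupport (HasCompactSupport.intro hh.2.isCompact
      fun z hz => h0 z hz)
  have hgi : Integrable fun z => g z * exp (-Φ z) := by
    refine cs (hgc.mul (continuous_exp.comp hΦs.continuous.neg)) fun z hz => ?_
    obtain ⟨a1, a2⟩ := hsupp z hz
    simp [hg, a1, a2]
  have hTi : Integrable T := cs hTc fun z hz => (hsupp z hz).2
  have hhi : Integrable fun z => ‖h z‖ ^ 2 := cs (by have := hh.1.continuous; fun_prop) fun z hz => by
    simp [(hsupp z hz).1]
  obtain ⟨F, hF, hFi, hFle⟩ := hormander hΦs hb hg0 (fun z w => by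
      have := hlevΦ z w
      have h2 := hq''0 (ψ z)
      refine le_trans ?_ this
      have : 0 ≤ ∑ j, ‖w j‖ ^ 2 := sum_nonneg fun j _ => sq_nonneg _
      positivity) hgi (by
    intro z w
    have e1 : ∑ j, dzb (ev j) (fun z => ((χ (ψ z) : ℝ) : ℂ) * h z) z * conj (w j) =
        dzb w (fun z => ((χ (ψ z) : ℝ) : ℂ) * h z) z := by
      rw [dzb_eq_sum]; exact sum_congr rfl fun j _ => mul_comm _ _
    rw [e1, dzb_mul (sm_ofReal (f := fun z => χ (ψ z)) (hχs.comp hψ)) hh.1,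
      dzb_comp_real hχd hψ]
    set d := dzb w (fun z => (ψ z : ℂ)) z with hd
    have e2 : ‖dzb w h z‖ ^ 2 ≤ (∑ j, ‖w j‖ ^ 2) * T z := by
      rw [dzb_eq_sum]
      refine le_trans (pow_le_pow_left₀ (norm_nonneg _) (norm_sum_le _ _) 2) ?_
      simp only [norm_mul, RCLike.norm_conj]
      exact Finset.sum_mul_sq_le_sq_mul_sq _ _ _
    have e3 : ∀ a b : ℂ, ‖a + b‖ ^ 2 ≤ 2 * ‖a‖ ^ 2 + 2 * ‖b‖ ^ 2 := fun a b => by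
      have := norm_add_le a b
      nlinarith [sq_nonneg (‖a‖ - ‖b‖), norm_nonneg (a + b), norm_nonneg a, norm_nonneg b]
    refine (e3 _ _).trans ?_
    simp only [norm_mul, mul_pow, norm_real, norm_eq_abs, sq_abs]
    have e4 : D * (χ' (ψ z) ^ 2 * ‖h z‖ ^ 2) * (qf'' t (ψ z) * ‖d‖ ^ 2) ≥
        2 * (χ' (ψ z) ^ 2 * ‖d‖ ^ 2 * ‖h z‖ ^ 2) := by
      by_cases hx : χ' (ψ z) = 0
      · simp [hx]
      · obtain ⟨a1, a2⟩ := hχ'0 _ hx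
        have a3 := qf''_ge ht a1 (by linarith)
        have a4 : 2 ≤ D * qf'' t (ψ z) := by
          calc 2 = D * ((1 + t)⁻¹ * c) := by rw [hD]; field_simp
            _ ≤ _ := by gcongr
        have a5 : 0 ≤ χ' (ψ z) ^ 2 * ‖d‖ ^ 2 * ‖h z‖ ^ 2 := by positivity
        nlinarith
    have e5 : 0 ≤ ∑ j, ‖w j‖ ^ 2 := sum_nonneg fun j _ => sq_nonneg _
    have e6 := hq''0 (ψ z)
    have e7 := hT0 z
    calc _ ≤ 2 * (χ (ψ z) ^ 2 * T z) * (∑ j, ‖w j‖ ^ 2) +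
          D * (χ' (ψ z) ^ 2 * ‖h z‖ ^ 2) * (qf'' t (ψ z) * ‖d‖ ^ 2) := by
            have := mul_le_mul_of_nonneg_left e2 (sq_nonneg (χ (ψ z)))
            nlinarith
      _ ≤ g z * (qf'' t (ψ z) * ‖d‖ ^ 2 + ∑ j, ‖w j‖ ^ 2) := by
            have f1 : 0 ≤ 2 * (χ (ψ z) ^ 2 * T z) * (qf'' t (ψ z) * ‖d‖ ^ 2) := by positivity
            have f2 : 0 ≤ D * (χ' (ψ z) ^ 2 * ‖h z‖ ^ 2) * (∑ j, ‖w j‖ ^ 2) := by positivity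
            simp only [hg]; linarith
      _ ≤ g z * lev Φ w z := mul_le_mul_of_nonneg_left (hlevΦ z w) (hg0 z))
  refine ⟨F, hF, hFi, hFle.trans ?_⟩
  have hSm : MeasurableSet {z | ψ z < -t} :=
    (isOpen_lt hψ.continuous continuous_const).measurableSet
  rw [← integral_indicator hSm, ← integral_const_mul, ← integral_const_mul,
    ← integral_add ((hhi.indicator hSm).const_mul _) (hTi.const_mul _)]
  refine integral_mono hgi (((hhi.indicator hSm).const_mul _).add (hTi.const_mul _)) fun z => ?_
  simp only [hg, add_mul]
  rw [add_comm]
  refine add_le_add ?_ ?_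
  · by_cases hx : χ' (ψ z) = 0
    · rw [hx]
      have : 0 ≤ indicator {z | ψ z < -t} (fun z => ‖h z‖ ^ 2) z :=
        indicator_nonneg (fun _ _ => sq_nonneg _) z
      simp only [ne_eq, OfNat.ofNat_ne_zero, not_false_eq_true, zero_pow, zero_mul, mul_zero]
      positivity
    · obtain ⟨a1, a2⟩ := hχ'0 _ hx
      rw [indicator_of_mem (show z ∈ {z | ψ z < -t} from a2)]
      have a3 : exp (-Φ z) ≤ exp 1 * exp t := by
        rw [← exp_add]
        exact exp_le_exp.2 (by linarith [hΦge z, hη0 z])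
      calc D * (χ' (ψ z) ^ 2 * ‖h z‖ ^ 2) * exp (-Φ z)
          ≤ D * (C ^ 2 * ‖h z‖ ^ 2) * (exp 1 * exp t) := by
            refine mul_le_mul (mul_le_mul_of_nonneg_left ?_ hD0.le) a3 (exp_pos _).le
              (by positivity)
            exact mul_le_mul_of_nonneg_right (hχ'b _) (sq_nonneg _)
        _ = _ := by rw [hD]; ring
  · by_cases hx : T z = 0
    · simp [hx]
    · obtain ⟨j, hj⟩ : ∃ j, dzb (ev j) h z ≠ 0 := by
        by_contra hcon
        push Not at hcon
        exact hx (Finset.sum_eq_zero fun j _ => by simp [hcon j])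
      have a3 : exp (-Φ z) ≤ exp (-L) :=
        exp_le_exp.2 (by linarith [hΦge z, hL z j hj])
      calc 2 * (χ (ψ z) ^ 2 * T z) * exp (-Φ z) ≤ 2 * (1 * T z) * exp (-L) := by
            have := hT0 z
            gcongr
            exact hχ1 _
        _ = _ := by ring

theorem RPsh.exists_glue {R R₁ R₂ k : ℝ} (hR : R < R₁) (hR2 : R₁ < R₂) (hk : 0 ≤ k)
    (hv : RPsh v (ball 0 R₂)) (hvk : ∀ z ∈ ball 0 R₂, -k ≤ v z) (hv0 : ∀ z ∈ ball 0 R₂, v z ≤ 0) :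
    ∃ u : Cn n → ℝ, RPsh u univ ∧ ∀ z ∈ ball 0 R, u z = v z := by
  classical
  set A := k / (R₁ - R) with hA
  have hA0 : 0 ≤ A := div_nonneg hk (by linarith)
  set ℓ : Cn n → ℝ := fun z => A * ‖z‖ + -(A * R₁) with hℓ
  have hℓp : RPsh ℓ univ := rpsh_norm.affine isOpen_univ hA0 _
  set u : Cn n → ℝ := fun z => if z ∈ ball 0 R₂ then Max.max (v z) (ℓ z) else ℓ z with hu
  have hin : ∀ z ∈ ball (0 : Cn n) R₂, u z = Max.max (v z) (ℓ z) := fun z hz => by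
    simp only [hu, if_pos hz]
  have hout : ∀ z : Cn n, R₁ < ‖z‖ → u z = ℓ z := by
    intro z hz
    simp only [hu]
    split_ifs with h
    · refine max_eq_right ((hv0 z h).trans ?_)
      simp only [hℓ]; nlinarith
    · rfl
  have hmax : RPsh (fun z => Max.max (v z) (ℓ z)) (ball 0 R₂) :=
    RPsh.max isOpen_ball hv (hℓp.mono (subset_univ _))
  have hout_ev : ∀ z : Cn n, R₁ < ‖z‖ → ∀ᶠ y in 𝓝 z, ℓ y = u y := fun z hz => by
    filter_upwards [(isOpen_lt continuous_const continuous_norm).mem_nhds hz] with y hy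
    exact (hout y hy).symm
  have hin_ev : ∀ z ∈ ball (0 : Cn n) R₂, ∀ᶠ y in 𝓝 z, Max.max (v y) (ℓ y) = u y :=
    fun z hz => by
    filter_upwards [isOpen_ball.mem_nhds hz] with y hy
    exact (hin y hy).symm
  have hcase : ∀ z : Cn n, z ∈ ball (0 : Cn n) R₂ ∨ R₁ < ‖z‖ := fun z => by
    rw [mem_ball_zero_iff]
    rcases lt_or_ge ‖z‖ R₂ with h | h
    · exact Or.inl h
    · exact Or.inr (by linarith)
  refine ⟨u, ⟨?_, ?_, ?_⟩, ?_⟩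
  · intro z _ y hy
    rw [nhdsWithin_univ]
    rcases hcase z with hz | hz
    · rw [hin z hz] at hy
      have h1 := hmax.usc z hz y hy
      rw [isOpen_ball.nhdsWithin_eq hz] at h1
      filter_upwards [h1, hin_ev z hz] with x hx hx'
      rwa [← hx']
    · rw [hout z hz] at hy
      have h1 := hℓp.usc z (mem_univ _) y hy
      rw [nhdsWithin_univ] at h1
      filter_upwards [h1, hout_ev z hz] with x hx hx'
      rwa [← hx']
  · obtain ⟨B, hB⟩ := hℓp.bdd
    refine ⟨B, fun z hz => (hB z hz).trans ?_⟩
    simp only [hu]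
    split_ifs
    · exact le_max_right _ _
    · exact le_rfl
  · intro z _
    rcases hcase z with hz | hz
    · exact (hmax.sub z hz).congr (hin_ev z hz)
    · exact (hℓp.sub z (mem_univ _)).congr (hout_ev z hz)
  · intro z hz
    rw [mem_ball_zero_iff] at hz
    have hz2 : z ∈ ball (0 : Cn n) R₂ := by rw [mem_ball_zero_iff]; linarith
    rw [hin z hz2]
    refine max_eq_left (le_trans ?_ (hvk z hz2))
    have : A * (R₁ - R) = k := by rw [hA]; field_simp [show R₁ - R ≠ 0 by linarith]
    simp only [hℓ]
    nlinarith

/-- Plurisubharmonic functions are decreasing-type limits of smooth global ones on smaller balls. -/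
theorem LPsh.exists_smooth_approx {R R' : ℝ} (hR : R < R') (hφ : LPsh φ (ball 0 R'))
    (hφ0 : ∀ z ∈ ball 0 R', φ z ≤ 0) :
    ∃ ψ : ℕ → Cn n → ℝ, (∀ k, ContDiff ℝ ∞ (ψ k)) ∧ (∀ k w z, 0 ≤ lev (ψ k) w z) ∧
      (∀ k : ℕ, ∀ z ∈ ball 0 R, -(k : ℝ) ≤ ψ k z ∧ ψ k z ≤ 0 ∧ φ z ≤ ψ k z) ∧
      ∀ z ∈ ball 0 R, ∀ c : ℝ, φ z < c → ∀ᶠ k in atTop, ψ k z ≤ c := by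
  set e := (R' - R) / 3 with he
  have he0 : 0 < e := by rw [he]; linarith
  have hneg : ∀ k : ℕ, ∀ z ∈ ball (0 : Cn n) R', -(k : ℝ) ≤ trunc φ k z := fun k z hz =>
    neg_le_trunc (hφ.lt_top z hz) _
  have hnp : ∀ k : ℕ, ∀ z ∈ ball (0 : Cn n) R', trunc φ k z ≤ 0 := fun k z hz => by
    rw [← coe_le_coe_iff, coe_trunc (hφ.lt_top z hz)]
    refine max_le (hφ0 z hz) ?_
    exact_mod_cast neg_nonpos.2 (Nat.cast_nonneg k)
  choose u hu hue using fun k : ℕ => RPsh.exists_glue (R := R + e) (R₁ := R + 2 * e) (R₂ := R')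
    (by linarith) (by rw [he]; linarith) (Nat.cast_nonneg k) (hφ.rpsh (k : ℝ)) (hneg k) (hnp k)
  have hek : ∀ k : ℕ, 0 < e / (k + 1) := fun k => by positivity
  have heke : ∀ k : ℕ, e / (k + 1) ≤ e := fun k => div_le_self he0.le (by
    have : (0 : ℝ) ≤ k := Nat.cast_nonneg k
    linarith)
  choose K hK using fun k : ℕ => exists_ker (n := n) (hek k)
  have hsub : ball (0 : Cn n) (R + e) ⊆ ball 0 R' :=
    ball_subset_ball (by rw [he]; linarith)
  have hsub' : ball (0 : Cn n) R ⊆ ball 0 (R + e) :=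
    ball_subset_ball (by linarith)
  have hadd : ∀ z ∈ ball (0 : Cn n) R, ∀ y : Cn n, ‖y‖ ≤ e → z + y ∈ ball 0 (R + e) := by
    intro z hz y hy
    rw [mem_ball_zero_iff] at hz ⊢
    linarith [norm_add_le z y]
  refine ⟨fun k => mol (u k) (K k), fun k => contDiff_mol (hu k) (hK k),
    fun k w z => lev_nonneg (contDiff_mol (hu k) (hK k)) (subAt_mol (hu k) (hK k) z) w, ?_, ?_⟩
  · intro k z hz
    have h1 := le_mol (hu k) (hK k) z
    rw [hue k z (hsub' hz)] at h1
    have hz' := hsub (hsub' hz)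
    refine ⟨(hneg k z hz').trans h1, mol_le (hu k) (hK k) fun y hy => ?_,
      (le_trunc (hφ.lt_top z hz') _).trans (coe_le_coe_iff.2 h1)⟩
    have h2 := hadd z hz y (hy.trans (heke k))
    rw [hue k _ h2]
    exact hnp k _ (hsub h2)
  · intro z hz c hc
    have hz' := hsub (hsub' hz)
    have h1 := hφ.usc z hz' c hc
    rw [isOpen_ball.nhdsWithin_eq hz'] at h1
    obtain ⟨δ, hδ, hball⟩ := Metric.eventually_nhds_iff.1 h1
    have h2 : Tendsto (fun k : ℕ => e / ((k : ℝ) + 1)) atTop (𝓝 0) :=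
      tendsto_const_nhds.div_atTop
        (tendsto_atTop_add_const_right _ _ tendsto_natCast_atTop_atTop)
    have h3 : ∀ᶠ k : ℕ in atTop, -c ≤ k := tendsto_natCast_atTop_atTop.eventually_ge_atTop (-c)
    filter_upwards [h2.eventually (gt_mem_nhds hδ), h3] with k hk hkc
    refine mol_le (hu k) (hK k) fun y hy => ?_
    have h4 := hadd z hz y (hy.trans (heke k))
    rw [hue k _ h4, ← coe_le_coe_iff, coe_trunc (hφ.lt_top _ (hsub h4))]
    refine max_le (hball (y := z + y) ?_).le (by exact_mod_cast (by linarith : -(k : ℝ) ≤ c))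
    rw [dist_eq_norm, add_sub_cancel_left]
    exact hy.trans_lt hk

theorem norm_sq_mul_volume_le {F : Cn n → ℂ} (hF : Differentiable ℂ F) (z : Cn n) (ε : ℝ) :
    ‖F z‖ ^ 2 * (volume (ball z ε)).toReal ≤ ∫ y in ball z ε, ‖F y‖ ^ 2 := by
  set c : ℂ := conj (F z) ^ 2 / (‖F z‖ ^ 2 : ℝ) with hc
  have hcn : ‖c‖ ≤ 1 := by
    rw [hc, norm_div, norm_pow, RCLike.norm_conj, norm_real, norm_eq_abs,
      abs_of_nonneg (sq_nonneg _)]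
    exact div_self_le_one _
  have hG : Differentiable ℂ fun y => c * F y ^ 2 := (hF.pow 2).const_mul c
  have hval : (c * F z ^ 2).re = ‖F z‖ ^ 2 := by
    by_cases h0 : F z = 0
    · simp [h0]
    · have e1 : c * F z ^ 2 = ((‖F z‖ ^ 2 : ℝ) : ℂ) := by
        have e2 : ((‖F z‖ ^ 2 : ℝ) : ℂ) ≠ 0 := by
          exact_mod_cast pow_ne_zero 2 (norm_ne_zero_iff.2 h0)
        rw [hc, div_mul_eq_mul_div, div_eq_iff e2, ← mul_pow, mul_comm (conj (F z)),
          ← norm_sq_eq_mul_conj]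
        ring
      rw [e1, ofReal_re]
  have hcont : Continuous fun y => (c * F y ^ 2).re := continuous_re.comp hG.continuous
  have hr : RPsh (fun y => (c * F y ^ 2).re) (closedBall z ε) := by
    refine ⟨hcont.upperSemicontinuous.upperSemicontinuousOn _, ?_, fun y _ => subAt_re_of_entire hG y⟩
    obtain ⟨B, hB⟩ := (isCompact_closedBall z ε).bddBelow_image hcont.continuousOn
    exact ⟨B, fun y hy => hB (mem_image_of_mem _ hy)⟩
  have h1 := hr.mul_volume_le (z := z) (ε := ε) subset_rfl
  simp only [hval] at h1
  have hInt : ∀ {g : Cn n → ℝ}, Continuous g → IntegrableOn g (ball z ε) := fun hg =>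
    (hg.continuousOn.integrableOn_compact (isCompact_closedBall z ε)).mono_set
      ball_subset_closedBall
  refine h1.trans (integral_mono (hInt hcont) (hInt (hF.continuous.norm.pow 2)) fun y => ?_)
  refine (Complex.re_le_norm _).trans ?_
  rw [norm_mul, norm_pow]
  exact mul_le_of_le_one_left (sq_nonneg _) hcn

/-- Montel's theorem on balls. -/
theorem exists_subseq_tendsto {F : ℕ → Cn n → ℂ} {r r' S : ℝ} (hr : 0 < r) (hrr : r < r')
    (hF : ∀ k, DifferentiableOn ℂ (F k) (ball 0 r')) (hS : ∀ k, ∀ z ∈ ball 0 r', ‖F k z‖ ≤ S) :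
    ∃ (σ : ℕ → ℕ) (G : Cn n → ℂ), StrictMono σ ∧ DifferentiableOn ℂ G (ball 0 r) ∧
      ∀ z ∈ ball 0 r, Tendsto (fun k => F (σ k) z) atTop (𝓝 (G z)) := by
  set Kc : Set (Cn n) := closedBall 0 r with hKc
  have hsub : Kc ⊆ ball 0 r' := closedBall_subset_ball hrr
  have : CompactSpace Kc := isCompact_iff_compactSpace.1 (isCompact_closedBall _ _)
  have hS0 : 0 ≤ S := (norm_nonneg _).trans (hS 0 0 (mem_ball_self (hr.trans hrr)))
  set Lc : ℝ≥0 := toNNReal (2 * S / (r' - r)) with hLc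
  have hlip : ∀ k, LipschitzOnWith Lc (F k) Kc := by
    intro k
    refine (convex_closedBall (0 : Cn n) r).lipschitzOnWith_of_nnnorm_fderiv_le (𝕜 := ℂ)
      (fun z hz => (hF k).differentiableAt (isOpen_ball.mem_nhds (hsub hz))) fun z hz => ?_
    have hb : ball z (r' - r) ⊆ ball 0 r' := by
      refine ball_subset_ball' ?_
      have := mem_closedBall.1 hz
      linarith
    have := norm_fderiv_le_of_bound_ball (f := F k) (z := z) (M := S) (by linarith : 0 < r' - r)
      ((hF k).mono hb) fun y hy => hS k y (hb hy)
    rw [← NNReal.coe_le_coe, coe_nnnorm, hLc, coe_toNNReal _ (div_nonneg (by positivity) (by linarith))]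
    exact this
  let f : ℕ → BoundedContinuousFunction Kc ℂ := fun k =>
    BoundedContinuousFunction.mkOfCompact ⟨fun x => F k x, by
      exact ((hF k).continuousOn.mono hsub).domRestrict⟩
  have hcomp : IsCompact (closure (Set.range f)) := by
    refine BoundedContinuousFunction.arzela_ascoli (closedBall (0 : ℂ) S)
      (isCompact_closedBall _ _) _ ?_ ?_
    · rintro _ x ⟨k, rfl⟩
      rw [mem_closedBall_zero_iff]
      exact hS k x (hsub x.2)
    · refine equicontinuous_of_continuity_modulus (fun s => Lc * s) ?_ _ ?_
      · have : Continuous fun s : ℝ => (Lc : ℝ) * s := by fun_prop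
        simpa using this.tendsto 0
      · rintro x y ⟨_, k, rfl⟩
        exact (hlip k).dist_le_mul x x.2 y y.2
  obtain ⟨G, _, σ, hσ, hG⟩ := hcomp.isSeqCompact (x := f) fun k => subset_closure ⟨k, rfl⟩
  classical
  let g : Cn n → ℂ := fun z => if h : z ∈ Kc then G ⟨z, h⟩ else 0
  have hgu : TendstoUniformlyOn (fun k => F (σ k)) g atTop Kc := by
    have h1 := BoundedContinuousFunction.tendsto_iff_tendstoUniformly.1 hG
    rw [tendstoUniformlyOn_iff]
    rw [tendstoUniformly_iff] at h1
    intro ε hε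
    filter_upwards [h1 ε hε] with k hk z hz
    have := hk ⟨z, hz⟩
    simp only [g, dif_pos hz]
    exact this
  refine ⟨σ, g, hσ, ?_, fun z hz => hgu.tendsto_at (ball_subset_closedBall hz)⟩
  intro z hz
  have hz' : ‖z‖ < r := by simpa using hz
  have hb : ball z (r - ‖z‖) ⊆ Kc := fun y hy => by
    rw [hKc, mem_closedBall_zero_iff]
    rw [mem_ball, dist_eq_norm] at hy
    have := norm_le_norm_add_norm_sub z y
    rw [norm_sub_rev] at this
    linarith
  have h2 := differentiableOn_of_tendstoUniformlyOn_ball (by linarith : 0 < r - ‖z‖)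
    (fun k => (hF (σ k)).mono (hb.trans hsub)) (hgu.mono hb)
  exact (h2.differentiableAt (ball_mem_nhds z (by linarith))).differentiableWithinAt

theorem exists_barrier {a b : ℝ} (hab : a < b) : ∃ κ : Cn n → ℝ, ContDiff ℝ ∞ κ ∧
    (∀ w z, 0 ≤ lev κ w z) ∧ (∀ z, 0 ≤ κ z) ∧ (∀ z ∈ ball 0 a, κ z = 0) ∧
    ∀ z, b ≤ ‖z‖ → (b - a) / 2 ≤ κ z := by
  obtain ⟨k, hk⟩ := exists_ker (n := n) (ε := (b - a) / 2) (by linarith)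
  have hv : RPsh (fun z : Cn n => Max.max (1 * ‖z‖ + -((a + b) / 2)) 0) univ :=
    RPsh.max isOpen_univ (rpsh_norm.affine isOpen_univ zero_le_one _) (RPsh.const 0 _)
  have h0 : ∀ z, 0 ≤ mol (fun z : Cn n => Max.max (1 * ‖z‖ + -((a + b) / 2)) 0) k z := fun z =>
    (le_max_right _ _).trans (le_mol hv hk z)
  refine ⟨_, contDiff_mol hv hk, fun w z => lev_nonneg (contDiff_mol hv hk) (subAt_mol hv hk z) w,
    h0, fun z hz => le_antisymm (mol_le hv hk fun y hy => ?_) (h0 z), fun z hz => ?_⟩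
  · rw [mem_ball_zero_iff] at hz
    refine max_le ?_ le_rfl
    linarith [norm_add_le z y]
  · refine le_trans ?_ ((le_max_left _ _).trans (le_mol hv hk z))
    linarith

theorem dzb_eq_zero_of_differentiableAt (hf : DifferentiableAt ℂ f z) (w : Cn n) : dzb w f z = 0 := by
  have h1 : fderiv ℝ f z = (fderiv ℂ f z).restrictScalars ℝ :=
    (hf.hasFDerivAt.restrictScalars ℝ).fderiv
  simp only [dzb, Dr, h1, ContinuousLinearMap.coe_restrictScalars', map_smul, smul_eq_mul]
  rw [← mul_assoc, I_mul_I]; ring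

theorem exists_holo_cutoff {r R R' : ℝ} (hr : 0 < r) (hrR : r < R) (hR : R < R')
    (hf : DifferentiableOn ℂ f (ball 0 R')) : ∃ h : Cn n → ℂ, Test h ∧
      (∀ z ∈ ball 0 r, h z = f z) ∧ (∀ z, R ≤ ‖z‖ → h z = 0) ∧ (∀ z, ‖h z‖ ≤ ‖f z‖) ∧
      ∀ z j, dzb (ev j) h z ≠ 0 → r ≤ ‖z‖ ∧ ‖z‖ < R := by
  let B : ContDiffBump (0 : Cn n) := ⟨r, (r + R) / 2, hr, by linarith⟩
  set h : Cn n → ℂ := fun z => (B z : ℂ) * f z with hh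
  have hzero : ∀ z, (r + R) / 2 ≤ ‖z‖ → h z = 0 := fun z hz => by
    have : B z = 0 := B.zero_of_le_dist (by simpa using hz)
    simp [hh, this]
  have htsupp : tsupport h ⊆ closedBall 0 ((r + R) / 2) := by
    refine closure_minimal (fun z hz => ?_) isClosed_closedBall
    by_contra hcon
    rw [mem_closedBall_zero_iff, not_le] at hcon
    exact hz (hzero z hcon.le)
  have hsm : Sm h := by
    rw [Sm, contDiff_iff_contDiffAt]
    intro z
    rcases lt_or_ge ‖z‖ R' with hz | hz
    · have hz' : z ∈ ball (0 : Cn n) R' := by simpa using hz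
      exact (ofRealCLM.contDiff.comp B.contDiff).contDiffAt.mul
        ((contDiffOn_real_of_holo isOpen_ball hf).contDiffAt
          (isOpen_ball.mem_nhds hz'))
    · have : h =ᶠ[𝓝 z] fun _ => 0 := by
        filter_upwards [(isOpen_lt continuous_const continuous_norm).mem_nhds
          (show (r + R) / 2 < ‖z‖ by linarith)] with y hy
        exact hzero y (le_of_lt hy)
      exact contDiffAt_const.congr_of_eventuallyEq this
  refine ⟨h, ⟨hsm, HasCompactSupport.of_support_subset_isCompact (isCompact_closedBall _ _)
    (subset_closure.trans htsupp)⟩, fun z hz => ?_, fun z hz => hzero z (by linarith), fun z => ?_,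
    fun z j hz => ⟨?_, ?_⟩⟩
  · have : B z = 1 := B.one_of_mem_closedBall (ball_subset_closedBall hz)
    simp [hh, this]
  · simp only [hh, norm_mul, norm_real, norm_eq_abs, abs_of_nonneg (B.nonneg)]
    exact mul_le_of_le_one_left (norm_nonneg _) B.le_one
  · by_contra hcon
    have hzr : z ∈ ball (0 : Cn n) r := by simpa using hcon
    refine hz ?_
    have he : h =ᶠ[𝓝 z] f := by
      filter_upwards [isOpen_ball.mem_nhds hzr] with y hy
      have : B y = 1 := B.one_of_mem_closedBall (ball_subset_closedBall hy)
      simp [hh, this]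
    refine dzb_eq_zero_of_differentiableAt (DifferentiableAt.congr_of_eventuallyEq
      (hf.differentiableAt (isOpen_ball.mem_nhds ?_)) he) _
    exact ball_subset_ball (by linarith) hzr
  · by_contra hcon
    refine hz ?_
    have : fderiv ℝ h z = 0 := by
      refine image_eq_zero_of_notMem_tsupport fun hz' => ?_
      have := htsupp (tsupport_fderiv_subset ℝ (f := h) hz')
      rw [mem_closedBall_zero_iff] at this
      linarith
    simp [dzb, Dr, this]

theorem step_estimate : ∃ K : ℝ, 0 < K ∧ ∀ (n : ℕ) (r R R' t k δ : ℝ) (ψ : Cn n → ℝ) (f : Cn n → ℂ),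
    0 < r → r < R → R < R' → R ≤ 1 → 0 ≤ t → 0 < δ → DifferentiableOn ℂ f (ball 0 R') →
    ContDiff ℝ ∞ ψ → (∀ w z, 0 ≤ lev ψ w z) →
    (∀ z ∈ ball 0 R, -k ≤ ψ z ∧ ψ z ≤ 0) →
    ∃ F : Cn n → ℂ, Differentiable ℂ F ∧
      ∫ z in ball 0 (r + (R - r) / 2),
        ‖(smoothTransition (-ψ z - t) : ℂ) * f z - F z‖ ^ 2 * exp (-ψ z) ≤
      exp (1 + n) * (K * (1 + t) * exp t *
        (∫ z in ball 0 R ∩ {z | ψ z < -t}, ‖f z‖ ^ 2) + δ) := by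
  obtain ⟨K, hK, hstep⟩ := exists_entire_step
  refine ⟨K, hK, ?_⟩
  intro n r R R' t k δ ψ f hr hrR hR hR1 ht hδ hf hψ hψl hψb
  set d := (R - r) / 4 with hd
  have hd0 : 0 < d := by rw [hd]; linarith
  obtain ⟨κ, hκ, hκl, hκ0, hκz, hκb⟩ := exists_barrier (n := n) (a := r + 2 * d) (b := r + 3 * d)
    (by linarith)
  obtain ⟨h, hh, hhf, hhz, hhle, hhd⟩ := exists_holo_cutoff (r := r + 3 * d) (R := R) (by linarith)
    (by linarith) hR hf
  set T := ∫ z, ∑ j, ‖dzb (ev j) h z‖ ^ 2 with hT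
  have hT0 : 0 ≤ T := integral_nonneg fun z => sum_nonneg fun j _ => sq_nonneg _
  obtain ⟨L, hL0, hL⟩ : ∃ L : ℝ, 0 ≤ L + k ∧ 2 * exp (-L) * T ≤ δ := by
    have h1 : Tendsto (fun L : ℝ => 2 * exp (-L) * T) atTop (𝓝 (2 * 0 * T)) :=
      ((tendsto_exp_neg_atTop_nhds_zero).const_mul 2).mul_const T
    rw [mul_zero, zero_mul] at h1
    obtain ⟨L, h2, h3⟩ := ((h1.eventually (gt_mem_nhds hδ)).and (eventually_ge_atTop (-k))).exists
    exact ⟨L, by linarith, h2.le⟩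
  set M := (L + k) * (2 / d) with hM
  have hM0 : 0 ≤ M := by positivity
  set η : Cn n → ℝ := fun z => M * κ z + ∑ j, ‖z j‖ ^ 2 with hη
  have hκM : ContDiff ℝ ∞ fun z => M * κ z := contDiff_const.mul hκ
  have hηs : ContDiff ℝ ∞ η := hκM.add contDiff_sum_norm_sq
  have hη0 : ∀ z, 0 ≤ η z := fun z => by
    have := hκ0 z
    have : 0 ≤ ∑ j, ‖z j‖ ^ 2 := sum_nonneg fun j _ => sq_nonneg _
    simp only [hη]; positivity
  obtain ⟨F, hF, hFi, hFle⟩ := hstep n t L ψ η h ht hψ hηs hh hψl (fun w z => by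
      rw [hη, lev_add hκM contDiff_sum_norm_sq, lev_const_mul hκ, lev_sum_norm_sq]
      have := mul_nonneg hM0 (hκl w z)
      linarith) hη0 (fun z j hz => by
      obtain ⟨h1, h2⟩ := hhd z j hz
      have h3 := (hψb z (by simpa using h2)).1
      have h4 := hκb z h1
      have h5 : M * (d / 2) = L + k := by rw [hM]; field_simp
      have h6 : M * (d / 2) ≤ M * κ z := mul_le_mul_of_nonneg_left (by linarith) hM0
      have h7 : 0 ≤ ∑ j, ‖z j‖ ^ 2 := sum_nonneg fun j _ => sq_nonneg _
      simp only [hη]; linarith)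
  refine ⟨F, hF, ?_⟩
  have hρ : r + (R - r) / 2 = r + 2 * d := by rw [hd]; ring
  rw [hρ]
  have hsubR : ball (0 : Cn n) (r + 2 * d) ⊆ ball 0 R :=
    ball_subset_ball (by linarith)
  have hcR : closedBall (0 : Cn n) R ⊆ ball 0 R' := closedBall_subset_ball hR
  have hχc : Continuous fun z => ((smoothTransition (-ψ z - t) : ℝ) : ℂ) :=
    Complex.continuous_ofReal.comp (smoothTransition.continuous.comp
      (by have := hψ.continuous; fun_prop))
  have hfc : ContinuousOn f (closedBall 0 R) := hf.continuousOn.mono hcR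
  have hi1 : IntegrableOn (fun z => ‖(smoothTransition (-ψ z - t) : ℂ) * f z - F z‖ ^ 2 *
      exp (-ψ z)) (ball 0 (r + 2 * d)) := by
    refine (ContinuousOn.integrableOn_compact (isCompact_closedBall (0 : Cn n) R) ?_).mono_set
      (hsubR.trans ball_subset_closedBall)
    exact ((((hχc.continuousOn.mul hfc).sub hF.continuous.continuousOn).norm).pow 2).mul
      (continuous_exp.comp hψ.continuous.neg).continuousOn
  calc _ ≤ ∫ z in ball 0 (r + 2 * d), exp (1 + n) *
        (‖(smoothTransition (-ψ z - t) : ℂ) * h z - F z‖ ^ 2 *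
          exp (-(qf t (ψ z) + η z))) := by
        refine setIntegral_mono_on hi1 (hFi.const_mul _).integrableOn
          isOpen_ball.measurableSet fun z hz => ?_
        rw [hhf z (ball_subset_ball (by linarith) hz), mul_left_comm, ← exp_add]
        refine mul_le_mul_of_nonneg_left (exp_le_exp.2 ?_) (sq_nonneg _)
        have e1 := qf_le ht (hψb z (hsubR hz)).2
        have e2 : ∑ j, ‖z j‖ ^ 2 ≤ n := by
          have : ∀ j ∈ (Finset.univ : Finset (Fin n)), ‖z j‖ ^ 2 ≤ 1 := fun j _ => by
            refine pow_le_one₀ (norm_nonneg _) ((norm_le_pi_norm z j).trans ?_)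
            have := hsubR hz
            rw [mem_ball_zero_iff] at this
            linarith
          simpa using sum_le_sum this
        simp only [hη, hκz z hz, mul_zero, zero_add]
        linarith
    _ ≤ exp (1 + n) * ∫ z, ‖(smoothTransition (-ψ z - t) : ℂ) * h z - F z‖ ^ 2 *
          exp (-(qf t (ψ z) + η z)) := by
        rw [integral_const_mul]
        refine mul_le_mul_of_nonneg_left (setIntegral_le_integral hFi (ae_of_all _ fun z => ?_))
          (exp_pos _).le
        have := exp_pos (-(qf t (ψ z) + η z))
        simp only [Pi.zero_apply]
        positivity
    _ ≤ _ := by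
        refine mul_le_mul_of_nonneg_left (hFle.trans (add_le_add ?_ hL)) (exp_pos _).le
        refine mul_le_mul_of_nonneg_left ?_ (by positivity)
        have m1 : MeasurableSet {z | ψ z < -t} :=
          (isOpen_lt hψ.continuous continuous_const).measurableSet
        have m2 := (isOpen_ball (x := (0 : Cn n)) (ε := R)).measurableSet.inter m1
        have i1 : Integrable fun z => ‖h z‖ ^ 2 := hh.integrable_norm_sq
        have i2 : IntegrableOn (fun z => ‖f z‖ ^ 2) (ball 0 R ∩ {z | ψ z < -t}) :=
          ((hfc.norm.pow 2).integrableOn_compact (isCompact_closedBall (0 : Cn n) R)).mono_set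
            (inter_subset_left.trans ball_subset_closedBall)
        rw [← integral_indicator m1, ← integral_indicator m2]
        refine integral_mono (i1.indicator m1) ((integrable_indicator_iff m2).2 i2) fun z => ?_
        by_cases hz : ‖z‖ < R
        · have hz' : z ∈ ball (0 : Cn n) R := by simpa using hz
          by_cases hz2 : ψ z < -t
          · rw [indicator_of_mem (show z ∈ {z | ψ z < -t} from hz2),
              indicator_of_mem (show z ∈ ball 0 R ∩ {z | ψ z < -t} from ⟨hz', hz2⟩)]
            exact pow_le_pow_left₀ (norm_nonneg _) (hhle z) 2
          · rw [indicator_of_notMem (show z ∉ {z | ψ z < -t} from hz2)]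
            exact indicator_nonneg (fun _ _ => sq_nonneg _) z
        · refine le_trans (le_of_eq ?_) (indicator_nonneg (fun _ _ => sq_nonneg _) z)
          rw [indicator_apply]
          simp [hhz z (not_lt.1 hz)]

theorem expE_coe (x : ℝ) : expE (x : EReal) = ofReal (exp x) := by
  simp [expE]

theorem wexp_neg_one_le_liminf (hz : φ z < ⊤) {s : ℕ → ℝ}
    (hs : ∀ c : ℝ, φ z < c → ∀ᶠ k in atTop, s k ≤ c) {a : ℕ → ℝ} {b : ℝ} (hb : 0 ≤ b)
    (hab : Tendsto a atTop (𝓝 b)) :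
    ofReal b * wexp (-1) φ z ≤
      liminf (fun k => ofReal (a k * exp (-s k))) atTop := by
  rcases hb.eq_or_lt with rfl | hb
  · simp
  have key : ∀ c : ℝ, φ z < c → ofReal (b * exp (-c)) ≤
      liminf (fun k => ofReal (a k * exp (-s k))) atTop := by
    intro c hc
    have h1 : Tendsto (fun k => ofReal (a k * exp (-c))) atTop
        (𝓝 (ofReal (b * exp (-c)))) :=
      ENNReal.tendsto_ofReal (hab.mul_const _)
    rw [← h1.liminf_eq]
    refine liminf_le_liminf ?_
    filter_upwards [hs c hc, hab.eventually (lt_mem_nhds hb)] with k hk hk'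
    have := exp_le_exp.2 (neg_le_neg hk)
    exact ofReal_le_ofReal (mul_le_mul_of_nonneg_left this hk'.le)
  unfold wexp
  generalize hx : φ z = x at *
  induction x with
  | bot =>
    have h2 : Tendsto (fun c : ℝ => ofReal (b * exp (-c))) atBot (𝓝 ⊤) := by
      exact ENNReal.tendsto_ofReal_nhds_top.2
        ((tendsto_exp_atTop.comp tendsto_neg_atBot_atTop).const_mul_atTop hb)
    have h3 := le_of_tendsto' h2 fun c => key c (EReal.bot_lt_coe c)
    exact le_trans le_top h3
  | coe x =>
    rw [show ((-1 : ℝ) : EReal) * (x : EReal) = ((-x : ℝ) : EReal) by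
      rw [← coe_mul]; simp, expE_coe, ← ofReal_mul hb.le]
    have h2 : Tendsto (fun c : ℝ => ofReal (b * exp (-c))) (𝓝[>] x)
        (𝓝 (ofReal (b * exp (-x)))) := by
      have : Continuous fun c : ℝ => ofReal (b * exp (-c)) :=
        ENNReal.continuous_ofReal.comp (by fun_prop)
      exact (this.tendsto x).mono_left nhdsWithin_le_nhds
    refine le_of_tendsto h2 ?_
    filter_upwards [self_mem_nhdsWithin] with c hc
    exact key c (by exact_mod_cast hc)
  | top => simp at hz

theorem ofReal_norm_sq (x : ℂ) : ofReal (‖x‖ ^ 2) = (‖x‖₊ : ℝ≥0∞) ^ 2 := by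
  rw [ofReal_pow (norm_nonneg _), ofReal_norm, enorm_eq_nnnorm]

theorem norm_sq_sub_le (a b c : ℂ) : ‖a - c‖ ^ 2 ≤ 2 * ‖a - b‖ ^ 2 + 2 * ‖b - c‖ ^ 2 := by
  have := norm_sub_le_norm_sub_add_norm_sub a b c
  nlinarith [sq_nonneg (‖a - b‖ - ‖b - c‖), norm_nonneg (a - c), norm_nonneg (a - b),
    norm_nonneg (b - c)]

/-- Correcting `f` modulo the multiplier ideal of `φ` to a function controlled by the mass of
`f` on a sublevel set of `φ`. -/
theorem mass_lemma (n : ℕ) : ∃ C : ℝ, 0 < C ∧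
    ∀ (r R R' t : ℝ) (φ : Cn n → EReal) (f : Cn n → ℂ), 0 < r → r < R → R < R' → R ≤ 1 → 0 ≤ t →
      LPsh φ (ball 0 R') → (∀ z ∈ ball 0 R', φ z ≤ 0) →
      DifferentiableOn ℂ f (ball 0 R') →
      ∃ F : Cn n → ℂ, DifferentiableOn ℂ F (ball 0 r) ∧
        (∀ z ∈ ball 0 r, ‖F z‖ ^ 2 * (volume (ball (0 : Cn n) ((R - r) / 4))).toReal ≤
          C * (1 + t) * exp t *
            ∫ z in ball 0 R ∩ {z | φ z < ((-t : ℝ) : EReal)}, ‖f z‖ ^ 2) ∧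
        ∫⁻ z in ball 0 r, (‖F z - f z‖₊ : ℝ≥0∞) ^ 2 * wexp (-1) φ z < ⊤ := by
  obtain ⟨K, hK, hstep⟩ := step_estimate
  refine ⟨2 * exp (1 + n) * K + 2, by positivity, ?_⟩
  intro r R R' t φ f hr hrR hR hR1 ht hφ hφ0 hf
  obtain ⟨ψ, hψ, hψl, hψb, hψlim⟩ := hφ.exists_smooth_approx hR hφ0
  set δ : ℕ → ℝ := fun k => 1 / ((k : ℝ) + 1) with hδ
  have hδ0 : ∀ k, 0 < δ k := fun k => by simp only [hδ]; positivity
  have hδ1 : ∀ k, δ k ≤ 1 := fun k => by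
    simp only [hδ]
    rw [div_le_one (by positivity)]
    have : (0 : ℝ) ≤ k := Nat.cast_nonneg k
    linarith
  choose F hF hFle using fun k : ℕ => hstep n r R R' t k (δ k) (ψ k) f hr hrR hR hR1 ht (hδ0 k) hf
    (hψ k) (hψl k) fun z hz => ⟨(hψb k z hz).1, (hψb k z hz).2.1⟩
  set ρ := r + (R - r) / 2 with hρ
  set D := ball (0 : Cn n) ρ with hD
  set m := ∫ z in ball 0 R ∩ {z | φ z < ((-t : ℝ) : EReal)}, ‖f z‖ ^ 2 with hm
  have hDR : D ⊆ ball 0 R := ball_subset_ball (by rw [hρ]; linarith)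
  have hcR : closedBall (0 : Cn n) R ⊆ ball 0 R' := closedBall_subset_ball hR
  have hfc : ContinuousOn f (closedBall 0 R) := hf.continuousOn.mono hcR
  have hInt : ∀ {g : Cn n → ℝ}, ContinuousOn g (closedBall 0 R) →
      IntegrableOn g (ball 0 R) := fun hg =>
    (hg.integrableOn_compact (isCompact_closedBall (0 : Cn n) R)).mono_set
      ball_subset_closedBall
  have hfi : IntegrableOn (fun z => ‖f z‖ ^ 2) (ball 0 R) := hInt (hfc.norm.pow 2)
  have hm0 : 0 ≤ m := integral_nonneg fun z => sq_nonneg _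
  have hmk : ∀ k, ∫ z in ball 0 R ∩ {z | ψ k z < -t}, ‖f z‖ ^ 2 ≤ m := by
    intro k
    refine setIntegral_mono_set (hfi.mono_set inter_subset_left)
      (ae_of_all _ fun z => sq_nonneg _) (LE.le.eventuallyLE fun z hz => ⟨hz.1, ?_⟩)
    exact ((hψb k z hz.1).2.2).trans_lt (by exact_mod_cast hz.2)
  set A : ℕ → ℝ := fun k => exp (1 + n) * (K * (1 + t) * exp t * m + δ k) with hA
  set χ : ℕ → Cn n → ℂ := fun k z => (smoothTransition (-ψ k z - t) : ℂ) with hχ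
  have hχc : ∀ k, Continuous (χ k) := fun k =>
    Complex.continuous_ofReal.comp (smoothTransition.continuous.comp
      (by have := (hψ k).continuous; fun_prop))
  have hA1 : ∀ k, ∫ z in D, ‖χ k z * f z - F k z‖ ^ 2 * exp (-ψ k z) ≤ A k := fun k =>
    (hFle k).trans (mul_le_mul_of_nonneg_left (add_le_add_left
      (mul_le_mul_of_nonneg_left (hmk k) (by positivity)) _) (exp_pos _).le)
  have hec : ∀ k, Continuous fun z => exp (-ψ k z) := fun k =>
    continuous_exp.comp (hψ k).continuous.neg
  have hi1 : ∀ k, IntegrableOn (fun z => ‖χ k z * f z - F k z‖ ^ 2 * exp (-ψ k z)) D :=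
    fun k => (hInt (((((hχc k).continuousOn.mul hfc).sub (hF k).continuous.continuousOn).norm.pow 2).mul
      (hec k).continuousOn)).mono_set hDR
  have hDm : MeasurableSet D := isOpen_ball.measurableSet
  have hA2 : ∀ k, ∫ z in D, ‖F k z‖ ^ 2 ≤ 2 * A k + 2 * m := by
    intro k
    have m1 : MeasurableSet {z | ψ k z < -t} :=
      (isOpen_lt (hψ k).continuous continuous_const).measurableSet
    have hi2 : IntegrableOn (fun z => {z | ψ k z < -t}.indicator (fun z => ‖f z‖ ^ 2) z) D :=
      (hfi.mono_set hDR).indicator m1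
    calc ∫ z in D, ‖F k z‖ ^ 2 ≤ ∫ z in D, (2 * (‖χ k z * f z - F k z‖ ^ 2 * exp (-ψ k z)) +
          2 * {z | ψ k z < -t}.indicator (fun z => ‖f z‖ ^ 2) z) := by
          refine setIntegral_mono_on ((hInt ((hF k).continuous.norm.pow 2).continuousOn).mono_set hDR)
            (((hi1 k).const_mul 2).add (hi2.const_mul 2)) hDm fun z hz => ?_
          have e1 := norm_sq_sub_le (F k z) (χ k z * f z) 0
          rw [sub_zero, sub_zero, norm_sub_rev] at e1
          have e2 : 1 ≤ exp (-ψ k z) := one_le_exp (by linarith [(hψb k z (hDR hz)).2.1])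
          have e3 : ‖χ k z * f z - F k z‖ ^ 2 ≤ ‖χ k z * f z - F k z‖ ^ 2 * exp (-ψ k z) :=
            le_mul_of_one_le_right (sq_nonneg _) e2
          have e4 : ‖χ k z * f z‖ ^ 2 ≤ {z | ψ k z < -t}.indicator (fun z => ‖f z‖ ^ 2) z := by
            by_cases hz2 : ψ k z < -t
            · rw [indicator_of_mem (show z ∈ {z | ψ k z < -t} from hz2), norm_mul, mul_pow]
              refine mul_le_of_le_one_left (sq_nonneg _) (pow_le_one₀ (norm_nonneg _) ?_)
              simp only [hχ, norm_real, norm_eq_abs,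
                abs_of_nonneg (smoothTransition.nonneg _)]
              exact smoothTransition.le_one _
            · have : χ k z = 0 := by
                simp only [hχ]
                rw [smoothTransition.zero_of_nonpos (by linarith)]; simp
              rw [this]
              simp only [zero_mul, norm_zero, ne_eq, OfNat.ofNat_ne_zero, not_false_eq_true, zero_pow]
              exact indicator_nonneg (fun _ _ => sq_nonneg _) z
          linarith
      _ = 2 * (∫ z in D, ‖χ k z * f z - F k z‖ ^ 2 * exp (-ψ k z)) +
          2 * ∫ z in D, {z | ψ k z < -t}.indicator (fun z => ‖f z‖ ^ 2) z := by
          rw [integral_add ((hi1 k).const_mul 2) (hi2.const_mul 2), integral_const_mul,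
            integral_const_mul]
      _ ≤ 2 * A k + 2 * m := by
          have e1 := hA1 k
          have e2 : ∫ z in D, {z | ψ k z < -t}.indicator (fun z => ‖f z‖ ^ 2) z ≤ m := by
            rw [setIntegral_indicator m1]
            refine le_trans (setIntegral_mono_set (hfi.mono_set inter_subset_left)
              (ae_of_all _ fun z => sq_nonneg _)
              (LE.le.eventuallyLE (inter_subset_inter_left _ hDR))) (hmk k)
          linarith
  set If := ∫ z in ball 0 R, ‖f z‖ ^ 2 with hIf
  have hA3 : ∀ k, ∫ z in D, ‖F k z - f z‖ ^ 2 * exp (-ψ k z) ≤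
      2 * A k + 2 * (exp (t + 1) * If) := by
    intro k
    have hi3 : IntegrableOn (fun z => ‖F k z - f z‖ ^ 2 * exp (-ψ k z)) D :=
      (hInt (((((hF k).continuous.continuousOn).sub hfc).norm.pow 2).mul
        (hec k).continuousOn)).mono_set hDR
    calc ∫ z in D, ‖F k z - f z‖ ^ 2 * exp (-ψ k z)
        ≤ ∫ z in D, (2 * (‖χ k z * f z - F k z‖ ^ 2 * exp (-ψ k z)) +
          2 * (exp (t + 1) * ‖f z‖ ^ 2)) := by
          refine setIntegral_mono_on hi3 (((hi1 k).const_mul 2).add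
            (((hfi.mono_set hDR).const_mul _).const_mul 2)) hDm fun z hz => ?_
          have e1 := norm_sq_sub_le (F k z) (χ k z * f z) (f z)
          rw [norm_sub_rev (F k z) (χ k z * f z)] at e1
          have e2 : ‖χ k z * f z - f z‖ ^ 2 * exp (-ψ k z) ≤ exp (t + 1) * ‖f z‖ ^ 2 := by
            by_cases hz2 : 1 ≤ -ψ k z - t
            · have : χ k z = 1 := by
                simp only [hχ]
                rw [smoothTransition.one_of_one_le hz2]; simp
              rw [this]
              simp only [one_mul, sub_self, norm_zero, ne_eq, OfNat.ofNat_ne_zero,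
                not_false_eq_true, zero_pow, zero_mul]
              positivity
            · rw [mul_comm]
              refine mul_le_mul (exp_le_exp.2 (by linarith)) ?_ (sq_nonneg _) (exp_pos _).le
              rw [show χ k z * f z - f z = -((1 - χ k z) * f z) by ring, norm_neg, norm_mul, mul_pow]
              refine mul_le_of_le_one_left (sq_nonneg _) (pow_le_one₀ (norm_nonneg _) ?_)
              simp only [hχ]
              rw [← Complex.ofReal_one, ← Complex.ofReal_sub, norm_real, norm_eq_abs,
                abs_le]
              constructor <;> linarith [smoothTransition.nonneg (-ψ k z - t),
                smoothTransition.le_one (-ψ k z - t)]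
          have e3 := mul_le_mul_of_nonneg_right e1 (exp_pos (-ψ k z)).le
          linarith
      _ = 2 * (∫ z in D, ‖χ k z * f z - F k z‖ ^ 2 * exp (-ψ k z)) +
          2 * (exp (t + 1) * ∫ z in D, ‖f z‖ ^ 2) := by
          rw [integral_add ((hi1 k).const_mul 2) (((hfi.mono_set hDR).const_mul _).const_mul 2),
            integral_const_mul, integral_const_mul, integral_const_mul]
      _ ≤ _ := by
          have e1 := hA1 k
          have e2 : ∫ z in D, ‖f z‖ ^ 2 ≤ If := setIntegral_mono_set hfi
            (ae_of_all _ fun z => sq_nonneg _) (LE.le.eventuallyLE hDR)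
          have e3 := mul_le_mul_of_nonneg_left e2 (exp_pos (t + 1)).le
          linarith
  set d := (R - r) / 4 with hd
  have hd0 : 0 < d := by rw [hd]; linarith
  set V := (volume (ball (0 : Cn n) d)).toReal with hV
  have hV0 : 0 < V := volume_ball_toReal_pos 0 hd0
  have hsup : ∀ k, ∀ z ∈ ball (0 : Cn n) (r + d), ‖F k z‖ ^ 2 * V ≤ 2 * A k + 2 * m := by
    intro k z hz
    have h1 := norm_sq_mul_volume_le (hF k) z d
    have h2 : volume (ball z d) = volume (ball (0 : Cn n) d) :=
      Measure.addHaar_ball_center volume z d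
    rw [h2] at h1
    refine h1.trans (le_trans ?_ (hA2 k))
    refine setIntegral_mono_set ((hInt ((hF k).continuous.norm.pow 2).continuousOn).mono_set hDR)
      (ae_of_all _ fun z => sq_nonneg _) (LE.le.eventuallyLE ?_)
    refine ball_subset_ball' ?_
    rw [mem_ball] at hz
    rw [hρ]; linarith
  set A0 := exp (1 + n) * (K * (1 + t) * exp t * m + 1) with hA0
  have hAk : ∀ k, A k ≤ A0 := fun k => mul_le_mul_of_nonneg_left (by linarith [hδ1 k])
    (exp_pos _).le
  have hA00 : 0 ≤ A0 := by positivity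
  obtain ⟨σ, G, hσ, hG, hlim⟩ := exists_subseq_tendsto (F := F) (r := r) (r' := r + d)
    (S := sqrt ((2 * A0 + 2 * m) / V)) hr (by linarith)
    (fun k => (hF k).differentiableOn) (fun k z hz => by
      refine le_sqrt_of_sq_le ?_
      rw [le_div_iff₀ hV0]
      linarith [hsup k z hz, hAk k])
  have hrρ : ball (0 : Cn n) r ⊆ D := ball_subset_ball (by rw [hρ]; linarith)
  refine ⟨G, hG, fun z hz => ?_, ?_⟩
  · have h1 : Tendsto (fun k => ‖F (σ k) z‖ ^ 2 * V) atTop (𝓝 (‖G z‖ ^ 2 * V)) :=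
      (((hlim z hz).norm).pow 2).mul_const V
    have h2 : Tendsto (fun k => 2 * A (σ k) + 2 * m) atTop
        (𝓝 (2 * (exp (1 + n) * (K * (1 + t) * exp t * m + 0)) + 2 * m)) := by
      have : Tendsto δ atTop (𝓝 0) := tendsto_one_div_add_atTop_nhds_zero_nat
      exact ((((this.comp hσ.tendsto_atTop).const_add _).const_mul _).const_mul 2).add_const _
    refine (le_of_tendsto_of_tendsto' h1 h2 fun k => hsup (σ k) z
      (ball_subset_ball (by linarith) hz)).trans ?_
    have : 1 ≤ (1 + t) * exp t := one_le_mul_of_one_le_of_one_le (by linarith)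
      (one_le_exp ht)
    nlinarith
  · have hB : ∀ k, ∫⁻ z in ball (0 : Cn n) r,
        ofReal (‖F k z - f z‖ ^ 2 * exp (-ψ k z)) ≤
        ofReal (2 * A0 + 2 * (exp (t + 1) * If)) := by
      intro k
      have hi3 : IntegrableOn (fun z => ‖F k z - f z‖ ^ 2 * exp (-ψ k z)) D :=
        (hInt (((((hF k).continuous.continuousOn).sub hfc).norm.pow 2).mul
          (hec k).continuousOn)).mono_set hDR
      refine (lintegral_mono_set hrρ).trans ?_
      rw [← ofReal_integral_eq_lintegral_ofReal hi3 (ae_of_all _ fun z => by positivity)]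
      exact ofReal_le_ofReal (by linarith [hA3 k, hAk k])
    have hmeas : ∀ k, AEMeasurable (fun z => ofReal (‖F k z - f z‖ ^ 2 * exp (-ψ k z)))
        (volume.restrict (ball (0 : Cn n) r)) := by
      intro k
      refine ENNReal.measurable_ofReal.comp_aemeasurable ?_
      refine ContinuousOn.aemeasurable ?_ isOpen_ball.measurableSet
      have := hfc.mono ((hrρ.trans hDR).trans ball_subset_closedBall)
      exact ((((hF k).continuous.continuousOn).sub this).norm.pow 2).mul (hec k).continuousOn
    refine lt_of_le_of_lt ?_ (ENNReal.ofReal_lt_top (r := 2 * A0 + 2 * (exp (t + 1) * If)))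
    calc _ ≤ ∫⁻ z in ball (0 : Cn n) r, liminf (fun k =>
          ofReal (‖F (σ k) z - f z‖ ^ 2 * exp (-ψ (σ k) z))) atTop := by
          refine setLIntegral_mono' isOpen_ball.measurableSet fun z hz => ?_
          have hzR := hDR (hrρ hz)
          rw [← ofReal_norm_sq]
          refine wexp_neg_one_le_liminf (s := fun k => ψ (σ k) z)
            (hφ.lt_top z (hcR (ball_subset_closedBall hzR)))
            (fun c hc => hσ.tendsto_atTop.eventually (hψlim z hzR c hc)) (sq_nonneg _) ?_
          exact (((hlim z hz).sub_const (f z)).norm).pow 2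
      _ ≤ liminf (fun k => ∫⁻ z in ball (0 : Cn n) r,
          ofReal (‖F (σ k) z - f z‖ ^ 2 * exp (-ψ (σ k) z))) atTop :=
          lintegral_liminf_le' fun k => hmeas (σ k)
      _ ≤ _ := by
          refine (liminf_le_liminf (v := fun _ => ofReal (2 * A0 + 2 * (exp (t + 1) * If)))
            (Eventually.of_forall fun k => hB (σ k))).trans ?_
          simp

theorem IntNear.mono {a b : Cn n → ℝ≥0∞} (hb : IntNear b) {C : ℝ≥0∞} (hC : C ≠ ⊤)
    (h : ∀ᶠ z in 𝓝 0, a z ≤ C * b z) : IntNear a := by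
  obtain ⟨U, hU, hi⟩ := hb
  obtain ⟨ε, hε, hball⟩ := Metric.mem_nhds_iff.1 (inter_mem hU h)
  refine ⟨ball 0 ε, ball_mem_nhds _ hε, ?_⟩
  calc ∫⁻ z in ball 0 ε, a z ≤ ∫⁻ z in ball 0 ε, C * b z :=
        setLIntegral_mono' isOpen_ball.measurableSet fun z hz => (hball hz).2
    _ = C * ∫⁻ z in ball 0 ε, b z := lintegral_const_mul' _ _ hC
    _ ≤ C * ∫⁻ z in U, b z := by
        gcongr
        exact fun z hz => (hball hz).1
    _ < ⊤ := ENNReal.mul_lt_top hC.lt_top hi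

theorem intNear_of_bounded {a : Cn n → ℝ≥0∞} {C : ℝ≥0∞} (hC : C ≠ ⊤) (h : ∀ᶠ z in 𝓝 0, a z ≤ C) :
    IntNear a := by
  have h1 : IntNear fun _ : Cn n => 1 :=
    ⟨ball 0 1, ball_mem_nhds _ one_pos, by
      simpa using (measure_ball_lt_top (μ := (volume : Measure (Cn n))))⟩
  exact h1.mono hC (by simpa using h)

theorem IntNear.add_mul {a b w : Cn n → ℝ≥0∞} (hU : U ∈ 𝓝 0) (ha : ContinuousOn a U)
    (hb : ContinuousOn b U) (h1 : IntNear fun z => a z * w z) (h2 : IntNear fun z => b z * w z) :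
    IntNear fun z => (a z + b z) * w z := by
  obtain ⟨U1, hU1, hi1⟩ := h1
  obtain ⟨U2, hU2, hi2⟩ := h2
  obtain ⟨ε, hε, hball⟩ := Metric.mem_nhds_iff.1 (inter_mem hU (inter_mem hU1 hU2))
  refine ⟨ball 0 ε, ball_mem_nhds _ hε, ?_⟩
  have hsub : ball 0 ε ⊆ U := fun z hz => (hball hz).1
  have hB : MeasurableSet (ball 0 ε ∩ {z | b z < a z}) :=
    (((hb.mono hsub).prodMk (ha.mono hsub)).isOpen_inter_preimage isOpen_ball
      (isOpen_lt continuous_fst continuous_snd)).measurableSet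
  rw [← lintegral_add_compl _ hB]
  refine ENNReal.add_lt_top.2 ⟨?_, ?_⟩
  · calc _ ≤ ∫⁻ z in ball 0 ε ∩ {z | b z < a z}, 2 * (a z * w z)
          ∂(volume.restrict (ball 0 ε)) := by
          refine setLIntegral_mono' hB fun z hz => ?_
          rw [← mul_assoc, two_mul]
          exact mul_le_mul_left (add_le_add_right (le_of_lt hz.2) _) _
      _ ≤ ∫⁻ z in U1, 2 * (a z * w z) := by
          refine (setLIntegral_le_lintegral _ _).trans ?_
          exact lintegral_mono_set fun z hz => (hball hz).2.1
      _ < ⊤ := by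
          rw [lintegral_const_mul' _ _ (by simp)]
          exact ENNReal.mul_lt_top (by simp) hi1
  · calc _ ≤ ∫⁻ z in (ball 0 ε ∩ {z | b z < a z})ᶜ, 2 * (b z * w z)
          ∂(volume.restrict (ball 0 ε)) := by
          refine lintegral_mono_ae ?_
          filter_upwards [ae_restrict_mem hB.compl,
            ae_restrict_of_ae (ae_restrict_mem isOpen_ball.measurableSet)] with z hz hz'
          rw [← mul_assoc, two_mul]
          exact mul_le_mul_left (add_le_add_left (not_lt.1 fun h => hz ⟨hz', h⟩) _) _
      _ ≤ ∫⁻ z in U2, 2 * (b z * w z) := by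
          refine (setLIntegral_le_lintegral _ _).trans ?_
          exact lintegral_mono_set fun z hz => (hball hz).2.2
      _ < ⊤ := by
          rw [lintegral_const_mul' _ _ (by simp)]
          exact ENNReal.mul_lt_top (by simp) hi2

theorem holoNear_of_ball (hr : 0 < r) (hf : DifferentiableOn ℂ f (ball 0 r)) : HoloNear f :=
  ⟨_, ball_mem_nhds _ hr, isOpen_ball, hf⟩

theorem HoloNear.eventually_bounded (hf : HoloNear f) :
    ∃ C : ℝ≥0, ∀ᶠ z in 𝓝 0, (‖f z‖₊ : ℝ≥0∞) ^ 2 ≤ C := by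
  obtain ⟨U, hU, -, hd⟩ := hf
  have hc : ContinuousAt f 0 := (hd.differentiableAt hU).continuousAt
  refine ⟨(‖f 0‖₊ + 1) ^ 2, ?_⟩
  filter_upwards [hc.nnnorm.eventually (gt_mem_nhds (lt_add_one _))] with z hz
  exact_mod_cast pow_le_pow_left' hz.le 2

theorem continuousOn_nnnorm_sq (hf : ContinuousOn f U) :
    ContinuousOn (fun z => (‖f z‖₊ : ℝ≥0∞) ^ 2) U :=
  (ENNReal.continuous_pow 2).comp_continuousOn
    (ENNReal.continuous_coe.comp_continuousOn hf.nnnorm)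

/-- The multiplier ideal of a density `w`. -/
def multIdeal (w : Cn n → ℝ≥0∞) : Set (Cn n → ℂ) :=
  {f | HoloNear f ∧ IntNear fun z => (‖f z‖₊ : ℝ≥0∞) ^ 2 * w z}

theorem isGermIdeal_multIdeal (w : Cn n → ℝ≥0∞) : IsGermIdeal (multIdeal w) := by
  refine ⟨fun f hf => hf.1, ⟨holoNear_const 0, ?_⟩, ?_, ?_, ?_⟩
  · exact intNear_of_bounded ENNReal.zero_ne_top (by simp)
  · rintro f ⟨hf, hfi⟩ g ⟨hg, hgi⟩
    obtain ⟨U, hU, hUo, hfd⟩ := hf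
    obtain ⟨V, hV, hVo, hgd⟩ := hg
    have hf' := hfd.mono (inter_subset_left (t := V))
    have hg' := hgd.mono (inter_subset_right (s := U))
    refine ⟨⟨U ∩ V, inter_mem hU hV, hUo.inter hVo, hf'.add hg'⟩, ?_⟩
    refine (IntNear.add_mul (inter_mem hU hV)
      (continuousOn_nnnorm_sq hf'.continuousOn) (continuousOn_nnnorm_sq hg'.continuousOn)
      hfi hgi).mono (C := 2) (by simp) (Eventually.of_forall fun z => ?_)
    rw [← mul_assoc]
    refine mul_le_mul_left ?_ _
    have h := norm_add_le (f z) (g z)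
    have h2 : ‖f z + g z‖ ^ 2 ≤ 2 * (‖f z‖ ^ 2 + ‖g z‖ ^ 2) := by
      nlinarith [sq_nonneg (‖f z‖ - ‖g z‖), norm_nonneg (f z + g z), norm_nonneg (f z),
        norm_nonneg (g z)]
    have h3 : ‖f z + g z‖₊ ^ 2 ≤ 2 * (‖f z‖₊ ^ 2 + ‖g z‖₊ ^ 2) := by exact_mod_cast h2
    exact_mod_cast h3
  · rintro f hf g ⟨hg, hgi⟩
    obtain ⟨C, hC⟩ := hf.eventually_bounded
    obtain ⟨U, hU, hUo, hfd⟩ := hf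
    obtain ⟨V, hV, hVo, hgd⟩ := hg
    refine ⟨⟨U ∩ V, inter_mem hU hV, hUo.inter hVo, (hfd.mono inter_subset_left).mul
      (hgd.mono inter_subset_right)⟩, hgi.mono (C := C) (by simp) ?_⟩
    filter_upwards [hC] with z hz
    rw [nnnorm_mul, ENNReal.coe_mul, mul_pow, mul_assoc]
    exact mul_le_mul_left hz _
  · rintro f ⟨hf, hfi⟩ g hfg
    obtain ⟨U, hU, hUo, hfd⟩ := hf
    obtain ⟨V, hV, hVo, h0V⟩ := _root_.eventually_nhds_iff.1 hfg
    refine ⟨⟨U ∩ V, inter_mem hU (hVo.mem_nhds h0V), hUo.inter hVo, ?_⟩, ?_⟩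
    · exact (hfd.mono inter_subset_left).congr fun z hz => (hV z hz.2).symm
    · refine hfi.mono (C := 1) (by simp) ?_
      filter_upwards [hfg] with z hz
      rw [hz, one_mul]

theorem isGermIdeal_iUnion {J : ℕ → Set (Cn n → ℂ)} (hJ : ∀ j, IsGermIdeal (J j))
    (hm : Monotone J) : IsGermIdeal (⋃ j, J j) := by
  refine ⟨?_, mem_iUnion.2 ⟨0, (hJ 0).zero⟩, ?_, ?_, ?_⟩
  · intro f hf
    obtain ⟨j, hj⟩ := mem_iUnion.1 hf
    exact (hJ j).holo f hj
  · intro f hf g hg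
    obtain ⟨j, hj⟩ := mem_iUnion.1 hf
    obtain ⟨i, hi⟩ := mem_iUnion.1 hg
    exact mem_iUnion.2 ⟨max j i, (hJ _).add f (hm (le_max_left _ _) hj) g
      (hm (le_max_right _ _) hi)⟩
  · intro f hf g hg
    obtain ⟨j, hj⟩ := mem_iUnion.1 hg
    exact mem_iUnion.2 ⟨j, (hJ j).mul f hf g hj⟩
  · intro f hf g hg
    obtain ⟨j, hj⟩ := mem_iUnion.1 hf
    exact mem_iUnion.2 ⟨j, (hJ j).congr f hj g hg⟩

theorem multIdeal_mono {v w : Cn n → ℝ≥0∞} {C : ℝ≥0∞} (hC : C ≠ ⊤)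
    (h : ∀ᶠ z in 𝓝 0, w z ≤ C * v z) : multIdeal v ⊆ multIdeal w := by
  rintro f ⟨hf, hi⟩
  refine ⟨hf, hi.mono hC ?_⟩
  filter_upwards [h] with z hz
  rw [mul_left_comm]
  exact mul_le_mul_right hz _

theorem intNear_normSq2 {k : ℕ} {g : Fin k → Cn n → ℂ} {w : Cn n → ℝ≥0∞}
    (h : ∀ i, g i ∈ multIdeal w) : IntNear fun z => normSq2 g z * w z := by
  choose U hU hUo hd using fun i => (h i).1
  have hV : (⋂ i, U i) ∈ 𝓝 (0 : Cn n) := (iInter_mem).2 hU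
  have hc : ∀ i, ContinuousOn (fun z => (‖g i z‖₊ : ℝ≥0∞) ^ 2) (⋂ i, U i) := fun i =>
    continuousOn_nnnorm_sq ((hd i).continuousOn.mono (iInter_subset _ i))
  unfold normSq2
  generalize (Finset.univ : Finset (Fin k)) = s
  induction s using Finset.induction_on with
  | empty => exact intNear_of_bounded ENNReal.zero_ne_top (by simp)
  | insert i s hi ih =>
    simp only [sum_insert hi]
    exact IntNear.add_mul hV (hc i) (continuousOn_finsetSum _ fun i _ => hc i) (h i).2 ih

theorem mem_multIdeal_of_normSq2 {k : ℕ} {g : Fin k → Cn n → ℂ} (hg : ∀ i, HoloNear (g i))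
    {w : Cn n → ℝ≥0∞} (h : IntNear fun z => normSq2 g z * w z) (i : Fin k) :
    g i ∈ multIdeal w := by
  refine ⟨hg i, h.mono (C := 1) (by simp) (Eventually.of_forall fun z => ?_)⟩
  rw [one_mul]
  exact mul_le_mul_left (single_le_sum (f := fun j => (‖g j z‖₊ : ℝ≥0∞) ^ 2)
    (fun _ _ => zero_le) (Finset.mem_univ i)) _

theorem wexp_le_of_le {φ ψ : Cn n → EReal} {C c : ℝ} (hc : 0 < c) (h : φ z ≤ ψ z + (C : EReal)) :
    wexp (-c) ψ z ≤ ofReal (exp (c * C)) * wexp (-c) φ z := by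
  unfold wexp
  have hn : -c < 0 := by linarith
  generalize φ z = x at *
  generalize ψ z = y at *
  induction y with
  | bot =>
    have : x = ⊥ := by simpa using h
    subst this
    rw [EReal.coe_mul_bot_of_neg hn]
    simp [expE, ENNReal.mul_top, exp_pos]
  | top =>
    rw [EReal.coe_mul_top_of_neg hn]
    simp [expE]
  | coe y =>
    induction x with
    | bot =>
      rw [EReal.coe_mul_bot_of_neg hn]
      simp [expE, ENNReal.mul_top, exp_pos]
    | top => exact absurd h (by rw [← coe_add]; exact not_le.2 (EReal.coe_lt_top _))
    | coe x =>
      have h' : x ≤ y + C := by exact_mod_cast h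
      rw [← coe_mul, ← coe_mul, expE_coe, expE_coe,
        ← ofReal_mul (exp_pos _).le, ← exp_add]
      refine ofReal_le_ofReal (exp_le_exp.2 ?_)
      nlinarith

theorem wexp_mul {a b : ℝ} :
    wexp a (fun z => (b : EReal) * φ z) z = wexp (a * b) φ z := by
  unfold wexp
  rw [← mul_assoc, coe_mul]

theorem ofReal_exp_le_wexp {c s : ℝ} (hc : 0 < c) (h : φ z ≤ ((-s : ℝ) : EReal)) :
    ofReal (exp (c * s)) ≤ wexp (-c) φ z := by
  have := wexp_le_of_le (φ := φ) (ψ := fun _ => (0 : ℝ)) (z := z) (C := -s) hc (by simpa using h)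
  simp only [wexp, ← coe_mul, expE_coe, mul_zero, exp_zero, ENNReal.ofReal_one] at this
  unfold wexp
  calc ofReal (exp (c * s)) = ofReal (exp (c * s)) * 1 := by simp
    _ ≤ ofReal (exp (c * s)) *
        (ofReal (exp (c * -s)) * expE (((-c : ℝ) : EReal) * φ z)) :=
        mul_le_mul_right this _
    _ = _ := by
        rw [← mul_assoc, ← ofReal_mul (exp_pos _).le, ← exp_add]
        simp

theorem volume_ball_toReal (hr : 0 < r) : (volume (ball (0 : Cn n) r)).toReal =
    r ^ Module.finrank ℝ (Cn n) * (volume (ball (0 : Cn n) 1)).toReal := by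
  rw [Measure.addHaar_ball_of_pos _ _ hr, ENNReal.toReal_mul, ENNReal.toReal_ofReal (by positivity)]

/-- Lower bound for the mass of `g` on the sublevel sets of a weight whose multiplier ideal is
contained in an ideal not containing `g`. -/
theorem IsGermIdeal.exists_mass_lower_bound {J : Set (Cn n → ℂ)} (hJ : IsGermIdeal J)
    (hg : HoloNear g) (hgJ : g ∉ J) :
    ∃ (M : ℕ) (c : ℝ), 0 < c ∧ ∀ (r R t : ℝ) (φ : Cn n → EReal), 0 < r → r ≤ 1 → 2 * r ≤ 1 →
      2 * r < R → 0 ≤ t → LPsh φ (ball 0 R) → (∀ z ∈ ball 0 R, φ z ≤ 0) →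
      DifferentiableOn ℂ g (ball 0 R) → multIdeal (wexp (-1) φ) ⊆ J →
      c * r ^ M ≤ (1 + t) * exp t *
        ∫ z in ball 0 (2 * r) ∩ {z | φ z < ((-t : ℝ) : EReal)}, ‖g z‖ ^ 2 := by
  obtain ⟨M, c, hc, hKC⟩ := hJ.exists_lower_bound hg hgJ
  obtain ⟨C, hC, hmass⟩ := mass_lemma n
  set d := Module.finrank ℝ (Cn n)
  set V := (volume (ball (0 : Cn n) 1)).toReal with hV
  have hV0 : 0 < V := volume_ball_toReal_pos 0 one_pos
  refine ⟨2 * M + d, c ^ 2 * (4⁻¹ ^ d * V) / C, by positivity, ?_⟩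
  intro r R t φ hr hr1 hr2 hR ht hφ hφ0 hgd hsub
  obtain ⟨F, hF, hFb, hFi⟩ := hmass r (2 * r) R t φ g hr (by linarith) hR hr2 ht hφ hφ0 hgd
  set m := ∫ z in ball 0 (2 * r) ∩ {z | φ z < ((-t : ℝ) : EReal)}, ‖g z‖ ^ 2 with hm
  have hm0 : 0 ≤ m := integral_nonneg fun z => sq_nonneg _
  have hvol : (volume (ball (0 : Cn n) ((2 * r - r) / 4))).toReal = r ^ d * (4⁻¹ ^ d * V) := by
    rw [volume_ball_toReal (by linarith), ← mul_assoc, ← mul_pow]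
    congr 2
    ring
  rw [hvol] at hFb
  set W := r ^ d * (4⁻¹ ^ d * V) with hW
  have hW0 : 0 < W := by positivity
  have hmem : (fun z => F z - g z) ∈ J := by
    refine hsub ⟨holoNear_of_ball hr (hF.sub (hgd.mono (ball_subset_ball (by linarith)))), ?_⟩
    exact ⟨_, ball_mem_nhds _ hr, hFi⟩
  have key := hKC F r (sqrt (C * (1 + t) * exp t * m / W)) hr (by linarith) hF
    (fun z hz => le_sqrt_of_sq_le ((le_div_iff₀ hW0).2 (hFb z hz))) hmem
  have h2 : (c * r ^ M) ^ 2 ≤ C * (1 + t) * exp t * m / W :=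
    (le_sqrt' (by positivity)).1 key
  rw [le_div_iff₀ hW0] at h2
  rw [div_mul_eq_mul_div, div_le_iff₀ hC]
  calc c ^ 2 * (4⁻¹ ^ d * V) * r ^ (2 * M + d) = (c * r ^ M) ^ 2 * W := by rw [hW]; ring
    _ ≤ _ := h2
    _ = _ := by ring

theorem LPsh.measurableSet_lt (hu : LPsh u Ω) (hΩ : IsOpen Ω) (a : EReal) :
    MeasurableSet (Ω ∩ {z | u z < a}) := by
  obtain ⟨W, hW, h⟩ := upperSemicontinuousOn_iff_preimage_Iio.1 hu.usc a
  exact h ▸ (hΩ.inter hW).measurableSet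

theorem integrableOn_norm_sq (hrR : r < R) (hg : DifferentiableOn ℂ g (ball 0 R)) :
    IntegrableOn (fun z => ‖g z‖ ^ 2) (ball 0 r) :=
  (((hg.continuousOn.mono (closedBall_subset_ball hrR)).norm.pow 2).integrableOn_compact
    (isCompact_closedBall 0 r)).mono_set ball_subset_closedBall

/-- Some positive multiple of a negative plurisubharmonic function has integrable exponential. -/
theorem PSHOn.exists_intNear (hR : 0 < R)
    (hφ : PSHOn φ (ball 0 R)) (hφ0 : ∀ z ∈ ball 0 R, φ z ≤ 0) :
    ∃ c > 0, IntNear (wexp (-c) φ) := by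
  have hL := hφ.lpsh isOpen_ball
  by_contra hcon
  push Not at hcon
  set q : ℕ → ℝ := fun j => 1 / ((j : ℝ) + 1) with hq
  have hq0 : ∀ j, 0 < q j := fun j => by simp only [hq]; positivity
  have hqm : Antitone q := fun i j hij => by
    simp only [hq]
    gcongr
  set J : ℕ → Set (Cn n → ℂ) := fun j => multIdeal (wexp (-1) fun z => (q j : EReal) * φ z) with hJ
  have hmono : Monotone J := by
    intro i j hij
    refine multIdeal_mono (C := 1) (by simp) ?_
    filter_upwards [ball_mem_nhds 0 hR] with z hz
    have := wexp_le_of_le (φ := fun z => (q i : EReal) * φ z)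
      (ψ := fun z => (q j : EReal) * φ z) (z := z) (C := 0) (c := 1) one_pos (by
        have hz0 := hφ0 z hz
        simp only [EReal.coe_zero, add_zero]
        exact EReal.mul_le_mul_of_nonpos_right (by exact_mod_cast hqm hij) hz0)
    simpa using this
  have h1 : (fun _ : Cn n => (1 : ℂ)) ∉ ⋃ j, J j := by
    intro h
    obtain ⟨j, -, hj⟩ := mem_iUnion.1 h
    refine hcon (q j) (hq0 j) (hj.mono (C := 1) (by simp) (Eventually.of_forall fun z => ?_))
    simp [wexp_mul]
  obtain ⟨M, c, hc, hmass⟩ := (isGermIdeal_iUnion (fun j => isGermIdeal_multIdeal _)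
    hmono).exists_mass_lower_bound (holoNear_const 1) h1
  set r := min (R / 3) (1 / 2)
  have hr : 0 < r := by positivity
  have hr1 : r ≤ R / 3 := min_le_left _ _
  have hr2 : r ≤ 1 / 2 := min_le_right _ _
  have hsub : ball (0 : Cn n) (2 * r) ⊆ ball 0 R :=
    ball_subset_ball (by linarith)
  set A : ℕ → Set (Cn n) := fun j =>
    ball 0 (2 * r) ∩ {z | (q j : EReal) * φ z < ((-1 : ℝ) : EReal)} with hA
  have hlow : ∀ j, c * r ^ M ≤ 2 * exp 1 * (volume (A j)).toReal := by
    intro j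
    have := hmass r R 1 (fun z => (q j : EReal) * φ z) hr (by linarith) (by linarith) (by linarith)
      zero_le_one (by simpa using hL.affine isOpen_ball (hq0 j) 0) (fun z hz => by
        have := mul_le_mul_of_nonneg_left (hφ0 z hz) (coe_nonneg.2 (hq0 j).le)
        simpa using this) (differentiableOn_const _) (subset_iUnion J j)
    rw [one_add_one_eq_two] at this
    simpa [Measure.real, hA] using this
  have hAm : ∀ j, MeasurableSet (A j) := fun j => by
    have := (hL.affine isOpen_ball (hq0 j) 0).measurableSet_lt isOpen_ball
      ((-1 : ℝ) : EReal)
    have h2 := (isOpen_ball (x := (0 : Cn n)) (ε := 2 * r)).measurableSet.inter this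
    convert h2 using 1
    rw [← inter_assoc, inter_eq_left.2 hsub]
    simp [hA]
  have hAanti : Antitone A := by
    intro i j hij z hz
    have h2 : (q j : EReal) * φ z < ((-1 : ℝ) : EReal) := hz.2
    refine ⟨hz.1, mem_ofPred.2 (lt_of_le_of_lt ?_ h2)⟩
    exact EReal.mul_le_mul_of_nonpos_right (by exact_mod_cast hqm hij) (hφ0 z (hsub hz.1))
  have hlim := tendsto_measure_iInter_atTop (μ := volume) (fun j => (hAm j).nullMeasurableSet) hAanti
    ⟨0, ((measure_mono inter_subset_left).trans_lt measure_ball_lt_top).ne⟩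
  have hzero : volume (⋂ j, A j) = 0 := by
    refine measure_mono_null (fun z hz => ?_) (hφ.volume_bot isOpen_ball)
    have hz' := mem_iInter.1 hz
    refine ⟨?_, hsub (hz' 0).1⟩
    show φ z = ⊥
    have hlt := fun j => (hz' j).2
    have htop := hL.lt_top z (hsub (hz' 0).1)
    simp only [mem_ofPred_eq] at hlt
    generalize φ z = x at *
    induction x with
    | bot => rfl
    | top => simp at htop
    | coe x =>
      exfalso
      obtain ⟨j, hj⟩ := exists_nat_gt (-x)
      have := hlt j
      rw [← coe_mul, coe_lt_coe_iff] at this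
      simp only [hq] at this
      rw [one_div, inv_mul_lt_iff₀ (by positivity)] at this
      linarith
  rw [hzero] at hlim
  have hlim2 := ((ENNReal.tendsto_toReal ENNReal.zero_ne_top).comp hlim).const_mul (2 * exp 1)
  have := ge_of_tendsto' hlim2 hlow
  simp only [ENNReal.toReal_zero, mul_zero] at this
  have : 0 < c * r ^ M := by positivity
  linarith

theorem ofReal_setIntegral_norm_sq {S : Set (Cn n)} (hi : IntegrableOn (fun z => ‖g z‖ ^ 2) S) :
    ofReal (∫ z in S, ‖g z‖ ^ 2) = ∫⁻ z in S, (‖g z‖₊ : ℝ≥0∞) ^ 2 := by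
  rw [ofReal_integral_eq_lintegral_ofReal hi (ae_of_all _ fun z => sq_nonneg _)]
  simp only [ofReal_norm_sq]

/-- Chebyshev's inequality for the weight `e^{-2u}` on a set where `u ≤ -s`. -/
theorem exp_mul_setIntegral_le {S U : Set (Cn n)} {s : ℝ} (hS : MeasurableSet S) (hSU : S ⊆ U)
    (hi : IntegrableOn (fun z => ‖g z‖ ^ 2) S) (hu : ∀ z ∈ S, u z ≤ ((-s : ℝ) : EReal))
    (hfin : ∫⁻ z in U, (‖g z‖₊ : ℝ≥0∞) ^ 2 * wexp (-2) u z < ⊤) :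
    exp (2 * s) * ∫ z in S, ‖g z‖ ^ 2 ≤
      (∫⁻ z in U, (‖g z‖₊ : ℝ≥0∞) ^ 2 * wexp (-2) u z).toReal := by
  rw [← ENNReal.ofReal_le_iff_le_toReal hfin.ne, ofReal_mul (exp_pos _).le,
    ofReal_setIntegral_norm_sq hi, ← lintegral_const_mul' _ _ ofReal_ne_top]
  calc _ ≤ ∫⁻ z in S, (‖g z‖₊ : ℝ≥0∞) ^ 2 * wexp (-2) u z := by
        refine setLIntegral_mono' hS fun z hz => ?_
        rw [mul_comm]
        exact mul_le_mul_right (ofReal_exp_le_wexp two_pos (hu z hz)) _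
    _ ≤ _ := lintegral_mono_set hSU

/-- Adding a sufficiently singular logarithmic pole as a lower barrier keeps a weight
nonintegrable, at the cost of an arbitrarily small increase of the exponent. -/
theorem LPsh.exists_max_log_not_mem {R a b : ℝ} (hR : 0 < R) (hφ : LPsh φ (ball 0 R))
    (hφ0 : ∀ z ∈ ball 0 R, φ z ≤ 0) (hg : DifferentiableOn ℂ g (ball 0 R)) (ha : 0 < a)
    (hab : a < b) (hn : g ∉ multIdeal (wexp (-2 * a) φ)) : ∃ N : ℕ, 0 < N ∧
      g ∉ multIdeal (wexp (-2) fun z => Max.max ((b : EReal) * φ z) ((N : ℝ) * elog ‖z‖)) := by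
  have hψ : (wexp (-1) fun z => ((2 * a : ℝ) : EReal) * φ z) = wexp (-2 * a) φ := by
    funext z
    rw [wexp_mul]
    congr 1
    ring
  have hψL : LPsh (fun z => ((2 * a : ℝ) : EReal) * φ z) (ball 0 R) := by
    simpa using hφ.affine isOpen_ball (a := 2 * a) (by positivity) 0
  have hψ0 : ∀ z ∈ ball 0 R, ((2 * a : ℝ) : EReal) * φ z ≤ 0 := fun z hz => by
    have := mul_le_mul_of_nonneg_left (hφ0 z hz) (coe_nonneg.2 (by positivity : 0 ≤ 2 * a))
    simpa using this
  obtain ⟨M, c, hc, hmass⟩ := (isGermIdeal_multIdeal _).exists_mass_lower_bound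
    (holoNear_of_ball hR hg) hn
  set l := b / a with hl
  have hl1 : 1 < l := (one_lt_div ha).2 hab
  set ε := (l - 1) / 4 with hε
  have hε0 : 0 < ε := by rw [hε]; linarith
  obtain ⟨N, hN⟩ := exists_nat_gt (M * l / (4 * ε))
  have hN0 : (0 : ℝ) < N := lt_of_le_of_lt (by positivity) hN
  refine ⟨N, by exact_mod_cast hN0, fun hmem => ?_⟩
  obtain ⟨-, U, hU, hfin⟩ := hmem
  obtain ⟨δ, hδ, hball⟩ := Metric.mem_nhds_iff.1 hU
  set A := (∫⁻ z in U, (‖g z‖₊ : ℝ≥0∞) ^ 2 *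
    wexp (-2) (fun z => Max.max ((b : EReal) * φ z) ((N : ℝ) * elog ‖z‖)) z).toReal with hA
  have hA0 : 0 ≤ A := ENNReal.toReal_nonneg
  set r : ℝ → ℝ := fun t => exp (-(l * t / (2 * N))) / 2 with hr
  have hrlim : Tendsto (fun t => 2 * r t) atTop (𝓝 0) := by
    have h1 : Tendsto (fun t : ℝ => l * t / (2 * N)) atTop atTop :=
      (tendsto_id.const_mul_atTop (by linarith : 0 < l)).atTop_div_const (by positivity)
    refine (tendsto_exp_neg_atTop_nhds_zero.comp h1).congr fun t => ?_
    simp only [hr, Function.comp]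
    ring
  have hmain : ∀ᶠ t in atTop, c * 2⁻¹ ^ M * exp (ε * t) ≤ A * (1 + 1 / ε) := by
    filter_upwards [hrlim.eventually (gt_mem_nhds (lt_min hδ (lt_min hR one_pos))),
      eventually_ge_atTop 0] with t ht ht0
    obtain ⟨ht1, ht2⟩ := lt_min_iff.1 ht
    obtain ⟨ht2, ht3⟩ := lt_min_iff.1 ht2
    have hr0 : 0 < r t := by simp only [hr]; positivity
    have h1 := hmass (r t) R t _ hr0 (by linarith) ht3.le ht2 ht0 hψL hψ0 hg (by rw [hψ])
    set S := ball 0 (2 * r t) ∩ {z | ((2 * a : ℝ) : EReal) * φ z < ((-t : ℝ) : EReal)}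
    have hSR : S ⊆ ball 0 R :=
      inter_subset_left.trans (ball_subset_ball ht2.le)
    have hSm : MeasurableSet S := by
      have h2 := (isOpen_ball (x := (0 : Cn n)) (ε := 2 * r t)).measurableSet.inter
        (hψL.measurableSet_lt isOpen_ball ((-t : ℝ) : EReal))
      rwa [← inter_assoc, inter_eq_left.2 (ball_subset_ball ht2.le)] at h2
    have h2 := exp_mul_setIntegral_le (s := l * t / 2) hSm
      (inter_subset_left.trans ((ball_subset_ball ht1.le).trans hball))
      ((integrableOn_norm_sq ht2 hg).mono_set inter_subset_left) (fun z hz => by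
        refine max_le ?_ ?_
        · have hz2 : ((2 * a : ℝ) : EReal) * φ z < ((-t : ℝ) : EReal) := hz.2
          have htop := hφ.lt_top z (hSR hz)
          generalize φ z = x at *
          induction x with
          | bot => rw [EReal.coe_mul_bot_of_pos (by linarith)]; simp
          | top => simp at htop
          | coe x =>
            rw [← coe_mul, coe_lt_coe_iff] at hz2
            rw [← coe_mul, coe_le_coe_iff, show b = l * a by rw [hl]; field_simp]
            nlinarith
        · have hz1 : ‖z‖ < exp (-(l * t / (2 * N))) := by
            have := mem_ball_zero_iff.1 hz.1
            simp only [hr] at this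
            linarith
          have hlog := (elog_lt_coe.2 hz1).le
          refine (mul_le_mul_of_nonneg_left hlog (coe_nonneg.2 hN0.le)).trans ?_
          rw [← coe_mul, coe_le_coe_iff]
          apply le_of_eq
          field_simp) hfin
    set m := ∫ z in S, ‖g z‖ ^ 2
    have hm0 : 0 ≤ m := integral_nonneg fun z => sq_nonneg _
    have hexp : exp (2 * ε * t) * exp t ≤
        exp (2 * (l * t / 2)) * exp (-(l * t / (2 * N))) ^ M := by
      rw [← exp_nat_mul, ← exp_add, ← exp_add]
      refine exp_le_exp.2 ?_
      have h3 : M * l / (2 * N) ≤ 2 * ε := by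
        rw [div_lt_iff₀ (by positivity)] at hN
        rw [div_le_iff₀ (by positivity)]
        nlinarith
      have h4 : (M : ℝ) * -(l * t / (2 * N)) = -(M * l / (2 * N) * t) := by ring
      rw [h4]
      have h5 := mul_le_mul_of_nonneg_right h3 ht0
      have h6 : l = 1 + 4 * ε := by rw [hε]; ring
      rw [show 2 * (l * t / 2) = t + 4 * (ε * t) by rw [h6]; ring]
      linarith
    have h7 : 1 + t ≤ (1 + 1 / ε) * exp (ε * t) := by
      have e1 := add_one_le_exp (ε * t)
      have e2 : t = 1 / ε * (ε * t) := by field_simp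
      have e3 : 0 ≤ ε * t := by positivity
      have e4 : 0 < 1 / ε := by positivity
      nlinarith
    have h8 : c * 2⁻¹ ^ M * exp (2 * ε * t) * exp t ≤ (1 + t) * exp t * A := by
      calc c * 2⁻¹ ^ M * exp (2 * ε * t) * exp t
          = c * 2⁻¹ ^ M * (exp (2 * ε * t) * exp t) := by ring
        _ ≤ c * 2⁻¹ ^ M * (exp (2 * (l * t / 2)) * exp (-(l * t / (2 * N))) ^ M) :=
            mul_le_mul_of_nonneg_left hexp (by positivity)
        _ = exp (2 * (l * t / 2)) * (c * r t ^ M) := by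
            simp only [hr]
            rw [div_pow, inv_pow]
            ring
        _ ≤ exp (2 * (l * t / 2)) * ((1 + t) * exp t * m) :=
            mul_le_mul_of_nonneg_left h1 (exp_pos _).le
        _ = (1 + t) * exp t * (exp (2 * (l * t / 2)) * m) := by ring
        _ ≤ _ := mul_le_mul_of_nonneg_left h2 (by positivity)
    have h9 : c * 2⁻¹ ^ M * exp (2 * ε * t) ≤ (1 + t) * A := by
      have := exp_pos t
      nlinarith
    have h10 : c * 2⁻¹ ^ M * exp (ε * t) * exp (ε * t) ≤
        A * (1 + 1 / ε) * exp (ε * t) := by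
      calc _ = c * 2⁻¹ ^ M * exp (2 * ε * t) := by
            rw [mul_assoc, ← exp_add]
            ring_nf
        _ ≤ (1 + t) * A := h9
        _ ≤ (1 + 1 / ε) * exp (ε * t) * A := mul_le_mul_of_nonneg_right h7 hA0
        _ = _ := by ring
    exact le_of_mul_le_mul_right h10 (exp_pos _)
  have hlim : Tendsto (fun t : ℝ => c * 2⁻¹ ^ M * exp (ε * t)) atTop atTop :=
    (tendsto_exp_atTop.comp (tendsto_id.const_mul_atTop hε0)).const_mul_atTop (by positivity)
  obtain ⟨t, h1, h2⟩ := (hmain.and (hlim.eventually (eventually_gt_atTop _))).exists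
  exact absurd h1 (not_le.2 h2)

theorem sum_exp_le (K : ℕ) :
    ∑ m ∈ Finset.range (K + 1), exp m ≤ 2 * exp K := by
  induction K with
  | zero => simp
  | succ K ih =>
    rw [Finset.sum_range_succ]
    have : 2 * exp K ≤ exp ((K + 1 : ℕ) : ℝ) := by
      push_cast
      rw [exp_add, mul_comm]
      exact mul_le_mul_of_nonneg_left (by linarith [add_one_le_exp 1]) (exp_pos _).le
    linarith

open Classical in
theorem sum_indicator_exp_le {P : ℕ → Prop} {y : ℝ≥0∞} (h : ∀ m : ℕ, P m → ofReal (exp m) ≤ y)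
    (K : ℕ) :
    ∑ m ∈ Finset.range K, (if P m then ofReal (exp m) else 0) ≤ 2 * y := by
  induction K with
  | zero => simp
  | succ K ih =>
    by_cases hK : P K
    · calc _ ≤ ∑ m ∈ Finset.range (K + 1), ofReal (exp m) := by
            gcongr with m
            split_ifs <;> simp
        _ = ofReal (∑ m ∈ Finset.range (K + 1), exp m) :=
            (ENNReal.ofReal_sum_of_nonneg fun m _ => (exp_pos _).le).symm
        _ ≤ ofReal (2 * exp K) := ofReal_le_ofReal (sum_exp_le K)
        _ = 2 * ofReal (exp K) := by rw [ofReal_mul two_pos.le]; simp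
        _ ≤ 2 * y := by gcongr; exact h K hK
    · rw [Finset.sum_range_succ, if_neg hK, add_zero]
      exact ih

/-- Nonintegrability passes to the limit of an increasing sequence of weights. -/
theorem not_mem_multIdeal_of_iSup {u : ℕ → Cn n → EReal} {W : Cn n → EReal} (hR : 0 < R)
    (hu : ∀ j, LPsh (u j) (ball 0 R)) (hu0 : ∀ j, ∀ z ∈ ball 0 R, u j z ≤ 0)
    (hmono : ∀ i j, i ≤ j → ∀ z ∈ ball 0 R, u i z ≤ u j z)
    (hW : ∀ᵐ z, z ∈ ball 0 R → W z = ⨆ j, u j z) (hg : DifferentiableOn ℂ g (ball 0 R))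
    (hn : ∀ j, g ∉ multIdeal (wexp (-2) (u j))) :
    g ∉ multIdeal (wexp (-2) W) := by
  classical
  rintro ⟨-, U, hU, hfin⟩
  have hψ : ∀ j, (wexp (-1) fun z => ((2 : ℝ) : EReal) * u j z) = wexp (-2) (u j) := by
    intro j
    funext z
    rw [wexp_mul]
    norm_num
  have hψL : ∀ j, LPsh (fun z => ((2 : ℝ) : EReal) * u j z) (ball 0 R) := fun j => by
    simpa using (hu j).affine isOpen_ball (a := 2) (by positivity) 0
  have hψ0 : ∀ j, ∀ z ∈ ball 0 R, ((2 : ℝ) : EReal) * u j z ≤ 0 := fun j z hz => by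
    have := mul_le_mul_of_nonneg_left (hu0 j z hz) (coe_nonneg.2 (by positivity : (0:ℝ) ≤ 2))
    simpa using this
  have hJ : Monotone fun j => multIdeal (wexp (-2) (u j)) := by
    intro i j hij
    refine multIdeal_mono (C := 1) (by simp) ?_
    filter_upwards [ball_mem_nhds 0 hR] with z hz
    have := wexp_le_of_le (φ := u i) (ψ := u j) (z := z) (C := 0) (c := 2) two_pos
      (by simpa using hmono i j hij z hz)
    simpa using this
  obtain ⟨M, c, hc, hmass⟩ := (isGermIdeal_iUnion (fun j => isGermIdeal_multIdeal _)
    hJ).exists_mass_lower_bound (holoNear_of_ball hR hg) (g := g) (by simpa using hn)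
  obtain ⟨δ, hδ, hball⟩ := Metric.mem_nhds_iff.1 hU
  set r := min δ (min R 1) / 3 with hr
  have hr0 : 0 < r := by positivity
  have hm1 := min_le_left δ (min R 1)
  have hm2 := (min_le_right δ (min R 1)).trans (min_le_left R 1)
  have hm3 := (min_le_right δ (min R 1)).trans (min_le_right R 1)
  have hsub : ball (0 : Cn n) (2 * r) ⊆ ball 0 R :=
    ball_subset_ball (by linarith)
  set D := ball (0 : Cn n) (2 * r) with hD
  have hDm : MeasurableSet D := isOpen_ball.measurableSet
  set T : ℕ → ℕ → Set (Cn n) := fun m j =>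
    D ∩ {z | ((2 : ℝ) : EReal) * u j z < ((-(m : ℝ) : ℝ) : EReal)} with hT
  have hTm : ∀ m j, MeasurableSet (T m j) := fun m j => by
    have h2 := hDm.inter ((hψL j).measurableSet_lt isOpen_ball ((-(m : ℝ) : ℝ) : EReal))
    rwa [← inter_assoc, inter_eq_left.2 hsub] at h2
  have hTanti : ∀ m, Antitone (T m) := by
    intro m i j hij z hz
    have h2 : ((2 : ℝ) : EReal) * u j z < ((-(m : ℝ) : ℝ) : EReal) := hz.2
    exact ⟨hz.1, mem_ofPred.2 (lt_of_le_of_lt (mul_le_mul_of_nonneg_left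
      (hmono i j hij z (hsub hz.1)) (coe_nonneg.2 (by positivity : (0:ℝ) ≤ 2))) h2)⟩
  have hgi : IntegrableOn (fun z => ‖g z‖ ^ 2) D := integrableOn_norm_sq (by linarith) hg
  set S : ℕ → Set (Cn n) := fun m => ⋂ j, T m j with hS
  have hSD : ∀ m, S m ⊆ D := fun m z hz => (mem_iInter.1 hz 0).1
  have hSm : ∀ m, MeasurableSet (S m) := fun m => MeasurableSet.iInter (hTm m)
  set κ := c * r ^ M with hκ
  have hκ0 : 0 < κ := by positivity
  have hlow : ∀ m : ℕ, κ ≤ (1 + (m : ℝ)) * exp m * ∫ z in S m, ‖g z‖ ^ 2 := by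
    intro m
    have hlim := (tendsto_setIntegral_of_antitone (hTm m) (hTanti m)
      ⟨0, hgi.mono_set inter_subset_left⟩).const_mul ((1 + (m : ℝ)) * exp m)
    refine ge_of_tendsto' hlim fun j => ?_
    refine hmass r R m _ hr0 (by linarith) (by linarith) (by linarith) (Nat.cast_nonneg m)
      (hψL j) (hψ0 j) hg ?_
    rw [hψ j]
    exact subset_iUnion (fun j => multIdeal (wexp (-2) (u j))) j
  set A := ∫⁻ z in U, (‖g z‖₊ : ℝ≥0∞) ^ 2 * wexp (-2) W z with hA
  have hgm : AEMeasurable (fun z => (‖g z‖₊ : ℝ≥0∞) ^ 2) (volume.restrict D) :=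
    (continuousOn_nnnorm_sq (hg.continuousOn.mono hsub)).aemeasurable hDm
  have hsum : ∀ K : ℕ, ofReal (∑ m ∈ Finset.range K, κ * (1 / ((m : ℝ) + 1))) ≤ 2 * A := by
    intro K
    calc ofReal (∑ m ∈ Finset.range K, κ * (1 / ((m : ℝ) + 1)))
        = ∑ m ∈ Finset.range K, ofReal (κ * (1 / ((m : ℝ) + 1))) :=
          ENNReal.ofReal_sum_of_nonneg fun m _ => by positivity
      _ ≤ ∑ m ∈ Finset.range K, ∫⁻ z in D, (S m).indicator
            (fun z => ofReal (exp m) * (‖g z‖₊ : ℝ≥0∞) ^ 2) z := by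
          refine sum_le_sum fun m _ => ?_
          rw [lintegral_indicator (hSm m), Measure.restrict_restrict (hSm m),
            inter_eq_left.2 (hSD m), lintegral_const_mul' _ _ ofReal_ne_top,
            ← ofReal_setIntegral_norm_sq (hgi.mono_set (hSD m)),
            ← ofReal_mul (exp_pos _).le]
          refine ofReal_le_ofReal ?_
          rw [mul_one_div, div_le_iff₀ (by positivity)]
          linarith [hlow m]
      _ = ∫⁻ z in D, ∑ m ∈ Finset.range K, (S m).indicator
            (fun z => ofReal (exp m) * (‖g z‖₊ : ℝ≥0∞) ^ 2) z :=
          (lintegral_finsetSum' _ fun m _ => (hgm.const_mul _).indicator (hSm m)).symm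
      _ ≤ ∫⁻ z in D, 2 * ((‖g z‖₊ : ℝ≥0∞) ^ 2 * wexp (-2) W z) := by
          refine lintegral_mono_ae ?_
          filter_upwards [ae_restrict_of_ae hW, ae_restrict_mem hDm] with z hz hzD
          have hpt : ∀ m : ℕ, z ∈ S m → ofReal (exp m) ≤ wexp (-2) W z := by
            intro m hm
            have h1 : W z ≤ ((-((m : ℝ) / 2) : ℝ) : EReal) := by
              rw [hz (hsub hzD)]
              refine iSup_le fun j => ?_
              have h2 : ((2 : ℝ) : EReal) * u j z < ((-(m : ℝ) : ℝ) : EReal) :=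
                (mem_iInter.1 hm j).2
              have htop := (hu j).lt_top z (hsub hzD)
              generalize u j z = x at *
              induction x with
              | bot => simp
              | top => simp at htop
              | coe x =>
                rw [← coe_mul, coe_lt_coe_iff] at h2
                rw [coe_le_coe_iff]
                linarith
            have h3 := ofReal_exp_le_wexp two_pos h1
            rwa [mul_div_cancel₀ _ two_ne_zero] at h3
          calc _ = (∑ m ∈ Finset.range K,
                (if z ∈ S m then ofReal (exp m) else 0)) * (‖g z‖₊ : ℝ≥0∞) ^ 2 := by
                rw [sum_mul]
                refine sum_congr rfl fun m _ => ?_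
                rw [indicator_apply, ite_mul, zero_mul]
            _ ≤ 2 * wexp (-2) W z * (‖g z‖₊ : ℝ≥0∞) ^ 2 :=
                mul_le_mul_left (sum_indicator_exp_le hpt K) _
            _ = _ := by ring
      _ ≤ ∫⁻ z in U, 2 * ((‖g z‖₊ : ℝ≥0∞) ^ 2 * wexp (-2) W z) :=
          lintegral_mono_set ((ball_subset_ball (by linarith)).trans hball)
      _ = 2 * A := lintegral_const_mul' _ _ (by simp)
  have hlim := tendsto_sum_range_one_div_nat_succ_atTop.const_mul_atTop hκ0
  have hA2 : 2 * A ≠ ⊤ := ENNReal.mul_ne_top (by simp) hfin.ne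
  obtain ⟨K, hK⟩ := (hlim.eventually (eventually_gt_atTop (2 * A).toReal)).exists
  rw [mul_sum] at hK
  exact absurd ((ENNReal.ofReal_le_iff_le_toReal hA2).1 (hsum K)) (not_le.2 hK)

/-- An ordering principle: if increasing sequences have upper bounds, a bounded monotone function
is maximized above every point. -/
theorem exists_forall_ge_le {α : Type*} [Preorder α] {I : α → ℝ≥0∞} {B : ℝ≥0∞} (hB : B ≠ ⊤)
    (hIB : ∀ a, I a ≤ B) (hI : Monotone I) (hseq : ∀ u : ℕ → α, Monotone u → ∃ w, ∀ j, u j ≤ w)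
    (a : α) :
    ∃ w, a ≤ w ∧ ∀ v, w ≤ v → I v ≤ I w := by
  set σ : α → ℝ≥0∞ := fun x => ⨆ v, ⨆ _ : x ≤ v, I v with hσ
  have hσB : ∀ x, σ x ≤ B := fun x => iSup₂_le fun v _ => hIB v
  have hstep : ∀ (x : α) (j : ℕ), ∃ v, x ≤ v ∧ σ x ≤ I v + ((j : ℝ≥0∞) + 1)⁻¹ := by
    intro x j
    by_contra hcon
    push Not at hcon
    have h1 : σ x + ((j : ℝ≥0∞) + 1)⁻¹ ≤ σ x := by
      simp only [hσ]
      rw [ENNReal.biSup_add' (p := fun v => x ≤ v) ⟨x, le_rfl⟩]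
      exact iSup₂_le fun v hv => (hcon v hv).le
    have h2 : ((j : ℝ≥0∞) + 1)⁻¹ ≤ 0 := by
      refine (ENNReal.add_le_add_iff_left ((hσB x).trans_lt hB.lt_top).ne).1 (h1.trans ?_)
      simp
    simp at h2
  choose nx hnx hnx2 using hstep
  set u : ℕ → α := fun j => Nat.rec a (fun j x => nx x j) j with hu
  have hus : ∀ j, u (j + 1) = nx (u j) j := fun j => rfl
  have humono : Monotone u := monotone_nat_of_le_succ fun j => by rw [hus]; exact hnx _ _
  obtain ⟨w, hw⟩ := hseq u humono
  refine ⟨w, hw 0, fun v hv => ?_⟩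
  have h1 : ∀ j : ℕ, I v ≤ I w + ((j : ℝ≥0∞) + 1)⁻¹ := fun j =>
    calc I v ≤ σ (u j) := le_iSup₂_of_le v ((hw j).trans hv) le_rfl
      _ ≤ I (u (j + 1)) + ((j : ℝ≥0∞) + 1)⁻¹ := by rw [hus]; exact hnx2 _ _
      _ ≤ _ := by gcongr; exact hI (hw (j + 1))
  have hlim : Tendsto (fun j : ℕ => I w + ((j : ℝ≥0∞) + 1)⁻¹) atTop (𝓝 (I w + 0)) := by
    refine tendsto_const_nhds.add ?_
    have := (tendsto_add_atTop_iff_nat 1).2 ENNReal.tendsto_inv_nat_nhds_zero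
    simpa using this
  simpa using ge_of_tendsto' hlim h1

theorem expE_strictMono : StrictMono expE := by
  intro x y hxy
  induction x with
  | bot =>
    induction y with
    | bot => simp at hxy
    | coe y => rw [expE_coe]; simp [expE, exp_pos]
    | top => simp [expE]
  | coe x =>
    induction y with
    | bot => simp at hxy
    | coe y =>
      rw [expE_coe, expE_coe, ENNReal.ofReal_lt_ofReal_iff (exp_pos _), exp_lt_exp]
      exact_mod_cast hxy
    | top => rw [expE_coe]; simp [expE]
  | top => simp at hxy

theorem LPsh.aemeasurable_expE {v : Cn n → EReal} (hv : LPsh v Ω) (hΩ : IsOpen Ω) :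
    AEMeasurable (fun z => expE (v z)) (volume.restrict Ω) :=
  expE_strictMono.monotone.measurable.comp_aemeasurable
    ((aemeasurable_indicator_iff hΩ.measurableSet).1
      (hv.usc.measurable_indicator hΩ.measurableSet).aemeasurable)

theorem not_intNear_normSq2_of_leO {k : ℕ} {g : Fin k → Cn n → ℂ} {φ ψ : Cn n → EReal}
    (h : ¬ IntNear fun z => normSq2 g z * wexp (-2) ψ z) (hle : leO φ ψ) :
    ¬ IntNear fun z => normSq2 g z * wexp (-2) φ z := by
  intro hi
  obtain ⟨C, hC⟩ := hle
  refine h (hi.mono (C := ofReal (exp (2 * C))) ofReal_ne_top ?_)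
  filter_upwards [hC] with z hz
  rw [mul_left_comm]
  exact mul_le_mul_right (wexp_le_of_le two_pos hz) _

theorem add_coe_le_of_le_coe {x : EReal} {K C : ℝ} (h : x ≤ (K : EReal)) :
    x + ((-C : ℝ) : EReal) ≤ ((K - C : ℝ) : EReal) := by
  rw [sub_eq_add_neg, coe_add]
  gcongr

theorem le_add_of_add_neg_le {x y : EReal} {C : ℝ} (h : x + ((-C : ℝ) : EReal) ≤ y) :
    x ≤ y + (C : EReal) := by
  have h2 : x + ((-C : ℝ) : EReal) + (C : EReal) ≤ y + (C : EReal) := by gcongr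
  rwa [add_assoc, ← coe_add, neg_add_cancel, EReal.coe_zero, add_zero] at h2

theorem log_le_elog_norm {N : ℕ} (hδ : 0 < δ) (hz : δ ≤ ‖z‖) :
    ((N * log δ : ℝ) : EReal) ≤ ((N : ℝ) : EReal) * elog ‖z‖ := by
  rw [elog_of_pos (hδ.trans_le hz), ← coe_mul, coe_le_coe_iff]
  exact mul_le_mul_of_nonneg_left (log_le_log hδ hz) (Nat.cast_nonneg N)

/-- Extension of a competitor defined near the origin by a weight dominating it on a shell. -/
theorem LPsh.glue_inner {u v : Cn n → EReal} {R δ δ' : ℝ} (hu : LPsh u (ball 0 R)) (hδR : δ ≤ R)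
    (hδ' : δ' < δ) (hv : LPsh v (ball 0 δ)) (h : ∀ z ∈ ball 0 δ, δ' ≤ ‖z‖ → v z ≤ u z) :
    LPsh (fun z => if ‖z‖ < δ then Max.max (v z) (u z) else u z) (ball 0 R) := by
  refine LPsh.of_local fun z hz => ?_
  by_cases hzδ : ‖z‖ < δ
  · refine ⟨ball 0 δ, isOpen_ball, mem_ball_zero_iff.2 hzδ, ?_⟩
    refine (LPsh.max isOpen_ball hv (hu.mono (ball_subset_ball hδR))).congr
      isOpen_ball fun y hy => ?_
    rw [if_pos (mem_ball_zero_iff.1 hy)]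
  · have hopen : IsOpen (ball (0 : Cn n) R ∩ {y | δ' < ‖y‖}) :=
      isOpen_ball.inter (isOpen_lt continuous_const continuous_norm)
    refine ⟨_, hopen, ⟨hz, mem_ofPred.2 (by linarith [not_lt.1 hzδ])⟩, ?_⟩
    refine (hu.mono inter_subset_left).congr hopen fun y hy => ?_
    split_ifs with hyδ
    · exact (max_eq_right (h y (mem_ball_zero_iff.2 hyδ) (le_of_lt hy.2))).symm
    · rfl

/-- Admissible competitors for the construction of a Zhou weight above `u₀`. -/
structure Competitor {k : ℕ} (g : Fin k → Cn n → ℂ) (u₀ : Cn n → EReal) (Ω : Set (Cn n))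
    (v : Cn n → EReal) : Prop where
  psh : LPsh v Ω
  nonpos : ∀ z ∈ Ω, v z ≤ 0
  le : ∀ z ∈ Ω, u₀ z ≤ v z
  nonint : ¬ IntNear fun z => normSq2 g z * wexp (-2) v z

theorem Competitor.exists_upper_bound {k : ℕ} {g : Fin k → Cn n → ℂ} {u₀ : Cn n → EReal}
    (hR : 0 < R) (hg : ∀ i, DifferentiableOn ℂ (g i) (ball 0 R)) {u : ℕ → Cn n → EReal}
    (hu : ∀ j, Competitor g u₀ (ball 0 R) (u j))
    (hmono : ∀ i j, i ≤ j → ∀ z ∈ ball 0 R, u i z ≤ u j z) :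
    ∃ W, Competitor g u₀ (ball 0 R) W ∧ ∀ j, ∀ z ∈ ball 0 R, u j z ≤ W z := by
  obtain ⟨W, hW, hW0, hWu, hWae⟩ := LPsh.exists_sup_regularization isOpen_ball
    (fun j => (hu j).psh) fun j => (hu j).nonpos
  refine ⟨W, ⟨hW, hW0, fun z hz => ((hu 0).le z hz).trans (hWu 0 z hz), fun hInt => ?_⟩, hWu⟩
  have hgn : ∀ i, HoloNear (g i) := fun i => holoNear_of_ball hR (hg i)
  have hex : ∀ i, ∃ j, g i ∈ multIdeal (wexp (-2) (u j)) := by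
    intro i
    by_contra hcon
    push Not at hcon
    exact not_mem_multIdeal_of_iSup hR (fun j => (hu j).psh) (fun j => (hu j).nonpos) hmono hWae
      (hg i) hcon (mem_multIdeal_of_normSq2 hgn hInt i)
  choose j hj using hex
  set m := Finset.univ.sup j
  refine (hu m).nonint (intNear_normSq2 fun i => multIdeal_mono (C := 1) (by simp) ?_ (hj i))
  filter_upwards [ball_mem_nhds 0 hR] with z hz
  have := wexp_le_of_le (φ := u (j i)) (ψ := u m) (z := z) (C := 0) (c := 2) two_pos
    (by simpa using hmono _ _ (Finset.le_sup (Finset.mem_univ i)) z hz)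
  simpa using this

theorem Competitor.exists_maximal {k : ℕ} {g : Fin k → Cn n → ℂ} {u₀ : Cn n → EReal} (hR : 0 < R)
    (hg : ∀ i, DifferentiableOn ℂ (g i) (ball 0 R)) (h₀ : Competitor g u₀ (ball 0 R) u₀) :
    ∃ u, Competitor g u₀ (ball 0 R) u ∧ ∀ v, Competitor g u₀ (ball 0 R) v →
      (∀ z ∈ ball 0 R, u z ≤ v z) → ∀ z ∈ ball 0 R, v z ≤ u z := by
  set B := ball (0 : Cn n) R with hB
  have hBm : MeasurableSet B := isOpen_ball.measurableSet
  let _ : Preorder (Σ' v, Competitor g u₀ B v) :=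
    Preorder.lift fun v => fun z : B => v.1 z
  have hle : ∀ {v w : (Σ' v, Competitor g u₀ B v)}, v ≤ w ↔ ∀ z ∈ B, v.1 z ≤ w.1 z :=
    fun {v w} => ⟨fun h z hz => h ⟨z, hz⟩, fun h z => h z.1 z.2⟩
  set I : (Σ' v, Competitor g u₀ B v) → ℝ≥0∞ := fun v => ∫⁻ z in B, expE (v.1 z) with hI
  have hIB : ∀ v, I v ≤ volume B := by
    intro v
    calc I v ≤ ∫⁻ z in B, 1 := setLIntegral_mono' hBm fun z hz => by
          have := expE_strictMono.monotone (v.2.nonpos z hz)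
          rwa [← EReal.coe_zero, expE_coe, exp_zero, ENNReal.ofReal_one] at this
      _ = volume B := by simp
  obtain ⟨u, -, hu⟩ := exists_forall_ge_le (I := I) measure_ball_lt_top.ne hIB
    (fun v w hvw => setLIntegral_mono' hBm fun z hz =>
      expE_strictMono.monotone (hle.1 hvw z hz))
    (fun s hs => by
      obtain ⟨W, hW, hWs⟩ := Competitor.exists_upper_bound hR hg (fun j => (s j).2)
        fun i j hij => hle.1 (hs hij)
      exact ⟨⟨W, hW⟩, fun j => hle.2 (hWs j)⟩) ⟨u₀, h₀⟩
  refine ⟨u.1, u.2, fun v hv huv z hz => ?_⟩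
  have h1 : (fun z => expE (u.1 z)) =ᵐ[volume.restrict B] fun z => expE (v z) := by
    refine ae_eq_of_ae_le_of_lintegral_le ?_ ((hIB u).trans_lt measure_ball_lt_top).ne
      (hv.psh.aemeasurable_expE isOpen_ball) (hu ⟨v, hv⟩ (hle.2 huv))
    filter_upwards [ae_restrict_mem hBm] with z hz
    exact expE_strictMono.monotone (huv z hz)
  refine LPsh.le_of_ae_le isOpen_ball hv.psh u.2.psh ?_ hz
  filter_upwards [(ae_restrict_iff' hBm).1 h1] with z hz' hzB
  exact (expE_strictMono.injective (hz' hzB)).ge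

/-- Existence of Zhou weights above a nonintegrable weight with a logarithmic lower barrier. -/
theorem exists_isZhouWeightFor {k : ℕ} {g : Fin k → Cn n → ℂ} {R b : ℝ} {N : ℕ}
    (hR : 0 < R) (hR1 : R ≤ 1) (hg : ∀ i, DifferentiableOn ℂ (g i) (ball 0 R))
    (hφ : PSHOn φ (ball 0 R)) (hφ0 : ∀ z ∈ ball 0 R, φ z ≤ 0) (hb : 0 < b)
    (hN : 0 < N) (hn : ¬ IntNear fun z => normSq2 g z *
      wexp (-2) (fun z => Max.max ((b : EReal) * φ z) ((N : ℝ) * elog ‖z‖)) z) :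
    ∃ Φ, IsZhouWeightFor (normSq2 g) Φ ∧ ∀ z ∈ ball 0 R, (b : EReal) * φ z ≤ Φ z := by
  have hN' : (0 : ℝ) < N := by exact_mod_cast hN
  set B := ball (0 : Cn n) R with hB
  have hlog0 : ∀ z ∈ B, ((N : ℝ) : EReal) * elog ‖z‖ ≤ 0 := by
    intro z hz
    have h1 := elog_mono ((mem_ball_zero_iff.1 hz).le.trans hR1)
    rw [elog_of_pos one_pos, log_one] at h1
    have := mul_le_mul_of_nonneg_left h1 (coe_nonneg.2 hN'.le)
    simpa using this
  have h₀ : Competitor g (fun z => Max.max ((b : EReal) * φ z) ((N : ℝ) * elog ‖z‖)) B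
      (fun z => Max.max ((b : EReal) * φ z) ((N : ℝ) * elog ‖z‖)) := by
    refine ⟨LPsh.max isOpen_ball ?_ ?_, fun z hz => max_le ?_ (hlog0 z hz),
      fun z _ => le_rfl, hn⟩
    · simpa using (hφ.lpsh isOpen_ball).affine isOpen_ball hb 0
    · simpa using (lpsh_log_norm.mono (subset_univ B)).affine isOpen_ball hN' 0
    · have := mul_le_mul_of_nonneg_left (hφ0 z hz) (coe_nonneg.2 hb.le)
      simpa using this
  obtain ⟨u, hu, hmax⟩ := Competitor.exists_maximal hR hg h₀
  have hub : ∀ z ∈ B, (b : EReal) * φ z ≤ u z := fun z hz => (le_max_left _ _).trans (hu.le z hz)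
  have hul : ∀ z ∈ B, ((N : ℝ) : EReal) * elog ‖z‖ ≤ u z := fun z hz =>
    (le_max_right _ _).trans (hu.le z hz)
  refine ⟨u, ⟨⟨B, ball_mem_nhds _ hR, isOpen_ball,
    hu.psh.pshOn isOpen_ball fun z hz => ?_⟩, ⟨N + 1, fun N₀ hN₀ => ?_⟩, hu.nonint, ?_⟩, hub⟩
  · obtain ⟨w, hwB, hw⟩ : ∃ w ∈ B, φ w ≠ ⊥ := by
      by_contra hcon
      push Not at hcon
      have h1 := hφ.volume_bot isOpen_ball
      rw [inter_eq_right.2 fun z hz => mem_ofPred.2 (hcon z hz)] at h1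
      exact (measure_ball_pos volume (0 : Cn n) hR).ne' h1
    refine ⟨w, ?_, fun hbot => hw ?_⟩
    · have hpc : IsPreconnected B := (convex_ball (0 : Cn n) R).isPreconnected
      rw [hpc.connectedComponentIn hz]
      exact hwB
    · have := hub w hwB
      rw [hbot, le_bot_iff] at this
      have htop := hφ.lt_top w hwB
      generalize φ w = x at *
      induction x with
      | bot => rfl
      | coe x => exact absurd this (by rw [← coe_mul]; exact EReal.coe_ne_bot _)
      | top => simp at htop
  · choose C hC using fun i => (holoNear_of_ball hR (hg i)).eventually_bounded
    refine intNear_of_bounded (C := ∑ i, (C i : ℝ≥0∞)) (ENNReal.sum_ne_top.2 fun i _ => by simp) ?_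
    filter_upwards [eventually_all.2 hC, ball_mem_nhds 0 hR] with z hz hzB
    have hle : ofReal (‖z‖ ^ (2 * N₀)) * wexp (-2) u z ≤ 1 := by
      rcases (norm_nonneg z).eq_or_lt with h0 | h0
      · rw [← h0, zero_pow (by omega)]
        simp
      · have h1 := wexp_le_of_le (φ := fun _ => ((N * log ‖z‖ : ℝ) : EReal)) (ψ := u) (z := z)
          (C := 0) (c := 2) two_pos (by simpa using (log_le_elog_norm h0 le_rfl).trans (hul z hzB))
        simp only [wexp, ← coe_mul, expE_coe, mul_zero, exp_zero, ENNReal.ofReal_one,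
          one_mul] at h1
        unfold wexp
        refine (mul_le_mul_right h1 _).trans ?_
        rw [← ofReal_mul (by positivity), ← ENNReal.ofReal_one]
        refine ofReal_le_ofReal ?_
        have h2 : ‖z‖ ^ (2 * N₀) ≤ ‖z‖ ^ (2 * N) :=
          pow_le_pow_of_le_one h0.le ((mem_ball_zero_iff.1 hzB).le.trans hR1) (by omega)
        have h3 : ‖z‖ ^ (2 * N) = exp (2 * (N * log ‖z‖)) := by
          rw [show 2 * ((N : ℝ) * log ‖z‖) = ((2 * N : ℕ) : ℝ) * log ‖z‖ by
            push_cast; ring, exp_nat_mul, exp_log h0]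
        refine (mul_le_mul_of_nonneg_right (h2.trans h3.le) (exp_pos _).le).trans ?_
        rw [← exp_add]
        simp
    rw [mul_assoc]
    calc _ ≤ normSq2 g z * 1 := mul_le_mul_right hle _
      _ ≤ _ := by
        rw [mul_one]
        exact sum_le_sum fun i _ => hz i
  · intro φ' hφ' hle hn'
    refine ⟨?_, hle⟩
    obtain ⟨C, hC⟩ := hle
    obtain ⟨V, hV, hVo, hφV⟩ := hφ'
    have hL := hφV.lpsh hVo
    obtain ⟨K, hK⟩ : ∃ K : ℝ, ∀ᶠ z in 𝓝 0, φ' z < (K : EReal) := by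
      have h0 := hL.lt_top 0 (mem_of_mem_nhds hV)
      obtain ⟨K, hK1, -⟩ := EReal.lt_iff_exists_real_btwn.1 h0
      have := hL.usc 0 (mem_of_mem_nhds hV) K hK1
      rw [hVo.nhdsWithin_eq (mem_of_mem_nhds hV)] at this
      exact ⟨K, this⟩
    obtain ⟨δ, hδ, hball⟩ := Metric.mem_nhds_iff.1
      (inter_mem (inter_mem hV (ball_mem_nhds 0 hR)) hK)
    set δ₁ := min δ R with hδ₁
    have hδ₁0 : 0 < δ₁ := lt_min hδ hR
    have hδ₁R : δ₁ ≤ R := min_le_right _ _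
    have hball₁ : ∀ z ∈ ball 0 δ₁, z ∈ V ∧ φ' z < (K : EReal) := fun z hz =>
      have := hball (ball_subset_ball (min_le_left _ _) hz)
      ⟨this.1.1, this.2⟩
    set C' := K - N * log (δ₁ / 2) with hC'
    have hsmall : ∀ z ∈ ball 0 δ₁,
        φ' z + ((-C' : ℝ) : EReal) ≤ ((N * log (δ₁ / 2) : ℝ) : EReal) := fun z hz => by
      have := add_coe_le_of_le_coe (C := C') (hball₁ z hz).2.le
      rwa [hC', sub_sub_cancel, ← hC'] at this
    have hlogneg : (N : ℝ) * log (δ₁ / 2) ≤ 0 :=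
      mul_nonpos_of_nonneg_of_nonpos hN'.le (log_nonpos (by linarith) (by linarith))
    have hvL : LPsh (fun z => φ' z + ((-C' : ℝ) : EReal)) (ball 0 δ₁) := by
      simpa using (hL.mono fun z hz => (hball₁ z hz).1).affine isOpen_ball one_pos (-C')
    have hv : Competitor g (fun z => Max.max ((b : EReal) * φ z) ((N : ℝ) * elog ‖z‖)) B
        (fun z => if ‖z‖ < δ₁ then Max.max (φ' z + ((-C' : ℝ) : EReal)) (u z) else u z) := by
      have huv : ∀ z, u z ≤
          if ‖z‖ < δ₁ then Max.max (φ' z + ((-C' : ℝ) : EReal)) (u z) else u z := fun z => by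
        split_ifs
        · exact le_max_right _ _
        · exact le_rfl
      refine ⟨hu.psh.glue_inner hδ₁R (half_lt_self hδ₁0) hvL fun z hz hz' => ?_, fun z hz => ?_,
        fun z hz => (hu.le z hz).trans (huv z), ?_⟩
      · exact (hsmall z hz).trans ((log_le_elog_norm (half_pos hδ₁0) hz').trans
          (hul z (ball_subset_ball hδ₁R hz)))
      · split_ifs with h
        · exact max_le ((hsmall z (mem_ball_zero_iff.2 h)).trans (by exact_mod_cast hlogneg))
            (hu.nonpos z hz)
        · exact hu.nonpos z hz
      · refine not_intNear_normSq2_of_leO hn' ⟨Max.max C (-C'), ?_⟩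
        filter_upwards [hC, ball_mem_nhds 0 hδ₁0] with z hz hzδ
        rw [if_pos (mem_ball_zero_iff.1 hzδ)]
        refine max_le ?_ (hz.trans ?_)
        · gcongr
          exact le_max_right _ _
        · gcongr
          exact le_max_left _ _
    have hfin := hmax _ hv fun z _ => by
      split_ifs
      · exact le_max_right _ _
      · exact le_rfl
    refine ⟨C', ?_⟩
    filter_upwards [ball_mem_nhds 0 hδ₁0] with z hz
    have := hfin z (ball_subset_ball hδ₁R hz)
    rw [if_pos (mem_ball_zero_iff.1 hz)] at this
    exact le_add_of_add_neg_le ((le_max_left _ _).trans this)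

theorem EReal.inv_mul_coe_mul {b : ℝ} (hb : b ≠ 0) (x : EReal) :
    ((b⁻¹ : ℝ) : EReal) * ((b : EReal) * x) = x := by
  rw [← mul_assoc, ← coe_mul, inv_mul_cancel₀ hb, EReal.coe_one, one_mul]

theorem leO.inv_mul {φ Φ : Cn n → EReal} {b : ℝ} (hb : 0 < b)
    (h : leO φ fun z => (b : EReal) * Φ z) : leO (fun z => ((b⁻¹ : ℝ) : EReal) * φ z) Φ := by
  obtain ⟨C, hC⟩ := h
  refine ⟨b⁻¹ * C, ?_⟩
  filter_upwards [hC] with z hz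
  have hb' := coe_nonneg.2 (inv_pos.2 hb).le
  refine (mul_le_mul_of_nonneg_left hz hb').trans ?_
  rw [EReal.left_distrib_of_nonneg_of_ne_top hb' (EReal.coe_ne_top _),
    EReal.inv_mul_coe_mul hb.ne', coe_mul]

theorem jumping_eq_of_nonpos {k : ℕ} {g : Fin k → Cn n → ℂ} (hR : 0 < R) (hR1 : R ≤ 1)
    (hg : ∀ i, DifferentiableOn ℂ (g i) (ball 0 R)) (hφ : PSHOn φ (ball 0 R))
    (hφ0 : ∀ z ∈ ball 0 R, φ z ≤ 0) :
    sSup {c : ℝ | 0 ≤ c ∧ IntNear fun z => normSq2 g z * wexp (-2 * c) φ z}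
      = 1 / sSup {s : ℝ | ∃ Φ : Cn n → EReal,
          IsZhouWeightFor (normSq2 g) Φ ∧ s = zhouNumber φ Φ} := by
  set S := {c : ℝ | 0 ≤ c ∧ IntNear fun z => normSq2 g z * wexp (-2 * c) φ z} with hS
  set T := {s : ℝ | ∃ Φ : Cn n → EReal,
          IsZhouWeightFor (normSq2 g) Φ ∧ s = zhouNumber φ Φ} with hT
  have hgn : ∀ i, HoloNear (g i) := fun i => holoNear_of_ball hR (hg i)
  have hbd : ∃ C : ℝ≥0∞, C ≠ ⊤ ∧ ∀ᶠ z in 𝓝 0, normSq2 g z ≤ C := by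
    choose C hC using fun i => (hgn i).eventually_bounded
    refine ⟨∑ i, (C i : ℝ≥0∞), ENNReal.sum_ne_top.2 fun i _ => by simp, ?_⟩
    filter_upwards [eventually_all.2 hC] with z hz
    exact sum_le_sum fun i _ => hz i
  obtain ⟨C, hC, hgC⟩ := hbd
  have hS0 : (0 : ℝ) ∈ S := by
    refine ⟨le_rfl, intNear_of_bounded hC ?_⟩
    filter_upwards [hgC] with z hz
    have : wexp (-2 * 0) φ z = 1 := by
      simp only [wexp, mul_zero, EReal.coe_zero, zero_mul]
      rw [← EReal.coe_zero, expE_coe, exp_zero, ENNReal.ofReal_one]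
    rwa [this, mul_one]
  have hdown : ∀ {c c'}, c ∈ S → 0 ≤ c' → c' ≤ c → c' ∈ S := by
    intro c c' hc h0 hcc
    refine ⟨h0, hc.2.mono (C := 1) (by simp) ?_⟩
    filter_upwards [ball_mem_nhds 0 hR] with z hz
    rw [one_mul, ← wexp_mul, ← wexp_mul]
    refine mul_le_mul_right ?_ _
    have := wexp_le_of_le (φ := fun z => (c : EReal) * φ z) (ψ := fun z => (c' : EReal) * φ z)
      (z := z) (C := 0) (c := 2) two_pos (by
        simp only [EReal.coe_zero, add_zero]
        exact EReal.mul_le_mul_of_nonpos_right (by exact_mod_cast hcc) (hφ0 z hz))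
    simpa using this
  have hnotS : ∀ {Φ : Cn n → EReal} {b : ℝ}, IsZhouWeightFor (normSq2 g) Φ → 0 < b →
      (leO φ fun z => (b : EReal) * Φ z) → b⁻¹ ∉ S := by
    intro Φ b hΦ hb hle hmem
    refine not_intNear_normSq2_of_leO hΦ.nonint (hle.inv_mul hb) ?_
    simpa only [wexp_mul] using hmem.2
  have hub : ∀ {Φ : Cn n → EReal} {b : ℝ}, IsZhouWeightFor (normSq2 g) Φ → 0 < b →
      (leO φ fun z => (b : EReal) * Φ z) → ∀ c ∈ S, c ≤ b⁻¹ := by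
    intro Φ b hΦ hb hle c hc
    by_contra hlt
    exact hnotS hΦ hb hle (hdown hc (inv_pos.2 hb).le (not_le.1 hlt).le)
  have hT0 : 0 ≤ sSup T := by
    refine sSup_nonneg ?_
    rintro s ⟨Φ, -, rfl⟩
    exact sSup_nonneg fun b hb => hb.1
  by_cases hbdd : BddAbove S
  · set c := sSup S with hc
    obtain ⟨c₀, hc₀, hi₀⟩ := hφ.exists_intNear hR hφ0
    have hc₀S : c₀ / 2 ∈ S := by
      refine ⟨by positivity, hi₀.mono hC ?_⟩
      filter_upwards [hgC] with z hz
      rw [show -2 * (c₀ / 2) = -c₀ by ring]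
      exact mul_le_mul_left hz _
    have hcpos : 0 < c := (half_pos hc₀).trans_le (le_csSup hbdd hc₀S)
    have hZ : ∀ {Φ}, IsZhouWeightFor (normSq2 g) Φ →
        ∀ b ∈ {b : ℝ | 0 ≤ b ∧ leO φ fun z => (b : EReal) * Φ z}, b ≤ 1 / c := by
      rintro Φ hΦ b ⟨hb0, hb⟩
      rcases hb0.eq_or_lt with rfl | hb0
      · positivity
      · have := csSup_le ⟨0, hS0⟩ (hub hΦ hb0 hb)
        rw [one_div]
        exact (le_inv_comm₀ hb0 hcpos).2 this
    have hTle : ∀ s ∈ T, s ≤ 1 / c := by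
      rintro s ⟨Φ, hΦ, rfl⟩
      exact Real.sSup_le (hZ hΦ) (by positivity)
    have hge : ∀ c' > c, 1 / c' ≤ sSup T := by
      intro c' hc'
      have hc'0 : 0 < c' := hcpos.trans hc'
      have hmid : (c + c') / 2 ∉ S := fun h => by linarith [le_csSup hbdd h]
      obtain ⟨i, hi⟩ : ∃ i, g i ∉ multIdeal (wexp (-2 * ((c + c') / 2)) φ) := by
        by_contra hcon
        push Not at hcon
        exact hmid ⟨by linarith, intNear_normSq2 hcon⟩
      obtain ⟨N, hN, hNi⟩ := (hφ.lpsh isOpen_ball).exists_max_log_not_mem hR hφ0 (hg i)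
        (by linarith) (by linarith : (c + c') / 2 < c') hi
      obtain ⟨Φ, hΦ, hle⟩ := exists_isZhouWeightFor hR hR1 hg hφ hφ0 hc'0 hN
        fun h => hNi (mem_multIdeal_of_normSq2 hgn h i)
      have hmem : 1 / c' ∈ {b : ℝ | 0 ≤ b ∧ leO φ fun z => (b : EReal) * Φ z} := by
        refine ⟨by positivity, 0, ?_⟩
        filter_upwards [ball_mem_nhds 0 hR] with z hz
        have := mul_le_mul_of_nonneg_left (hle z hz) (coe_nonneg.2 (inv_pos.2 hc'0).le)
        rw [EReal.inv_mul_coe_mul hc'0.ne'] at this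
        simpa using this
      exact (le_csSup ⟨1 / c, hZ hΦ⟩ hmem).trans (le_csSup ⟨1 / c, hTle⟩ ⟨Φ, hΦ, rfl⟩)
    have hxpos : 0 < sSup T := lt_of_lt_of_le (by positivity) (hge (c + 1) (by linarith))
    refine le_antisymm ?_ (le_of_forall_gt_imp_ge_of_dense fun c' hc' => ?_)
    · have := Real.sSup_le hTle (by positivity)
      rw [le_div_comm₀ hcpos hxpos]
      exact this
    · rw [div_le_comm₀ hxpos (hcpos.trans hc')]
      exact hge c' hc'
  · have hT1 : sSup T ≤ 0 := by
      refine sSup_nonpos ?_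
      rintro s ⟨Φ, hΦ, rfl⟩
      refine sSup_nonpos ?_
      rintro b ⟨-, hb⟩
      by_contra hlt
      exact hbdd ⟨b⁻¹, fun c hc => hub hΦ (not_le.1 hlt) hb c hc⟩
    rw [sSup_of_not_bddAbove hbdd, le_antisymm hT1 hT0, div_zero]

theorem PSHOn.exists_ball_nonpos (hU : U ∈ 𝓝 0) (hUo : IsOpen U) (hφ : PSHOn φ U) :
    ∃ K : ℝ, ∃ R > 0, ∀ r, 0 < r → r ≤ R →
      PSHOn (fun z => φ z + ((-K : ℝ) : EReal)) (ball 0 r) ∧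
      ∀ z ∈ ball 0 r, φ z + ((-K : ℝ) : EReal) ≤ 0 := by
  have hL := hφ.lpsh hUo
  have h0 := hL.lt_top 0 (mem_of_mem_nhds hU)
  obtain ⟨K, hK1, -⟩ := EReal.lt_iff_exists_real_btwn.1 h0
  have hK := hL.usc 0 (mem_of_mem_nhds hU) K hK1
  rw [hUo.nhdsWithin_eq (mem_of_mem_nhds hU)] at hK
  obtain ⟨R, hR, hball⟩ := Metric.mem_nhds_iff.1 (inter_mem hU hK)
  refine ⟨K, R, hR, fun r hr hrR => ?_⟩
  have hsub : ∀ z ∈ ball 0 r, z ∈ U ∧ φ z < (K : EReal) := fun z hz =>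
    hball (ball_subset_ball hrR hz)
  have hL' : LPsh (fun z => φ z + ((-K : ℝ) : EReal)) (ball 0 r) := by
    simpa using (hL.mono fun z hz => (hsub z hz).1).affine isOpen_ball one_pos (-K)
  refine ⟨hL'.pshOn isOpen_ball fun z hz => ?_, fun z hz => ?_⟩
  · obtain ⟨w, hwB, hw⟩ : ∃ w ∈ ball 0 r, φ w ≠ ⊥ := by
      by_contra hcon
      push Not at hcon
      refine (measure_ball_pos volume (0 : Cn n) hr).ne'
        (measure_mono_null (fun z hz => ?_) (hφ.volume_bot hUo))
      exact ⟨hcon z hz, (hsub z hz).1⟩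
    refine ⟨w, ?_, fun hbot => hw ?_⟩
    · rw [(convex_ball (0 : Cn n) r).isPreconnected.connectedComponentIn hz]
      exact hwB
    · simpa [EReal.add_eq_bot_iff] using hbot
  · have := add_coe_le_of_le_coe (C := K) (hsub z hz).2.le
    simpa using this

/-- the jumping number of an ideal equals the reciprocal of the supremum
of Zhou numbers over all Zhou weights related to `|I|²`. -/
theorem statement8 {n k : ℕ} (g : Fin k → Cn n → ℂ) (hg : ∀ j, HoloNear (g j))
    (hI : ∃ j, ¬ (∀ᶠ z in 𝓝 (0 : Cn n), g j z = 0))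
    (φ : Cn n → EReal) (hφ : PSHNear φ) :
    sSup {c : ℝ | 0 ≤ c ∧ IntNear fun z => normSq2 g z * wexp (-2 * c) φ z}
      = 1 / sSup {s : ℝ | ∃ Φ : Cn n → EReal,
          IsZhouWeightFor (normSq2 g) Φ ∧ s = zhouNumber φ Φ} := by
  obtain ⟨U, hU, hUo, hψ⟩ := hφ
  obtain ⟨K, R, hR, hball⟩ := hψ.exists_ball_nonpos hU hUo
  choose V hV hVo hd using hg
  obtain ⟨δ, hδ, hδV⟩ := Metric.mem_nhds_iff.1 ((iInter_mem (s := V)).2 hV)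
  set r := min (min R δ) 1
  have hr : 0 < r := lt_min (lt_min hR hδ) one_pos
  obtain ⟨hp, hn⟩ := hball r hr ((min_le_left _ _).trans (min_le_left _ _))
  have hmain := jumping_eq_of_nonpos hr (min_le_right _ _) (fun i => (hd i).mono fun z hz =>
    mem_iInter.1 (hδV (ball_subset_ball ((min_le_left _ _).trans (min_le_right _ _))
      hz)) i) hp hn
  have hback : ∀ z, φ z = φ z + ((-K : ℝ) : EReal) + (K : EReal) := fun z => by
    rw [add_assoc, ← coe_add, neg_add_cancel, EReal.coe_zero, add_zero]
  have hInt : ∀ c : ℝ, 0 ≤ c → ((IntNear fun z => normSq2 g z * wexp (-2 * c) φ z) ↔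
      IntNear fun z => normSq2 g z * wexp (-2 * c) (fun z => φ z + ((-K : ℝ) : EReal)) z) := by
    intro c hc
    rcases hc.eq_or_lt with rfl | hc
    · simp [wexp]
    rw [neg_mul]
    constructor <;> intro h
    · refine h.mono (C := ofReal (exp (2 * c * K))) ofReal_ne_top
        (Eventually.of_forall fun z => ?_)
      rw [mul_left_comm]
      exact mul_le_mul_right (wexp_le_of_le (by positivity) (hback z).le) _
    · refine h.mono (C := ofReal (exp (2 * c * -K))) ofReal_ne_top
        (Eventually.of_forall fun z => ?_)
      rw [mul_left_comm]
      exact mul_le_mul_right (wexp_le_of_le (by positivity) le_rfl) _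
  have hzhou : ∀ Φ, zhouNumber φ Φ = zhouNumber (fun z => φ z + ((-K : ℝ) : EReal)) Φ := by
    intro Φ
    unfold zhouNumber
    congr 1
    ext b
    refine and_congr_right fun _ => ⟨?_, ?_⟩ <;> rintro ⟨C, hC⟩
    · refine ⟨C + -K, hC.mono fun z hz => ?_⟩
      rw [coe_add, ← add_assoc]
      exact add_le_add_left hz _
    · refine ⟨C + K, hC.mono fun z hz => ?_⟩
      refine (hback z).le.trans ?_
      rw [coe_add, ← add_assoc ((b : EReal) * Φ z)]
      exact add_le_add_left hz _
  simp only [hzhou]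
  rw [← hmain]
  congr 1
  ext c
  exact and_congr_right fun hc => hInt c hc
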